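/- Let A be a commutative Noetherian ring of Krull dimension one, let π ∈ A be an element such that the Krull dimension of A/πA is zero, and let R = A[[x_1,...,x_n]] be a formal power series ring over A. Then for every ideal I of R and every integer i ≥ 0, the set of associated primes of H^i_I(R) that contain π is finite. -/

import Mathlib

namespace LCF
open scoped Pointwise

section sat
variable {R M : Type*} [CommRing R] [AddCommGroup M] [Module R M]

/-- Saturation of `N` in `U` with respect to the complement of the prime `P`. -/
def sat (P : Ideal R) [P.IsPrime] (N U : Submodule R M) : Submodule R M where
  carrier := {u | u ∈ U ∧ ∃ s, s ∉ P ∧ s • u ∈ N}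
  zero_mem' := ⟨U.zero_mem, 1, fun h => Ideal.IsPrime.ne_top ‹_› ((Ideal.eq_top_iff_one _).2 h), by simp⟩
  add_mem' := by
    rintro a b ⟨ha, s, hs, hsa⟩ ⟨hb, t, ht, htb⟩
    refine ⟨U.add_mem ha hb, s * t, fun h => ((Ideal.IsPrime.mem_or_mem ‹_› h).elim hs ht), ?_⟩
    rw [smul_add]
    refine N.add_mem ?_ ?_
    · rw [mul_comm, mul_smul]; exact N.smul_mem _ hsa
    · rw [mul_smul]; exact N.smul_mem _ htb
  smul_mem' := by
    rintro c a ⟨ha, s, hs, hsa⟩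
    exact ⟨U.smul_mem _ ha, s, hs, by rw [smul_comm]; exact N.smul_mem _ hsa⟩

lemma mem_sat {P : Ideal R} [P.IsPrime] {N U : Submodule R M} {u : M} :
    u ∈ sat P N U ↔ u ∈ U ∧ ∃ s, s ∉ P ∧ s • u ∈ N := Iff.rfl

lemma one_notMem_prime (P : Ideal R) [P.IsPrime] : (1 : R) ∉ P :=
  fun h => Ideal.IsPrime.ne_top ‹_› ((Ideal.eq_top_iff_one _).2 h)

lemma sat_le {P : Ideal R} [P.IsPrime] {N U : Submodule R M} : sat P N U ≤ U := fun _ h => h.1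

lemma le_sat {P : Ideal R} [P.IsPrime] {N U : Submodule R M} (h : N ≤ U) : N ≤ sat P N U :=
  fun x hx => ⟨h hx, 1, one_notMem_prime P, by simpa using hx⟩

lemma sat_mono {P : Ideal R} [P.IsPrime] {N N' U : Submodule R M} (h : N ≤ N') :
    sat P N U ≤ sat P N' U :=
  fun _ ⟨hx, s, hs, hsx⟩ => ⟨hx, s, hs, h hsx⟩

lemma sat_sat {P : Ideal R} [P.IsPrime] {N U : Submodule R M} :
    sat P (sat P N U) U ≤ sat P N U := by
  rintro x ⟨hx, s, hs, -, t, ht, h⟩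
  exact ⟨hx, t * s, fun h => ((Ideal.IsPrime.mem_or_mem ‹_› h).elim ht hs), by rwa [mul_smul]⟩

lemma exists_smul_le_of_le_sat {P : Ideal R} [P.IsPrime] {N U J : Submodule R M} (hJ : J.FG)
    (h : J ≤ sat P N U) : ∃ s, s ∉ P ∧ s • J ≤ N := by
  induction J, hJ using Submodule.fg_induction with
  | singleton x =>
    obtain ⟨-, s, hs, h⟩ := h (Submodule.mem_span_singleton_self x)
    refine ⟨s, hs, ?_⟩
    rw [Submodule.smul_span, Submodule.span_le]
    rintro _ ⟨y, rfl, rfl⟩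
    exact h
  | sup J₁ J₂ _ _ h1 h2 =>
    obtain ⟨s, hs, h1⟩ := h1 (le_sup_left.trans h)
    obtain ⟨t, ht, h2⟩ := h2 (le_sup_right.trans h)
    refine ⟨s * t, fun h => ((Ideal.IsPrime.mem_or_mem ‹_› h).elim hs ht), ?_⟩
    rw [Submodule.smul_sup', sup_le_iff]
    constructor
    · rw [mul_comm, mul_smul]
      rintro _ ⟨y, hy, rfl⟩
      exact N.smul_mem _ (h1 hy)
    · rw [mul_smul]
      rintro _ ⟨y, hy, rfl⟩
      exact N.smul_mem _ (h2 hy)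

theorem sat_bound [IsNoetherianRing R] (𝔡 P : Ideal R) [P.IsPrime] (hP : P ∈ 𝔡.minimalPrimes)
    (J : Submodule R M) (hJ : J.FG) :
    ∃ lam : Submodule R M → ℕ, ∀ X Y, 𝔡 • J ≤ X → X ≤ Y → Y ≤ J → sat P X J ≤ X → ¬ Y ≤ X →
      lam X < lam Y := by
  classical
  let Q := ↥J ⧸ (𝔡 • ⊤ : Submodule R J)
  have : Module.Finite R J := Module.Finite.iff_fg.2 hJ
  let Rp := Localization.AtPrime P
  let L := LocalizedModule P.primeCompl Q
  let f : Q →ₗ[R] L := LocalizedModule.mkLinearMap P.primeCompl Q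
  have : IsNoetherian Rp L := by
    have : Module.Finite Rp L := inferInstance
    infer_instance
  let 𝔢 : Ideal Rp := 𝔡.map (algebraMap R Rp)
  have hart : IsArtinianRing (Rp ⧸ 𝔢) := by
    apply IsLocalRing.quotient_artinian_of_mem_minimalPrimes_of_isLocalRing
    rwa [IsLocalization.minimalPrimes_map P.primeCompl (Localization.AtPrime P) 𝔡,
      Set.mem_preimage, Localization.AtPrime.under_maximalIdeal]
  have hkill : ∀ r ∈ 𝔡, ∀ q : Q, r • q = 0 := by
    intro r hr q
    obtain ⟨y, rfl⟩ := Submodule.mkQ_surjective _ q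
    rw [← map_smul]
    exact (Submodule.Quotient.mk_eq_zero _).2 (Submodule.smul_mem_smul hr trivial)
  have htors : Module.IsTorsionBySet Rp L (𝔢 : Set Rp) := by
    have : 𝔢 ≤ Module.annihilator Rp L := by
      refine Ideal.map_le_iff_le_comap.2 fun r hr => ?_
      rw [Ideal.mem_comap, Module.mem_annihilator]
      intro l
      induction l using LocalizedModule.induction_on with
      | h m s =>
        rw [algebraMap_smul, LocalizedModule.smul'_mk, hkill r hr, LocalizedModule.zero_mk]
    intro x r
    exact Module.mem_annihilator.1 (this r.2) x
  let : Module (Rp ⧸ 𝔢) L := htors.module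
  have : IsScalarTower Rp (Rp ⧸ 𝔢) L := htors.isScalarTower
  have : Module.Finite (Rp ⧸ 𝔢) L := Module.Finite.of_restrictScalars_finite Rp _ _
  have : IsArtinian Rp L :=
    isArtinian_of_surjective_algebraMap (R := Rp ⧸ 𝔢) (M := L) Ideal.Quotient.mk_surjective
  let g : Submodule R M → Submodule Rp L := fun X =>
    ((X.comap J.subtype).map (Submodule.mkQ (𝔡 • ⊤ : Submodule R J))).localized' Rp P.primeCompl f
  have hfin : ∀ X : Submodule Rp L, Order.height X < ⊤ := fun X => by
    rw [← WithBot.coe_lt_coe]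
    apply lt_of_le_of_lt (Order.height_le_krullDim X)
    simpa using Order.krullDim_ne_top_of_finiteDimensionalOrder.lt_top
  refine ⟨fun X => (Order.height (g X)).toNat, fun X Y hX hXY hYJ hs hYX => ?_⟩
  have hlt : g X < g Y := by
    refine lt_of_le_of_ne ?_ ?_
    · exact (Submodule.localized'gi Rp P.primeCompl f).gc.monotone_l
        (Submodule.map_mono (Submodule.comap_mono hXY))
    · intro h
      obtain ⟨y, hy, hyX⟩ := Set.not_subset.1 hYX
      have h1 : f (Submodule.mkQ _ ⟨y, hYJ hy⟩) ∈ g X := by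
        rw [h]
        exact ⟨_, Submodule.mem_map_of_mem (show (⟨y, hYJ hy⟩ : J) ∈ Y.comap J.subtype from hy), 1,
          by rw [IsLocalizedModule.mk'_one]⟩
      obtain ⟨_, ⟨x, hx, rfl⟩, s, hs'⟩ := h1
      rw [IsLocalizedModule.mk'_eq_iff, Submonoid.smul_def, ← map_smul f] at hs'
      obtain ⟨t, ht⟩ := (IsLocalizedModule.eq_iff_exists P.primeCompl f).1 hs'
      apply hyX
      apply hs
      refine ⟨hYJ hy, (t : R) * s, (t * s).2, ?_⟩
      have h2 : Submodule.mkQ (𝔡 • ⊤ : Submodule R J) ((t : R) • x - ((t : R) * s) • ⟨y, hYJ hy⟩) = 0 := by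
        rw [map_sub, map_smul, map_smul, mul_smul, sub_eq_zero]
        exact ht
      rw [Submodule.mkQ_apply, Submodule.Quotient.mk_eq_zero] at h2
      have h3 : (((t : R) • x - ((t : R) * s) • ⟨y, hYJ hy⟩ : J) : M) ∈ 𝔡 • J := by
        have := Submodule.mem_map_of_mem (f := J.subtype) h2
        rwa [Submodule.map_smul'', Submodule.map_top, Submodule.range_subtype] at this
      have h4 := X.sub_mem (X.smul_mem (t : R) hx) (hX h3)
      simpa using h4
  have := Order.height_strictMono hlt (hfin _)
  rw [← ENat.natCast_toNat (hfin (g X)).ne, ← ENat.natCast_toNat (hfin (g Y)).ne] at this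
  exact_mod_cast this

end sat

/-- ascending chain condition on a set -/
def ACC {α : Type*} [PartialOrder α] (S : Set α) : Prop :=
  ∀ c : ℕ → α, Monotone c → (∀ i, c i ∈ S) → ∃ n, ∀ m ≥ n, c m = c n

lemma ACC.mono {α : Type*} [PartialOrder α] {S T : Set α} (h : S ⊆ T) (hT : ACC T) : ACC S :=
  fun c hc hS => hT c hc fun i => h (hS i)

lemma ACC.of_two {α β γ : Type*} [PartialOrder α] [PartialOrder β] [PartialOrder γ] {S : Set α}
    {T : Set β} {T' : Set γ} (hT : ACC T) (hT' : ACC T') (g : α → β) (g' : α → γ)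
    (hg : ∀ x ∈ S, ∀ y ∈ S, x ≤ y → g x ≤ g y) (hg' : ∀ x ∈ S, ∀ y ∈ S, x ≤ y → g' x ≤ g' y)
    (h1 : ∀ x ∈ S, g x ∈ T) (h2 : ∀ x ∈ S, g' x ∈ T')
    (hinj : ∀ x ∈ S, ∀ y ∈ S, x ≤ y → g x = g y → g' x = g' y → x = y) : ACC S := by
  intro c hc hS
  obtain ⟨n, hn⟩ := hT (fun i => g (c i)) (fun i j h => hg _ (hS i) _ (hS j) (hc h)) fun i => h1 _ (hS i)
  obtain ⟨n', hn'⟩ := hT' (fun i => g' (c i)) (fun i j h => hg' _ (hS i) _ (hS j) (hc h))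
    fun i => h2 _ (hS i)
  refine ⟨max n n', fun m hm => ?_⟩
  refine (hinj _ (hS _) _ (hS m) (hc hm) ?_ ?_).symm
  · simp only [ge_iff_le] at hn hm
    rw [hn m (le_trans (le_max_left _ _) hm), hn _ (le_max_left _ _)]
  · simp only [ge_iff_le] at hn' hm
    rw [hn' m (le_trans (le_max_right _ _) hm), hn' _ (le_max_right _ _)]

lemma ACC.of_one {α β : Type*} [PartialOrder α] [PartialOrder β] {S : Set α}
    {T : Set β} (hT : ACC T) (g : α → β)
    (hg : ∀ x ∈ S, ∀ y ∈ S, x ≤ y → g x ≤ g y)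
    (h1 : ∀ x ∈ S, g x ∈ T)
    (hinj : ∀ x ∈ S, ∀ y ∈ S, x ≤ y → g x = g y → x = y) : ACC S :=
  hT.of_two hT g g hg hg h1 h1 fun x hx y hy h h' _ => hinj x hx y hy h h'

lemma ACC.tail {α : Type*} [PartialOrder α] {S : Set α} {c : ℕ → α} (hS : ACC S) (hc : Monotone c)
    (j : ℕ) (h : ∀ i ≥ j, c i ∈ S) : ∃ n, ∀ m ≥ n, c m = c n := by
  obtain ⟨n, hn⟩ := hS (fun i => c (j + i)) (fun a b h => hc (by lia)) fun i => h _ (by lia)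
  refine ⟨j + n, fun m hm => ?_⟩
  obtain ⟨k, rfl⟩ := Nat.exists_eq_add_of_le hm
  rw [add_assoc]; exact hn _ (by lia)

/-- modular law: joint injectivity of `⊓`, `⊔`. -/
lemma eq_of_inf_sup {α : Type*} [Lattice α] [IsModularLattice α] {x y z : α} (h : x ≤ y)
    (h1 : x ⊓ z = y ⊓ z) (h2 : x ⊔ z = y ⊔ z) : x = y :=
  eq_of_le_of_inf_le_of_sup_le h h1.ge h2.ge

end LCF

namespace LCF
open scoped Pointwise

/-- Abstract Cartier-type data on the lattice of submodules. -/
structure CartierData (R M : Type*) [CommRing R] [AddCommGroup M] [Module R M] (p : ℕ) where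
  φ : Submodule R M → Submodule R M
  F : Submodule R M → Submodule R M
  gc : GaloisConnection φ F
  φF : ∀ X, φ (F X) = X
  φsmul : ∀ (r : R) X, φ (r ^ p • X) = r • φ X
  D : Submodule R M → Prop
  D_top : D ⊤
  D_inf : ∀ {X Y}, D X → D Y → D (X ⊓ Y)
  D_sup : ∀ {X Y}, D X → D Y → D (X ⊔ Y)
  D_φ : ∀ {X}, D X → D (φ X)
  D_F : ∀ {X}, D X → D (F X)
  FφD : ∀ {X}, D X → F (φ X) = X
  D_sat : ∀ (P : Ideal R) [P.IsPrime] {N U}, D N → D U → D (sat P N U)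
  M0 : Submodule R M
  M0fg : M0.FG
  φM0 : φ M0 ≤ M0
  exh : ∀ u : M, ∃ e, φ^[e] (Submodule.span R {u}) ≤ M0

namespace CartierData
variable {R M : Type*} [CommRing R] [AddCommGroup M] [Module R M] {p : ℕ} (C : CartierData R M p)

lemma mono {X Y : Submodule R M} (h : X ≤ Y) : C.φ X ≤ C.φ Y := C.gc.monotone_l h

lemma itmono (e : ℕ) {X Y : Submodule R M} (h : X ≤ Y) : C.φ^[e] X ≤ C.φ^[e] Y :=
  (Monotone.iterate (fun _ _ h => C.mono h) e) h

lemma D_it {X} (h : C.D X) (e : ℕ) : C.D (C.φ^[e] X) := by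
  induction e with
  | zero => exact h
  | succ e ih => rw [Function.iterate_succ_apply']; exact C.D_φ ih

lemma fix_it {X} (h : C.φ X = X) (e : ℕ) : C.φ^[e] X = X := Function.iterate_fixed h e

lemma φinf {X Y} (hX : C.D X) (hY : C.D Y) : C.φ (X ⊓ Y) = C.φ X ⊓ C.φ Y := by
  apply le_antisymm (le_inf (C.mono inf_le_left) (C.mono inf_le_right))
  rw [← C.φF (C.φ X ⊓ C.φ Y), C.gc.u_inf, C.FφD hX, C.FφD hY]

lemma itinf {X Y} (hX : C.D X) (hY : C.D Y) (e : ℕ) :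
    C.φ^[e] (X ⊓ Y) = C.φ^[e] X ⊓ C.φ^[e] Y := by
  induction e with
  | zero => rfl
  | succ e ih => simp only [Function.iterate_succ_apply', ih]; exact C.φinf (C.D_it hX e) (C.D_it hY e)

lemma le_of_φ_le {X Y} (hY : C.D Y) (h : C.φ X ≤ C.φ Y) : X ≤ Y := by
  have := C.gc.le_iff_le.1 h
  rwa [C.FφD hY] at this

lemma le_of_it_le {X Y} (hY : C.D Y) (e : ℕ) (h : C.φ^[e] X ≤ C.φ^[e] Y) : X ≤ Y := by
  induction e with
  | zero => exact h
  | succ e ih =>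
    simp only [Function.iterate_succ_apply'] at h
    exact ih (C.le_of_φ_le (C.D_it hY e) h)

lemma smul_F_le (r : R) (X) : r ^ p • C.F X ≤ C.F (r • X) := by
  rw [← C.gc.le_iff_le, C.φsmul, C.φF]

lemma smul_le_φ {𝔟 𝔠 : Ideal R} {J N : Submodule R M} (h : ∀ r ∈ 𝔟, r ^ p ∈ 𝔠) (hJ : C.φ J = J)
    (hN : 𝔠 • J ≤ N) : 𝔟 • J ≤ C.φ N := by
  rw [Submodule.smul_le]
  intro r hr x hx
  have : r • J ≤ C.φ N := by
    conv_lhs => rw [← hJ, ← C.φsmul]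
    refine C.mono (le_trans ?_ hN)
    rintro _ ⟨y, hy, rfl⟩
    exact Submodule.smul_mem_smul (h r hr) hy
  exact this (Submodule.smul_mem_pointwise_smul x r J hx)

lemma smul_le_it (hp : 2 ≤ p) {a : Ideal R} {J N : Submodule R M} (hJ : C.φ J = J)
    (hN : a • J ≤ N) (e : ℕ) : a • J ≤ C.φ^[e] N := by
  induction e with
  | zero => exact hN
  | succ e ih =>
    rw [Function.iterate_succ_apply']
    exact C.smul_le_φ (fun r hr => Ideal.pow_mem_of_mem _ hr _ (by lia)) hJ ih

lemma eventually_smul_le (hp : 2 ≤ p) {a : Ideal R} {J N : Submodule R M} (hJ : C.φ J = J)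
    (t e : ℕ) (hN : a ^ t • J ≤ C.φ^[e] N) : ∃ e0, ∀ e ≥ e0, a • J ≤ C.φ^[e] N := by
  induction t using Nat.strong_induction_on generalizing e with
  | _ t ih =>
    rcases Nat.lt_or_ge t 2 with ht | ht
    · have h1 : a • J ≤ C.φ^[e] N := by
        refine le_trans ?_ hN
        interval_cases t
        · simpa using Submodule.smul_le_right
        · simp
      refine ⟨e, fun e' he => ?_⟩
      obtain ⟨k, rfl⟩ := Nat.exists_eq_add_of_le' he
      rw [Function.iterate_add_apply]
      exact C.smul_le_it hp hJ h1 k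
    · refine ih ((t + 1) / 2) (by lia) (e + 1) ?_
      rw [Function.iterate_succ_apply']
      refine C.smul_le_φ (fun r hr => ?_) hJ hN
      have := Ideal.pow_mem_pow hr p
      rw [← pow_mul] at this
      refine Ideal.pow_le_pow_right ?_ this
      have : (t + 1) / 2 * 2 ≤ (t + 1) / 2 * p := Nat.mul_le_mul_left _ hp
      lia

/-- `J` is a finite generating (HSL) piece of `U`. -/
structure Gen (U J : Submodule R M) : Prop where
  D : C.D U
  fix : C.φ U = U
  fg : J.FG
  le : J ≤ U
  fixJ : C.φ J = J
  exh : ∀ u ∈ U, ∃ e, C.φ^[e] (Submodule.span R {u}) ≤ J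

variable {C}

lemma Gen.ev {U J : Submodule R M} (h : C.Gen U J) {u : M} (hu : u ∈ U) :
    ∃ e0, ∀ e ≥ e0, C.φ^[e] (Submodule.span R {u}) ≤ J := by
  obtain ⟨e, he⟩ := h.exh u hu
  refine ⟨e, fun e' he' => ?_⟩
  obtain ⟨k, rfl⟩ := Nat.exists_eq_add_of_le' he'
  rw [Function.iterate_add_apply]
  exact (C.itmono k he).trans (C.fix_it h.fixJ k).le

lemma Gen.det {U J N N' : Submodule R M} (h : C.Gen U J) (hN : N ≤ U) (hN' : C.D N')
    (H : ∀ e0, ∃ e ≥ e0, C.φ^[e] N ⊓ J ≤ C.φ^[e] N') : N ≤ N' := by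
  intro u hu
  obtain ⟨e0, he0⟩ := h.ev (hN hu)
  obtain ⟨e, he, hle⟩ := H e0
  have : Submodule.span R {u} ≤ N' := by
    apply C.le_of_it_le hN' e
    refine le_trans (le_inf (C.itmono e ?_) (he0 e he)) hle
    rwa [Submodule.span_singleton_le_iff_mem]
  exact this (Submodule.mem_span_singleton_self u)

variable (C) in
theorem exists_gen [IsNoetherianRing R] (hp : 2 ≤ p) {U : Submodule R M} (hU : C.D U)
    (hfix : C.φ U = U) : ∃ J, C.Gen U J := by
  have : IsNoetherian R C.M0 := isNoetherian_of_fg_of_noetherian _ C.M0fg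
  set J : ℕ → Submodule R M := fun d => C.φ^[d] (U ⊓ C.M0) with hJdef
  have hJs : ∀ d, J (d + 1) = C.φ (J d) := fun d => Function.iterate_succ_apply' _ _ _
  have hJanti : ∀ d, J (d + 1) ≤ J d := by
    intro d
    simp only [hJdef, Function.iterate_succ_apply]
    refine C.itmono d (le_inf ((C.mono inf_le_left).trans hfix.le) ((C.mono inf_le_right).trans C.φM0))
  have hJA : Antitone J := antitone_nat_of_succ_le hJanti
  have hJ0 : ∀ d, J d ≤ U ⊓ C.M0 := fun d => hJA (Nat.zero_le d)
  have hJfg : ∀ d, (J d).FG := fun d => by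
    have := (IsNoetherian.noetherian (Submodule.comap C.M0.subtype (J d))).map C.M0.subtype
    rwa [Submodule.map_comap_subtype, inf_eq_right.2 ((hJ0 d).trans inf_le_right)] at this
  let 𝔠 : ℕ → Ideal R := fun d => (J (d + 1)).colon (J d : Set M)
  have mem𝔠 : ∀ d r, r ∈ 𝔠 d ↔ r • J d ≤ J (d + 1) := by
    intro d r
    rw [Submodule.mem_colon]
    constructor
    · rintro h _ ⟨y, hy, rfl⟩; exact h y hy
    · intro h y hy; exact h (Submodule.smul_mem_pointwise_smul y r _ hy)
  have h𝔠 : Monotone 𝔠 := by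
    refine monotone_nat_of_le_succ fun d r hr => ?_
    rw [mem𝔠] at hr ⊢
    rw [hJs (d + 1)]
    nth_rewrite 1 [hJs d]
    rw [← C.φsmul]
    refine C.mono (le_trans ?_ hr)
    rintro _ ⟨y, hy, rfl⟩
    obtain ⟨q, rfl⟩ : ∃ q, p = q + 1 := ⟨p - 1, by lia⟩
    have : (r ^ (q + 1)) • y = r • (r ^ q • y) := by rw [pow_succ', mul_smul]
    change (r ^ (q + 1)) • y ∈ _
    rw [this]
    exact Submodule.smul_mem_pointwise_smul _ _ _ (Submodule.smul_mem _ _ hy)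
  obtain ⟨d0, hd0⟩ := monotone_stabilizes_iff_noetherian.2 (inferInstance : IsNoetherian R R) ⟨𝔠, h𝔠⟩
  change ∀ m, d0 ≤ m → 𝔠 d0 = 𝔠 m at hd0
  by_cases htop : 𝔠 d0 = ⊤
  · refine ⟨J d0, hU, hfix, hJfg d0, (hJ0 d0).trans inf_le_left, ?_, ?_⟩
    · rw [← hJs]
      refine le_antisymm (hJanti _) ?_
      have := (mem𝔠 d0 1).1 (by rw [htop]; trivial)
      simpa using this
    · intro u hu
      obtain ⟨e, he⟩ := C.exh u
      refine ⟨d0 + e, ?_⟩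
      rw [Function.iterate_add_apply]
      refine C.itmono d0 (le_inf ?_ he)
      refine (C.itmono e ?_).trans (C.fix_it hfix e).le
      rwa [Submodule.span_singleton_le_iff_mem]
  · exfalso
    let 𝔡 : Ideal R := Ideal.span ((fun r => r ^ 2) '' (𝔠 d0 : Set R))
    have h𝔡 : ∀ d ≥ d0, 𝔡 • J d0 ≤ J d := by
      intro d hd
      induction d, hd using Nat.le_induction with
      | base => exact Submodule.smul_le_right
      | succ d hd ih =>
        rw [Submodule.smul_le]
        intro r hr x hx
        induction hr using Submodule.span_induction with
        | zero => simp
        | add a b _ _ ha hb => rw [add_smul]; exact Submodule.add_mem _ ha hb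
        | smul c a _ ha => rw [smul_eq_mul, mul_smul]; exact Submodule.smul_mem _ _ ha
        | mem r2 h =>
          obtain ⟨r, hr, rfl⟩ := h
          have h1 : r • J d0 ≤ J (d0 + 1) := (mem𝔠 _ _).1 hr
          have h2 : r • J (d0 + 1) ≤ J (d + 1) := by
            rw [hJs, hJs, ← C.φsmul]
            refine C.mono (le_trans ?_ ih)
            rintro _ ⟨y, hy, rfl⟩
            refine Submodule.smul_mem_smul ?_ hy
            obtain ⟨q, rfl⟩ : ∃ q, p = q + 2 := ⟨p - 2, by lia⟩
            rw [pow_add]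
            exact Ideal.mul_mem_left _ _ (Ideal.subset_span ⟨r, hr, rfl⟩)
          change (r ^ 2) • x ∈ _
          rw [pow_two, mul_smul]
          exact h2 (Submodule.smul_mem_pointwise_smul _ _ _
            (h1 (Submodule.smul_mem_pointwise_smul _ _ _ hx)))
    obtain ⟨P, hP⟩ := Ideal.nonempty_minimalPrimes htop
    have hPp : P.IsPrime := hP.1.1
    have hP𝔡 : P ∈ 𝔡.minimalPrimes := by
      have key : ∀ Q : Ideal R, Q.IsPrime → (𝔡 ≤ Q ↔ 𝔠 d0 ≤ Q) := by
        intro Q hQ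
        constructor
        · intro h r hr
          exact hQ.mem_of_pow_mem 2 (h (Ideal.subset_span ⟨r, hr, rfl⟩))
        · intro h
          refine Ideal.span_le.2 ?_
          rintro _ ⟨r, hr, rfl⟩
          exact Ideal.pow_mem_of_mem _ (h hr) _ (by simp)
      refine ⟨⟨hPp, (key P hPp).2 hP.1.2⟩, fun Q hQ hQP => hP.2 ⟨hQ.1, (key Q hQ.1).1 hQ.2⟩ hQP⟩
    obtain ⟨lam, hlam⟩ := sat_bound 𝔡 P hP𝔡 (J d0) (hJfg d0)
    have hstep : ∀ d ≥ d0, lam (sat P (J (d + 1)) (J d0)) < lam (sat P (J d) (J d0)) := by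
      intro d hd
      refine hlam _ _ ((h𝔡 _ (by lia)).trans (le_sat (hJA (by lia)))) (sat_mono (hJanti d)) sat_le
        sat_sat fun hle => ?_
      obtain ⟨s, hs, hsJ⟩ := exists_smul_le_of_le_sat (hJfg d) ((le_sat (hJA hd)).trans hle)
      have := (mem𝔠 d s).2 hsJ
      rw [← hd0 d hd] at this
      exact hs (hP.1.2 this)
    have : ∀ k, lam (sat P (J (d0 + k)) (J d0)) + k ≤ lam (sat P (J d0) (J d0)) := by
      intro k
      induction k with
      | zero => simp
      | succ k ih => have := hstep (d0 + k) (by lia); rw [← add_assoc]; lia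
    have := this (lam (sat P (J d0) (J d0)) + 1)
    lia

variable (C) in
/-- torsion predicate -/
def Tor (a : Ideal R) (J N : Submodule R M) : Prop := ∃ t e, a ^ t • J ≤ C.φ^[e] N

lemma Tor.ev (hp : 2 ≤ p) {a : Ideal R} {J N : Submodule R M} (h : C.Tor a J N) (hJ : C.φ J = J) :
    ∃ e0, ∀ e ≥ e0, a • J ≤ C.φ^[e] N := by
  obtain ⟨t, e, h⟩ := h
  exact C.eventually_smul_le hp hJ t e h

lemma Tor.of_ev {a : Ideal R} {J N : Submodule R M} (h : ∃ e0, ∀ e ≥ e0, a • J ≤ C.φ^[e] N) :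
    C.Tor a J N := by
  obtain ⟨e0, h⟩ := h
  exact ⟨1, e0, by simpa using h e0 le_rfl⟩

lemma Tor.mono {a : Ideal R} {J N N' : Submodule R M} (h : C.Tor a J N) (hN : N ≤ N') :
    C.Tor a J N' := by
  obtain ⟨t, e, h⟩ := h
  exact ⟨t, e, h.trans (C.itmono e hN)⟩

lemma Tor.inf (hp : 2 ≤ p) {a : Ideal R} {J N N' : Submodule R M} (h : C.Tor a J N)
    (h' : C.Tor a J N') (hJ : C.φ J = J) (hN : C.D N) (hN' : C.D N') : C.Tor a J (N ⊓ N') := by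
  obtain ⟨e, he⟩ := h.ev hp hJ
  obtain ⟨e', he'⟩ := h'.ev hp hJ
  refine Tor.of_ev ⟨max e e', fun d hd => ?_⟩
  rw [C.itinf hN hN']
  exact le_inf (he d (le_trans (le_max_left _ _) hd)) (he' d (le_trans (le_max_right _ _) hd))

lemma Tor.φ (hp : 2 ≤ p) {a : Ideal R} {J N : Submodule R M} (h : C.Tor a J N) (hJ : C.φ J = J) :
    C.Tor a J (C.φ N) := by
  obtain ⟨e, he⟩ := h.ev hp hJ
  refine Tor.of_ev ⟨e, fun d hd => ?_⟩
  rw [← Function.iterate_succ_apply]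
  exact he _ (by lia)

lemma sat_φ {P : Ideal R} [P.IsPrime] {N U : Submodule R M} (hN : C.D N) (hU : C.D U)
    (hfix : C.φ U = U) (h : sat P N U ≤ N) : sat P (C.φ N) U ≤ C.φ N := by
  rintro u ⟨hu, s, hs, hsu⟩
  have h1 : C.F (Submodule.span R {u}) ≤ N := by
    intro v hv
    refine h ⟨?_, s ^ p, fun h => hs (Ideal.IsPrime.mem_of_pow_mem ‹_› _ h), ?_⟩
    · have : C.F U = U := by conv_lhs => rw [← hfix, C.FφD hU]
      rw [← this]
      refine C.gc.monotone_u ?_ hv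
      rwa [Submodule.span_singleton_le_iff_mem]
    · have h2 := C.smul_F_le s _ (Submodule.smul_mem_pointwise_smul v (s ^ p) _ hv)
      rw [← C.FφD hN]
      refine C.gc.monotone_u ?_ h2
      rw [Submodule.smul_span, Submodule.span_le]
      rintro _ ⟨y, rfl, rfl⟩
      exact hsu
  have h2 := C.mono h1
  rw [C.φF] at h2
  exact h2 (Submodule.mem_span_singleton_self u)

lemma sat_it {P : Ideal R} [P.IsPrime] {N U : Submodule R M} (hN : C.D N) (hU : C.D U)
    (hfix : C.φ U = U) (h : sat P N U ≤ N) (e : ℕ) : sat P (C.φ^[e] N) U ≤ C.φ^[e] N := by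
  induction e with
  | zero => exact h
  | succ e ih => rw [Function.iterate_succ_apply']; exact sat_φ (C.D_it hN e) hU hfix ih

end CartierData
end LCF

namespace LCF
open scoped Pointwise

namespace CartierData
variable {R M : Type*} [CommRing R] [AddCommGroup M] [Module R M] {p : ℕ} {C : CartierData R M p}

variable (C) in
def Lam (a P : Ideal R) [P.IsPrime] (U J : Submodule R M) : Set (Submodule R M) :=
  {N | C.D N ∧ N ≤ U ∧ sat P N U ≤ N ∧ C.Tor a J N}

theorem exists_rank [IsNoetherianRing R] (hp : 2 ≤ p) (a P : Ideal R) [P.IsPrime]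
    (hP : P ∈ a.minimalPrimes) {U J : Submodule R M} (hg : C.Gen U J) :
    ∃ (rk : Submodule R M → ℕ) (l : ℕ), (∀ N ∈ C.Lam a P U J, rk N ≤ l) ∧
      ∀ N ∈ C.Lam a P U J, ∀ N' ∈ C.Lam a P U J, N < N' → rk N < rk N' := by
  obtain ⟨lam, hlam⟩ := sat_bound a P hP J hg.fg
  let S : Submodule R M → Set ℕ := fun N => {v | ∃ e0, ∀ e ≥ e0, lam (C.φ^[e] N ⊓ J) ≤ v}
  have hsat : ∀ N ∈ C.Lam a P U J, ∀ e, sat P (C.φ^[e] N ⊓ J) J ≤ C.φ^[e] N ⊓ J := by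
    rintro N ⟨hD, hNU, hs, -⟩ e x ⟨hx, s, hsP, hsx⟩
    exact ⟨sat_it hD hg.D hg.fix hs e ⟨hg.le hx, s, hsP, hsx.1⟩, hx⟩
  have hmem : ∀ N ∈ C.Lam a P U J, lam J ∈ S N := by
    intro N hN
    obtain ⟨e0, he0⟩ := hN.2.2.2.ev hp hg.fixJ
    refine ⟨e0, fun e he => ?_⟩
    by_cases hJ : J ≤ C.φ^[e] N ⊓ J
    · rw [le_antisymm inf_le_right hJ]
    · exact (hlam _ _ (le_inf (he0 e he) Submodule.smul_le_right) inf_le_right le_rfl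
        (hsat N hN e) hJ).le
  refine ⟨fun N => sInf (S N), lam J, fun N hN => Nat.sInf_le (hmem N hN), ?_⟩
  intro N hN N' hN' hlt
  have h1 : sInf (S N') ∈ S N' := Nat.sInf_mem ⟨_, hmem N' hN'⟩
  have h2 : ∃ e0, ∀ e ≥ e0, lam (C.φ^[e] N ⊓ J) < lam (C.φ^[e] N' ⊓ J) := by
    obtain ⟨e0, he0⟩ := hN.2.2.2.ev hp hg.fixJ
    have h3 : ∃ e1, ∀ e ≥ e1, ¬ (C.φ^[e] N' ⊓ J ≤ C.φ^[e] N) := by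
      by_contra hcon
      push Not at hcon
      exact hlt.not_ge (hg.det hN'.2.1 hN.1 hcon)
    obtain ⟨e1, he1⟩ := h3
    refine ⟨max e0 e1, fun e he => ?_⟩
    refine hlam _ _ (le_inf (he0 e (le_trans (le_max_left _ _) he)) Submodule.smul_le_right)
      (inf_le_inf_right _ (C.itmono e hlt.le)) inf_le_right (hsat N hN e) fun h => ?_
    exact he1 e (le_trans (le_max_right _ _) he) (h.trans inf_le_left)
  obtain ⟨e0, h1⟩ := h1
  obtain ⟨e1, h2⟩ := h2
  have hpos : 0 < sInf (S N') := by
    have := h1 (max e0 e1) (le_max_left _ _)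
    have := h2 (max e0 e1) (le_max_right _ _)
    lia
  have : sInf (S N) ≤ sInf (S N') - 1 := by
    refine Nat.sInf_le ⟨max e0 e1, fun e he => ?_⟩
    have := h1 e (le_trans (le_max_left _ _) he)
    have := h2 e (le_trans (le_max_right _ _) he)
    lia
  change sInf (S N) < sInf (S N')
  lia

lemma lam_inf (hp : 2 ≤ p) {a P : Ideal R} [P.IsPrime] {U J N N' : Submodule R M} (hg : C.Gen U J)
    (h : N ∈ C.Lam a P U J) (h' : N' ∈ C.Lam a P U J) : N ⊓ N' ∈ C.Lam a P U J := by
  refine ⟨C.D_inf h.1 h'.1, inf_le_left.trans h.2.1, ?_,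
    Tor.inf hp h.2.2.2 h'.2.2.2 hg.fixJ h.1 h'.1⟩
  exact le_inf ((sat_mono inf_le_left).trans h.2.2.1) ((sat_mono inf_le_right).trans h'.2.2.1)

lemma lam_φ (hp : 2 ≤ p) {a P : Ideal R} [P.IsPrime] {U J N : Submodule R M} (hg : C.Gen U J)
    (h : N ∈ C.Lam a P U J) : C.φ N ∈ C.Lam a P U J :=
  ⟨C.D_φ h.1, (C.mono h.2.1).trans hg.fix.le, sat_φ h.1 hg.D hg.fix h.2.2.1,
    Tor.φ hp h.2.2.2 hg.fixJ⟩

lemma lam_it (hp : 2 ≤ p) {a P : Ideal R} [P.IsPrime] {U J N : Submodule R M} (hg : C.Gen U J)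
    (h : N ∈ C.Lam a P U J) (e : ℕ) : C.φ^[e] N ∈ C.Lam a P U J := by
  induction e with
  | zero => exact h
  | succ e ih => rw [Function.iterate_succ_apply']; exact lam_φ hp hg ih

/-- interval ACC is stable under intersections of lower bounds -/
lemma acc_inf {N N' W : Submodule R M} (hD : C.D N) (hD' : C.D N') (hNW : N ≤ W) (hNW' : N' ≤ W)
    (h : ACC {X | C.D X ∧ N ≤ X ∧ X ≤ W}) (h' : ACC {X | C.D X ∧ N' ≤ X ∧ X ≤ W}) :
    ACC {X | C.D X ∧ N ⊓ N' ≤ X ∧ X ≤ W} := by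
  refine h.of_two h' (fun X => X ⊔ N) (fun X => (X ⊓ N) ⊔ N') ?_ ?_ ?_ ?_ ?_
  · intro x _ y _ hxy; exact sup_le_sup_right hxy _
  · intro x _ y _ hxy; exact sup_le_sup_right (inf_le_inf_right _ hxy) _
  · rintro x ⟨hx, -, hxW⟩; exact ⟨C.D_sup hx hD, le_sup_right, sup_le hxW hNW⟩
  · rintro x ⟨hx, -, hxW⟩
    exact ⟨C.D_sup (C.D_inf hx hD) hD', le_sup_right, sup_le (inf_le_left.trans hxW) hNW'⟩
  · rintro x ⟨_, hx, _⟩ y ⟨_, hy, _⟩ hxy h1 h2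
    have key : ∀ z, N ⊓ N' ≤ z → ((z ⊓ N) ⊔ N') ⊓ N = z ⊓ N := by
      intro z hz
      rw [sup_inf_assoc_of_le _ (inf_le_right : z ⊓ N ≤ N)]
      refine sup_eq_left.2 (le_inf (le_trans (by rw [inf_comm]) hz) inf_le_right)
    refine eq_of_inf_sup hxy ?_ h1
    rw [← key x hx, ← key y hy]
    exact congrArg (· ⊓ N) h2

lemma acc_φ {N W : Submodule R M} (hW : C.D W) (hfix : C.φ W = W)
    (h : ACC {X | C.D X ∧ N ≤ X ∧ X ≤ W}) : ACC {X | C.D X ∧ C.φ N ≤ X ∧ X ≤ W} := by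
  refine h.of_one C.F ?_ ?_ ?_
  · intro x _ y _ hxy; exact C.gc.monotone_u hxy
  · rintro x ⟨hx, hN, hxW⟩
    refine ⟨C.D_F hx, C.gc.le_iff_le.1 hN, ?_⟩
    have : C.F W = W := by conv_lhs => rw [← hfix, C.FφD hW]
    rw [← this]; exact C.gc.monotone_u hxW
  · intro x _ y _ _ he
    rw [← C.φF x, ← C.φF y, he]

theorem main_step [IsNoetherianRing R] (hp : 2 ≤ p) (a P : Ideal R) [P.IsPrime]
    (hP : P ∈ a.minimalPrimes) {U J : Submodule R M} (hg : C.Gen U J)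
    (IH : ∀ b : Ideal R, a < b → ∀ U J : Submodule R M, C.Gen U J →
      ACC {N | C.D N ∧ N ≤ U ∧ C.Tor b J N})
    (W : Submodule R M) (hW : W ∈ C.Lam a P U J) (hWfix : C.φ W = W) :
    ACC {N | C.D N ∧ N ≤ W ∧ C.Tor a J N} := by
  obtain ⟨rk, l, hl, hrk⟩ := exists_rank hp a P hP hg
  induction hr : rk W using Nat.strong_induction_on generalizing W with
  | _ r ih =>
  subst hr
  obtain ⟨JW, hJW⟩ := C.exists_gen hp hW.1 hWfix
  have hJWJ : JW ≤ J := by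
    have : ∃ e, C.φ^[e] JW ≤ J := by
      have hev : ∃ e0, ∀ e ≥ e0, C.φ^[e] JW ≤ J := by
        have aux : ∀ X : Submodule R M, X.FG → X ≤ U → ∃ e0, ∀ e ≥ e0, C.φ^[e] X ≤ J := by
          intro X hX
          induction X, hX using Submodule.fg_induction with
          | singleton x =>
            intro h
            exact hg.ev (h (Submodule.mem_span_singleton_self x))
          | sup X Y _ _ h1 h2 =>
            intro h
            obtain ⟨e1, h1⟩ := h1 (le_sup_left.trans h)
            obtain ⟨e2, h2⟩ := h2 (le_sup_right.trans h)
            refine ⟨max e1 e2, fun e he => ?_⟩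
            have hsup : C.φ^[e] (X ⊔ Y) = C.φ^[e] X ⊔ C.φ^[e] Y := by
              clear * -
              induction e with
              | zero => rfl
              | succ e ih => simp only [Function.iterate_succ_apply', ih, C.gc.l_sup]
            rw [hsup]
            exact sup_le (h1 e (le_trans (le_max_left _ _) he)) (h2 e (le_trans (le_max_right _ _) he))
        exact aux JW hJW.fg (hJW.le.trans hW.2.1)
      obtain ⟨e0, h⟩ := hev
      exact ⟨e0, h _ le_rfl⟩
    obtain ⟨e, he⟩ := this
    rwa [C.fix_it hJW.fixJ] at he
  -- a submodule whose saturation contains W has the ACC above it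
  have good : ∀ N, C.D N → N ≤ W → C.Tor a J N → W ≤ sat P N U →
      ACC {X | C.D X ∧ N ≤ X ∧ X ≤ W} := by
    intro N hN hNW hNt hs
    obtain ⟨s, hsP, hsJ⟩ := exists_smul_le_of_le_sat hJW.fg (hJW.le.trans hs)
    have hlt : a < a ⊔ Ideal.span {s} := by
      refine lt_of_le_of_ne le_sup_left fun h => hsP (hP.1.2 ?_)
      rw [h]; exact Ideal.mem_sup_right (Ideal.mem_span_singleton_self s)
    refine (IH _ hlt W JW hJW).mono ?_
    rintro X ⟨hX, hNX, hXW⟩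
    refine ⟨hX, hXW, Tor.mono ?_ hNX⟩
    obtain ⟨e0, he0⟩ := hNt.ev hp hg.fixJ
    refine Tor.of_ev ⟨e0, fun e he => ?_⟩
    rw [Submodule.sup_smul, sup_le_iff]
    refine ⟨le_trans (Submodule.smul_mono le_rfl hJWJ) (he0 e he), ?_⟩
    refine C.smul_le_it hp hJW.fixJ ?_ e
    rwa [Submodule.ideal_span_singleton_smul]
  have satmem : ∀ N, C.D N → N ≤ W → C.Tor a J N → sat P N U ∈ C.Lam a P U J ∧ sat P N U ≤ W := by
    intro N hN hNW hNt
    exact ⟨⟨C.D_sat P hN hg.D, sat_le, sat_sat, hNt.mono (le_sat (hNW.trans hW.2.1))⟩,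
      (sat_mono hNW).trans hW.2.2.1⟩
  by_cases hex : ∃ N, N ∈ C.Lam a P U J ∧ N ≤ W ∧ N ≠ W
  · -- choose N1 maximal (by rank)
    obtain ⟨N1, ⟨hN1, hN1W, hN1ne⟩, hmax⟩ : ∃ N1, (N1 ∈ C.Lam a P U J ∧ N1 ≤ W ∧ N1 ≠ W) ∧
        ∀ N, N ∈ C.Lam a P U J → N ≤ W → N ≠ W → N1 ≤ N → N = N1 := by
      let T := {N | N ∈ C.Lam a P U J ∧ N ≤ W ∧ N ≠ W}
      have hwf := (measure (fun N : Submodule R M => l - rk N)).wf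
      obtain ⟨N1, h1, h2⟩ := hwf.has_min T hex
      refine ⟨N1, h1, fun N hN hNW hne hle => ?_⟩
      by_contra hcon
      have hlt := hrk N1 h1.1 N hN (lt_of_le_of_ne hle (Ne.symm hcon))
      have := hl N hN
      exact h2 N ⟨hN, hNW, hne⟩ (by change l - rk N < l - rk N1; lia)
    have acc1 : ACC {X | C.D X ∧ N1 ≤ X ∧ X ≤ W} := by
      intro c hc hS
      by_cases hall : ∀ i, c i = N1
      · exact ⟨0, fun m _ => by rw [hall m, hall 0]⟩
      · push Not at hall
        obtain ⟨j, hj⟩ := hall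
        have hjS := hS j
        have ht : C.Tor a J (c j) := hN1.2.2.2.mono hjS.2.1
        obtain ⟨h1, h2⟩ := satmem (c j) hjS.1 hjS.2.2 ht
        have h3 : sat P (c j) U = W := by
          by_contra hne
          have h4 := hmax _ h1 h2 hne (hjS.2.1.trans (le_sat (hjS.2.2.trans hW.2.1)))
          apply hj
          exact le_antisymm (by rw [← h4]; exact le_sat (hjS.2.2.trans hW.2.1)) hjS.2.1
        exact (good (c j) hjS.1 hjS.2.2 ht h3.ge).tail hc j
          fun i hi => ⟨(hS i).1, hc hi, (hS i).2.2⟩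
    have accit : ∀ d, ACC {X | C.D X ∧ C.φ^[d] N1 ≤ X ∧ X ≤ W} := by
      intro d
      induction d with
      | zero => exact acc1
      | succ d ih => simp only [Function.iterate_succ_apply']; exact acc_φ hW.1 hWfix ih
    have itle : ∀ d, C.φ^[d] N1 ≤ W := fun d => (C.itmono d hN1W).trans (C.fix_it hWfix d).le
    -- finite intersections
    let V : ℕ → Submodule R M := fun m => Nat.rec N1 (fun i X => X ⊓ C.φ^[i + 1] N1) m
    have hVs : ∀ m, V (m + 1) = V m ⊓ C.φ^[m + 1] N1 := fun m => rfl
    have hVlam : ∀ m, V m ∈ C.Lam a P U J := by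
      intro m
      induction m with
      | zero => exact hN1
      | succ m ih => rw [hVs]; exact lam_inf hp hg ih (lam_it hp hg hN1 _)
    have hVle : ∀ m, V m ≤ N1 := by
      intro m
      induction m with
      | zero => exact le_rfl
      | succ m ih => rw [hVs]; exact inf_le_left.trans ih
    have hVacc : ∀ m, ACC {X | C.D X ∧ V m ≤ X ∧ X ≤ W} := by
      intro m
      induction m with
      | zero => exact acc1
      | succ m ih =>
        rw [hVs]
        exact acc_inf (hVlam m).1 (lam_it hp hg hN1 _).1 ((hVle m).trans hN1W) (itle _) ih (accit _)
    have hVφ : ∀ m, V (m + 1) = N1 ⊓ C.φ (V m) := by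
      intro m
      induction m with
      | zero => rfl
      | succ m ih =>
        have h1 : C.φ (V (m + 1)) = C.φ (V m) ⊓ C.φ^[m + 1 + 1] N1 := by
          rw [hVs m, C.φinf (hVlam m).1 (lam_it hp hg hN1 _).1, ← Function.iterate_succ_apply' C.φ]
        rw [h1, ← inf_assoc, ← ih, hVs (m + 1)]
    obtain ⟨m, hm⟩ : ∃ m, V (m + 1) = V m := by
      by_contra hcon
      push Not at hcon
      have : ∀ k, rk (V k) + k ≤ rk (V 0) := by
        intro k
        induction k with
        | zero => simp
        | succ k ih =>
          have := hrk _ (hVlam (k + 1)) _ (hVlam k) (lt_of_le_of_ne inf_le_left (hcon k))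
          lia
      have := this (rk (V 0) + 1)
      lia
    have hle : V m ≤ C.φ (V m) := by
      conv_lhs => rw [← hm, hVφ]
      exact inf_le_right
    obtain ⟨d, hd⟩ : ∃ d, C.φ^[d + 1] (V m) = C.φ^[d] (V m) := by
      by_contra hcon
      push Not at hcon
      have : ∀ k, k ≤ rk (C.φ^[k] (V m)) := by
        intro k
        induction k with
        | zero => simp
        | succ k ih =>
          have := hrk _ (lam_it hp hg (hVlam m) k) _ (lam_it hp hg (hVlam m) (k + 1))
            (lt_of_le_of_ne (by rw [Function.iterate_succ_apply]; exact C.itmono k hle)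
              (hcon k).symm)
          lia
      have h1 := this (l + 1)
      have h2 := hl _ (lam_it hp hg (hVlam m) (l + 1))
      lia
    have hZacc : ACC {X | C.D X ∧ C.φ^[d] (V m) ≤ X ∧ X ≤ W} := by
      clear hd
      induction d with
      | zero => exact hVacc m
      | succ d ih => simp only [Function.iterate_succ_apply']; exact acc_φ hW.1 hWfix ih
    set Z := C.φ^[d] (V m) with hZ
    have hZfix : C.φ Z = Z := by rw [hZ, ← Function.iterate_succ_apply' C.φ]; exact hd
    have hZlam : Z ∈ C.Lam a P U J := lam_it hp hg (hVlam m) d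
    have hZW : Z ≤ W := (C.itmono d (hVle m)).trans (itle d)
    have hZne : Z ≠ W := by
      intro h
      have h1 : C.φ^[d] W ≤ C.φ^[d] (V m) := by rw [C.fix_it hWfix, ← hZ, h]
      have h2 := C.le_of_it_le (hVlam m).1 d h1
      exact hN1ne (le_antisymm hN1W (h2.trans (hVle m)))
    have hrkZ := hrk Z hZlam W hW (lt_of_le_of_ne hZW hZne)
    have accZ := ih (rk Z) hrkZ Z hZlam hZfix rfl
    refine accZ.of_two hZacc (fun X => X ⊓ Z) (fun X => X ⊔ Z) ?_ ?_ ?_ ?_ ?_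
    · intro x _ y _ h; exact inf_le_inf_right _ h
    · intro x _ y _ h; exact sup_le_sup_right h _
    · rintro x ⟨hx, hxW, hxt⟩
      exact ⟨C.D_inf hx hZlam.1, inf_le_right, Tor.inf hp hxt hZlam.2.2.2 hg.fixJ hx hZlam.1⟩
    · rintro x ⟨hx, hxW, hxt⟩
      exact ⟨C.D_sup hx hZlam.1, le_sup_right, sup_le hxW hZW⟩
    · intro x _ y _ hxy h1 h2
      exact eq_of_inf_sup hxy h1 h2
  · push Not at hex
    intro c hc hS
    obtain ⟨h1, h2⟩ := satmem (c 0) (hS 0).1 (hS 0).2.1 (hS 0).2.2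
    exact good (c 0) (hS 0).1 (hS 0).2.1 (hS 0).2.2 (hex _ h1 h2).ge c hc
      fun i => ⟨(hS i).1, hc (Nat.zero_le i), (hS i).2.1⟩

theorem main_acc [IsNoetherianRing R] (hp : 2 ≤ p) (a : Ideal R) :
    ∀ U J : Submodule R M, C.Gen U J → ACC {N | C.D N ∧ N ≤ U ∧ C.Tor a J N} := by
  induction a using IsNoetherian.induction with
  | hgt a IH =>
  intro U J hg
  by_cases ha : a = ⊤
  · subst ha
    intro c hc hS
    have : ∀ i, c i = U := by
      intro i
      obtain ⟨hD, hU, hT⟩ := hS i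
      obtain ⟨e0, he0⟩ := hT.ev hp hg.fixJ
      refine le_antisymm hU (hg.det le_rfl hD fun e1 => ⟨max e0 e1, le_max_right _ _, ?_⟩)
      have := he0 (max e0 e1) (le_max_left _ _)
      rw [Submodule.top_smul] at this
      exact inf_le_right.trans this
    exact ⟨0, fun m _ => by rw [this, this]⟩
  · obtain ⟨P, hP⟩ := Ideal.nonempty_minimalPrimes ha
    have := hP.1.1
    exact main_step hp a P hP hg (fun b hb => IH b hb) U ⟨hg.D, le_rfl, sat_le, 0, 0, by
      simpa using hg.le⟩ hg.fix

variable (C) in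
theorem acc [IsNoetherianRing R] (hp : 2 ≤ p) : ACC {N | C.D N} := by
  have htop : C.φ ⊤ = ⊤ := top_le_iff.1 (by
    conv_lhs => rw [← C.φF ⊤]
    exact C.mono le_top)
  obtain ⟨J, hJ⟩ := C.exists_gen hp C.D_top htop
  refine (main_acc (C := C) hp ⊥ ⊤ J hJ).mono ?_
  intro N hN
  exact ⟨hN, le_top, 1, 0, by simp⟩

end CartierData
end LCF

namespace LCF
open MvPowerSeries

noncomputable section

section hasse
variable {σ A : Type*} [CommRing A]

/-- Hasse derivatives on power series. -/
def hd (i : σ) (t : ℕ) : MvPowerSeries σ A →ₗ[A] MvPowerSeries σ A where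
  toFun r := fun m => ((m i + t).choose t : A) * coeff (m + Finsupp.single i t) r
  map_add' r s := by
    funext m
    change _ * coeff _ (r + s) = _ * coeff _ r + _ * coeff _ s
    rw [map_add, mul_add]
  map_smul' a r := by
    funext m
    change _ * coeff _ (a • r) = a * (_ * coeff _ r)
    rw [map_smul, smul_eq_mul, mul_left_comm]

lemma coeff_hd (i : σ) (t : ℕ) (r : MvPowerSeries σ A) (m : σ →₀ ℕ) :
    coeff m (hd i t r) = ((m i + t).choose t : A) * coeff (m + Finsupp.single i t) r := rfl

lemma hd_zero (i : σ) (r : MvPowerSeries σ A) : hd i 0 r = r := by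
  ext m; simp [coeff_hd]

lemma hd_mul (i : σ) (t : ℕ) (r s : MvPowerSeries σ A) :
    hd i t (r * s) = ∑ x ∈ Finset.HasAntidiagonal.antidiagonal t, hd i x.1 r * hd i x.2 s := by
  classical
  ext m
  rw [coeff_hd, map_sum, coeff_mul, Finset.mul_sum]
  have h1 : ∀ x ∈ Finset.HasAntidiagonal.antidiagonal t, coeff m (hd i x.1 r * hd i x.2 s) =
      ∑ y ∈ Finset.HasAntidiagonal.antidiagonal (m + Finsupp.single i t),
        ((y.1 i).choose x.1 * (y.2 i).choose x.2 : A) * (coeff y.1 r * coeff y.2 s) := by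
    rintro ⟨c, d⟩ hx
    rw [Finset.HasAntidiagonal.mem_antidiagonal] at hx
    simp only at hx
    rw [coeff_mul]
    refine Finset.sum_of_injOn
      (fun y => (y.1 + Finsupp.single i c, y.2 + Finsupp.single i d)) ?_ ?_ ?_ ?_
    · rintro ⟨a, b⟩ - ⟨a', b'⟩ - h
      simpa using h
    · rintro ⟨a, b⟩ h
      simp only [Finset.mem_coe, Finset.HasAntidiagonal.mem_antidiagonal] at h ⊢
      rw [← h, ← hx, Finsupp.single_add]; abel
    · rintro ⟨a, b⟩ h hn
      rw [Finset.HasAntidiagonal.mem_antidiagonal] at h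
      simp only at h
      by_cases hc : c ≤ a i
      · by_cases hd' : d ≤ b i
        · exfalso
          apply hn
          refine ⟨(a - Finsupp.single i c, b - Finsupp.single i d), ?_, ?_⟩
          · simp only [Finset.mem_coe, Finset.HasAntidiagonal.mem_antidiagonal]
            ext j
            have := DFunLike.congr_fun h j
            simp only [Finsupp.coe_add, Pi.add_apply, Finsupp.coe_tsub, Pi.sub_apply] at this ⊢
            by_cases hj : j = i
            · subst hj; simp only [Finsupp.single_eq_same] at this ⊢; lia
            · simp only [Finsupp.single_apply, Ne.symm hj, if_false] at this ⊢; lia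
          · simp only [Prod.mk.injEq]
            constructor
            · exact tsub_add_cancel_of_le (by simpa using hc)
            · exact tsub_add_cancel_of_le (by simpa using hd')
        · simp [Nat.choose_eq_zero_of_lt (not_le.1 hd')]
      · simp [Nat.choose_eq_zero_of_lt (not_le.1 hc)]
    · rintro ⟨a, b⟩ -
      simp only [coeff_hd, Finsupp.coe_add, Pi.add_apply, Finsupp.single_eq_same]
      ring
  rw [Finset.sum_congr rfl h1, Finset.sum_comm]
  refine Finset.sum_congr rfl ?_
  rintro ⟨a, b⟩ h
  rw [Finset.HasAntidiagonal.mem_antidiagonal] at h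
  have := DFunLike.congr_fun h i
  simp only [Finsupp.coe_add, Pi.add_apply, Finsupp.single_eq_same] at this
  rw [← Finset.sum_mul, ← this, Nat.add_choose_eq]
  push_cast
  rfl

lemma hd_C (i : σ) (t : ℕ) (a : A) : hd i t (C a : MvPowerSeries σ A) = if t = 0 then C a else 0 := by
  classical
  split_ifs with h
  · subst h; exact hd_zero _ _
  · ext m
    rw [coeff_hd, coeff_C, if_neg, mul_zero, map_zero]
    intro h'
    have := DFunLike.congr_fun h' i
    simp [h] at this

lemma hd_C_mul (i : σ) (t : ℕ) (a : A) (r : MvPowerSeries σ A) : hd i t (C a * r) = C a * hd i t r := by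
  rw [← MvPowerSeries.smul_eq_C_mul, ← MvPowerSeries.smul_eq_C_mul, map_smul]

/-- Taylor homomorphism. -/
def tay (i : σ) : MvPowerSeries σ A →+* PowerSeries (MvPowerSeries σ A) where
  toFun r := PowerSeries.mk fun t => hd i t r
  map_zero' := by ext; simp
  map_one' := by
    ext1 t
    have := hd_C i t (1 : A)
    rw [map_one] at this
    rw [PowerSeries.coeff_mk, this, PowerSeries.coeff_one]
  map_add' r s := by ext1; simp
  map_mul' r s := by
    ext1 t
    rw [PowerSeries.coeff_mk, PowerSeries.coeff_mul, hd_mul]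
    simp

@[simp] lemma coeff_tay (i : σ) (t : ℕ) (r : MvPowerSeries σ A) :
    PowerSeries.coeff t (tay i r) = hd i t r := PowerSeries.coeff_mk t fun t => hd i t r

lemma hd_X_self (i : σ) (t : ℕ) : hd i t (X i : MvPowerSeries σ A) =
    if t = 0 then X i else if t = 1 then 1 else 0 := by
  classical
  split_ifs with h h'
  · subst h; exact hd_zero _ _
  · subst h'
    ext m
    rw [coeff_hd, coeff_X, coeff_one]
    by_cases hm : m = 0
    · subst hm; simp
    · rw [if_neg, if_neg hm, mul_zero]
      simpa using hm
  · ext m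
    rw [coeff_hd, coeff_X, if_neg, mul_zero, map_zero]
    intro h2
    have := DFunLike.congr_fun h2 i
    simp at this
    lia

lemma hd_X_ne {i j : σ} (hij : j ≠ i) (t : ℕ) : hd i t (X j : MvPowerSeries σ A) =
    if t = 0 then X j else 0 := by
  classical
  split_ifs with h
  · subst h; exact hd_zero _ _
  · ext m
    rw [coeff_hd, coeff_X, if_neg, mul_zero, map_zero]
    intro h2
    have := DFunLike.congr_fun h2 i
    simp [Finsupp.single_apply, hij] at this
    lia

lemma tay_X_self (i : σ) : tay i (X i : MvPowerSeries σ A) = PowerSeries.C (X i) + PowerSeries.X := by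
  ext1 t
  rw [coeff_tay, hd_X_self, map_add, PowerSeries.coeff_C, PowerSeries.coeff_X]
  rcases t with _ | _ | t <;> simp

lemma tay_X_ne {i j : σ} (hij : j ≠ i) : tay i (X j : MvPowerSeries σ A) = PowerSeries.C (X j) := by
  ext1 t
  rw [coeff_tay, hd_X_ne hij, PowerSeries.coeff_C]

/-- functoriality in coefficients -/
lemma hd_map {B : Type*} [CommRing B] (g : A →+* B) (i : σ) (t : ℕ) (r : MvPowerSeries σ A) :
    hd i t (MvPowerSeries.map g r) = MvPowerSeries.map g (hd i t r) := by
  ext m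
  simp [coeff_hd]

end hasse

/-- Taylor structure on an algebra over the power series ring. -/
structure TayRing (σ A L : Type*) [CommRing A] [CommRing L] [Algebra (MvPowerSeries σ A) L] where
  T : σ → L →+* PowerSeries L
  T_alg : ∀ i r, T i (algebraMap (MvPowerSeries σ A) L r) =
    PowerSeries.map (algebraMap (MvPowerSeries σ A) L) (tay i r)
  T_zero : ∀ i v, PowerSeries.coeff 0 (T i v) = v

namespace TayRing
variable {σ A L : Type*} [CommRing A] [CommRing L] [Algebra (MvPowerSeries σ A) L]
  (TR : TayRing σ A L)

/-- the operators -/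
def D (i : σ) (t : ℕ) : L →+ L :=
  (PowerSeries.coeff (R := L) t).toAddMonoidHom.comp (TR.T i).toAddMonoidHom

lemma D_def (i : σ) (t : ℕ) (v : L) : TR.D i t v = PowerSeries.coeff t (TR.T i v) := rfl

lemma D_zero (i : σ) (v : L) : TR.D i 0 v = v := TR.T_zero i v

lemma D_mul (i : σ) (t : ℕ) (v w : L) :
    TR.D i t (v * w) = ∑ x ∈ Finset.HasAntidiagonal.antidiagonal t, TR.D i x.1 v * TR.D i x.2 w := by
  simp only [D_def, map_mul, PowerSeries.coeff_mul]

lemma D_alg (i : σ) (t : ℕ) (r : MvPowerSeries σ A) :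
    TR.D i t (algebraMap _ L r) = algebraMap _ L (hd i t r) := by
  rw [D_def, TR.T_alg, PowerSeries.coeff_map, coeff_tay]

lemma D_smul (i : σ) (t : ℕ) (r : MvPowerSeries σ A) (w : L) :
    TR.D i t (r • w) = ∑ x ∈ Finset.HasAntidiagonal.antidiagonal t, hd i x.1 r • TR.D i x.2 w := by
  simp only [Algebra.smul_def, D_mul, D_alg]

/-- D-stable submodules. -/
def Stable (N : Submodule (MvPowerSeries σ A) L) : Prop := ∀ i t, ∀ v ∈ N, TR.D i t v ∈ N

lemma Stable.inf {TR : TayRing σ A L} {N N' : Submodule (MvPowerSeries σ A) L} (h : TR.Stable N)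
    (h' : TR.Stable N') : TR.Stable (N ⊓ N') :=
  fun i t v hv => ⟨h i t v hv.1, h' i t v hv.2⟩

lemma stable_top : TR.Stable ⊤ := fun _ _ _ _ => trivial

lemma Stable.sup {TR : TayRing σ A L} {N N' : Submodule (MvPowerSeries σ A) L} (h : TR.Stable N)
    (h' : TR.Stable N') : TR.Stable (N ⊔ N') := by
  intro i t v hv
  obtain ⟨a, ha, b, hb, rfl⟩ := Submodule.mem_sup.1 hv
  rw [map_add]
  exact Submodule.add_mem_sup (h i t a ha) (h' i t b hb)

/-- stability of a span can be checked on generators -/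
lemma stable_span {s : Set L} (h : ∀ i t, ∀ v ∈ s, TR.D i t v ∈ Submodule.span (MvPowerSeries σ A) s) :
    TR.Stable (Submodule.span (MvPowerSeries σ A) s) := by
  intro i t v hv
  induction hv using Submodule.span_induction generalizing t with
  | mem x hx => exact h i t x hx
  | zero => simp
  | add x y _ _ hx hy => rw [map_add]; exact Submodule.add_mem _ (hx t) (hy t)
  | smul r x _ hx =>
    rw [D_smul]
    exact Submodule.sum_mem _ fun y _ => Submodule.smul_mem _ _ (hx _)

end TayRing

lemma TayRing.exists_inv_form {R L : Type*} [CommRing R] [CommRing L] [Algebra R L] (f : R)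
    [IsLocalization.Away f L] (u : L) :
    ∃ (j : ℕ) (r : R), algebraMap _ L f ^ j * u = algebraMap _ L r := by
  obtain ⟨⟨r, ⟨_, j, rfl⟩⟩, h⟩ := IsLocalization.surj (Submonoid.powers f) u
  refine ⟨j, r, ?_⟩
  rw [← h]
  simp [mul_comm]

section locring
variable {σ A : Type*} [CommRing A] (f : MvPowerSeries σ A) (L : Type*) [CommRing L]
  [Algebra (MvPowerSeries σ A) L] [IsLocalization.Away f L]

/-- The Taylor structure on a localization. -/
def locTay : TayRing σ A L where
  T i := IsLocalization.Away.lift f (g := (PowerSeries.map (algebraMap (MvPowerSeries σ A) L)).comp (tay i))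
    (by
      rw [PowerSeries.isUnit_iff_constantCoeff, ← PowerSeries.coeff_zero_eq_constantCoeff_apply,
        RingHom.comp_apply, PowerSeries.coeff_map, coeff_tay, hd_zero]
      exact IsLocalization.Away.algebraMap_isUnit f)
  T_alg i r := by rw [IsLocalization.Away.lift_eq]; rfl
  T_zero i v := by
    have : ((PowerSeries.constantCoeff (R := L)).comp (IsLocalization.Away.lift (S := L) f
        (g := (PowerSeries.map (algebraMap (MvPowerSeries σ A) L)).comp (tay i))
        (by
          rw [PowerSeries.isUnit_iff_constantCoeff, ← PowerSeries.coeff_zero_eq_constantCoeff_apply,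
            RingHom.comp_apply, PowerSeries.coeff_map, coeff_tay, hd_zero]
          exact IsLocalization.Away.algebraMap_isUnit f))) = RingHom.id L := by
      apply IsLocalization.ringHom_ext (Submonoid.powers f)
      ext r
      simp only [RingHom.comp_apply, IsLocalization.Away.lift_eq, RingHom.id_apply]
      rw [← PowerSeries.coeff_zero_eq_constantCoeff_apply, PowerSeries.coeff_map, coeff_tay, hd_zero]
    rw [PowerSeries.coeff_zero_eq_constantCoeff_apply]
    exact RingHom.congr_fun this v

end locring
end
end LCF

namespace LCF
open MvPowerSeries

noncomputable section

section gen
variable {σ A L : Type*} [CommRing A] [CommRing L] [Algebra (MvPowerSeries σ A) L]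
  (TR : TayRing σ A L)
namespace TayRing

lemma pow_smul_D_mem {N : Submodule (MvPowerSeries σ A) L} (hN : TR.Stable N) (i : σ)
    (s : MvPowerSeries σ A) (u : L) (h : s • u ∈ N) (t : ℕ) : s ^ (t + 1) • TR.D i t u ∈ N := by
  induction t using Nat.strong_induction_on with
  | _ t ih =>
    have h1 := hN i t _ h
    rw [D_smul] at h1
    rw [← Finset.add_sum_erase _ _ (a := (0, t)) (by simp)] at h1
    have h2 : ∑ x ∈ (Finset.HasAntidiagonal.antidiagonal t).erase (0, t),
        s ^ t • hd i x.1 s • TR.D i x.2 u ∈ N := by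
      refine Submodule.sum_mem _ ?_
      rintro ⟨c, d⟩ hx
      simp only [Finset.mem_erase, ne_eq, Prod.mk.injEq, Finset.HasAntidiagonal.mem_antidiagonal] at hx
      obtain ⟨hx1, hx2⟩ := hx
      have hc : d < t := by
        rcases Nat.eq_zero_or_pos c with rfl | h
        · exfalso; apply hx1; constructor <;> lia
        · lia
      have h3 := ih d hc
      have h4 : s ^ t = s ^ (t - (d + 1)) * s ^ (d + 1) := by rw [← pow_add]; congr 1; lia
      rw [smul_comm, h4, mul_smul]
      exact Submodule.smul_mem _ _ (Submodule.smul_mem _ _ h3)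
    have h5 := Submodule.smul_mem _ (s ^ t) h1
    rw [smul_add, Finset.smul_sum] at h5
    have h6 := (Submodule.add_mem_iff_left _ h2).1 h5
    simp only [hd_zero] at h6
    rwa [pow_succ, mul_smul]

lemma stable_sat (P : Ideal (MvPowerSeries σ A)) [P.IsPrime] {N U : Submodule (MvPowerSeries σ A) L}
    (hN : TR.Stable N) (hU : TR.Stable U) : TR.Stable (sat P N U) := by
  intro i t v hv
  rw [mem_sat] at hv ⊢
  obtain ⟨hv, s, hs, h⟩ := hv
  refine ⟨hU i t v hv, s ^ (t + 1), ?_, TR.pow_smul_D_mem hN i s v h t⟩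
  intro h'
  exact hs (Ideal.IsPrime.mem_of_pow_mem inferInstance _ h')

lemma D_pow_char (p : ℕ) [Fact p.Prime] [CharP L p] (i : σ) (c : ℕ) (v : L) :
    TR.D i c (v ^ p) = if p ∣ c then TR.D i (c / p) v ^ p else 0 := by
  have hp : p ≠ 0 := (Fact.out : p.Prime).ne_zero
  have h1 : (TR.T i v) ^ p = PowerSeries.map (frobenius L p) (PowerSeries.expand p hp (TR.T i v)) :=
    (MvPowerSeries.map_frobenius_expand p hp).symm
  rw [D_def, map_pow, h1, PowerSeries.coeff_map]
  split_ifs with h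
  · obtain ⟨d, rfl⟩ := h
    rw [PowerSeries.coeff_expand_mul, Nat.mul_div_cancel_left _ (Nat.pos_of_ne_zero hp), frobenius_def]
    rfl
  · rw [PowerSeries.coeff_expand_of_not_dvd p hp _ h, map_zero]

lemma D_pow_mul (p : ℕ) [Fact p.Prime] [CharP L p] (i : σ) (w v : L) (t : ℕ) (ht : t < p) :
    TR.D i t (w ^ p * v) = w ^ p * TR.D i t v := by
  rw [D_mul, Finset.sum_eq_single (0, t)]
  · rw [D_zero]
  · rintro ⟨c, d⟩ hx hne
    rw [Finset.HasAntidiagonal.mem_antidiagonal] at hx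
    have hc : c ≠ 0 := by rintro rfl; apply hne; simp at hx; simp [hx]
    rw [D_pow_char, if_neg, zero_mul]
    simp only at hx
    intro h
    have := Nat.le_of_dvd (by lia) h
    lia
  · simp

lemma D_X_ne_mul {i j : σ} (hij : j ≠ i) (t : ℕ) (v : L) :
    TR.D i t ((X j : MvPowerSeries σ A) • v) = (X j : MvPowerSeries σ A) • TR.D i t v := by
  rw [D_smul, Finset.sum_eq_single (0, t)]
  · rw [hd_zero]
  · rintro ⟨c, d⟩ hx hne
    rw [Finset.HasAntidiagonal.mem_antidiagonal] at hx
    have hc : c ≠ 0 := by rintro rfl; apply hne; simp at hx; simp [hx]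
    rw [hd_X_ne hij, if_neg hc, zero_smul]
  · simp

lemma D_X_ne_pow_mul {i j : σ} (hij : j ≠ i) (t c : ℕ) (v : L) :
    TR.D i t ((X j : MvPowerSeries σ A) ^ c • v) = (X j : MvPowerSeries σ A) ^ c • TR.D i t v := by
  induction c generalizing v with
  | zero => simp
  | succ c ih => rw [pow_succ, mul_smul, ih, TR.D_X_ne_mul hij, mul_smul]

end TayRing

lemma hd_X_pow {σ A : Type*} [CommRing A] (i : σ) (c t : ℕ) :
    hd i t ((X i : MvPowerSeries σ A) ^ c) = (c.choose t : MvPowerSeries σ A) * X i ^ (c - t) := by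
  rw [← coeff_tay, map_pow, tay_X_self, add_comm, add_pow, map_sum]
  rw [Finset.sum_eq_single t]
  · rw [← map_pow, ← map_natCast (PowerSeries.C), mul_assoc, ← map_mul, mul_comm (PowerSeries.X ^ t),
      PowerSeries.coeff_C_mul_X_pow, if_pos rfl, mul_comm]
  · intro b _ hb
    rw [← map_pow, ← map_natCast (PowerSeries.C), mul_assoc, ← map_mul, mul_comm (PowerSeries.X ^ b),
      PowerSeries.coeff_C_mul_X_pow, if_neg hb.symm]
  · intro h
    have h' : c < t := by simpa using h
    simp [Nat.choose_eq_zero_of_lt h']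

namespace TayRing
/-- one-variable reconstruction identity -/
lemma recon (p : ℕ) [Fact p.Prime] [CharP L p] (i : σ) (v : L) :
    v = ∑ b ∈ Finset.range p, (X i : MvPowerSeries σ A) ^ (p - 1 - b) •
      TR.D i (p - 1) ((X i : MvPowerSeries σ A) ^ b • v) := by
  have hp := (Fact.out : p.Prime).two_le
  have h1 : ∀ b ∈ Finset.range p, (X i : MvPowerSeries σ A) ^ (p - 1 - b) •
      TR.D i (p - 1) ((X i : MvPowerSeries σ A) ^ b • v) =
      ∑ x ∈ Finset.HasAntidiagonal.antidiagonal (p - 1),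
        ((b.choose x.1 : ℕ) : L) * ((X i : MvPowerSeries σ A) ^ x.2 • TR.D i x.2 v) := by
    intro b hb
    have hb : b < p := by simpa using hb
    rw [D_smul, Finset.smul_sum]
    refine Finset.sum_congr rfl ?_
    rintro ⟨c, d⟩ hx
    rw [Finset.HasAntidiagonal.mem_antidiagonal] at hx
    simp only at hx ⊢
    rw [hd_X_pow]
    by_cases hcb : c ≤ b
    · rw [smul_smul, mul_left_comm, ← pow_add, show p - 1 - b + (b - c) = d by lia, mul_smul,
        Algebra.smul_def ((b.choose c : ℕ) : MvPowerSeries σ A), map_natCast]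
    · rw [Nat.choose_eq_zero_of_lt (not_le.1 hcb)]; simp
  rw [Finset.sum_congr rfl h1, Finset.sum_comm]
  have h2 : ∀ c, ∑ b ∈ Finset.range p, b.choose c = p.choose (c + 1) := by
    intro c
    have h3 : ∀ q : ℕ, ∑ b ∈ Finset.range q, b.choose c = q.choose (c + 1) := by
      intro q
      induction q with
      | zero => simp
      | succ q ih => rw [Finset.sum_range_succ, ih, Nat.choose_succ_succ, add_comm]
    exact h3 p
  rw [Finset.sum_eq_single (p - 1, 0)]
  · simp only [D_zero, pow_zero, one_smul]
    rw [← Finset.sum_mul, ← Nat.cast_sum, h2, Nat.sub_add_cancel (by lia), Nat.choose_self]; simp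
  · rintro ⟨c, d⟩ hx hne
    rw [Finset.HasAntidiagonal.mem_antidiagonal] at hx
    simp only at hx ⊢
    have hc : c + 1 < p := by
      by_contra h
      apply hne
      have : c = p - 1 := by lia
      subst this
      simp at hx; simp [hx]
    rw [← Finset.sum_mul, ← Nat.cast_sum, h2]
    rw [(CharP.cast_eq_zero_iff L p _).2 ((Fact.out : p.Prime).dvd_choose_self (by lia) hc), zero_mul]
  · simp

/-- composite of `D i (p-1)` over a list of variables -/
def E (p : ℕ) : List σ → L →+ L
  | [] => AddMonoidHom.id L
  | i :: l => (TR.D i (p - 1)).comp (E p l)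

lemma E_nil (p : ℕ) (v : L) : TR.E p [] v = v := rfl
lemma E_cons (p : ℕ) (i : σ) (l : List σ) (v : L) : TR.E p (i :: l) v = TR.D i (p-1) (TR.E p l v) := rfl

lemma E_pow_mul (p : ℕ) [Fact p.Prime] [CharP L p] (l : List σ) (w v : L) :
    TR.E p l (w ^ p * v) = w ^ p * TR.E p l v := by
  have hp := (Fact.out : p.Prime).two_le
  induction l with
  | nil => rfl
  | cons i l ih => rw [E_cons, E_cons, ih, TR.D_pow_mul p i _ _ _ (by lia)]

lemma E_mem (p : ℕ) (l : List σ) {N : Submodule (MvPowerSeries σ A) L} (hN : TR.Stable N) {v : L}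
    (hv : v ∈ N) : TR.E p l v ∈ N := by
  induction l with
  | nil => exact hv
  | cons i l ih => exact hN _ _ _ ih

lemma E_X_pow (p : ℕ) (l : List σ) (i : σ) (hi : i ∉ l) (c : ℕ) (v : L) :
    TR.E p l ((X i : MvPowerSeries σ A) ^ c • v) = (X i : MvPowerSeries σ A) ^ c • TR.E p l v := by
  induction l with
  | nil => rfl
  | cons j l ih =>
    rw [List.mem_cons, not_or] at hi
    rw [E_cons, E_cons, ih hi.2, TR.D_X_ne_pow_mul hi.1]

lemma mem_of_E_mem (p : ℕ) [Fact p.Prime] [CharP L p] (l : List σ) (hl : l.Nodup)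
    (N : Submodule (MvPowerSeries σ A) L) (w : L)
    (h : ∀ r : MvPowerSeries σ A, TR.E p l (r • w) ∈ N) : w ∈ N := by
  induction l with
  | nil => simpa [E_nil] using h 1
  | cons i l ih =>
    rw [List.nodup_cons] at hl
    refine ih hl.2 fun r => ?_
    rw [TR.recon p i (TR.E p l (r • w))]
    refine Submodule.sum_mem _ fun b _ => Submodule.smul_mem _ _ ?_
    rw [← TR.E_X_pow p l i hl.1, ← E_cons, smul_smul]
    exact h _

/-- the monomial with exponents `p-1` -/
def xm (p : ℕ) (l : List σ) : MvPowerSeries σ A := (l.map fun i => X i ^ (p - 1)).prod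

lemma E_xm (p : ℕ) [Fact p.Prime] [CharP L p] (l : List σ) (hl : l.Nodup) (u : L) :
    TR.E p l (xm (A := A) p l • u ^ p) = u ^ p := by
  have hp := (Fact.out : p.Prime).two_le
  induction l with
  | nil => simp [xm, E_nil]
  | cons i l ih =>
    rw [List.nodup_cons] at hl
    have : xm (A := A) p (i :: l) = X i ^ (p - 1) * xm p l := by simp [xm]
    rw [this, mul_smul, E_cons, TR.E_X_pow p l i hl.1, ih hl.2, Algebra.smul_def, mul_comm,
      TR.D_pow_mul p i _ _ _ (by lia), D_alg, hd_X_pow]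
    simp

end TayRing
end gen
end
end LCF

namespace LCF
open MvPowerSeries

noncomputable section
set_option linter.unusedSectionVars false
namespace TayRing

section pth
variable {σ k L : Type*} [Field k] [CommRing L] [Algebra (MvPowerSeries σ k) L]
  (TR : TayRing σ k L)

/-- iterated Hasse derivative on the power series ring -/
def Ehd (p : ℕ) : List σ → MvPowerSeries σ k → MvPowerSeries σ k
  | [], r => r
  | i :: l, r => hd i (p - 1) (Ehd p l r)

lemma E_alg (p : ℕ) (l : List σ) (r : MvPowerSeries σ k) :
    TR.E p l (algebraMap _ L r) = algebraMap _ L (Ehd p l r) := by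
  induction l with
  | nil => rfl
  | cons i l ih => rw [E_cons, ih, D_alg]; rfl

lemma choose_cast_zero (p : ℕ) [Fact p.Prime] [CharP k p] (m : ℕ) (h : ¬ p ∣ m) :
    (((m + (p - 1)).choose (p - 1) : ℕ) : k) = 0 := by
  have hp := (Fact.out : p.Prime)
  rw [CharP.cast_eq_zero_iff k p]
  have h1 := Nat.choose_succ_right_eq (m + (p - 1)) (p - 1)
  rw [Nat.sub_add_cancel hp.one_le, Nat.add_sub_cancel] at h1
  exact (hp.dvd_mul.1 (Dvd.intro_left _ h1)).resolve_right h

lemma coeff_Ehd_zero (p : ℕ) [Fact p.Prime] [CharP k p] (l : List σ) (r : MvPowerSeries σ k) (i : σ)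
    (hi : i ∈ l) (m : σ →₀ ℕ) (h : ¬ p ∣ m i) (hl : l.Nodup) : coeff m (Ehd p l r) = 0 := by
  classical
  induction l generalizing m with
  | nil => simp at hi
  | cons j l ih =>
    rw [List.nodup_cons] at hl
    change coeff m (hd j (p - 1) (Ehd p l r)) = 0
    rw [coeff_hd]
    rcases List.mem_cons.1 hi with rfl | hi'
    · rw [choose_cast_zero p _ h, zero_mul]
    · rw [ih hi' _ ?_ hl.2, mul_zero]
      have : i ≠ j := by rintro rfl; exact hl.1 hi'
      simpa [Finsupp.single_apply, this.symm] using h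

lemma exists_pth (p : ℕ) [Fact p.Prime] [CharP k p] [PerfectRing k p] (l : List σ) (hl : l.Nodup)
    (hall : ∀ i, i ∈ l) (r : MvPowerSeries σ k) : ∃ s : MvPowerSeries σ k, Ehd p l r = s ^ p := by
  classical
  have hp : p ≠ 0 := (Fact.out : p.Prime).ne_zero
  let s : MvPowerSeries σ k := fun m => (frobeniusEquiv k p).symm (coeff (p • m) (Ehd p l r))
  have hs : ∀ m, coeff m s = (frobeniusEquiv k p).symm (coeff (p • m) (Ehd p l r)) := fun m => rfl
  refine ⟨s, ?_⟩
  rw [← MvPowerSeries.map_frobenius_expand p hp]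
  ext m
  rw [coeff_map]
  by_cases h : ∀ i, p ∣ m i
  · have hm : m = p • (m.mapRange (fun n => n / p) (Nat.zero_div p)) :=
      Finsupp.ext fun a => (Nat.mul_div_cancel' (h a)).symm
    rw [hm, coeff_expand_smul, hs]
    exact (frobenius_apply_frobeniusEquiv_symm k p _).symm
  · push Not at h
    obtain ⟨i, hi⟩ := h
    rw [coeff_expand_of_not_dvd p hp _ hi, map_zero, coeff_Ehd_zero p l r i (hall i) m hi hl]
end pth

section main
variable {σ k : Type*} [Finite σ] [Field k] (p : ℕ) [Fact p.Prime] [CharP k p] [PerfectRing k p]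
  (f : MvPowerSeries σ k) {L : Type*} [CommRing L] [IsDomain L] [Algebra (MvPowerSeries σ k) L]
  [IsLocalization.Away f L] [CharP L p] (TR : TayRing σ k L)

variable (σ) in
/-- list of all the variables -/
def vars : List σ := by
  have := Fintype.ofFinite σ
  exact (Finset.univ : Finset σ).toList

lemma vars_nodup : (vars σ).Nodup := Finset.nodup_toList _
lemma mem_vars (i : σ) : i ∈ vars σ := by simp [vars]

lemma exists_rho (f : MvPowerSeries σ k) [IsLocalization.Away f L] (v : L) : ∃ w : L, TR.E p (vars σ) v = w ^ p := by
  have hp := (Fact.out : p.Prime).two_le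
  obtain ⟨j, r, h⟩ := exists_inv_form f v
  obtain ⟨s, hs⟩ := exists_pth p (vars σ) vars_nodup mem_vars (f ^ ((p - 1) * j) * r)
  have hu : IsUnit (algebraMap (MvPowerSeries σ k) L f) := IsLocalization.Away.algebraMap_isUnit f
  obtain ⟨u, hu⟩ := hu
  refine ⟨↑(u⁻¹) ^ j * algebraMap _ L s, ?_⟩
  have h1 : v = (↑(u⁻¹) ^ j : L) ^ p * algebraMap _ L (f ^ ((p - 1) * j) * r) := by
    rw [map_mul, ← h, map_pow, ← hu, ← pow_mul, ← mul_assoc, ← mul_assoc, mul_assoc _ (_ ^ _) (_ ^ _),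
      ← pow_add, show (p - 1) * j + j = j * p by
        rw [← Nat.succ_mul, Nat.succ_eq_add_one, Nat.sub_add_cancel (by lia), mul_comm], ← mul_pow]
    simp
  rw [h1, E_pow_mul, E_alg, hs, map_pow, mul_pow]

/-- the p-th root of `E` -/
def rho (v : L) : L := (exists_rho p TR f v).choose
lemma rho_pow (v : L) : rho p f TR v ^ p = TR.E p (vars σ) v := ((exists_rho p TR f v).choose_spec).symm

lemma pow_inj {v w : L} (h : v ^ p = w ^ p) : v = w := frobenius_inj L p h

lemma rho_add (v w : L) : rho p f TR (v + w) = rho p f TR v + rho p f TR w := by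
  apply pow_inj p
  rw [add_pow_char, rho_pow, rho_pow, rho_pow, map_add]

lemma rho_zero : rho p f TR 0 = 0 := by
  apply pow_inj p
  rw [rho_pow, map_zero, zero_pow (Fact.out : p.Prime).ne_zero]

lemma rho_pow_mul (w v : L) : rho p f TR (w ^ p * v) = w * rho p f TR v := by
  apply pow_inj p
  rw [rho_pow, E_pow_mul, mul_pow, rho_pow]

lemma rho_pow_smul (r : MvPowerSeries σ k) (v : L) : rho p f TR (r ^ p • v) = r • rho p f TR v := by
  rw [Algebra.smul_def, Algebra.smul_def, map_pow, rho_pow_mul]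

lemma rho_alg (r : MvPowerSeries σ k) : ∃ s : MvPowerSeries σ k, rho p f TR (algebraMap _ L r) = algebraMap _ L s := by
  obtain ⟨s, hs⟩ := exists_pth p (vars σ) vars_nodup mem_vars r
  refine ⟨s, pow_inj p ?_⟩
  rw [rho_pow, E_alg, hs, map_pow]

lemma rho_xm (u : L) : rho p f TR (xm (A := k) p (vars σ) • u ^ p) = u := by
  apply pow_inj p
  rw [rho_pow, E_xm p (TR := TR) _ vars_nodup]

/-- φ -/
def phi (X : Submodule (MvPowerSeries σ k) L) : Submodule (MvPowerSeries σ k) L where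
  carrier := rho p f TR '' X
  add_mem' := by
    rintro _ _ ⟨a, ha, rfl⟩ ⟨b, hb, rfl⟩
    exact ⟨a + b, X.add_mem ha hb, rho_add p f TR a b⟩
  zero_mem' := ⟨0, X.zero_mem, rho_zero p f TR⟩
  smul_mem' := by
    rintro r _ ⟨a, ha, rfl⟩
    exact ⟨r ^ p • a, X.smul_mem _ ha, rho_pow_smul p f TR r a⟩

lemma mem_phi {X : Submodule (MvPowerSeries σ k) L} {u : L} :
    u ∈ phi p f TR X ↔ ∃ v ∈ X, rho p f TR v = u := Iff.rfl

/-- F -/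
def FF (X : Submodule (MvPowerSeries σ k) L) : Submodule (MvPowerSeries σ k) L where
  carrier := {v | ∀ r : MvPowerSeries σ k, rho p f TR (r • v) ∈ X}
  add_mem' := by
    intro a b ha hb r
    rw [smul_add, rho_add]
    exact X.add_mem (ha r) (hb r)
  zero_mem' := by intro r; rw [smul_zero, rho_zero]; exact X.zero_mem
  smul_mem' := by
    intro s a ha r
    rw [smul_smul]
    exact ha _

lemma mem_FF {X : Submodule (MvPowerSeries σ k) L} {u : L} :
    u ∈ FF p f TR X ↔ ∀ r : MvPowerSeries σ k, rho p f TR (r • u) ∈ X := Iff.rfl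

lemma mem_phi_stable {N : Submodule (MvPowerSeries σ k) L} (hN : TR.Stable N) {u : L} :
    u ∈ phi p f TR N ↔ u ^ p ∈ N := by
  constructor
  · rintro ⟨v, hv, rfl⟩
    rw [rho_pow]
    exact TR.E_mem p _ hN hv
  · intro h
    exact ⟨_, N.smul_mem _ h, rho_xm p f TR u⟩

lemma pow_mem_FF {N : Submodule (MvPowerSeries σ k) L} {y : L} (hy : y ∈ N) : y ^ p ∈ FF p f TR N := by
  intro r
  obtain ⟨s, hs⟩ := rho_alg p f TR r
  rw [Algebra.smul_def, mul_comm, rho_pow_mul, hs, mul_comm, ← Algebra.smul_def]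
  exact N.smul_mem _ hy

lemma FF_eq_span (N : Submodule (MvPowerSeries σ k) L) :
    FF p f TR N = Submodule.span _ ((fun y => y ^ p) '' (N : Set L)) := by
  apply le_antisymm
  · intro v hv
    refine TR.mem_of_E_mem p (vars σ) vars_nodup _ v fun r => ?_
    rw [← rho_pow p f TR]
    exact Submodule.subset_span ⟨_, hv r, rfl⟩
  · rw [Submodule.span_le]
    rintro _ ⟨y, hy, rfl⟩
    exact pow_mem_FF p f TR hy

/-- `f^{-j} R` -/
def Mj (j : ℕ) : Submodule (MvPowerSeries σ k) L :=
  Submodule.span _ {((IsLocalization.Away.invSelf f : L)) ^ j}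

lemma mem_Mj {j : ℕ} {u : L} : u ∈ Mj f j ↔ ∃ r, algebraMap _ L f ^ j * u = algebraMap (MvPowerSeries σ k) L r := by
  have h : algebraMap _ L f * IsLocalization.Away.invSelf f = 1 := IsLocalization.Away.mul_invSelf f
  rw [Mj, Submodule.mem_span_singleton]
  constructor
  · rintro ⟨r, rfl⟩
    refine ⟨r, ?_⟩
    rw [mul_smul_comm, ← mul_pow, h, one_pow, Algebra.smul_def, mul_one]
  · rintro ⟨r, hr⟩
    refine ⟨r, ?_⟩
    rw [Algebra.smul_def, ← hr, mul_right_comm, ← mul_pow, h, one_pow, one_mul]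

lemma phi_Mj {j j' : ℕ} (h : j ≤ p * j') : phi p f TR (Mj f j) ≤ Mj f j' := by
  rintro _ ⟨v, hv, rfl⟩
  rw [SetLike.mem_coe, mem_Mj] at hv
  obtain ⟨r, hr⟩ := hv
  rw [mem_Mj, ← rho_pow_mul, ← pow_mul, mul_comm j', show p * j' = (p * j' - j) + j by lia, pow_add,
    mul_assoc, hr, ← map_pow, ← map_mul]
  exact rho_alg p f TR _

/-- the Cartier data -/
def cartier : CartierData (MvPowerSeries σ k) L p where
  φ := phi p f TR
  F := FF p f TR
  gc X Y := by
    constructor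
    · intro h v hv r
      exact h ⟨_, X.smul_mem r hv, rfl⟩
    · rintro h _ ⟨v, hv, rfl⟩
      simpa using h hv 1
  φF X := by
    apply le_antisymm
    · rintro _ ⟨v, hv, rfl⟩
      simpa using hv 1
    · intro u hu
      exact ⟨_, Submodule.smul_mem _ _ (pow_mem_FF p f TR hu), rho_xm p f TR u⟩
  φsmul r X := by
    ext u
    rw [mem_phi, Submodule.mem_smul_pointwise_iff_exists]
    constructor
    · rintro ⟨v, hv, rfl⟩
      obtain ⟨w, hw, rfl⟩ := (Submodule.mem_smul_pointwise_iff_exists _ _ _).1 hv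
      exact ⟨_, ⟨w, hw, rfl⟩, (rho_pow_smul p f TR r w).symm⟩
    · rintro ⟨_, ⟨w, hw, rfl⟩, rfl⟩
      exact ⟨_, Submodule.smul_mem_pointwise_smul _ _ _ hw, rho_pow_smul p f TR r w⟩
  D := TR.Stable
  D_top := TR.stable_top
  D_inf := Stable.inf
  D_sup := Stable.sup
  D_φ := by
    intro X hX i t v hv
    rw [mem_phi_stable p f TR hX] at hv ⊢
    have := hX i (p * t) _ hv
    rwa [D_pow_char, if_pos (dvd_mul_right p t), Nat.mul_div_cancel_left _ (Fact.out : p.Prime).pos] at this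
  D_F := by
    intro X hX
    rw [FF_eq_span]
    apply stable_span
    rintro i t _ ⟨y, hy, rfl⟩
    simp only [D_pow_char]
    split_ifs
    · exact Submodule.subset_span ⟨_, hX _ _ _ hy, rfl⟩
    · exact Submodule.zero_mem _
  FφD := by
    intro X hX
    apply le_antisymm
    · intro v hv
      refine TR.mem_of_E_mem p (vars σ) vars_nodup _ v fun r => ?_
      rw [← rho_pow p f TR, ← mem_phi_stable p f TR hX]
      exact hv r
    · intro v hv r
      exact ⟨_, X.smul_mem r hv, rfl⟩
  D_sat P _ _ _ hN hU := TR.stable_sat P hN hU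
  M0 := Mj f 1
  M0fg := Submodule.fg_span_singleton _
  φM0 := phi_Mj p f TR (by simpa using (Fact.out : p.Prime).one_le)
  exh u := by
    have hp := (Fact.out : p.Prime).two_le
    have hmono : Monotone (phi p f TR) := by
      rintro X Y h _ ⟨v, hv, rfl⟩
      exact ⟨v, h hv, rfl⟩
    obtain ⟨j, r, hr⟩ := exists_inv_form f u
    have h1 : ∀ j : ℕ, (phi p f TR)^[j] (Mj f (j + 1)) ≤ Mj f 1 := by
      intro j
      induction j with
      | zero => exact le_rfl
      | succ j ih =>
        rw [Function.iterate_succ_apply]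
        refine (hmono.iterate j (phi_Mj p f TR (j' := j + 1) ?_)).trans ih
        nlinarith
    refine ⟨j, (hmono.iterate j ?_).trans (h1 j)⟩
    rw [Submodule.span_le, Set.singleton_subset_iff, SetLike.mem_coe, mem_Mj]
    exact ⟨f * r, by rw [pow_succ', mul_assoc, hr, map_mul]⟩

theorem acc_stable_perfect (p : ℕ) [Fact p.Prime] [CharP k p] [PerfectRing k p] [CharP L p]
    (f : MvPowerSeries σ k) [IsLocalization.Away f L] : ACC {N | TR.Stable N} :=
  (cartier p f TR).acc (Fact.out : p.Prime).two_le

end main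
end TayRing
end
end LCF

namespace LCF
open MvPowerSeries

noncomputable section
namespace TayRing

section compat
variable {σ A B L L' : Type*} [CommRing A] [CommRing B] [CommRing L] [CommRing L']
  [Algebra (MvPowerSeries σ A) L] [Algebra (MvPowerSeries σ B) L']
  (TR : TayRing σ A L) (TR' : TayRing σ B L') (f : MvPowerSeries σ A) [IsLocalization.Away f L]
  (g : A →+* B) (ι : L →+* L')

lemma D_compat (i : σ) (t : ℕ) (v : L) (f : MvPowerSeries σ A) [IsLocalization.Away f L]
    (hι : ∀ r : MvPowerSeries σ A, ι (algebraMap _ L r) = algebraMap _ L' (MvPowerSeries.map g r)) :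
    TR'.D i t (ι v) = ι (TR.D i t v) := by
  have : (TR'.T i).comp ι = (PowerSeries.map ι).comp (TR.T i) := by
    apply IsLocalization.ringHom_ext (Submonoid.powers f)
    ext1 r
    simp only [RingHom.comp_apply]
    rw [hι, TR'.T_alg, TR.T_alg]
    ext1 t
    rw [PowerSeries.coeff_map, PowerSeries.coeff_map, PowerSeries.coeff_map, coeff_tay, coeff_tay, hι,
      hd_map]
  have h2 := RingHom.congr_fun this v
  rw [D_def, D_def, ← PowerSeries.coeff_map, ← RingHom.comp_apply, this]
  rfl

end compat

section retr
variable {σ k K : Type*} [Field k] [Field K] [Algebra k K]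

/-- coefficientwise application of a linear functional -/
def Pr (l : K →ₗ[k] k) (h : MvPowerSeries σ K) : MvPowerSeries σ k := fun m => l (coeff m h)

lemma coeff_Pr (l : K →ₗ[k] k) (h : MvPowerSeries σ K) (m) : coeff m (Pr l h) = l (coeff m h) := rfl

lemma Pr_add (l : K →ₗ[k] k) (h h' : MvPowerSeries σ K) : Pr l (h + h') = Pr l h + Pr l h' := by
  ext m; simp [coeff_Pr]

lemma Pr_zero (l : K →ₗ[k] k) : Pr l (0 : MvPowerSeries σ K) = 0 := by
  ext m; simp [coeff_Pr]

lemma Pr_mul (l : K →ₗ[k] k) (h : MvPowerSeries σ K) (r : MvPowerSeries σ k) :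
    Pr l (h * MvPowerSeries.map (algebraMap k K) r) = Pr l h * r := by
  classical
  ext m
  rw [coeff_Pr, coeff_mul, coeff_mul, map_sum]
  refine Finset.sum_congr rfl fun x _ => ?_
  rw [coeff_map, coeff_Pr, mul_comm, ← Algebra.smul_def, map_smul, smul_eq_mul, mul_comm]

lemma Pr_map (l : K →ₗ[k] k) (hl : l 1 = 1) (r : MvPowerSeries σ k) :
    Pr l (MvPowerSeries.map (algebraMap k K) r) = r := by
  ext m
  rw [coeff_Pr, coeff_map, Algebra.algebraMap_eq_smul_one, map_smul, hl, smul_eq_mul, mul_one]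

lemma exists_retr : ∃ l : K →ₗ[k] k, l 1 = 1 := by
  obtain ⟨l, hl⟩ := (Algebra.linearMap k K).exists_leftInverse_of_injective
    (LinearMap.ker_eq_bot.2 (algebraMap k K).injective)
  refine ⟨l, ?_⟩
  have := LinearMap.congr_fun hl 1
  simpa using this

variable {L L' : Type*} [CommRing L] [CommRing L'] [IsDomain L']
  [Algebra (MvPowerSeries σ k) L] [Algebra (MvPowerSeries σ K) L']

lemma base_change_inj (f : MvPowerSeries σ k) [IsLocalization.Away f L] (ι : L →+* L')
    (hι : ∀ r : MvPowerSeries σ k, ι (algebraMap _ L r) = algebraMap _ L' (MvPowerSeries.map (algebraMap k K) r))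
    (hinj : Function.Injective (algebraMap (MvPowerSeries σ K) L'))
    (N : Submodule (MvPowerSeries σ k) L) (v : L)
    (hv : ι v ∈ Submodule.span (MvPowerSeries σ K) (ι '' N)) : v ∈ N := by
  obtain ⟨l, hl⟩ := exists_retr (k := k) (K := K)
  let z : L := IsLocalization.Away.invSelf f
  have hz : algebraMap _ L f * z = 1 := IsLocalization.Away.mul_invSelf f
  have hz' : ∀ (e : ℕ) (x : L), z ^ e * (algebraMap _ L f ^ e * x) = x := by
    intro e x
    rw [← mul_assoc, ← mul_pow, mul_comm z, hz, one_pow, one_mul]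
  have key : ∀ w ∈ Submodule.span (MvPowerSeries σ K) (ι '' N), ∃ e0 : ℕ, ∀ e ≥ e0,
      ∃ h : MvPowerSeries σ K, algebraMap _ L' h = ι (algebraMap _ L f) ^ e * w ∧
        ∀ g : MvPowerSeries σ K, z ^ e * algebraMap _ L (Pr l (g * h)) ∈ N := by
    intro w hw
    induction hw using Submodule.span_induction with
    | mem x hx =>
      obtain ⟨n, hn, rfl⟩ := hx
      obtain ⟨e0, r, hr⟩ := exists_inv_form f n
      refine ⟨e0, fun e he => ⟨MvPowerSeries.map (algebraMap k K) (f ^ (e - e0) * r), ?_, fun g => ?_⟩⟩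
      · rw [← hι, map_mul, ← hr, map_pow, ← mul_assoc, ← pow_add, Nat.sub_add_cancel he, map_mul, map_pow]
      · rw [Pr_mul, map_mul, map_mul, ← hr, map_pow, ← mul_assoc (_ ^ (e - e0)), ← pow_add,
          Nat.sub_add_cancel he, mul_left_comm, hz', ← Algebra.smul_def]
        exact N.smul_mem _ hn
    | zero =>
      refine ⟨0, fun e _ => ⟨0, by simp, fun g => ?_⟩⟩
      rw [mul_zero, Pr_zero, map_zero, mul_zero]; exact N.zero_mem
    | add x y _ _ hx hy =>
      obtain ⟨e1, h1⟩ := hx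
      obtain ⟨e2, h2⟩ := hy
      refine ⟨max e1 e2, fun e he => ?_⟩
      obtain ⟨a, ha, ha'⟩ := h1 e (le_trans (le_max_left _ _) he)
      obtain ⟨b, hb, hb'⟩ := h2 e (le_trans (le_max_right _ _) he)
      refine ⟨a + b, by rw [map_add, ha, hb, mul_add], fun g => ?_⟩
      rw [mul_add, Pr_add, map_add, mul_add]
      exact N.add_mem (ha' g) (hb' g)
    | smul c x _ hx =>
      obtain ⟨e1, h1⟩ := hx
      refine ⟨e1, fun e he => ?_⟩
      obtain ⟨a, ha, ha'⟩ := h1 e he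
      refine ⟨c * a, by rw [map_mul, ha, Algebra.smul_def, mul_left_comm], fun g => ?_⟩
      rw [← mul_assoc]
      exact ha' _
  obtain ⟨e0, h0⟩ := key _ hv
  obtain ⟨e1, r, hr⟩ := exists_inv_form f v
  obtain ⟨h, hh, hh'⟩ := h0 (e0 + e1) (by lia)
  have h1 : h = MvPowerSeries.map (algebraMap k K) (f ^ e0 * r) := by
    apply hinj
    rw [hh, ← hι, map_mul, ← hr, map_pow, ← mul_assoc, ← pow_add, map_mul, map_pow]
  have h2 := hh' 1
  rw [one_mul, h1, Pr_map l hl, map_mul, map_pow, ← hr, ← mul_assoc (_ ^ e0), ← pow_add, hz'] at h2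
  exact h2

end retr

theorem acc_stable_charP {σ k L : Type*} [Finite σ] [Field k] (p : ℕ) [Fact p.Prime] [CharP k p]
    [CommRing L] [Algebra (MvPowerSeries σ k) L] (f : MvPowerSeries σ k) (hf : f ≠ 0)
    [IsLocalization.Away f L] (TR : TayRing σ k L) : ACC {N | TR.Stable N} := by
  let K := AlgebraicClosure k
  have : CharP K p := charP_of_injective_algebraMap (algebraMap k K).injective p
  let g : MvPowerSeries σ k →+* MvPowerSeries σ K := MvPowerSeries.map (algebraMap k K)
  have hg : Function.Injective g := by
    intro r s h
    ext m
    have := congrArg (coeff m) h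
    simpa [g] using this
  let f' := g f
  have hf' : f' ≠ 0 := by
    intro h
    exact hf (hg (by rw [map_zero]; exact h))
  have : IsDomain (MvPowerSeries σ K) := NoZeroDivisors.to_isDomain _
  let L' := Localization.Away f'
  have hle : Submonoid.powers f' ≤ nonZeroDivisors (MvPowerSeries σ K) :=
    powers_le_nonZeroDivisors_of_noZeroDivisors hf'
  have : IsDomain L' := IsLocalization.isDomain_localization hle
  have hinj : Function.Injective (algebraMap (MvPowerSeries σ K) L') := IsLocalization.injective L' hle
  have hinj' : Function.Injective ((algebraMap (MvPowerSeries σ K) L').comp (C (σ := σ) (R := K))) :=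
    RingHom.injective _
  have : CharP L' p := by
    exact charP_of_injective_ringHom hinj' p
  let ι : L →+* L' := IsLocalization.Away.lift f (g := (algebraMap (MvPowerSeries σ K) L').comp g)
    (IsLocalization.Away.algebraMap_isUnit f')
  have hι : ∀ r : MvPowerSeries σ k, ι (algebraMap _ L r) = algebraMap _ L' (MvPowerSeries.map (algebraMap k K) r) := by
    intro r
    simp only [ι, IsLocalization.Away.lift_eq]
    rfl
  let TR' : TayRing σ K L' := locTay f' L'
  have hacc : ACC {N | TR'.Stable N} := TR'.acc_stable_perfect p f'
  refine ACC.of_one hacc (fun N => Submodule.span (MvPowerSeries σ K) (ι '' N)) ?_ ?_ ?_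
  · intro N _ N' _ h
    exact Submodule.span_mono (Set.image_mono h)
  · intro N hN
    apply stable_span
    rintro i t _ ⟨n, hn, rfl⟩
    rw [D_compat TR TR' (algebraMap k K) ι i t n f hι]
    exact Submodule.subset_span ⟨_, hN i t n hn, rfl⟩
  · intro N _ N' _ h h'
    refine le_antisymm h fun v hv => ?_
    refine base_change_inj f ι hι hinj N v ?_
    have h2 : ι v ∈ Submodule.span (MvPowerSeries σ K) (ι '' N') :=
      Submodule.subset_span ⟨v, hv, rfl⟩
    exact h'.symm ▸ h2

end TayRing
end
end LCF

namespace LCF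
noncomputable section

section rk
variable {K Φ : Type*} [Field K] [AddCommGroup Φ] [Module K Φ]

/-- dimension of `U` modulo `B` -/
def rk (U B : Submodule K Φ) : ℕ := Module.finrank K (U.map B.mkQ)

/-- finite dimensionality of `U` modulo `B` -/
def FD (U B : Submodule K Φ) : Prop := FiniteDimensional K (U.map B.mkQ)

lemma FD.mono {U U' B : Submodule K Φ} (h : FD U' B) (hU : U ≤ U') : FD U B := by
  unfold FD at *
  exact Submodule.finiteDimensional_of_le (Submodule.map_mono hU)

lemma FD.mono_right {U B B' : Submodule K Φ} (h : FD U B) (hB : B ≤ B') : FD U B' := by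
  unfold FD at *
  have : U.map B'.mkQ = (U.map B.mkQ).map (Submodule.factor hB) := by
    rw [← Submodule.map_comp]; rfl
  rw [this]
  infer_instance

lemma rk_mono {U U' B : Submodule K Φ} (h : FD U' B) (hU : U ≤ U') : rk U B ≤ rk U' B := by
  unfold FD at h
  exact Submodule.finrank_mono (Submodule.map_mono hU)

lemma rk_add {U B B' : Submodule K Φ} (h : FD U B) (hB : B ≤ B') :
    rk U B = rk U B' + rk (U ⊓ B') B := by
  unfold FD at h
  have h1 : U.map B'.mkQ = (U.map B.mkQ).map (Submodule.factor hB) := by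
    rw [← Submodule.map_comp]; rfl
  have h2 := LinearMap.finrank_range_add_finrank_ker ((Submodule.factor hB).domRestrict (U.map B.mkQ))
  rw [LinearMap.range_domRestrict, ← h1] at h2
  rw [rk, rk, ← h2, rk]
  congr 1
  have h3 : (U ⊓ B').map B.mkQ = ((LinearMap.ker ((Submodule.factor hB).domRestrict (U.map B.mkQ)))).map
      (U.map B.mkQ).subtype := by
    ext x
    simp only [Submodule.mem_map, LinearMap.mem_ker, LinearMap.domRestrict_apply]
    constructor
    · rintro ⟨u, ⟨hu, hu'⟩, rfl⟩
      refine ⟨⟨B.mkQ u, ⟨u, hu, rfl⟩⟩, ?_, rfl⟩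
      simpa using hu'
    · rintro ⟨⟨_, u, hu, rfl⟩, hy, rfl⟩
      refine ⟨u, ⟨hu, ?_⟩, rfl⟩
      simpa using hy
  rw [h3]
  exact (LinearEquiv.finrank_eq (Submodule.equivMapOfInjective (U.map B.mkQ).subtype (Submodule.injective_subtype _)
    (LinearMap.ker ((Submodule.factor hB).domRestrict (U.map B.mkQ)))))

/-- chain lemma -/
lemma rk_chain (B : ℕ → Submodule K Φ) (hB : Monotone B) (G : Submodule K Φ) (m : ℕ → ℕ)
    (h : FD G (B 0)) (i : ℕ) (hm : ∀ a < i, m a ≤ rk (G ⊓ B (a + 1)) (B a)) :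
    ∑ a ∈ Finset.range i, m a ≤ rk G (B 0) := by
  have : ∑ a ∈ Finset.range i, m a + rk G (B i) ≤ rk G (B 0) := by
    induction i with
    | zero => simp
    | succ i ih =>
      have h1 := ih fun a ha => hm a (by lia)
      have h2 := rk_add (h.mono_right (hB (Nat.zero_le i))) (hB (Nat.le_succ i))
      have h3 := hm i (by lia)
      rw [Finset.sum_range_succ]
      lia
  lia

lemma map_mkQ_equiv (s : Φ ≃ₗ[K] Φ) (U B : Submodule K Φ) :
    (U.map s.toLinearMap).map (B.map s.toLinearMap).mkQ =
      (U.map B.mkQ).map (Submodule.Quotient.equiv B (B.map s.toLinearMap) s rfl).toLinearMap := by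
  rw [← Submodule.map_comp, ← Submodule.map_comp]; rfl

lemma rk_equiv (s : Φ ≃ₗ[K] Φ) (U B : Submodule K Φ) :
    rk (U.map s.toLinearMap) (B.map s.toLinearMap) = rk U B := by
  rw [rk, rk, map_mkQ_equiv]
  exact LinearEquiv.finrank_map_eq _ _

lemma FD_span {S : Set Φ} (hS : S.Finite) (B : Submodule K Φ) : FD (Submodule.span K S) B := by
  unfold FD
  have := FiniteDimensional.span_of_finite K hS
  infer_instance

end rk
end
end LCF

namespace LCF
noncomputable section
set_option linter.unusedSectionVars false

section bern
variable {K V : Type*} [Field K] [CharZero K] [AddCommGroup V] [Module K V]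

/-- faithful filtered families of operators -/
structure Faith (W : ℕ → Submodule K V) (d m : ℕ) (Q : ℕ → Submodule K (Module.End K V)) : Prop where
  fin : ∀ j, FiniteDimensional K (Q j)
  faithful : ∀ j, ∀ P ∈ Q j, (∀ w ∈ W j, P w = 0) → P = 0
  maps : ∀ j, ∀ P ∈ Q j, ∀ i, ∀ w ∈ W i, P w ∈ W (i + j + d)
  dim : ∀ j, (d + 1) * (j + m).choose m ≤ Module.finrank K (Q j)

/-- sum map -/
def sumMap (Q : ℕ → Submodule K (Module.End K V)) (Y : Module.End K V) (j : ℕ) :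
    (∀ a : Fin (j + 1), Q (j - a)) →ₗ[K] Module.End K V :=
  ∑ a : Fin (j + 1), (LinearMap.mulLeft K (Y ^ (a : ℕ))) ∘ₗ (Q (j - a)).subtype ∘ₗ LinearMap.proj a

lemma sumMap_apply (Q : ℕ → Submodule K (Module.End K V)) (Y : Module.End K V) (j : ℕ)
    (x : ∀ a : Fin (j + 1), Q (j - a)) :
    sumMap Q Y j x = ∑ a : Fin (j + 1), Y ^ (a : ℕ) * (x a : Module.End K V) := by
  simp [sumMap]

lemma comm_pow (Y Z : Module.End K V) (h : Z * Y - Y * Z = 1) (a : ℕ) :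
    Z * Y ^ a = Y ^ a * Z + (a : ℕ) • Y ^ (a - 1) := by
  induction a with
  | zero => simp
  | succ a ih =>
    have h' : Z * Y = Y * Z + 1 := by rw [← h]; abel
    rw [pow_succ, ← mul_assoc, ih, add_mul, mul_assoc, h', mul_add, mul_one, ← mul_assoc, ← pow_succ]
    rcases a with _ | a
    · simp
    · simp only [Nat.add_sub_cancel, smul_mul_assoc, ← pow_succ]
      rw [succ_nsmul (Y ^ (a+1)) (a+1)]
      abel

lemma faith_key {W : ℕ → Submodule K V} {Q : ℕ → Submodule K (Module.End K V)}
    (hf : ∀ j, ∀ P ∈ Q j, (∀ w ∈ W j, P w = 0) → P = 0) (hmono : Monotone W)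
    (Y Z : Module.End K V) (h : Z * Y - Y * Z = 1) (hZ : ∀ j, ∀ w ∈ W j, Z w ∈ W (j + 1))
    (hc : ∀ j, ∀ P ∈ Q j, Commute Z P) (j : ℕ) : ∀ (q : ℕ → Module.End K V),
    (∀ a ≤ j, q a ∈ Q (j - a)) →
    (∀ w ∈ W j, (∑ a ∈ Finset.range (j + 1), Y ^ a * q a) w = 0) → ∀ a ≤ j, q a = 0 := by
  induction j with
  | zero =>
    intro q hq hw a ha
    obtain rfl : a = 0 := by lia
    refine hf 0 _ (hq 0 le_rfl) ?_
    simpa using hw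
  | succ j ih =>
    intro q hq hw
    have h1 : ∀ a ≤ j, ((a + 1 : ℕ) : K) • q (a + 1) = 0 := by
      refine ih (fun a => ((a + 1 : ℕ) : K) • q (a + 1)) ?_ ?_
      · intro a ha
        have := hq (a + 1) (by lia)
        rw [show j + 1 - (a + 1) = j - a by lia] at this
        exact Submodule.smul_mem _ _ this
      · intro w hw'
        have e : (∑ a ∈ Finset.range (j + 1), Y ^ a * (((a + 1 : ℕ) : K) • q (a + 1))) =
            Z * (∑ a ∈ Finset.range (j + 1 + 1), Y ^ a * q a)
              - (∑ a ∈ Finset.range (j + 1 + 1), Y ^ a * q a) * Z := by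
          rw [Finset.mul_sum, Finset.sum_mul, ← Finset.sum_sub_distrib]
          have : ∀ a ∈ Finset.range (j + 1 + 1), Z * (Y ^ a * q a) - Y ^ a * q a * Z =
              ((a : ℕ) • Y ^ (a - 1)) * q a := by
            intro a ha
            have ha' : a ≤ j + 1 := by simpa [Nat.lt_succ_iff] using ha
            rw [← mul_assoc, comm_pow Y Z h, mul_assoc, ← (hc _ _ (hq a ha')).eq, add_mul, mul_assoc]
            abel
          rw [Finset.sum_congr rfl this, Finset.sum_range_succ' _ (j + 1)]
          rw [zero_smul, zero_mul, add_zero]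
          refine Finset.sum_congr rfl fun a _ => ?_
          rw [smul_mul_assoc, mul_smul_comm, Nat.cast_smul_eq_nsmul, Nat.add_sub_cancel]
        rw [e, LinearMap.sub_apply, Module.End.mul_apply, Module.End.mul_apply,
          hw _ (hmono (Nat.le_succ j) hw'), hw _ (hZ _ _ hw'), map_zero, sub_zero]
    have h2 : ∀ a ≤ j, q (a + 1) = 0 := fun a ha => by
      have := h1 a ha
      rw [smul_eq_zero] at this
      rcases this with h | h
      · exact absurd h (Nat.cast_ne_zero.mpr (Nat.succ_ne_zero a))
      · exact h
    intro a ha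
    rcases a with _ | a
    · refine hf (j + 1) _ (hq 0 (by lia)) fun w hw' => ?_
      have := hw w hw'
      rw [Finset.sum_range_succ', Finset.sum_eq_zero] at this
      · simpa using this
      · intro a ha
        rw [h2 a (by simpa [Nat.lt_succ_iff] using ha), mul_zero]
    · exact h2 a (by lia)

lemma hockey (m j : ℕ) : ∑ a : Fin (j + 1), (j - (a : ℕ) + m).choose m = (j + (m + 1)).choose (m + 1) := by
  rw [Fin.sum_univ_eq_sum_range (fun a => (j - a + m).choose m)]
  rw [Finset.sum_range_reflect (fun a => (a + m).choose m) (j+1) |>.symm.trans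
    (Finset.sum_congr rfl fun a ha => by congr 1) |>.symm]
  rw [Nat.sum_range_add_choose, add_assoc]

lemma Faith.step {W : ℕ → Submodule K V} {d m : ℕ} {Q : ℕ → Submodule K (Module.End K V)}
    (hQ : Faith W d m Q) (hmono : Monotone W)
    (Y Z : Module.End K V) (h : Z * Y - Y * Z = 1) (hZ : ∀ j, ∀ w ∈ W j, Z w ∈ W (j + 1))
    (hY : ∀ j, ∀ w ∈ W j, Y w ∈ W (j + 1))
    (hc : ∀ j, ∀ P ∈ Q j, Commute Z P) :
    ∃ Q' : ℕ → Submodule K (Module.End K V), Faith W d (m + 1) Q' ∧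
      ∀ T : Module.End K V, Commute T Y → (∀ j, ∀ P ∈ Q j, Commute T P) →
        ∀ j, ∀ P ∈ Q' j, Commute T P := by
  have hYp : ∀ a j, ∀ w ∈ W j, (Y ^ a) w ∈ W (j + a) := by
    intro a
    induction a with
    | zero => intro j w hw; simpa using hw
    | succ a ih =>
      intro j w hw
      rw [pow_succ', Module.End.mul_apply]
      exact hY _ _ (ih j w hw)
  have := hQ.fin
  have key : ∀ j (x : ∀ a : Fin (j + 1), Q (j - a)), (∀ w ∈ W j, sumMap Q Y j x w = 0) → x = 0 := by
    intro j x hx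
    let q : ℕ → Module.End K V := fun a => if ha : a < j + 1 then (x ⟨a, ha⟩ : Module.End K V) else 0
    have hq : ∀ a : Fin (j + 1), q a = x a := fun a => by simp only [q, dif_pos a.2]
    have h1 := faith_key hQ.faithful hmono Y Z h hZ hc j q (fun a ha => by
      have := (x ⟨a, by lia⟩).2
      rw [← hq] at this; exact this) (fun w hw => by
      rw [← hx w hw, sumMap_apply, ← Fin.sum_univ_eq_sum_range (fun a => Y ^ a * q a)]
      simp only [hq])
    ext1 a
    apply Subtype.ext
    rw [← hq]
    exact h1 a (by lia)
  refine ⟨fun j => LinearMap.range (sumMap Q Y j), ⟨fun j => inferInstance, ?_, ?_, ?_⟩, ?_⟩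
  · rintro j _ ⟨x, rfl⟩ hw
    rw [key j x hw, map_zero]
  · rintro j _ ⟨x, rfl⟩ i w hw
    rw [sumMap_apply, LinearMap.sum_apply]
    refine Submodule.sum_mem _ fun a _ => ?_
    rw [Module.End.mul_apply]
    have := hYp a _ _ (hQ.maps _ _ (x a).2 i w hw)
    refine hmono ?_ this
    lia
  · intro j
    have inj : Function.Injective (sumMap Q Y j) := by
      rw [injective_iff_map_eq_zero]
      intro x hx
      exact key j x fun w _ => by rw [hx]; rfl
    rw [LinearMap.finrank_range_of_inj inj, Module.finrank_pi_fintype, ← hockey, Finset.mul_sum]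
    exact Finset.sum_le_sum fun a _ => hQ.dim _
  · rintro T hT hTQ j _ ⟨x, rfl⟩
    rw [sumMap_apply]
    refine Commute.sum_right _ _ _ fun a _ => ?_
    exact (hT.pow_right _).mul_right (hTQ _ _ (x a).2)

end bern
end
end LCF

namespace LCF
noncomputable section
set_option linter.unusedSectionVars false

section bern
variable {K V : Type*} [Field K] [CharZero K] [AddCommGroup V] [Module K V]

/-- commuting Weyl operators -/
structure WeylOps (h : ℕ) (X Δ : Fin h → Module.End K V) (s : Module.End K V) : Prop where
  XX : ∀ l l', Commute (X l) (X l')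
  DD : ∀ l l', Commute (Δ l) (Δ l')
  DX : ∀ l l', l ≠ l' → Commute (Δ l) (X l')
  one : ∀ l, Δ l * X l - X l * Δ l = 1
  sX : ∀ l, Commute s (X l)
  sD : ∀ l, Commute s (Δ l)

variable {h : ℕ} {X Δ : Fin h → Module.End K V} {s : Module.End K V}

lemma faith_base (W : ℕ → Submodule K V) (hmono : Monotone W) (hs : ∀ j, ∀ w ∈ W j, s w ∈ W (j + 1)) (d : ℕ)
    (v : V) (hv : v ∈ W 0) (hq : ∀ q : Polynomial K, q.natDegree ≤ d → Polynomial.aeval s q v = 0 → q = 0) :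
    ∃ Q : ℕ → Submodule K (Module.End K V), Faith W d 0 Q ∧
      ∀ T : Module.End K V, Commute s T → ∀ j, ∀ P ∈ Q j, Commute T P := by
  have hsp : ∀ a j, ∀ w ∈ W j, (s ^ a) w ∈ W (j + a) := by
    intro a
    induction a with
    | zero => intro j w hw; simpa using hw
    | succ a ih =>
      intro j w hw
      rw [pow_succ', Module.End.mul_apply]
      exact hs _ _ (ih j w hw)
  have hdeg : ∀ q ∈ Polynomial.degreeLT K (d + 1), q.natDegree ≤ d := by
    intro q hq
    rw [Polynomial.mem_degreeLT] at hq
    by_cases h0 : q = 0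
    · simp [h0]
    exact Nat.lt_succ_iff.mp ((Polynomial.natDegree_lt_iff_degree_lt h0).mpr hq)
  let al := (Polynomial.aeval s : Polynomial K →ₐ[K] Module.End K V).toLinearMap
  have e0 := Polynomial.degreeLTEquiv K (d + 1)
  have hfin : FiniteDimensional K (Polynomial.degreeLT K (d + 1)) := e0.symm.finiteDimensional
  refine ⟨fun _ => (Polynomial.degreeLT K (d + 1)).map al, ⟨fun j => inferInstance, ?_, ?_, ?_⟩, ?_⟩
  · rintro j _ ⟨q, hqd, rfl⟩ hw
    rw [hq q (hdeg q hqd) (hw v (hmono (Nat.zero_le _) hv)), map_zero]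
  · rintro j _ ⟨q, hqd, rfl⟩ i w hw
    change Polynomial.aeval s q w ∈ _
    rw [Polynomial.aeval_eq_sum_range, LinearMap.sum_apply]
    refine Submodule.sum_mem _ fun a ha => ?_
    rw [LinearMap.smul_apply]
    refine Submodule.smul_mem _ _ (hmono ?_ (hsp a _ _ hw))
    have := hdeg q hqd
    simp only [Finset.mem_range] at ha
    lia
  · intro j
    have inj : Function.Injective (al.domRestrict (Polynomial.degreeLT K (d + 1))) := by
      rw [injective_iff_map_eq_zero]
      rintro ⟨q, hqd⟩ hx
      apply Subtype.ext
      refine hq q (hdeg q hqd) ?_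
      have : Polynomial.aeval s q = 0 := hx
      rw [this]; rfl
    have := LinearMap.finrank_range_of_inj inj
    rw [LinearMap.range_domRestrict, e0.finrank_eq] at this
    rw [this]; simp
  · rintro T hT j _ ⟨q, hqd, rfl⟩
    change Commute T (Polynomial.aeval s q)
    rw [Polynomial.aeval_eq_sum_range]
    refine Commute.sum_right _ _ _ fun a _ => ?_
    exact (hT.symm.pow_right _).smul_right _

lemma faith_all (hO : WeylOps h X Δ s) (W : ℕ → Submodule K V) (hmono : Monotone W)
    (hs : ∀ j, ∀ w ∈ W j, s w ∈ W (j + 1))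
    (hX : ∀ l j, ∀ w ∈ W j, X l w ∈ W (j + 1))
    (hD : ∀ l j, ∀ w ∈ W j, Δ l w ∈ W (j + 1))
    (d : ℕ)
    (v : V) (hv : v ∈ W 0) (hq : ∀ q : Polynomial K, q.natDegree ≤ d → Polynomial.aeval s q v = 0 → q = 0)
    (t : ℕ) (ht : t ≤ h) :
    ∃ Q : ℕ → Submodule K (Module.End K V), Faith W d (2 * t) Q ∧
      ∀ l : Fin h, t ≤ l → ∀ j, ∀ P ∈ Q j, Commute (X l) P ∧ Commute (Δ l) P := by
  induction t with
  | zero =>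
    obtain ⟨Q, hQ, hc⟩ := faith_base (s := s) W hmono hs d v hv hq
    exact ⟨Q, hQ, fun l _ j P hP => ⟨hc _ (hO.sX l) j P hP, hc _ (hO.sD l) j P hP⟩⟩
  | succ t ih =>
    obtain ⟨Q, hQ, hc⟩ := ih (by lia)
    let l : Fin h := ⟨t, by lia⟩
    obtain ⟨Q1, hQ1, hc1⟩ := hQ.step hmono (Δ l) (-X l)
      (by rw [neg_mul, mul_neg, ← hO.one l]; abel)
      (fun j w hw => by rw [LinearMap.neg_apply]; exact Submodule.neg_mem _ (hX l j w hw))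
      (hD l) (fun j P hP => ((hc l le_rfl j P hP).1).neg_left)
    obtain ⟨Q2, hQ2, hc2⟩ := hQ1.step hmono (X l) (Δ l)
      (hO.one l) (hD l) (hX l)
      (fun j P hP => hc1 _ (Commute.refl _) (fun j P hP => (hc l le_rfl j P hP).2) j P hP)
    refine ⟨Q2, hQ2, fun l' hl' j P hP => ⟨?_, ?_⟩⟩
    · refine hc2 _ (hO.XX _ _) (fun j P hP => hc1 _ ?_ (fun j P hP => (hc l' (by lia) j P hP).1) j P hP) j P hP
      refine (hO.DX _ _ ?_).symm
      intro e; rw [← e] at hl'; simp [l] at hl'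
    · refine hc2 _ ?_ (fun j P hP => hc1 _ (hO.DD _ _) (fun j P hP => (hc l' (by lia) j P hP).2) j P hP) j P hP
      refine (hO.DX _ _ ?_)
      intro e; rw [e] at hl'; simp [l] at hl'

lemma bernstein (hO : WeylOps h X Δ s) (W : ℕ → Submodule K V) (hmono : Monotone W)
    (hfd : ∀ j, FiniteDimensional K (W j))
    (hs : ∀ j, ∀ w ∈ W j, s w ∈ W (j + 1))
    (hX : ∀ l j, ∀ w ∈ W j, X l w ∈ W (j + 1))
    (hD : ∀ l j, ∀ w ∈ W j, Δ l w ∈ W (j + 1))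
    (d : ℕ)
    (v : V) (hv : v ∈ W 0) (hq : ∀ q : Polynomial K, q.natDegree ≤ d → Polynomial.aeval s q v = 0 → q = 0)
    (j : ℕ) : (d + 1) * (j + 2 * h).choose (2 * h) ≤
      Module.finrank K (W j) * Module.finrank K (W (2 * j + d)) := by
  obtain ⟨Q, hQ, -⟩ := faith_all hO W hmono hs hX hD d v hv hq h le_rfl
  refine (hQ.dim j).trans ?_
  rw [← Module.finrank_linearMap K K]
  have hm : ∀ P : Q j, ∀ w : W j, (P : Module.End K V) w ∈ W (2 * j + d) := fun P w => by
    have := hQ.maps j P P.2 j w w.2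
    rwa [← two_mul] at this
  let F : Q j →ₗ[K] (W j →ₗ[K] W (2 * j + d)) :=
    { toFun := fun P => ((P : Module.End K V).domRestrict (W j)).codRestrict _ (hm P)
      map_add' := fun P P' => by ext; rfl
      map_smul' := fun c P => by ext; rfl }
  refine LinearMap.finrank_le_finrank_of_injective (f := F) ?_
  rw [injective_iff_map_eq_zero]
  intro P hP
  apply Subtype.ext
  refine hQ.faithful j P P.2 fun w hw => ?_
  have := LinearMap.congr_fun hP ⟨w, hw⟩
  exact congrArg Subtype.val this

lemma bernstein_rk (hO : WeylOps h X Δ s) (B : Submodule K V)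
    (hBs : ∀ w ∈ B, s w ∈ B) (hBX : ∀ l, ∀ w ∈ B, X l w ∈ B) (hBD : ∀ l, ∀ w ∈ B, Δ l w ∈ B)
    (W : ℕ → Submodule K V) (hmono : Monotone W)
    (hfd : ∀ j, FD (W j) B)
    (hs : ∀ j, ∀ w ∈ W j, s w ∈ W (j + 1))
    (hX : ∀ l j, ∀ w ∈ W j, X l w ∈ W (j + 1))
    (hD : ∀ l j, ∀ w ∈ W j, Δ l w ∈ W (j + 1))
    (d : ℕ)
    (v : V) (hv : v ∈ W 0) (hq : ∀ q : Polynomial K, q.natDegree ≤ d → Polynomial.aeval s q v ∈ B → q = 0)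
    (j : ℕ) : (d + 1) * (j + 2 * h).choose (2 * h) ≤ rk (W j) B * rk (W (2 * j + d)) B := by
  have hae : ∀ q : Polynomial K, ∀ w, Polynomial.aeval (B.mapQ B s hBs) q (B.mkQ w) = B.mkQ (Polynomial.aeval s q w) := by
    intro q
    induction q using Polynomial.induction_on' with
    | add p q hp hq => intro w; rw [map_add, map_add, LinearMap.add_apply, LinearMap.add_apply, hp, hq, map_add]
    | monomial n a =>
      have : ∀ n w, ((B.mapQ B s hBs) ^ n) (B.mkQ w) = B.mkQ ((s ^ n) w) := by
        intro n
        induction n with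
        | zero => intro w; simp
        | succ n ih => intro w; rw [pow_succ, pow_succ, Module.End.mul_apply, Module.End.mul_apply, ← ih]; rfl
      intro w
      rw [Polynomial.aeval_monomial, Polynomial.aeval_monomial, ← Algebra.smul_def, ← Algebra.smul_def,
        LinearMap.smul_apply, LinearMap.smul_apply, this, map_smul]
  have hcom : ∀ (S T : Module.End K V) (hS : ∀ w ∈ B, S w ∈ B) (hT : ∀ w ∈ B, T w ∈ B), Commute S T →
      Commute (B.mapQ B S hS) (B.mapQ B T hT) := by
    intro S T hS hT hST
    ext w
    have := congrArg (fun f => B.mkQ (f w)) hST.eq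
    exact this
  refine bernstein (K := K) (V := V ⧸ B) (X := fun l => B.mapQ B (X l) (hBX l)) (Δ := fun l => B.mapQ B (Δ l) (hBD l))
    (s := B.mapQ B s hBs) ?_ (fun j => (W j).map B.mkQ) (fun i j hij => Submodule.map_mono (hmono hij))
    hfd ?_ ?_ ?_ d (B.mkQ v) ⟨v, hv, rfl⟩ ?_ j
  · refine ⟨fun l l' => hcom _ _ _ _ (hO.XX l l'), fun l l' => hcom _ _ _ _ (hO.DD l l'),
      fun l l' hl => hcom _ _ _ _ (hO.DX l l' hl), fun l => ?_, fun l => hcom _ _ _ _ (hO.sX l),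
      fun l => hcom _ _ _ _ (hO.sD l)⟩
    ext w
    have := congrArg (fun f => B.mkQ (f w)) (hO.one l)
    exact this
  · rintro j _ ⟨w, hw, rfl⟩
    exact ⟨s w, hs j w hw, rfl⟩
  · rintro l j _ ⟨w, hw, rfl⟩
    exact ⟨_, hX l j w hw, rfl⟩
  · rintro l j _ ⟨w, hw, rfl⟩
    exact ⟨_, hD l j w hw, rfl⟩
  · intro q hd hq'
    refine hq q hd ?_
    rw [hae] at hq'
    simpa using hq'

end bern
end
end LCF

namespace LCF
noncomputable section
set_option linter.unusedSectionVars false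

section dco
variable {A : Type*} [CommRing A]
/-- coefficientwise derivation -/
def dco (δ : Derivation ℤ A A) : Derivation ℤ (Polynomial A) (Polynomial A) :=
  (PolynomialModule.equivPolynomialSelf (R := A)).toLinearMap.compDer δ.mapCoeffs

lemma coeff_dco (δ : Derivation ℤ A A) (p : Polynomial A) (n : ℕ) :
    (dco δ p).coeff n = δ (p.coeff n) := by
  rw [← Derivation.mapCoeffs_apply]
  rfl

lemma dco_monomial (δ : Derivation ℤ A A) (n : ℕ) (a : A) :
    dco δ (Polynomial.monomial n a) = Polynomial.monomial n (δ a) := by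
  ext i
  rw [coeff_dco, Polynomial.coeff_monomial, Polynomial.coeff_monomial]
  split_ifs <;> simp
end dco

section hol
variable {K V : Type*} [Field K] [CharZero K] [AddCommGroup V] [Module K V]
variable {h : ℕ} {X Δ : Fin h → Module.End K V} {s : Module.End K V}

lemma choose_lower (j m : ℕ) : (j + 1) ^ m ≤ m.factorial * (j + m).choose m := by
  rw [← Nat.ascFactorial_eq_factorial_mul_choose]
  exact Nat.pow_succ_le_ascFactorial _ _

/-- filtration generated by a vector -/
def gen (X Δ : Fin h → Module.End K V) (s : Module.End K V) (w : V) : ℕ → Submodule K V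
  | 0 => K ∙ w
  | j + 1 => gen X Δ s w j ⊔ (gen X Δ s w j).map s ⊔ (⨆ l, (gen X Δ s w j).map (X l)) ⊔
      (⨆ l, (gen X Δ s w j).map (Δ l))

lemma gen_mono (w : V) : Monotone (gen X Δ s w) :=
  monotone_nat_of_le_succ fun _ => le_sup_left.trans (le_sup_left.trans le_sup_left)

lemma gen_s (w : V) (j : ℕ) : ∀ u ∈ gen X Δ s w j, s u ∈ gen X Δ s w (j + 1) := fun u hu =>
  (le_sup_right.trans (le_sup_left.trans le_sup_left) : _ ≤ gen X Δ s w (j + 1)) ⟨u, hu, rfl⟩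

lemma gen_X (w : V) (l) (j : ℕ) : ∀ u ∈ gen X Δ s w j, X l u ∈ gen X Δ s w (j + 1) := fun u hu =>
  (le_sup_right.trans le_sup_left : _ ≤ gen X Δ s w (j + 1))
    (Submodule.mem_iSup_of_mem l ⟨u, hu, rfl⟩)

lemma gen_D (w : V) (l) (j : ℕ) : ∀ u ∈ gen X Δ s w j, Δ l u ∈ gen X Δ s w (j + 1) := fun u hu =>
  (le_sup_right : _ ≤ gen X Δ s w (j + 1))
    (Submodule.mem_iSup_of_mem l ⟨u, hu, rfl⟩)

lemma gen_le (w : V) (B : ℕ → Submodule K V) (hw : w ∈ B 0) (hB : Monotone B)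
    (hs : ∀ j, ∀ w ∈ B j, s w ∈ B (j + 1))
    (hX : ∀ l j, ∀ w ∈ B j, X l w ∈ B (j + 1))
    (hD : ∀ l j, ∀ w ∈ B j, Δ l w ∈ B (j + 1)) (j : ℕ) : gen X Δ s w j ≤ B j := by
  induction j with
  | zero => simpa [gen] using hw
  | succ j ih =>
    simp only [gen, sup_le_iff, iSup_le_iff, Submodule.map_le_iff_le_comap]
    exact ⟨⟨⟨ih.trans (hB (Nat.le_succ j)), fun u hu => hs j _ (ih hu)⟩,
      fun l u hu => hX l j _ (ih hu)⟩, fun l u hu => hD l j _ (ih hu)⟩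

lemma rk_bot (U : Submodule K V) : rk U ⊥ = Module.finrank K U := by
  unfold rk
  exact (LinearEquiv.finrank_eq (Submodule.equivMapOfInjective _
    (by rw [← LinearMap.ker_eq_bot]; simp) U)).symm

/-- chain bound -/
lemma chain_bound (hO : WeylOps h X Δ s) (W : ℕ → Submodule K V) (hmono : Monotone W)
    (hfd : ∀ j, FiniteDimensional K (W j))
    (hs : ∀ j, ∀ w ∈ W j, s w ∈ W (j + 1))
    (hX : ∀ l j, ∀ w ∈ W j, X l w ∈ W (j + 1))
    (hD : ∀ l j, ∀ w ∈ W j, Δ l w ∈ W (j + 1))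
    (C : ℕ) (hC : ∀ j, Module.finrank K (W j) ≤ C * (j + 1) ^ h)
    (B : ℕ → Submodule K V) (hB : Monotone B) (hB0 : B 0 = ⊥)
    (hBs : ∀ t, ∀ w ∈ B t, s w ∈ B t) (hBX : ∀ t l, ∀ w ∈ B t, X l w ∈ B t)
    (hBD : ∀ t l, ∀ w ∈ B t, Δ l w ∈ B t) :
    ∃ t, ∀ j, W j ⊓ B (t + 1) ≤ B t := by
  by_contra hcon
  push Not at hcon
  have hcon' : ∀ t, ∃ j w, w ∈ W j ∧ w ∈ B (t + 1) ∧ w ∉ B t := by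
    intro t
    obtain ⟨j, hj⟩ := hcon t
    obtain ⟨w, hw, hw'⟩ := SetLike.not_le_iff_exists.mp hj
    exact ⟨j, w, hw.1, hw.2, hw'⟩
  choose r w hwW hwB hwn using hcon'
  let ℓ := C ^ 2 * 9 ^ h * (2 * h).factorial + 1
  let R := ∑ t ∈ Finset.range ℓ, r t
  have hR : ∀ t < ℓ, r t ≤ R := fun t ht =>
    Finset.single_le_sum (f := r) (fun _ _ => Nat.zero_le _) (Finset.mem_range.mpr ht)
  let j := R + 1
  let a : ℕ → ℕ := fun t => rk (gen X Δ s (w t) (2 * j)) (B t)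
  have hle : ∀ t < ℓ, ∀ i, gen X Δ s (w t) i ≤ W (R + i) ⊓ B (t + 1) := by
    intro t ht i
    refine gen_le (w t) (fun i => W (R + i) ⊓ B (t + 1)) ⟨hmono (hR t ht) (hwW t), hwB t⟩ ?_ ?_ ?_ ?_ i
    · intro i i' h; exact inf_le_inf_right _ (hmono (by lia))
    · rintro i u ⟨h1, h2⟩; exact ⟨hs _ _ h1, hBs _ _ h2⟩
    · rintro l i u ⟨h1, h2⟩; exact ⟨hX _ _ _ h1, hBX _ _ _ h2⟩
    · rintro l i u ⟨h1, h2⟩; exact ⟨hD _ _ _ h1, hBD _ _ _ h2⟩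
  have hFD : ∀ i (B : Submodule K V), FD (W i) B := fun i B => by
    unfold FD; have := hfd i; infer_instance
  have h1 : ∀ t < ℓ, (j + 2 * h).choose (2 * h) ≤ a t ^ 2 := by
    intro t ht
    have hb := bernstein_rk hO (B t) (hBs t) (hBX t) (hBD t) (gen X Δ s (w t)) (gen_mono _)
      (fun i => (hFD (R + i) _).mono ((hle t ht i).trans inf_le_left)) (gen_s _) (gen_X _) (gen_D _) 0 (w t)
      (Submodule.mem_span_singleton_self _) ?_ j
    · rw [zero_add, one_mul, add_zero] at hb
      refine hb.trans ?_
      rw [pow_two]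
      refine Nat.mul_le_mul_right _ (rk_mono ((hFD (R + 2 * j) _).mono ((hle t ht _).trans inf_le_left)) ?_)
      exact gen_mono _ (by lia)
    · intro q hq hqB
      rw [Nat.le_zero, Polynomial.natDegree_eq_zero] at hq
      obtain ⟨c, rfl⟩ := hq
      by_contra hc
      have hc' : c ≠ 0 := fun h => hc (by simp [h])
      rw [Polynomial.aeval_C, Module.algebraMap_end_apply] at hqB
      exact hwn t ((Submodule.smul_mem_iff _ hc').mp hqB)
  have h2 : ∑ t ∈ Finset.range ℓ, a t ≤ Module.finrank K (W (R + 2 * j)) := by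
    rw [← rk_bot, ← hB0]
    refine rk_chain B hB _ a (hFD _ _) ℓ fun t ht => ?_
    exact rk_mono ((hFD _ _).mono inf_le_left) (hle t ht _)
  have h3 : ∑ t ∈ Finset.range ℓ, a t ^ 2 ≤ (∑ t ∈ Finset.range ℓ, a t) ^ 2 := by
    exact Finset.sum_sq_le_sq_sum_of_nonneg (fun _ _ => Nat.zero_le _)
  have h4 : ℓ * (j + 2 * h).choose (2 * h) ≤ ∑ t ∈ Finset.range ℓ, a t ^ 2 := by
    have := Finset.card_nsmul_le_sum (Finset.range ℓ) (fun t => a t ^ 2) _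
      (fun t ht => h1 t (Finset.mem_range.mp ht))
    simpa using this
  have h5 := hC (R + 2 * j)
  have h6 : ℓ * (j + 2 * h).choose (2 * h) ≤ (C * (3 * j) ^ h) ^ 2 := by
    refine h4.trans (h3.trans (Nat.pow_le_pow_left (h2.trans (h5.trans ?_)) 2))
    exact Nat.mul_le_mul_left _ (Nat.pow_le_pow_left (by lia) h)
  have h7 := choose_lower j (2 * h)
  have h8 : ℓ * (j + 1) ^ (2 * h) ≤ (ℓ - 1) * j ^ (2 * h) := by
    calc ℓ * (j + 1) ^ (2 * h) ≤ ℓ * ((2 * h).factorial * (j + 2 * h).choose (2 * h)) :=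
          Nat.mul_le_mul_left _ h7
      _ = (2 * h).factorial * (ℓ * (j + 2 * h).choose (2 * h)) := by ring
      _ ≤ (2 * h).factorial * (C * (3 * j) ^ h) ^ 2 := Nat.mul_le_mul_left _ h6
      _ = _ := by
        simp only [ℓ, Nat.add_sub_cancel, mul_pow, pow_mul]
        rw [show (9:ℕ) = 3 ^ 2 by norm_num, ← pow_mul, ← pow_mul, ← pow_mul, ← pow_mul, mul_comm 2 h]
        ring
  have h9 : (ℓ - 1) * j ^ (2 * h) < ℓ * (j + 1) ^ (2 * h) := by
    have e1 : j ^ (2 * h) ≤ (j + 1) ^ (2 * h) := Nat.pow_le_pow_left (by lia) _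
    have e2 : 0 < (j + 1) ^ (2 * h) := by positivity
    calc (ℓ - 1) * j ^ (2 * h) ≤ (ℓ - 1) * (j + 1) ^ (2 * h) := Nat.mul_le_mul_left _ e1
      _ < _ := Nat.mul_lt_mul_of_pos_right (by simp [ℓ]) e2
  lia

lemma exists_ann (hO : WeylOps h X Δ s) (W : ℕ → Submodule K V) (hmono : Monotone W)
    (hfd : ∀ j, FiniteDimensional K (W j))
    (hs : ∀ j, ∀ w ∈ W j, s w ∈ W (j + 1))
    (hX : ∀ l j, ∀ w ∈ W j, X l w ∈ W (j + 1))
    (hD : ∀ l j, ∀ w ∈ W j, Δ l w ∈ W (j + 1))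
    (C : ℕ) (hC : ∀ j, Module.finrank K (W j) ≤ C * (j + 1) ^ h)
    (v : V) (hv : v ∈ W 0) : ∃ q : Polynomial K, q ≠ 0 ∧ Polynomial.aeval s q v = 0 := by
  by_contra hcon
  push Not at hcon
  let j := C ^ 2 * 3 ^ h * (2 * h).factorial
  have hb := bernstein hO W hmono hfd hs hX hD j v hv
    (fun q _ hq => by by_contra h0; exact hcon q h0 hq) j
  have h7 := choose_lower j (2 * h)
  have h8 : (j + 1) * (j + 1) ^ (2 * h) ≤ j * (j + 1) ^ (2 * h) := by
    calc (j + 1) * (j + 1) ^ (2 * h) ≤ (j + 1) * ((2 * h).factorial * (j + 2 * h).choose (2 * h)) :=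
          Nat.mul_le_mul_left _ h7
      _ = (2 * h).factorial * ((j + 1) * (j + 2 * h).choose (2 * h)) := by ring
      _ ≤ (2 * h).factorial * ((C * (j + 1) ^ h) * (C * (3 * (j + 1)) ^ h)) := by
        refine Nat.mul_le_mul_left _ (hb.trans (Nat.mul_le_mul (hC _) ((hC _).trans ?_)))
        exact Nat.mul_le_mul_left _ (Nat.pow_le_pow_left (by lia) h)
      _ = (C ^ 2 * 3 ^ h * (2 * h).factorial) * (j + 1) ^ (2 * h) := by
        rw [mul_pow, two_mul h, pow_add]; ring
      _ = _ := rfl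
  have e2 : 0 < (j + 1) ^ (2 * h) := by positivity
  have := Nat.le_of_mul_le_mul_right h8 e2
  lia

lemma aeval_N {N : V →+ V} {δ : Derivation ℤ K K} (hN : ∀ (κ : K) w, N (κ • w) = κ • N w + δ κ • w)
    (hNs : ∀ w, N (s w) = s (N w)) (q : Polynomial K) (w : V) :
    N (Polynomial.aeval s q w) = Polynomial.aeval s q (N w) + Polynomial.aeval s (dco δ q) w := by
  induction q using Polynomial.induction_on' with
  | add p q hp hq =>
    simp only [map_add, LinearMap.add_apply, hp, hq]
    abel
  | monomial n a =>
    have : ∀ n w, N ((s ^ n) w) = (s ^ n) (N w) := by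
      intro n
      induction n with
      | zero => intro w; simp
      | succ n ih => intro w; rw [pow_succ, Module.End.mul_apply, Module.End.mul_apply, ih, hNs]
    rw [dco_monomial, Polynomial.aeval_monomial, Polynomial.aeval_monomial, ← Algebra.smul_def, ← Algebra.smul_def,
        LinearMap.smul_apply, LinearMap.smul_apply, LinearMap.smul_apply, hN, this]

/-- Abstract holonomicity theorem. -/
theorem hol_main {τ : Type*} (N : τ → V →+ V) (δ : τ → Derivation ℤ K K)
    (hN : ∀ i (κ : K) w, N i (κ • w) = κ • N i w + δ i κ • w)
    (hNs : ∀ i w, N i (s w) = s (N i w))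
    (hO : WeylOps h X Δ s) (W : ℕ → Submodule K V) (hmono : Monotone W)
    (hfd : ∀ j, FiniteDimensional K (W j))
    (hs : ∀ j, ∀ w ∈ W j, s w ∈ W (j + 1))
    (hX : ∀ l j, ∀ w ∈ W j, X l w ∈ W (j + 1))
    (hD : ∀ l j, ∀ w ∈ W j, Δ l w ∈ W (j + 1))
    (hNW : ∀ i j, ∀ w ∈ W j, N i w ∈ W (j + 1))
    (C : ℕ) (hC : ∀ j, Module.finrank K (W j) ≤ C * (j + 1) ^ h)
    (v : V) (hv : W 0 = K ∙ v)
    (hgen : ∀ j, ∀ B : Submodule K V, W j ≤ B → (∀ w ∈ W j, s w ∈ B) → (∀ l, ∀ w ∈ W j, X l w ∈ B) →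
      (∀ l, ∀ w ∈ W j, Δ l w ∈ B) → (∀ i, ∀ w ∈ W j, N i w ∈ B) → W (j + 1) ≤ B) :
    ∃ c : Polynomial K, c.Monic ∧ (∀ i, dco (δ i) c = 0) ∧ Polynomial.aeval s c v = 0 := by
  have hv0 : v ∈ W 0 := by rw [hv]; exact Submodule.mem_span_singleton_self _
  obtain ⟨q, hq0, hq⟩ := exists_ann hO W hmono hfd hs hX hD C hC v hv0
  let p : Module.End K V := Polynomial.aeval s q
  have hcomm : ∀ T : Module.End K V, Commute s T → ∀ r : Polynomial K, Commute (Polynomial.aeval s r) T := by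
    intro T hT r
    rw [Polynomial.aeval_eq_sum_range]
    exact Commute.sum_left _ _ _ fun a _ => (hT.pow_left _).smul_left _
  have hpsW : ∀ (r : Polynomial K) j, ∃ j', ∀ w ∈ W j, Polynomial.aeval s r w ∈ W j' := by
    intro r j
    have hsp : ∀ a j, ∀ w ∈ W j, (s ^ a) w ∈ W (j + a) := by
      intro a
      induction a with
      | zero => intro j w hw; simpa using hw
      | succ a ih =>
        intro j w hw
        rw [pow_succ', Module.End.mul_apply]
        exact hs _ _ (ih j w hw)
    refine ⟨j + r.natDegree, fun w hw => ?_⟩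
    rw [Polynomial.aeval_eq_sum_range, LinearMap.sum_apply]
    refine Submodule.sum_mem _ fun a ha => ?_
    rw [LinearMap.smul_apply]
    refine Submodule.smul_mem _ _ (hmono ?_ (hsp a _ _ hw))
    simp only [Finset.mem_range] at ha
    lia
  have hcs : ∀ (T : Module.End K V), Commute s T → ∀ t, ∀ w ∈ LinearMap.ker (p ^ t), T w ∈ LinearMap.ker (p ^ t) := by
    intro T hT t w hw
    rw [LinearMap.mem_ker] at hw ⊢
    have := LinearMap.congr_fun ((hcomm T hT q).pow_left t).eq w
    rw [Module.End.mul_apply, Module.End.mul_apply, hw, map_zero] at this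
    exact this
  obtain ⟨t, ht⟩ := chain_bound hO W hmono hfd hs hX hD C hC (fun t => LinearMap.ker (p ^ t))
    (fun a b hab w hw => by
      obtain ⟨c, rfl⟩ := Nat.exists_eq_add_of_le' hab
      rw [LinearMap.mem_ker] at hw ⊢
      rw [pow_add, Module.End.mul_apply, hw, map_zero])
    (by ext w; simp) (fun t => hcs s (Commute.refl _) t) (fun t l => hcs _ (hO.sX l) t)
    (fun t l => hcs _ (hO.sD l) t)
  have hWt : ∀ j, W j ≤ LinearMap.ker (p ^ (j + 1)) := by
    have hup : ∀ j, LinearMap.ker (p ^ (j + 1)) ≤ LinearMap.ker (p ^ (j + 1 + 1)) := fun j w hw => by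
      rw [LinearMap.mem_ker] at hw ⊢
      rw [pow_succ', Module.End.mul_apply, hw, map_zero]
    intro j
    induction j with
    | zero =>
      rw [hv, Submodule.span_singleton_le_iff_mem]
      simpa [p] using hq
    | succ j ih =>
      refine hgen j _ (ih.trans (hup j)) (fun w hw => hup j (hcs s (Commute.refl _) _ _ (ih hw)))
        (fun l w hw => hup j (hcs _ (hO.sX l) _ _ (ih hw))) (fun l w hw => hup j (hcs _ (hO.sD l) _ _ (ih hw))) ?_
      intro i w hw
      have h1 := aeval_N (hN i) (hNs i) (q ^ (j + 1 + 1)) w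
      have h2 := ih hw
      rw [LinearMap.mem_ker] at h2 ⊢
      rw [map_pow, pow_succ' _ (j + 1), Module.End.mul_apply] at h1
      change N i (p ((p ^ (j + 1)) w)) = _ at h1
      rw [h2, map_zero, map_zero, ← pow_succ', Derivation.leibniz_pow] at h1
      rw [Nat.add_sub_cancel, smul_eq_mul, mul_comm, map_nsmul, LinearMap.smul_apply, map_mul, map_pow,
        Module.End.mul_apply] at h1
      have h2' : (Polynomial.aeval s q ^ (j + 1)) w = 0 := h2
      rw [h2', map_zero, smul_zero, add_zero] at h1
      exact h1.symm
  have hall : ∀ r j, W j ⊓ LinearMap.ker (p ^ (t + r)) ≤ LinearMap.ker (p ^ t) := by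
    intro r
    induction r with
    | zero => intro j; exact inf_le_right
    | succ r ih =>
      rintro j w ⟨hw, hw'⟩
      refine ih j ⟨hw, ?_⟩
      obtain ⟨j', hj'⟩ := hpsW (q ^ r) j
      have h1 := hj' w hw
      rw [map_pow] at h1
      change (p ^ r) w ∈ _ at h1
      have h2 := ht j' ⟨h1, (by
        change (p ^ (t + 1)) ((p ^ r) w) = 0
        rw [← Module.End.mul_apply, ← pow_add]
        rw [show t + 1 + r = t + (r + 1) by ring]; exact hw')⟩
      change (p ^ t) ((p ^ r) w) = 0 at h2
      rw [← Module.End.mul_apply, ← pow_add] at h2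
      exact h2
  have hex : ∃ n, ∃ c : Polynomial K, c ≠ 0 ∧ c.natDegree = n ∧ ∀ j, ∀ w ∈ W j, Polynomial.aeval s c w = 0 := by
    refine ⟨_, q ^ t, pow_ne_zero _ hq0, rfl, fun j w hw => ?_⟩
    have := hall (j + 1) j ⟨hw, (by
      have := hWt j hw
      rw [LinearMap.mem_ker] at this
      change (p ^ (t + (j + 1))) w = 0
      rw [pow_add, Module.End.mul_apply, this, map_zero])⟩
    rw [map_pow]
    exact this
  classical
  obtain ⟨c, hc0, hcn, hc⟩ := Nat.find_spec hex
  have hmin : ∀ c' : Polynomial K, c'.natDegree < c.natDegree → (∀ j, ∀ w ∈ W j, Polynomial.aeval s c' w = 0) → c' = 0 := by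
    intro c' h1 h2
    by_contra h0
    exact Nat.find_min hex (hcn ▸ h1) ⟨c', h0, rfl, h2⟩
  refine ⟨c * Polynomial.C c.leadingCoeff⁻¹, Polynomial.monic_mul_leadingCoeff_inv hc0, fun i => ?_, ?_⟩
  · set c1 := c * Polynomial.C c.leadingCoeff⁻¹ with hc1
    have hm : c1.Monic := Polynomial.monic_mul_leadingCoeff_inv hc0
    have hk : ∀ j, ∀ w ∈ W j, Polynomial.aeval s c1 w = 0 := fun j w hw => by
      rw [hc1, mul_comm, map_mul, Module.End.mul_apply, hc j w hw, map_zero]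
    have hd : c1.natDegree = c.natDegree := Polynomial.natDegree_mul_leadingCoeff_inv c hc0
    have hk' : ∀ j, ∀ w ∈ W j, Polynomial.aeval s (dco (δ i) c1) w = 0 := fun j w hw => by
      have := aeval_N (hN i) (hNs i) c1 w
      rw [hk j w hw, map_zero, hk _ _ (hNW i j w hw), zero_add] at this
      exact this.symm
    by_contra h0
    refine h0 (hmin _ ?_ hk')
    rw [← hd]
    have hle : (dco (δ i) c1).natDegree ≤ c1.natDegree := by
      rw [Polynomial.natDegree_le_iff_coeff_eq_zero]
      intro n hn
      rw [coeff_dco, Polynomial.coeff_eq_zero_of_natDegree_lt hn, map_zero]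
    refine lt_of_le_of_ne hle fun e => h0 ?_
    rw [← Polynomial.leadingCoeff_eq_zero, Polynomial.leadingCoeff, e, coeff_dco,
      hm.coeff_natDegree, Derivation.map_one_eq_zero]
  · rw [mul_comm, map_mul, Module.End.mul_apply, hc 0 v hv0, map_zero]

end hol
end
end LCF

namespace LCF
noncomputable section
set_option linter.unusedSectionVars false

section sig
variable {K V : Type*} [Field K] [CharZero K] [AddCommGroup V] [Module K V]
variable {h : ℕ} {τ : Type*}

/-- filtration generated by a vector, with tangential operators -/
def genT (X Δ : Fin h → Module.End K V) (s : Module.End K V) (N : τ → V →+ V) (w : V) : ℕ → Submodule K V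
  | 0 => K ∙ w
  | j + 1 => Submodule.span K ((genT X Δ s N w j : Set V) ∪ s '' (genT X Δ s N w j : Set V) ∪
      (⋃ l, X l '' (genT X Δ s N w j : Set V)) ∪ (⋃ l, Δ l '' (genT X Δ s N w j : Set V)) ∪
      (⋃ i, N i '' (genT X Δ s N w j : Set V)))

variable {X Δ : Fin h → Module.End K V} {s : Module.End K V} {N : τ → V →+ V}

lemma genT_le_succ (w : V) (j : ℕ) : genT X Δ s N w j ≤ genT X Δ s N w (j + 1) := fun u hu =>
  Submodule.subset_span (Or.inl (Or.inl (Or.inl (Or.inl hu))))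

lemma genT_mono (w : V) : Monotone (genT X Δ s N w) :=
  monotone_nat_of_le_succ fun j => genT_le_succ w j

lemma genT_s (w : V) (j : ℕ) : ∀ u ∈ genT X Δ s N w j, s u ∈ genT X Δ s N w (j + 1) := fun u hu =>
  Submodule.subset_span (Or.inl (Or.inl (Or.inl (Or.inr ⟨u, hu, rfl⟩))))

lemma genT_X (w : V) (l) (j : ℕ) : ∀ u ∈ genT X Δ s N w j, X l u ∈ genT X Δ s N w (j + 1) := fun u hu =>
  Submodule.subset_span (Or.inl (Or.inl (Or.inr (Set.mem_iUnion.mpr ⟨l, u, hu, rfl⟩))))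

lemma genT_D (w : V) (l) (j : ℕ) : ∀ u ∈ genT X Δ s N w j, Δ l u ∈ genT X Δ s N w (j + 1) := fun u hu =>
  Submodule.subset_span (Or.inl (Or.inr (Set.mem_iUnion.mpr ⟨l, u, hu, rfl⟩)))

lemma genT_N (w : V) (i) (j : ℕ) : ∀ u ∈ genT X Δ s N w j, N i u ∈ genT X Δ s N w (j + 1) := fun u hu =>
  Submodule.subset_span (Or.inr (Set.mem_iUnion.mpr ⟨i, u, hu, rfl⟩))

lemma genT_le (w : V) (j : ℕ) (B : Submodule K V) (h0 : genT X Δ s N w j ≤ B)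
    (hs : ∀ u ∈ genT X Δ s N w j, s u ∈ B) (hX : ∀ l, ∀ u ∈ genT X Δ s N w j, X l u ∈ B)
    (hD : ∀ l, ∀ u ∈ genT X Δ s N w j, Δ l u ∈ B) (hN : ∀ l, ∀ u ∈ genT X Δ s N w j, N l u ∈ B) :
    genT X Δ s N w (j + 1) ≤ B := by
  rw [genT, Submodule.span_le]
  rintro u ((((hu | ⟨u, hu, rfl⟩) | hu) | hu) | hu)
  · exact h0 hu
  · exact hs _ hu
  · obtain ⟨l, u, hu', rfl⟩ := Set.mem_iUnion.mp hu
    exact hX _ _ hu'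
  · obtain ⟨l, u, hu', rfl⟩ := Set.mem_iUnion.mp hu
    exact hD _ _ hu'
  · obtain ⟨l, u, hu', rfl⟩ := Set.mem_iUnion.mp hu
    exact hN _ _ hu'

lemma rk_of_span {U B : Submodule K V} (F : Finset V) (hU : U ≤ Submodule.span K (F : Set V) ⊔ B) :
    FD U B ∧ rk U B ≤ F.card := by
  classical
  have h1 : U.map B.mkQ ≤ Submodule.span K ((F.image B.mkQ : Finset (V ⧸ B)) : Set (V ⧸ B)) := by
    refine (Submodule.map_mono hU).trans ?_
    rw [Submodule.map_sup, Submodule.map_span, Finset.coe_image]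
    refine sup_le le_rfl ?_
    rw [Submodule.map_le_iff_le_comap]
    intro b hb
    have : B.mkQ b = 0 := by simpa using hb
    rw [Submodule.mem_comap, this]
    exact Submodule.zero_mem _
  have hfin := FiniteDimensional.span_of_finite K (F.image B.mkQ).finite_toSet
  refine ⟨Submodule.finiteDimensional_of_le h1, ?_⟩
  refine (Submodule.finrank_mono h1).trans ((finrank_span_finset_le_card _).trans Finset.card_image_le)

/-- the abstract theorem with the shift operator -/
theorem hol_sigma (δ : τ → Derivation ℤ K K)
    (hN : ∀ i (κ : K) w, N i (κ • w) = κ • N i w + δ i κ • w)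
    (hNs : ∀ i w, N i (s w) = s (N i w))
    (hO : WeylOps h X Δ s) (B : Submodule K V)
    (hBs : ∀ w ∈ B, s w ∈ B) (hBX : ∀ l, ∀ w ∈ B, X l w ∈ B) (hBD : ∀ l, ∀ w ∈ B, Δ l w ∈ B)
    (hBN : ∀ l, ∀ w ∈ B, N l w ∈ B)
    (σ : V ≃ₗ[K] V) (hσ : B ≤ B.map σ.toLinearMap) (v : V)
    (hv : ∀ j, genT X Δ s N v j ≤ B.map σ.toLinearMap) (C : ℕ)
    (hC : ∀ i j, ∃ F : Finset V, F.card ≤ (j + 1) * (C * (i + j + 1) ^ h) ∧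
      ∀ a < i, (genT X Δ s N v j).map (σ ^ a).toLinearMap ≤ Submodule.span K (F : Set V) ⊔ B) :
    ∃ c : Polynomial K, c.Monic ∧ (∀ i, dco (δ i) c = 0) ∧ Polynomial.aeval s c v ∈ B := by
  -- growth
  let Bs : ℕ → Submodule K V := fun a => B.map (σ ^ a).toLinearMap
  have hBs_succ : ∀ a, Bs (a + 1) = (B.map σ.toLinearMap).map (σ ^ a).toLinearMap := by
    intro a
    rw [← Submodule.map_comp]; rfl
  have hBmono : Monotone Bs := monotone_nat_of_le_succ fun a => by
    rw [hBs_succ]; exact Submodule.map_mono hσ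
  have hB0 : Bs 0 = B := by
    ext x; simp [Bs]
  have growth : ∀ j, FD (genT X Δ s N v j) B ∧ rk (genT X Δ s N v j) B ≤ (C * 2 ^ h) * (j + 1) ^ h := by
    intro j
    obtain ⟨F, hF, hFle⟩ := hC (j + 1) j
    let G : Submodule K V := ⨆ a ∈ Finset.range (j + 1), (genT X Δ s N v j).map (σ ^ a).toLinearMap
    have hG : G ≤ Submodule.span K (F : Set V) ⊔ B :=
      iSup₂_le fun a ha => hFle a (Finset.mem_range.mp ha)
    obtain ⟨hG1, hG2⟩ := rk_of_span F hG
    have hle : ∀ a < j + 1, (genT X Δ s N v j).map (σ ^ a).toLinearMap ≤ G := fun a ha =>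
      le_iSup₂_of_le a (Finset.mem_range.mpr ha) le_rfl
    have h0 : genT X Δ s N v j ≤ G := by
      refine le_trans ?_ (hle 0 (by lia))
      intro u hu
      exact ⟨u, hu, by simp⟩
    refine ⟨hG1.mono h0, ?_⟩
    have hch := rk_chain Bs hBmono G (fun _ => rk (genT X Δ s N v j) B) (by rw [hB0]; exact hG1) (j + 1) ?_
    · rw [Finset.sum_const, Finset.card_range, hB0, smul_eq_mul] at hch
      have := (hch.trans hG2).trans hF
      have := Nat.le_of_mul_le_mul_left this (by lia)
      refine this.trans (le_of_eq ?_)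
      rw [show j + 1 + j + 1 = 2 * (j + 1) by ring, mul_pow]; ring
    · intro a ha
      rw [← rk_equiv (σ ^ a)]
      refine rk_mono ?_ (le_inf (hle a ha) ?_)
      · have : FD G (Bs a) := hG1.mono_right (by rw [← hB0]; exact hBmono (Nat.zero_le a))
        exact this.mono inf_le_left
      · rw [hBs_succ]; exact Submodule.map_mono (hv j)
  -- pass to the quotient
  have hcom : ∀ (S T : Module.End K V) (hS : ∀ w ∈ B, S w ∈ B) (hT : ∀ w ∈ B, T w ∈ B), Commute S T →
      Commute (B.mapQ B S hS) (B.mapQ B T hT) := by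
    intro S T hS hT hST
    ext w
    have := congrArg (fun f => B.mkQ (f w)) hST.eq
    exact this
  have hae : ∀ q : Polynomial K, ∀ w, Polynomial.aeval (B.mapQ B s hBs) q (B.mkQ w) = B.mkQ (Polynomial.aeval s q w) := by
    intro q
    induction q using Polynomial.induction_on' with
    | add p q hp hq => intro w; rw [map_add, map_add, LinearMap.add_apply, LinearMap.add_apply, hp, hq, map_add]
    | monomial n a =>
      have : ∀ n w, ((B.mapQ B s hBs) ^ n) (B.mkQ w) = B.mkQ ((s ^ n) w) := by
        intro n
        induction n with
        | zero => intro w; simp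
        | succ n ih => intro w; rw [pow_succ, pow_succ, Module.End.mul_apply, Module.End.mul_apply, ← ih]; rfl
      intro w
      rw [Polynomial.aeval_monomial, Polynomial.aeval_monomial, ← Algebra.smul_def, ← Algebra.smul_def,
        LinearMap.smul_apply, LinearMap.smul_apply, this, map_smul]
  let N' : τ → (V ⧸ B) →+ (V ⧸ B) := fun i =>
    QuotientAddGroup.map B.toAddSubgroup B.toAddSubgroup (N i) (fun w hw => hBN i w hw)
  have hN' : ∀ i w, N' i (B.mkQ w) = B.mkQ (N i w) := fun i w => rfl
  have hsurj : ∀ x : V ⧸ B, ∃ w, B.mkQ w = x := B.mkQ_surjective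
  suffices hm : ∃ c : Polynomial K, c.Monic ∧ (∀ i, dco (δ i) c = 0) ∧
      Polynomial.aeval (B.mapQ B s hBs) c (B.mkQ v) = 0 by
    obtain ⟨c, h1, h2, h3⟩ := hm
    refine ⟨c, h1, h2, ?_⟩
    rw [hae] at h3
    simpa using h3
  refine hol_main (K := K) (V := V ⧸ B) (X := fun l => B.mapQ B (X l) (hBX l))
    (Δ := fun l => B.mapQ B (Δ l) (hBD l))
    (s := B.mapQ B s hBs) N' δ
    (fun i κ x => by
      obtain ⟨w, rfl⟩ := hsurj x
      rw [← map_smul, hN', hN, map_add, map_smul, map_smul, hN'])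
    (fun i x => by
      obtain ⟨w, rfl⟩ := hsurj x
      have := congrArg B.mkQ (hNs i w)
      exact this) ?_ (fun j => (genT X Δ s N v j).map B.mkQ)
    (fun i j hij => Submodule.map_mono (genT_mono v hij)) (fun j => (growth j).1) ?_ ?_ ?_ ?_ (C * 2 ^ h)
    (fun j => (growth j).2) (B.mkQ v) (by simp [genT, Submodule.map_span]) ?_
  · refine ⟨fun l l' => hcom _ _ _ _ (hO.XX l l'), fun l l' => hcom _ _ _ _ (hO.DD l l'),
      fun l l' hl => hcom _ _ _ _ (hO.DX l l' hl), fun l => ?_, fun l => hcom _ _ _ _ (hO.sX l),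
      fun l => hcom _ _ _ _ (hO.sD l)⟩
    ext w
    have := congrArg (fun f => B.mkQ (f w)) (hO.one l)
    exact this
  · rintro j _ ⟨w, hw, rfl⟩
    exact ⟨_, genT_s v j w hw, rfl⟩
  · rintro l j _ ⟨w, hw, rfl⟩
    exact ⟨_, genT_X v l j w hw, rfl⟩
  · rintro l j _ ⟨w, hw, rfl⟩
    exact ⟨_, genT_D v l j w hw, rfl⟩
  · rintro l j _ ⟨w, hw, rfl⟩
    exact ⟨_, genT_N v l j w hw, rfl⟩
  · intro j B' h0 hs' hX' hD' hN''
    rw [Submodule.map_le_iff_le_comap] at h0 ⊢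
    exact genT_le v j _ h0 (fun u hu => hs' _ ⟨u, hu, rfl⟩) (fun l u hu => hX' l _ ⟨u, hu, rfl⟩)
      (fun l u hu => hD' l _ ⟨u, hu, rfl⟩) (fun l u hu => hN'' l _ ⟨u, hu, rfl⟩)

end sig
end
end LCF

namespace LCF
noncomputable section
set_option linter.unusedSectionVars false

section fder
variable {B Φ : Type*} [CommRing B] [IsDomain B] [Field Φ] [Algebra B Φ] [IsFractionRing B Φ]

/-- auxiliary ring homomorphism to dual numbers -/
def fderAux (D : Derivation ℤ B B) : B →+* TrivSqZeroExt Φ Φ where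
  toFun b := ((algebraMap B Φ b, algebraMap B Φ (D b)) : Φ × Φ)
  map_one' := by
    refine TrivSqZeroExt.ext ?_ ?_
    · show algebraMap B Φ 1 = 1
      simp
    · show algebraMap B Φ (D 1) = 0
      simp
  map_zero' := by
    refine TrivSqZeroExt.ext ?_ ?_
    · show algebraMap B Φ 0 = 0
      simp
    · show algebraMap B Φ (D 0) = 0
      simp
  map_add' a b := by
    refine TrivSqZeroExt.ext ?_ ?_
    · show algebraMap B Φ (a + b) = algebraMap B Φ a + algebraMap B Φ b
      simp
    · show algebraMap B Φ (D (a + b)) = algebraMap B Φ (D a) + algebraMap B Φ (D b)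
      simp
  map_mul' a b := by
    refine TrivSqZeroExt.ext ?_ ?_
    · show algebraMap B Φ (a * b) = algebraMap B Φ a * algebraMap B Φ b
      simp
    · show algebraMap B Φ (D (a * b)) = algebraMap B Φ a * algebraMap B Φ (D b) + algebraMap B Φ (D a) * algebraMap B Φ b
      rw [D.leibniz]
      simp only [smul_eq_mul, map_add, map_mul]
      ring

lemma fderAux_fst (D : Derivation ℤ B B) (b : B) : (fderAux (Φ := Φ) D b).fst = algebraMap B Φ b := rfl
lemma fderAux_snd (D : Derivation ℤ B B) (b : B) : (fderAux (Φ := Φ) D b).snd = algebraMap B Φ (D b) := rfl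

variable (Φ) in
lemma fderAux_unit (D : Derivation ℤ B B) (y : nonZeroDivisors B) : IsUnit (fderAux (Φ := Φ) D y) := by
  rw [TrivSqZeroExt.isUnit_iff_isUnit_fst]
  simp [fderAux_fst]

/-- lift -/
def fderLift (D : Derivation ℤ B B) : Φ →+* TrivSqZeroExt Φ Φ :=
  IsLocalization.lift (M := nonZeroDivisors B) (fderAux_unit Φ D)

lemma fderLift_alg (D : Derivation ℤ B B) (b : B) : fderLift (Φ := Φ) D (algebraMap B Φ b) = fderAux D b :=
  IsLocalization.lift_eq _ _

lemma fderLift_fst (D : Derivation ℤ B B) (g : Φ) : (fderLift (Φ := Φ) D g).fst = g := by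
  have : (TrivSqZeroExt.fstHom Φ Φ Φ).toRingHom.comp (fderLift (Φ := Φ) D) = RingHom.id Φ := by
    apply IsLocalization.ringHom_ext (nonZeroDivisors B)
    ext b
    simp [fderLift_alg, fderAux_fst]
  exact congrArg (fun h : Φ →+* Φ => h g) this

variable (Φ) in
/-- extension of a derivation to the fraction field -/
def fder (D : Derivation ℤ B B) : Derivation ℤ Φ Φ :=
  Derivation.mk' ((((TrivSqZeroExt.sndHom Φ Φ).toAddMonoidHom).comp
    (fderLift (Φ := Φ) D).toAddMonoidHom).toIntLinearMap) (by
    intro a b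
    show (fderLift D (a * b)).snd = a • (fderLift D b).snd + b • (fderLift D a).snd
    rw [map_mul, TrivSqZeroExt.snd_mul, fderLift_fst, fderLift_fst]
    simp [mul_comm])

lemma fder_alg (D : Derivation ℤ B B) (b : B) : fder Φ D (algebraMap B Φ b) = algebraMap B Φ (D b) := by
  show (fderLift D (algebraMap B Φ b)).snd = _
  rw [fderLift_alg]
  rw [fderAux_snd]

/-- derivations into a module agreeing on `B` agree on fractions -/
lemma der_ext {W : Type*} [Field W] [Algebra Φ W] (D D' : Derivation ℤ Φ W)
    (h : ∀ b : B, D (algebraMap B Φ b) = D' (algebraMap B Φ b)) : D = D' := by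
  ext g
  obtain ⟨a, b, hb, rfl⟩ := IsFractionRing.div_surjective (A := B) g
  have hb0 : algebraMap B Φ b ≠ 0 := by
    simpa using nonZeroDivisors.ne_zero hb
  set q := algebraMap B Φ a / algebraMap B Φ b with hq
  have e : algebraMap B Φ b * q = algebraMap B Φ a := by rw [hq]; field_simp
  have h1 := congrArg D e
  have h2 := congrArg D' e
  rw [Derivation.leibniz] at h1 h2
  rw [h, h, ← h2] at h1
  have := add_right_cancel h1
  exact smul_right_injective W hb0 this
end fder
end
end LCF

namespace LCF
noncomputable section
set_option linter.unusedSectionVars false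

/-- compatible derivations on fraction fields -/
lemma der_compat {B Φ Φ' : Type*} [CommRing B] [IsDomain B] [Field Φ] [Algebra B Φ] [IsFractionRing B Φ]
    [Field Φ'] (Θ : Φ →+* Φ') (E : Derivation ℤ Φ Φ) (E' : Derivation ℤ Φ' Φ')
    (h : ∀ b : B, E' (Θ (algebraMap B Φ b)) = Θ (E (algebraMap B Φ b))) (g : Φ) : E' (Θ g) = Θ (E g) := by
  obtain ⟨a, b, hb, rfl⟩ := IsFractionRing.div_surjective (A := B) g
  have hb0 : algebraMap B Φ b ≠ 0 := by
    simpa using nonZeroDivisors.ne_zero hb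
  set q := algebraMap B Φ a / algebraMap B Φ b with hq
  have e : algebraMap B Φ b * q = algebraMap B Φ a := by rw [hq]; field_simp
  have h1 := congrArg (fun z => E' (Θ z)) e
  have h2 := congrArg (fun z => Θ (E z)) e
  simp only [map_mul, Derivation.leibniz, smul_eq_mul, map_add] at h1 h2
  rw [h, h, ← h2] at h1
  have h3 := add_right_cancel h1
  exact mul_left_cancel₀ (by simpa using hb0) h3

section setup
variable {k R : Type*} [Field k] [CommRing R] [IsDomain R] [Algebra k R]

variable {Φ : Type*} [Field Φ] [Algebra (Polynomial R) Φ] [IsFractionRing (Polynomial R) Φ]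

variable (R Φ) in
/-- embedding of the base -/
def al : R →+* Φ := (algebraMap (Polynomial R) Φ).comp Polynomial.C

variable (R Φ) in
/-- the variable s -/
def sX : Φ := algebraMap (Polynomial R) Φ Polynomial.X

variable (Φ) in
/-- coefficientwise derivation -/
def dP (D : Derivation k R R) : Derivation ℤ Φ Φ := fder Φ (dco (D.restrictScalars ℤ))

lemma dP_poly (D : Derivation k R R) (p : Polynomial R) :
    dP Φ D (algebraMap (Polynomial R) Φ p) = algebraMap (Polynomial R) Φ (dco (D.restrictScalars ℤ) p) :=
  fder_alg _ _

lemma algR (r : R) : al R Φ r = algebraMap (Polynomial R) Φ (Polynomial.C r) :=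
  rfl

variable (R Φ) in
lemma algR_inj : Function.Injective (al R Φ) := by
  intro a b h
  rw [algR, algR] at h
  exact Polynomial.C_injective (IsFractionRing.injective (Polynomial R) Φ h)

lemma dco_C {A : Type*} [CommRing A] (δ : Derivation ℤ A A) (a : A) :
    dco δ (Polynomial.C a) = Polynomial.C (δ a) := by
  rw [← Polynomial.monomial_zero_left, dco_monomial, Polynomial.monomial_zero_left]

lemma dP_alg (D : Derivation k R R) (r : R) : dP Φ D (al R Φ r) = al R Φ (D r) := by
  rw [algR, dP_poly, dco_C, algR]; rfl

lemma dP_sX (D : Derivation k R R) : dP Φ D (sX R Φ) = 0 := by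
  rw [sX, dP_poly, ← Polynomial.monomial_one_one_eq_X, dco_monomial]
  simp

variable (R Φ) in
/-- polynomials with constant coefficients -/
def kp : Polynomial k →+* Φ := (algebraMap (Polynomial R) Φ).comp (Polynomial.mapRingHom (algebraMap k R))

lemma kp_ne {p : Polynomial k} (hp : p ≠ 0) : kp R Φ p ≠ 0 := by
  have h1 : Function.Injective (kp (k := k) R Φ) := by
    refine (IsFractionRing.injective (Polynomial R) Φ).comp ?_
    exact Polynomial.map_injective _ (algebraMap k R).injective
  exact (map_ne_zero_iff _ h1).mpr hp

lemma dP_kp (D : Derivation k R R) (p : Polynomial k) : dP Φ D (kp R Φ p) = 0 := by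
  show dP Φ D (algebraMap _ _ (p.map (algebraMap k R))) = 0
  rw [dP_poly]
  convert map_zero (algebraMap (Polynomial R) Φ)
  ext i
  rw [coeff_dco, Polynomial.coeff_map]
  simp

variable (Φ) in
/-- connection -/
def nab (f : R) (D : Derivation k R R) : Φ →+ Φ :=
  (dP Φ D : Φ →+ Φ) + AddMonoidHom.mulLeft
    (sX R Φ * (al R Φ (D f) / al R Φ f))

lemma nab_def (f : R) (D : Derivation k R R) (g : Φ) : nab Φ f D g = dP Φ D g +
    sX R Φ * (al R Φ (D f) / al R Φ f) * g := rfl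

lemma nab_mul (f : R) (D : Derivation k R R) (a g : Φ) : nab Φ f D (a * g) = a * nab Φ f D g + dP Φ D a * g := by
  rw [nab_def, nab_def, Derivation.leibniz]
  simp only [smul_eq_mul]
  ring

variable (R) in
/-- shift of polynomials -/
def tauP : Polynomial R ≃+* Polynomial R := (Polynomial.algEquivAevalXAddC (-1 : R)).toRingEquiv

variable (R Φ) in
/-- shift -/
def tau : Φ ≃+* Φ := IsFractionRing.ringEquivOfRingEquiv (tauP R)

lemma tau_algP (p : Polynomial R) : tau R Φ (algebraMap _ _ p) = algebraMap _ _ (tauP R p) :=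
  IsFractionRing.ringEquivOfRingEquiv_algebraMap _ _

lemma tauP_C (r : R) : tauP R (Polynomial.C r) = Polynomial.C r := by
  simp [tauP]

lemma tauP_X : tauP R Polynomial.X = Polynomial.X - 1 := by
  simp [tauP, sub_eq_add_neg]

lemma tau_alg (r : R) : tau R Φ (al R Φ r) = al R Φ r := by
  rw [algR, tau_algP, tauP_C]

lemma tau_symm_alg (r : R) : (tau R Φ).symm (al R Φ r) = al R Φ r := by
  rw [RingEquiv.symm_apply_eq, tau_alg]

lemma tau_sX : tau R Φ (sX R Φ) = sX R Φ - 1 := by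
  rw [sX, tau_algP, tauP_X]; simp

lemma tau_symm_sX : (tau R Φ).symm (sX R Φ) = sX R Φ + 1 := by
  rw [RingEquiv.symm_apply_eq, map_add, tau_sX]; simp

lemma tau_kp (p : Polynomial k) : tau R Φ (kp R Φ p) = kp R Φ (tauP k p) := by
  have : ((tau R Φ : Φ →+* Φ)).comp (kp (k := k) R Φ) = (kp R Φ).comp (tauP k : Polynomial k →+* Polynomial k) := by
    apply Polynomial.ringHom_ext
    · intro a
      simp [kp, tau_algP, tauP_C]
    · simp [kp, tau_algP, tauP_X]
  exact congrArg (fun h : Polynomial k →+* Φ => h p) this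

lemma dP_tau (D : Derivation k R R) (g : Φ) : dP Φ D (tau R Φ g) = tau R Φ (dP Φ D g) := by
  have hX : ∀ g, dP Φ D ((tau R Φ : Φ →+* Φ) g) = (tau R Φ : Φ →+* Φ) (dP Φ D g) := by
    refine der_compat (B := Polynomial R) (tau R Φ : Φ →+* Φ) (dP Φ D) (dP Φ D) ?_
    intro p
    induction p using Polynomial.induction_on' with
    | add p q hp hq => simp only [map_add, hp, hq]
    | monomial n a =>
      rw [← Polynomial.C_mul_X_pow_eq_monomial, map_mul, map_pow, ← algR]
      change dP Φ D (tau R Φ (al R Φ a * (sX R Φ) ^ n)) = tau R Φ (dP Φ D (al R Φ a * (sX R Φ) ^ n))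
      rw [map_mul, map_pow, tau_alg, tau_sX, Derivation.leibniz, Derivation.leibniz,
        Derivation.leibniz_pow, Derivation.leibniz_pow]
      simp [dP_sX, dP_alg, tau_alg, tau_sX]
  exact hX g

/-- sigma -/
def sig (f : R) (g : Φ) : Φ := tau R Φ g / al R Φ f

/-- inverse of sigma -/
def sigI (f : R) (g : Φ) : Φ := al R Φ f * (tau R Φ).symm g

variable {f : R} (hf : f ≠ 0)

variable (Φ) in
lemma algR_ne {r : R} (hr : r ≠ 0) : al R Φ r ≠ 0 := by
  simpa using (map_ne_zero_iff _ (algR_inj R Φ)).mpr hr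

lemma sig_nab (hf : f ≠ 0) (D : Derivation k R R) (g : Φ) : sig f (nab Φ f D g) = nab Φ f D (sig f g) := by
  have h0 := algR_ne Φ hf
  have h1 : sig f g = (al R Φ f)⁻¹ * tau R Φ g := by rw [sig, div_eq_inv_mul]
  have h2 : dP Φ D (al R Φ f)⁻¹ = - (al R Φ (D f)) / (al R Φ f) ^ 2 := by
    have := congrArg (dP Φ D) (mul_inv_cancel₀ h0)
    rw [Derivation.leibniz, Derivation.map_one_eq_zero, dP_alg] at this
    simp only [smul_eq_mul] at this
    rw [eq_div_iff (pow_ne_zero 2 h0)]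
    have h3 := inv_mul_cancel₀ h0
    linear_combination (al R Φ f) * this - (al R Φ (D f)) * h3
  rw [h1, nab_mul, nab_def, sig, nab_def, dP_tau, h2]
  simp only [map_add, map_mul, map_div₀, tau_alg, tau_sX]
  field_simp
  ring

lemma sigI_sig (hf : f ≠ 0) (g : Φ) : sigI f (sig f g) = g := by
  have h0 := algR_ne Φ hf
  rw [sigI, sig, map_div₀, tau_symm_alg, RingEquiv.symm_apply_apply]
  field_simp

lemma sig_sigI (hf : f ≠ 0) (g : Φ) : sig f (sigI f g) = g := by
  have h0 := algR_ne Φ hf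
  rw [sigI, sig, map_mul, tau_alg, RingEquiv.apply_symm_apply]
  field_simp

lemma sigI_nab (hf : f ≠ 0) (D : Derivation k R R) (g : Φ) : sigI f (nab Φ f D g) = nab Φ f D (sigI f g) := by
  conv_lhs => rw [← sig_sigI hf g, ← sig_nab hf, sigI_sig hf]

lemma sig_mul (a g : Φ) : sig f (a * g) = tau R Φ a * sig f g := by
  rw [sig, sig, map_mul, mul_div_assoc]
lemma sigI_mul (a g : Φ) : sigI f (a * g) = (tau R Φ).symm a * sigI f g := by
  rw [sigI, sigI, map_mul]; ring
lemma sig_add (a g : Φ) : sig f (a + g) = sig f a + sig f g := by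
  rw [sig, map_add, add_div]; rfl
lemma sigI_add (a g : Φ) : sigI f (a + g) = sigI f a + sigI f g := by
  rw [sigI, map_add, mul_add]; rfl
lemma sig_zero : sig f (0 : Φ) = 0 := by simp [sig]
lemma sigI_zero : sigI f (0 : Φ) = 0 := by simp [sigI]
end setup
end
end LCF

namespace LCF
noncomputable section
set_option linter.unusedSectionVars false

section setup
variable {k R : Type*} [Field k] [CommRing R] [IsDomain R] [Algebra k R]
variable {Φ : Type*} [Field Φ] [Algebra (Polynomial R) Φ] [IsFractionRing (Polynomial R) Φ]

variable (k Φ) in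
/-- filtration of the module generated by `f^s` -/
def Yf (f : R) : ℕ → Submodule (Polynomial R) Φ
  | 0 => Submodule.span (Polynomial R) {1}
  | c + 1 => Submodule.span (Polynomial R) ((Yf f c : Set Φ) ∪ ⋃ D : Derivation k R R, nab Φ f D '' (Yf f c : Set Φ))

lemma Yf_mono (f : R) : Monotone (Yf k Φ f) :=
  monotone_nat_of_le_succ fun _ _ hg => Submodule.subset_span (Or.inl hg)

lemma one_mem_Yf (f : R) (c : ℕ) : (1 : Φ) ∈ Yf k Φ f c :=
  Yf_mono f (Nat.zero_le c) (Submodule.mem_span_singleton_self _)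

lemma nab_Yf (f : R) (D : Derivation k R R) (c : ℕ) {g : Φ} (hg : g ∈ Yf k Φ f c) :
    nab Φ f D g ∈ Yf k Φ f (c + 1) :=
  Submodule.subset_span (Or.inr (Set.mem_iUnion.mpr ⟨D, g, hg, rfl⟩))

lemma smul_nab (f : R) (D : Derivation k R R) (p : Polynomial R) (g : Φ) :
    nab Φ f D (p • g) = p • nab Φ f D g + dco (D.restrictScalars ℤ) p • g := by
  rw [Algebra.smul_def, nab_mul, dP_poly, Algebra.smul_def, Algebra.smul_def]

/-- induction principle for the filtration -/
lemma Yf_le (f : R) (Q : ℕ → AddSubgroup Φ) (h0 : ∀ p : Polynomial R, algebraMap _ Φ p ∈ Q 0)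
    (hm : ∀ c, Q c ≤ Q (c + 1)) (hs : ∀ c (p : Polynomial R), ∀ g ∈ Q c, p • g ∈ Q c)
    (hn : ∀ c (D : Derivation k R R), ∀ g ∈ Q c, nab Φ f D g ∈ Q (c + 1)) :
    ∀ c, ∀ g ∈ Yf k Φ f c, g ∈ Q c := by
  intro c
  induction c with
  | zero =>
    intro g hg
    obtain ⟨p, rfl⟩ := Submodule.mem_span_singleton.mp hg
    rw [Algebra.smul_def, mul_one]
    exact h0 p
  | succ c ih =>
    intro g hg
    rw [Yf] at hg
    induction hg using Submodule.span_induction with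
    | mem g hg =>
      rcases hg with hg | hg
      · exact hm c (ih g hg)
      · obtain ⟨D, g, hg', rfl⟩ := Set.mem_iUnion.mp hg
        exact hn c D g (ih g hg')
    | zero => exact zero_mem _
    | add x y _ _ hx hy => exact add_mem hx hy
    | smul p x _ hx => exact hs _ p x hx

variable (k Φ) in
/-- saturation by constant polynomials -/
def Y1 (f : R) (c : ℕ) : Submodule (Polynomial R) Φ where
  carrier := {g | ∃ p : Polynomial k, p ≠ 0 ∧ kp R Φ p * g ∈ Yf k Φ f c}
  zero_mem' := ⟨1, one_ne_zero, by simp⟩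
  add_mem' := by
    rintro g g' ⟨p, hp, h⟩ ⟨p', hp', h'⟩
    refine ⟨p * p', mul_ne_zero hp hp', ?_⟩
    have : kp R Φ (p * p') * (g + g') = (p'.map (algebraMap k R)) • (kp R Φ p * g) +
        (p.map (algebraMap k R)) • (kp R Φ p' * g') := by
      rw [Algebra.smul_def, Algebra.smul_def, map_mul]
      change _ = kp R Φ p' * _ + kp R Φ p * _
      ring
    rw [this]
    exact add_mem (Submodule.smul_mem _ _ h) (Submodule.smul_mem _ _ h')
  smul_mem' := by
    rintro q g ⟨p, hp, h⟩
    refine ⟨p, hp, ?_⟩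
    rw [mul_smul_comm]
    exact Submodule.smul_mem _ _ h

lemma mem_Y1 {f : R} {c : ℕ} {g : Φ} :
    g ∈ Y1 k Φ f c ↔ ∃ p : Polynomial k, p ≠ 0 ∧ kp R Φ p * g ∈ Yf k Φ f c := Iff.rfl

lemma Y1_mono (f : R) : Monotone (Y1 k Φ f) := fun _ _ h _ ⟨p, hp, h'⟩ => ⟨p, hp, Yf_mono f h h'⟩

lemma Yf_le_Y1 (f : R) (c : ℕ) : Yf k Φ f c ≤ Y1 k Φ f c := fun g hg => ⟨1, one_ne_zero, by simpa using hg⟩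

lemma Y1_sat (f : R) (c : ℕ) {p : Polynomial k} (hp : p ≠ 0) {g : Φ} (h : kp R Φ p * g ∈ Y1 k Φ f c) :
    g ∈ Y1 k Φ f c := by
  obtain ⟨q, hq, h⟩ := h
  exact ⟨q * p, mul_ne_zero hq hp, by rwa [map_mul, mul_assoc]⟩

lemma nab_kp (f : R) (D : Derivation k R R) (p : Polynomial k) (g : Φ) :
    nab Φ f D (kp R Φ p * g) = kp R Φ p * nab Φ f D g := by
  rw [nab_mul, dP_kp, zero_mul, add_zero]

lemma nab_Y1 (f : R) (D : Derivation k R R) (c : ℕ) {g : Φ} (hg : g ∈ Y1 k Φ f c) :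
    nab Φ f D g ∈ Y1 k Φ f (c + 1) := by
  obtain ⟨p, hp, h⟩ := hg
  exact ⟨p, hp, by rw [← nab_kp]; exact nab_Yf f D c h⟩

variable (k Φ) in
/-- union -/
def YY (f : R) : Submodule (Polynomial R) Φ := ⨆ c, Y1 k Φ f c

lemma mem_YY {f : R} {g : Φ} : g ∈ YY k Φ f ↔ ∃ c, g ∈ Y1 k Φ f c :=
  Submodule.mem_iSup_of_directed _ (Y1_mono f).directed_le

lemma one_mem_YY (f : R) : (1 : Φ) ∈ YY k Φ f := mem_YY.mpr ⟨0, Yf_le_Y1 _ _ (one_mem_Yf f 0)⟩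

lemma YY_sat (f : R) {p : Polynomial k} (hp : p ≠ 0) {g : Φ} (h : kp R Φ p * g ∈ YY k Φ f) :
    g ∈ YY k Φ f := by
  obtain ⟨c, hc⟩ := mem_YY.mp h
  exact mem_YY.mpr ⟨c, Y1_sat f c hp hc⟩

lemma nab_YY (f : R) (D : Derivation k R R) {g : Φ} (hg : g ∈ YY k Φ f) : nab Φ f D g ∈ YY k Φ f := by
  obtain ⟨c, hc⟩ := mem_YY.mp hg
  exact mem_YY.mpr ⟨_, nab_Y1 f D c hc⟩

lemma tauP_ne {p : Polynomial k} (hp : p ≠ 0) : tauP k p ≠ 0 := by simpa using hp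

lemma tau_symm_algP (p : Polynomial R) : (tau R Φ).symm (algebraMap _ _ p) = algebraMap _ _ ((tauP R).symm p) := by
  rw [RingEquiv.symm_apply_eq, tau_algP, RingEquiv.apply_symm_apply]

lemma tau_symm_kp (p : Polynomial k) : (tau R Φ).symm (kp R Φ p) = kp R Φ ((tauP k).symm p) := by
  rw [RingEquiv.symm_apply_eq, tau_kp, RingEquiv.apply_symm_apply]

variable (Φ) in
/-- additive sigma -/
def sigA (f : R) : Φ →+ Φ := AddMonoidHom.mk' (sig f) fun _ _ => sig_add _ _
variable (Φ) in
/-- additive sigma inverse -/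
def sigIA (f : R) : Φ →+ Φ := AddMonoidHom.mk' (sigI f) fun _ _ => sigI_add _ _

lemma sigI_Yf {f : R} (hf : f ≠ 0) : ∀ c, ∀ g ∈ Yf k Φ f c, sigI f g ∈ Yf k Φ f c := by
  refine Yf_le (k := k) f (fun c => (Yf k Φ f c).toAddSubgroup.comap (sigIA Φ f)) ?_ ?_ ?_ ?_
  · intro p
    show sigI f _ ∈ Yf k Φ f 0
    rw [sigI, tau_symm_algP]
    refine Submodule.mem_span_singleton.mpr ⟨Polynomial.C f * (tauP R).symm p, ?_⟩
    rw [Algebra.smul_def, mul_one, map_mul]; rfl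
  · intro c g hg
    exact Yf_mono f (Nat.le_succ c) hg
  · intro c p g hg
    show sigI f _ ∈ Yf k Φ f c
    rw [Algebra.smul_def, sigI_mul, tau_symm_algP, ← Algebra.smul_def]
    exact Submodule.smul_mem _ _ hg
  · intro c D g hg
    show sigI f _ ∈ Yf k Φ f (c + 1)
    rw [sigI_nab hf]
    exact nab_Yf f D c hg

lemma sigI_YY {f : R} (hf : f ≠ 0) {g : Φ} (hg : g ∈ YY k Φ f) : sigI f g ∈ YY k Φ f := by
  obtain ⟨c, p, hp, h⟩ := mem_YY.mp hg
  refine mem_YY.mpr ⟨c, (tauP k).symm p, by simpa using hp, ?_⟩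
  rw [← tau_symm_kp, ← sigI_mul]
  exact sigI_Yf hf c _ h

variable (k Φ) in
/-- obstruction ideal, filtered -/
def bA1 (f : R) (c : ℕ) : Ideal R where
  carrier := {a | al R Φ a / al R Φ f ∈ Y1 k Φ f c}
  zero_mem' := by simp
  add_mem' := by
    intro a b ha hb
    simp only [Set.mem_setOf_eq, map_add, add_div] at *
    exact add_mem ha hb
  smul_mem' := by
    intro r a ha
    simp only [Set.mem_setOf_eq, smul_eq_mul, map_mul, mul_div_assoc] at *
    exact Submodule.smul_mem _ (Polynomial.C r) ha |> fun h => by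
      rwa [Algebra.smul_def] at h

variable (k Φ) in
/-- obstruction ideal -/
def bA (f : R) : Ideal R := ⨆ c, bA1 k Φ f c

lemma bA1_mono (f : R) : Monotone (bA1 k Φ f) := fun _ _ h _ ha => Y1_mono f h ha

lemma mem_bA {f : R} {a : R} : a ∈ bA k Φ f ↔ al R Φ a / al R Φ f ∈ YY k Φ f := by
  rw [mem_YY]
  exact Submodule.mem_iSup_of_directed _ (bA1_mono f).directed_le

lemma exists_bA1 [IsNoetherianRing R] (f : R) : ∃ c, bA k Φ f = bA1 k Φ f c := by
  obtain ⟨n, hn⟩ := monotone_stabilizes_iff_noetherian.mpr ‹IsNoetherianRing R› ⟨bA1 k Φ f, bA1_mono f⟩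
  refine ⟨n, le_antisymm (iSup_le fun c => ?_) (le_iSup _ n)⟩
  rcases le_total c n with h | h
  · exact bA1_mono f h
  · exact (hn c h).ge

lemma der_pow (D : Derivation k R R) (A : Ideal R) (N : ℕ) {a : R} (ha : a ∈ A ^ (N + 1)) : D a ∈ A ^ N := by
  induction N generalizing a with
  | zero => simp
  | succ N ih =>
    rw [pow_succ] at ha
    refine Submodule.mul_induction_on ha ?_ ?_
    · intro x hx y hy
      rw [D.leibniz]
      simp only [smul_eq_mul]
      refine add_mem (Ideal.mul_mem_right _ _ hx) ?_
      rw [pow_succ, mul_comm y]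
      exact Ideal.mul_mem_mul (ih hx) hy
    · intro x y hx hy
      rw [map_add]; exact add_mem hx hy

variable (k Φ) in
/-- auxiliary torsion-type module -/
def TT (f : R) (N : ℕ) : Submodule (Polynomial R) Φ where
  carrier := {g | ∀ a ∈ bA k Φ f ^ N, al R Φ a * g ∈ YY k Φ f}
  zero_mem' := by intro a _; simp
  add_mem' := by
    intro g g' h h' a ha
    rw [mul_add]; exact add_mem (h a ha) (h' a ha)
  smul_mem' := by
    intro p g h a ha
    rw [mul_smul_comm]; exact Submodule.smul_mem _ _ (h a ha)

lemma TT_mono (f : R) : Monotone (TT k Φ f) := fun _ _ h _ hg a ha => hg a (Ideal.pow_le_pow_right h ha)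

lemma nab_TT (f : R) (D : Derivation k R R) (N : ℕ) {g : Φ} (hg : g ∈ TT k Φ f N) :
    nab Φ f D g ∈ TT k Φ f (N + 1) := by
  intro a ha
  have h1 := nab_mul f D (al R Φ a) g
  rw [dP_alg] at h1
  rw [eq_sub_of_add_eq h1.symm]
  exact sub_mem (nab_YY f D (hg a (Ideal.pow_le_pow_right (Nat.le_succ N) ha))) (hg _ (der_pow D _ N ha))

/-- iterated sigma of one -/
lemma sig_iter (f : R) (j : ℕ) (g : Φ) : (sig f)^[j] g = ((tau R Φ : Φ → Φ)^[j] g) / al R Φ f ^ j := by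
  induction j with
  | zero => simp
  | succ j ih =>
    rw [Function.iterate_succ_apply', ih, sig, map_div₀, map_pow, tau_alg, Function.iterate_succ_apply', pow_succ,
      div_div]

lemma tau_iter_kp (j : ℕ) (p : Polynomial k) : ∃ q : Polynomial k, (p ≠ 0 → q ≠ 0) ∧
    (tau R Φ : Φ → Φ)^[j] (kp R Φ p) = kp R Φ q := by
  induction j with
  | zero => exact ⟨p, id, rfl⟩
  | succ j ih =>
    obtain ⟨q, hq, h⟩ := ih
    refine ⟨tauP k q, fun hp => tauP_ne (hq hp), ?_⟩
    rw [Function.iterate_succ_apply', h, tau_kp]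

lemma tau_iter_mul (j : ℕ) (a b : Φ) : (tau R Φ : Φ → Φ)^[j] (a * b) =
    (tau R Φ : Φ → Φ)^[j] a * (tau R Φ : Φ → Φ)^[j] b := by
  induction j with
  | zero => rfl
  | succ j ih => simp only [Function.iterate_succ_apply', ih, map_mul]

lemma tau_iter_al (j : ℕ) (r : R) : (tau R Φ : Φ → Φ)^[j] (al R Φ r) = al R Φ r := by
  induction j with
  | zero => rfl
  | succ j ih => rw [Function.iterate_succ_apply', ih, tau_alg]

lemma tau_iter_inv (j : ℕ) (r : Φ) : (tau R Φ : Φ → Φ)^[j] r⁻¹ = ((tau R Φ : Φ → Φ)^[j] r)⁻¹ := by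
  induction j with
  | zero => rfl
  | succ j ih => simp only [Function.iterate_succ_apply', ih, map_inv₀]

lemma tau_iter_algP (j : ℕ) (p : Polynomial R) : ∃ q : Polynomial R,
    (tau R Φ : Φ → Φ)^[j] (algebraMap _ _ p) = algebraMap _ _ q := by
  induction j with
  | zero => exact ⟨p, rfl⟩
  | succ j ih =>
    obtain ⟨q, h⟩ := ih
    exact ⟨tauP R q, by rw [Function.iterate_succ_apply', h, tau_algP]⟩

lemma sig_iter_nab {f : R} (hf : f ≠ 0) (D : Derivation k R R) (j : ℕ) (g : Φ) :
    (sig f)^[j] (nab Φ f D g) = nab Φ f D ((sig f)^[j] g) := by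
  induction j with
  | zero => rfl
  | succ j ih => rw [Function.iterate_succ_apply', ih, Function.iterate_succ_apply', sig_nab hf]

lemma sig_iter_smul (f : R) (j : ℕ) (p : Polynomial R) (g : Φ) : ∃ q : Polynomial R,
    (sig f)^[j] (p • g) = q • (sig f)^[j] g := by
  obtain ⟨q, hq⟩ := tau_iter_algP (Φ := Φ) j p
  refine ⟨q, ?_⟩
  rw [sig_iter, sig_iter, Algebra.smul_def, tau_iter_mul, hq, Algebra.smul_def, mul_div_assoc]

lemma sig_iter_add (f : R) (j : ℕ) (g g' : Φ) : (sig f)^[j] (g + g') = (sig f)^[j] g + (sig f)^[j] g' := by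
  induction j with
  | zero => rfl
  | succ j ih => simp only [Function.iterate_succ_apply', ih, sig_add]

theorem pow_mem_TT [IsNoetherianRing R] {f : R} (hf : f ≠ 0) :
    ∃ c, ∀ j, (1 : Φ) / al R Φ f ^ j ∈ TT k Φ f (c * j) := by
  obtain ⟨c, hc⟩ := exists_bA1 (k := k) (Φ := Φ) f
  refine ⟨c + 1, fun j => ?_⟩
  induction j with
  | zero =>
    intro a _
    simp only [pow_zero, div_one, mul_one]
    have := Submodule.smul_mem _ (Polynomial.C a) (one_mem_YY (k := k) (Φ := Φ) f)
    rwa [Algebra.smul_def, mul_one] at this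
  | succ j ih =>
    set N := (c + 1) * j with hN
    have key : ∀ c, ∀ g ∈ Yf k Φ f c, (sig f)^[j] g ∈ TT k Φ f (N + c) := by
      refine Yf_le (k := k) f (fun c => (TT k Φ f (N + c)).toAddSubgroup.comap
        (AddMonoidHom.mk' ((sig f)^[j]) (sig_iter_add f j))) ?_ ?_ ?_ ?_
      · intro p
        show (sig f)^[j] _ ∈ TT k Φ f N
        obtain ⟨q, hq⟩ := sig_iter_smul (Φ := Φ) f j p 1
        rw [Algebra.smul_def, mul_one] at hq
        rw [hq]
        refine Submodule.smul_mem _ _ ?_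
        rw [sig_iter]
        have : (tau R Φ : Φ → Φ)^[j] 1 = 1 := by
          simpa using tau_iter_al (Φ := Φ) j (1 : R)
        rwa [this]
      · intro c g hg
        exact TT_mono f (by omega) hg
      · intro c p g hg
        show (sig f)^[j] _ ∈ TT k Φ f (N + c)
        obtain ⟨q, hq⟩ := sig_iter_smul (Φ := Φ) f j p g
        rw [hq]
        exact Submodule.smul_mem _ _ hg
      · intro c D g hg
        show (sig f)^[j] _ ∈ TT k Φ f (N + (c + 1))
        rw [sig_iter_nab hf]
        exact nab_TT f D _ hg
    have h2 : ∀ a ∈ bA k Φ f, al R Φ a / al R Φ f ^ (j + 1) ∈ TT k Φ f (N + c) := by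
      intro a ha
      rw [hc] at ha
      obtain ⟨p, hp, h⟩ := ha
      have h3 := key c _ h
      obtain ⟨q, hq, h4⟩ := tau_iter_kp (R := R) (Φ := Φ) j p
      rw [sig_iter, tau_iter_mul, h4, div_eq_mul_inv (al R Φ a), tau_iter_mul, tau_iter_al, tau_iter_inv, tau_iter_al] at h3
      have h5 : kp R Φ q * (al R Φ a * (al R Φ f)⁻¹) / al R Φ f ^ j = kp R Φ q * (al R Φ a / al R Φ f ^ (j + 1)) := by
        rw [pow_succ, mul_div_assoc, ← div_eq_mul_inv, div_div, mul_comm (al R Φ f)]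
      rw [h5] at h3
      intro b hb
      have h6 := h3 b hb
      rw [mul_left_comm] at h6
      exact YY_sat f (hq hp) h6
    intro a ha
    have e : (c + 1) * (j + 1) = (N + c) + 1 := by rw [hN]; ring
    rw [e, pow_succ] at ha
    refine Submodule.mul_induction_on ha ?_ ?_
    · intro x hx y hy
      have := h2 y hy x hx
      rwa [mul_div_assoc', ← map_mul, div_eq_mul_one_div] at this
    · intro x y hx hy
      rw [map_add, add_mul]; exact add_mem hx hy
end setup
end
end LCF

namespace LCF
noncomputable section
set_option linter.unusedSectionVars false

section comm
variable {k R : Type*} [Field k] [CommRing R] [IsDomain R] [Algebra k R]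
variable {Φ : Type*} [Field Φ] [Algebra (Polynomial R) Φ] [IsFractionRing (Polynomial R) Φ]

lemma dP_comm (D D' : Derivation k R R) (h : ∀ r, D (D' r) = D' (D r)) (g : Φ) :
    dP Φ D (dP Φ D' g) = dP Φ D' (dP Φ D g) := by
  have : ⁅dP Φ D, dP Φ D'⁆ = 0 := by
    refine der_ext (B := Polynomial R) _ _ ?_
    intro p
    rw [Derivation.commutator_apply, dP_poly, dP_poly, dP_poly, dP_poly, Derivation.zero_apply, sub_eq_zero]
    congr 1
    ext i
    simp only [coeff_dco]
    exact h _
  have h2 := congrArg (fun E : Derivation ℤ Φ Φ => E g) this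
  simp only [Derivation.commutator_apply, Derivation.zero_apply, sub_eq_zero] at h2
  exact h2

lemma nab_comm {f : R} (hf : f ≠ 0) (D D' : Derivation k R R) (h : ∀ r, D (D' r) = D' (D r)) (g : Φ) :
    nab Φ f D (nab Φ f D' g) = nab Φ f D' (nab Φ f D g) := by
  have h0 := algR_ne Φ hf
  have hd : ∀ (D D' : Derivation k R R), dP Φ D (al R Φ (D' f) / al R Φ f) = al R Φ (D (D' f)) / al R Φ f -
      al R Φ (D' f) * al R Φ (D f) / al R Φ f ^ 2 := by
    intro D D'
    have h1 : al R Φ f * (al R Φ (D' f) / al R Φ f) = al R Φ (D' f) := by field_simp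
    have := congrArg (dP Φ D) h1
    rw [Derivation.leibniz, dP_alg, dP_alg] at this
    simp only [smul_eq_mul] at this
    have h2 := eq_sub_of_add_eq this
    rw [← mul_right_inj' h0, h2]
    field_simp
  simp only [nab_def, map_add, Derivation.leibniz, smul_eq_mul, dP_sX, hd, dP_comm D D' h, h]
  ring
end comm

section hol
variable {k R : Type*} [Field k] [CommRing R] [IsDomain R] [Algebra k R]
variable {Φ : Type*} [Field Φ] [Algebra (Polynomial R) Φ] [IsFractionRing (Polynomial R) Φ]
variable {S K : Type*} [CommRing S] [IsDomain S] [Algebra k S] [Field K] [Algebra S K] [IsFractionRing S K]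
variable [Algebra K Φ] (ρ : S →ₐ[k] R) (hρ : Function.Injective ρ)
variable (hK : ∀ s, algebraMap K Φ (algebraMap S K s) = al R Φ (ρ s))

variable (k Φ) in
/-- saturated submodule over the small field -/
def SY (f : R) : Submodule K Φ where
  carrier := {g | ∃ s : S, s ≠ 0 ∧ al R Φ (ρ s) * g ∈ YY k Φ f}
  zero_mem' := ⟨1, one_ne_zero, by simp⟩
  add_mem' := by
    rintro g g' ⟨s, hs, h⟩ ⟨s', hs', h'⟩
    refine ⟨s * s', mul_ne_zero hs hs', ?_⟩
    have : al R Φ (ρ (s * s')) * (g + g') = Polynomial.C (ρ s') • (al R Φ (ρ s) * g) +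
        Polynomial.C (ρ s) • (al R Φ (ρ s') * g') := by
      rw [Algebra.smul_def, Algebra.smul_def, map_mul, map_mul]
      change _ = al R Φ (ρ s') * _ + al R Φ (ρ s) * _
      ring
    rw [this]
    exact add_mem (Submodule.smul_mem _ _ h) (Submodule.smul_mem _ _ h')
  smul_mem' := by
    rintro κ g ⟨s, hs, h⟩
    obtain ⟨a, b, hb, rfl⟩ := IsFractionRing.div_surjective (A := S) κ
    have hb0 : algebraMap S K b ≠ 0 := by
      simpa using nonZeroDivisors.ne_zero hb
    have hb1 : algebraMap K Φ (algebraMap S K b) ≠ 0 := by simpa using hb0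
    refine ⟨s * b, mul_ne_zero hs (nonZeroDivisors.ne_zero hb), ?_⟩
    have : al R Φ (ρ (s * b)) * ((algebraMap S K a / algebraMap S K b) • g) =
        Polynomial.C (ρ a) • (al R Φ (ρ s) * g) := by
      rw [Algebra.smul_def, Algebra.smul_def, map_div₀, map_mul, map_mul, ← hK b, hK a]
      change _ = al R Φ (ρ a) * _
      field_simp
    rw [this]
    exact Submodule.smul_mem _ _ h

lemma YY_le_SY (f : R) {g : Φ} (h : g ∈ YY k Φ f) : g ∈ SY k Φ ρ hK f := ⟨1, one_ne_zero, by simpa using h⟩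

lemma SY_smulP (f : R) (p : Polynomial R) {g : Φ} (h : g ∈ SY k Φ ρ hK f) :
    algebraMap _ Φ p * g ∈ SY k Φ ρ hK f := by
  obtain ⟨s, hs, h⟩ := h
  refine ⟨s, hs, ?_⟩
  rw [mul_left_comm, ← Algebra.smul_def]
  exact Submodule.smul_mem _ _ h

lemma SY_nab (f : R) (D : Derivation k R R) (d : Derivation k S S) (hd : ∀ s, D (ρ s) = ρ (d s))
    {g : Φ} (h : g ∈ SY k Φ ρ hK f) : nab Φ f D g ∈ SY k Φ ρ hK f := by
  obtain ⟨s, hs, h⟩ := h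
  refine ⟨s * s, mul_ne_zero hs hs, ?_⟩
  have h1 := nab_mul f D (al R Φ (ρ s)) g
  rw [dP_alg, hd] at h1
  have : al R Φ (ρ (s * s)) * nab Φ f D g = Polynomial.C (ρ s) • nab Φ f D (al R Φ (ρ s) * g) -
      Polynomial.C (ρ (d s)) • (al R Φ (ρ s) * g) := by
    rw [Algebra.smul_def, Algebra.smul_def]
    change _ = al R Φ (ρ s) * _ - al R Φ (ρ (d s)) * _
    rw [h1, map_mul, map_mul]
    ring
  rw [this]
  exact sub_mem (Submodule.smul_mem _ _ (nab_YY f D h)) (Submodule.smul_mem _ _ h)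

lemma SY_sigI {f : R} (hf : f ≠ 0) {g : Φ} (h : g ∈ SY k Φ ρ hK f) : sigI f g ∈ SY k Φ ρ hK f := by
  obtain ⟨s, hs, h⟩ := h
  refine ⟨s, hs, ?_⟩
  have := sigI_YY hf h
  rwa [sigI_mul, tau_symm_alg] at this

end hol
end
end LCF

namespace LCF
noncomputable section
set_option linter.unusedSectionVars false

section hol
variable {k R : Type*} [Field k] [CommRing R] [IsDomain R] [Algebra k R]
variable {Φ : Type*} [Field Φ] [Algebra (Polynomial R) Φ] [IsFractionRing (Polynomial R) Φ]
variable {S K : Type*} [CommRing S] [IsDomain S] [Algebra k S] [Field K] [Algebra S K] [IsFractionRing S K]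
variable [Algebra K Φ] (ρ : S →ₐ[k] R)
variable (hK : ∀ s, algebraMap K Φ (algebraMap S K s) = al R Φ (ρ s))

variable (K) in
/-- derivation of the small field -/
def dK (d : Derivation k S S) : Derivation ℤ K K := fder K (d.restrictScalars ℤ)

lemma dK_alg (d : Derivation k S S) (s : S) : dK K d (algebraMap S K s) = algebraMap S K (d s) := fder_alg _ _

lemma dP_K {ρ : S →ₐ[k] R} (hK : ∀ s, algebraMap K Φ (algebraMap S K s) = al R Φ (ρ s))
    (D : Derivation k R R) (d : Derivation k S S) (hd : ∀ s, D (ρ s) = ρ (d s)) (κ : K) :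
    dP Φ D (algebraMap K Φ κ) = algebraMap K Φ (dK K d κ) := by
  refine der_compat (B := S) (algebraMap K Φ) (dK K d) (dP Φ D) ?_ κ
  intro s
  rw [hK, dP_alg, dK_alg, hK, hd]

lemma dK_zero (κ : K) : dK K (0 : Derivation k S S) κ = 0 := by
  have : dK K (0 : Derivation k S S) = 0 := der_ext (B := S) _ _ fun s => by rw [dK_alg]; simp
  rw [this]; rfl

lemma nab_smulK {ρ : S →ₐ[k] R} (hK : ∀ s, algebraMap K Φ (algebraMap S K s) = al R Φ (ρ s)) (f : R)
    (D : Derivation k R R) (d : Derivation k S S) (hd : ∀ s, D (ρ s) = ρ (d s)) (κ : K) (g : Φ) :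
    nab Φ f D (κ • g) = κ • nab Φ f D g + dK K d κ • g := by
  rw [Algebra.smul_def, nab_mul, dP_K hK D d hd, Algebra.smul_def, Algebra.smul_def]

lemma tau_K {ρ : S →ₐ[k] R} (hK : ∀ s, algebraMap K Φ (algebraMap S K s) = al R Φ (ρ s)) (κ : K) :
    tau R Φ (algebraMap K Φ κ) = algebraMap K Φ κ := by
  obtain ⟨a, b, hb, rfl⟩ := IsFractionRing.div_surjective (A := S) κ
  rw [map_div₀, map_div₀, hK, hK, tau_alg, tau_alg]

/-- sigma as a linear equivalence -/
def sigE {ρ : S →ₐ[k] R} (hK : ∀ s, algebraMap K Φ (algebraMap S K s) = al R Φ (ρ s)) {f : R} (hf : f ≠ 0) :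
    Φ ≃ₗ[K] Φ where
  toFun := sig f
  invFun := sigI f
  map_add' := sig_add
  map_smul' κ g := by rw [Algebra.smul_def, sig_mul, tau_K hK, ← Algebra.smul_def]; rfl
  left_inv := sigI_sig hf
  right_inv := sig_sigI hf

variable (K Φ) in
/-- pole and degree bounded elements -/
def EE (f : R) (M d : ℕ) : Submodule K Φ :=
  Submodule.span K {g | ∃ p : Polynomial R, p.natDegree ≤ d ∧ g = algebraMap _ Φ p / al R Φ f ^ M}

lemma EE_mono {f : R} (hf : f ≠ 0) {M M' d d' : ℕ} (hM : M ≤ M') (hd : d ≤ d') : EE Φ K f M d ≤ EE Φ K f M' d' := by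
  have h0 := algR_ne Φ hf
  refine Submodule.span_mono ?_
  rintro g ⟨p, hp, rfl⟩
  refine ⟨Polynomial.C (f ^ (M' - M)) * p, (Polynomial.natDegree_C_mul_le _ _).trans (hp.trans hd), ?_⟩
  rw [map_mul, ← algR, map_pow, div_eq_div_iff (pow_ne_zero _ h0) (pow_ne_zero _ h0)]
  obtain ⟨t, rfl⟩ := Nat.exists_eq_add_of_le hM
  rw [Nat.add_sub_cancel_left, pow_add]
  ring

lemma EE_lin {f : R} {M M' d d' : ℕ} (T : Module.End K Φ)
    (h : ∀ p : Polynomial R, p.natDegree ≤ d → T (algebraMap _ Φ p / al R Φ f ^ M) ∈ EE Φ K f M' d') :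
    ∀ g ∈ EE Φ K f M d, T g ∈ EE Φ K f M' d' := by
  intro g hg
  have : EE Φ K f M d ≤ (EE Φ K f M' d').comap T := by
    refine Submodule.span_le.mpr ?_
    rintro g ⟨p, hp, rfl⟩
    exact h p hp
  exact this hg

lemma nab_gen {f : R} (hf : f ≠ 0) (D : Derivation k R R) (M d : ℕ) (p : Polynomial R) (hp : p.natDegree ≤ d) :
    nab Φ f D (algebraMap _ Φ p / al R Φ f ^ M) ∈ EE Φ K f (M + 1) (d + 1) := by
  have h0 := algR_ne Φ hf
  refine Submodule.subset_span ⟨Polynomial.C f * dco (D.restrictScalars ℤ) p - Polynomial.C (M * D f) * p +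
    Polynomial.C (D f) * (Polynomial.X * p), ?_, ?_⟩
  · refine (Polynomial.natDegree_add_le _ _).trans (max_le ((Polynomial.natDegree_sub_le _ _).trans (max_le ?_ ?_)) ?_)
    · refine (Polynomial.natDegree_C_mul_le _ _).trans ?_
      refine (Polynomial.natDegree_le_iff_coeff_eq_zero.mpr ?_)
      intro N hN
      rw [coeff_dco, Polynomial.coeff_eq_zero_of_natDegree_lt (by omega)]
      simp
    · exact (Polynomial.natDegree_C_mul_le _ _).trans (by omega)
    · refine (Polynomial.natDegree_C_mul_le _ _).trans (Polynomial.natDegree_mul_le.trans ?_)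
      have := Polynomial.natDegree_X_le (R := R)
      omega
  · have h1 : al R Φ f ^ M * (algebraMap _ Φ p / al R Φ f ^ M) = algebraMap _ Φ p := by
      field_simp
    have h2 := congrArg (dP Φ D) h1
    rw [Derivation.leibniz, dP_poly, Derivation.leibniz_pow, dP_alg] at h2
    simp only [smul_eq_mul, nsmul_eq_mul] at h2
    have hX : algebraMap (Polynomial R) Φ Polynomial.X = sX R Φ := rfl
    have hC : ∀ r, algebraMap (Polynomial R) Φ (Polynomial.C r) = al R Φ r := fun r => rfl
    simp only [nab_def, map_add, map_sub, map_mul, ← h2, hC, hX, map_natCast]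
    rcases M with _ | M
    · simp
      field_simp
    · simp only [Nat.add_sub_cancel]
      field_simp
      ring

lemma nab_EE {ρ : S →ₐ[k] R} (hK : ∀ s, algebraMap K Φ (algebraMap S K s) = al R Φ (ρ s)) {f : R} (hf : f ≠ 0)
    (D : Derivation k R R) (d : Derivation k S S) (hd : ∀ s, D (ρ s) = ρ (d s)) (M j : ℕ) :
    ∀ u ∈ EE Φ K f M j, nab Φ f D u ∈ EE Φ K f (M + 1) (j + 1) := by
  intro u hu
  have h0 : EE Φ K f M j ≤ EE Φ K f (M + 1) (j + 1) := EE_mono hf (by omega) (by omega)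
  have key : ∀ v ∈ EE Φ K f M j, nab Φ f D v ∈ EE Φ K f (M + 1) (j + 1) := by
    intro v hv
    refine Submodule.span_induction (p := fun v _ => nab Φ f D v ∈ EE Φ K f (M + 1) (j + 1)) ?_ ?_ ?_ ?_ hv
    · rintro g ⟨p, hp, rfl⟩
      exact nab_gen hf D M j p hp
    · rw [map_zero]; exact zero_mem _
    · intro x y _ _ hx hy
      rw [map_add]; exact add_mem hx hy
    · intro κ x hx' hx
      rw [nab_smulK hK f D d hd]
      exact add_mem (Submodule.smul_mem _ _ hx) (Submodule.smul_mem _ _ (h0 hx'))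
  exact key u hu

lemma tauP_deg (p : Polynomial R) : (tauP R p).natDegree ≤ p.natDegree := by
  show (Polynomial.aeval (Polynomial.X + Polynomial.C (-1)) p : Polynomial R).natDegree ≤ _
  rw [← Polynomial.comp_eq_aeval]
  refine Polynomial.natDegree_comp_le.trans ?_
  have : (Polynomial.X + Polynomial.C (-1) : Polynomial R).natDegree ≤ 1 := by
    exact (Polynomial.natDegree_X_add_C (R := R) (-1)).le
  nlinarith

set_option maxHeartbeats 1000000 in
/-- The holonomic step. -/
theorem hol_step (hK : ∀ s, algebraMap K Φ (algebraMap S K s) = al R Φ (ρ s)) [IsNoetherianRing R] [CharZero K] {f : R} (hf : f ≠ 0) {h : ℕ} {τ : Type*}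
    (Da : τ → Derivation k R R) (da : τ → Derivation k S S) (hda : ∀ i s, Da i (ρ s) = ρ (da i s))
    (Db : Fin h → Derivation k R R) (hdb : ∀ l s, Db l (ρ s) = 0)
    (hDb : ∀ l l' r, Db l (Db l' r) = Db l' (Db l r)) (x : Fin h → R) (hx : ∀ l, Db l (x l) = 1)
    (hx' : ∀ l l', l ≠ l' → Db l (x l') = 0) (N0 : ℕ)
    (hfin : ∀ (N : ℕ) (r : R), ∃ s : (Fin h → Fin (N0 * N)) → S,
      r - ∑ b, ρ (s b) * ∏ l, x l ^ (b l : ℕ) ∈ bA k Φ f ^ N)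
    (hconst : ∀ κ : K, (∀ i, dK K (da i) κ = 0) → ∃ a : k, κ = algebraMap S K (algebraMap k S a)) :
    ∃ s : S, s ≠ 0 ∧ ρ s ∈ bA k Φ f := by
  classical
  have h0 := algR_ne Φ hf
  have hdb' : ∀ l s, Db l (ρ s) = ρ ((0 : Derivation k S S) s) := fun l s => by rw [hdb]; simp
  set Xo : Fin h → Module.End K Φ := fun l => LinearMap.mulLeft K (al R Φ (x l)) with hXo
  set so : Module.End K Φ := LinearMap.mulLeft K (sX R Φ) with hso
  set Δ : Fin h → Module.End K Φ := fun l =>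
    { toFun := nab Φ f (Db l)
      map_add' := map_add _
      map_smul' := fun κ g => by
        rw [nab_smulK hK f (Db l) 0 (hdb' l), dK_zero, zero_smul, add_zero]; rfl } with hΔ
  have hΔa : ∀ l g, Δ l g = nab Φ f (Db l) g := fun l g => rfl
  set N : τ → Φ →+ Φ := fun i => nab Φ f (Da i) with hN
  have hO : WeylOps h Xo Δ so := by
    refine ⟨?_, ?_, ?_, ?_, ?_, ?_⟩
    · intro l l'
      ext g
      simp [hXo, mul_left_comm]
    · intro l l'
      ext g
      exact nab_comm hf _ _ (hDb l l') g
    · intro l l' hl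
      ext g
      show nab Φ f (Db l) (al R Φ (x l') * g) = al R Φ (x l') * nab Φ f (Db l) g
      rw [nab_mul, dP_alg, hx' l l' hl]; simp
    · intro l
      ext g
      show nab Φ f (Db l) (al R Φ (x l) * g) - al R Φ (x l) * nab Φ f (Db l) g = g
      rw [nab_mul, dP_alg, hx]; simp
    · intro l
      ext g
      simp [hXo, hso, mul_left_comm]
    · intro l
      ext g
      show sX R Φ * nab Φ f (Db l) g = nab Φ f (Db l) (sX R Φ * g)
      rw [nab_mul, dP_sX]; simp
  set B : Submodule K Φ := SY k Φ ρ hK f with hB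
  set σ : Φ ≃ₗ[K] Φ := sigE hK hf with hσ
  have hσa : ∀ g, σ g = sig f g := fun g => rfl
  obtain ⟨c0, hc0⟩ := pow_mem_TT (k := k) (Φ := Φ) hf
  have hBs : ∀ w ∈ B, so w ∈ B := fun w hw => SY_smulP ρ hK f Polynomial.X hw
  have hBX : ∀ l, ∀ w ∈ B, Xo l w ∈ B := fun l w hw => SY_smulP ρ hK f (Polynomial.C (x l)) hw
  have hBD : ∀ l, ∀ w ∈ B, Δ l w ∈ B := fun l w hw => SY_nab ρ hK f (Db l) 0 (hdb' l) hw
  have hBN : ∀ i, ∀ w ∈ B, N i w ∈ B := fun i w hw => SY_nab ρ hK f (Da i) (da i) (hda i) hw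
  have hBσ : ∀ w, w ∈ B.map σ.toLinearMap ↔ sigI f w ∈ B := by
    intro w
    constructor
    · rintro ⟨u, hu, rfl⟩
      have : sigI f (σ u) = u := sigI_sig hf u
      exact this.symm ▸ hu
    · intro hw
      exact ⟨_, hw, sig_sigI hf w⟩
  -- generation bound
  have hgen : ∀ j, genT Xo Δ so N ((1 : Φ) / al R Φ f) j ≤ EE Φ K f (1 + j) j := by
    intro j
    induction j with
    | zero =>
      rw [genT, Submodule.span_singleton_le_iff_mem]
      exact Submodule.subset_span ⟨1, by simp, by simp⟩
    | succ j ih =>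
      refine genT_le _ _ _ (ih.trans (EE_mono hf (by omega) (by omega))) ?_ ?_ ?_ ?_
      · intro u hu
        refine EE_mono hf (Nat.le_succ _) le_rfl (EE_lin (M := 1 + j) (d := j) so ?_ u (ih hu))
        intro p hp
        refine Submodule.subset_span ⟨Polynomial.X * p, ?_, ?_⟩
        · refine Polynomial.natDegree_mul_le.trans ?_
          have := Polynomial.natDegree_X_le (R := R)
          omega
        · rw [map_mul, mul_div_assoc]; rfl
      · intro l u hu
        refine EE_mono hf (Nat.le_succ _) (Nat.le_succ _) (EE_lin (M := 1 + j) (d := j) (Xo l) ?_ u (ih hu))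
        intro p hp
        refine Submodule.subset_span ⟨Polynomial.C (x l) * p, (Polynomial.natDegree_C_mul_le _ _).trans hp, ?_⟩
        rw [map_mul, mul_div_assoc]; rfl
      · intro l u hu
        refine EE_lin (M := 1 + j) (d := j) (Δ l) ?_ u (ih hu)
        intro p hp
        exact nab_gen hf (Db l) (1 + j) j p hp
      · intro l u hu
        exact nab_EE hK hf (Da l) (da l) (hda l) (1 + j) j u (ih hu)
  have hEσ : ∀ M d a, (EE Φ K f M d).map (σ ^ a).toLinearMap ≤ EE Φ K f (M + a) d := by
    intro M d a
    rw [Submodule.map_le_iff_le_comap, EE, Submodule.span_le]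
    rintro g ⟨p, hp, rfl⟩
    show (σ ^ a) _ ∈ EE Φ K f (M + a) d
    rw [LinearEquiv.pow_apply]
    induction a with
    | zero => exact Submodule.subset_span ⟨p, hp, rfl⟩
    | succ a ih =>
      rw [Function.iterate_succ_apply']
      refine EE_lin (M := M + a) (M' := M + (a + 1)) (d := d) (d' := d) σ.toLinearMap ?_ _ ih
      intro q hq
      refine Submodule.subset_span ⟨tauP R q, (tauP_deg q).trans hq, ?_⟩
      show sig f _ = _
      rw [sig, map_div₀, map_pow, tau_alg, tau_algP, ← add_assoc, pow_succ, div_div]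
  have hEF : ∀ M d, ∃ F : Finset Φ, F.card ≤ (d + 1) * (N0 * (c0 * M)) ^ h ∧
      EE Φ K f M d ≤ Submodule.span K F ⊔ B := by
    intro M d
    refine ⟨Finset.univ.image fun q : Fin (d + 1) × (Fin h → Fin (N0 * (c0 * M))) =>
      sX R Φ ^ (q.1 : ℕ) * al R Φ (∏ l, x l ^ (q.2 l : ℕ)) / al R Φ f ^ M, ?_, ?_⟩
    · refine Finset.card_image_le.trans ?_
      simp
    · rw [EE, Submodule.span_le]
      rintro g ⟨p, hp, rfl⟩
      rw [p.as_sum_range' (d + 1) (by omega), map_sum, Finset.sum_div]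
      refine Submodule.sum_mem _ ?_
      intro c hc
      rw [Finset.mem_range] at hc
      obtain ⟨s, hs⟩ := hfin (c0 * M) (p.coeff c)
      have e : algebraMap (Polynomial R) Φ (Polynomial.monomial c (p.coeff c)) / al R Φ f ^ M =
          ∑ b, (algebraMap S K (s b)) • (sX R Φ ^ c * al R Φ (∏ l, x l ^ (b l : ℕ)) / al R Φ f ^ M) +
          algebraMap (Polynomial R) Φ (Polynomial.X ^ c) * (al R Φ (p.coeff c - ∑ b, ρ (s b) * ∏ l, x l ^ (b l : ℕ)) * (1 / al R Φ f ^ M)) := by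
        have hX : algebraMap (Polynomial R) Φ Polynomial.X = sX R Φ := rfl
        have hC : ∀ r, algebraMap (Polynomial R) Φ (Polynomial.C r) = al R Φ r := fun r => rfl
        simp only [Algebra.smul_def, hK]
        rw [← Polynomial.C_mul_X_pow_eq_monomial, map_mul, map_pow, hX, hC, map_sub, map_sum, sub_mul, mul_sub,
          Finset.sum_mul, Finset.mul_sum, ← add_sub_assoc, add_comm (∑ b, _), add_sub_assoc, ← Finset.sum_sub_distrib,
          Finset.sum_eq_zero]
        · ring
        · intro b _
          rw [map_mul]
          ring
      rw [e]
      refine add_mem (Submodule.mem_sup_left (Submodule.sum_mem _ fun b _ => Submodule.smul_mem _ _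
        (Submodule.subset_span ?_))) (Submodule.mem_sup_right (SY_smulP ρ hK f _ (YY_le_SY ρ hK f (hc0 M _ hs))))
      rw [Finset.coe_image]
      exact ⟨(⟨c, hc⟩, b), by simp, rfl⟩
  obtain ⟨c, hcm, hcd, hc⟩ := hol_sigma (X := Xo) (Δ := Δ) (s := so) (N := N) (fun i => dK K (da i))
    (fun i κ w => nab_smulK hK f (Da i) (da i) (hda i) κ w)
    (fun i w => by
      show nab Φ f (Da i) (sX R Φ * w) = sX R Φ * nab Φ f (Da i) w
      rw [nab_mul, dP_sX]; simp) hO B hBs hBX hBD hBN σ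
    (fun w hw => (hBσ w).mpr (SY_sigI ρ hK hf hw)) ((1 : Φ) / al R Φ f)
    (by
      intro j
      induction j with
      | zero =>
        rw [genT, Submodule.span_singleton_le_iff_mem, hBσ]
        have : sigI f (1 / al R Φ f) = (1 : Φ) := by
          rw [sigI, map_div₀, tau_symm_alg]
          simp [h0]
        rw [this]
        exact YY_le_SY ρ hK f (one_mem_YY f)
      | succ j ih =>
        refine genT_le _ _ _ ih ?_ ?_ ?_ ?_
        · intro u hu
          rw [hBσ]
          show sigI f (sX R Φ * u) ∈ B
          rw [sigI_mul, tau_symm_sX]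
          have := SY_smulP ρ hK f (Polynomial.X + 1) ((hBσ u).mp (ih hu))
          rwa [map_add, map_one] at this
        · intro l u hu
          rw [hBσ]
          show sigI f (al R Φ (x l) * u) ∈ B
          rw [sigI_mul, tau_symm_alg]
          exact hBX l _ ((hBσ u).mp (ih hu))
        · intro l u hu
          rw [hBσ, hΔa, sigI_nab hf]
          exact hBD l _ ((hBσ u).mp (ih hu))
        · intro l u hu
          rw [hBσ]
          show sigI f (nab Φ f (Da l) u) ∈ B
          rw [sigI_nab hf]
          exact hBN l _ ((hBσ u).mp (ih hu)))
    ((N0 * c0) ^ h)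
    (by
      intro i j
      obtain ⟨F, hF1, hF2⟩ := hEF (i + j) j
      refine ⟨F, hF1.trans ?_, ?_⟩
      · refine Nat.mul_le_mul_left _ ?_
        rw [← mul_pow]
        refine Nat.pow_le_pow_left ?_ h
        rw [mul_assoc]
        exact Nat.mul_le_mul_left _ (Nat.mul_le_mul_left _ (Nat.le_succ _))
      · intro a ha
        refine le_trans ?_ hF2
        refine (Submodule.map_mono (hgen j)).trans ((hEσ _ _ a).trans (EE_mono hf (by omega) le_rfl)))
  -- descend the polynomial
  have hck : ∃ q : Polynomial k, c = q.map ((algebraMap S K).comp (algebraMap k S)) := by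
    have h1 : ∀ n, ∃ a : k, c.coeff n = algebraMap S K (algebraMap k S a) := by
      intro n
      refine hconst _ fun i => ?_
      have := congrArg (fun q => Polynomial.coeff q n) (hcd i)
      simpa [coeff_dco] using this
    choose a ha using h1
    refine ⟨∑ n ∈ Finset.range (c.natDegree + 1), Polynomial.monomial n (a n), ?_⟩
    conv_lhs => rw [c.as_sum_range]
    rw [Polynomial.map_sum]
    refine Finset.sum_congr rfl fun n _ => ?_
    rw [Polynomial.map_monomial, ha]; rfl
  obtain ⟨q, rfl⟩ := hck
  have hq : q ≠ 0 := by
    rintro rfl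
    simp at hcm
  have hev : Polynomial.aeval so (q.map ((algebraMap S K).comp (algebraMap k S))) ((1 : Φ) / al R Φ f) =
      kp R Φ q * (1 / al R Φ f) := by
    have h1 : Polynomial.aeval so (q.map ((algebraMap S K).comp (algebraMap k S))) =
        Algebra.lmul K Φ (Polynomial.aeval (sX R Φ) (q.map ((algebraMap S K).comp (algebraMap k S)))) :=
      Polynomial.aeval_algHom_apply (Algebra.lmul K Φ) (sX R Φ) _
    have h2 : Polynomial.aeval (sX R Φ) (q.map ((algebraMap S K).comp (algebraMap k S))) = kp R Φ q := by
      have h3 : (Polynomial.aeval (sX R Φ)).toRingHom.comp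
          (Polynomial.mapRingHom ((algebraMap S K).comp (algebraMap k S))) = kp R Φ := by
        apply Polynomial.ringHom_ext
        · intro a
          simp [kp, hK, al]
        · simp [kp, sX]
      exact congrArg (fun h : Polynomial k →+* Φ => h q) h3
    rw [h1, h2]; rfl
  rw [hev] at hc
  obtain ⟨s, hs, hs'⟩ := hc
  refine ⟨s, hs, mem_bA.mpr (YY_sat f hq ?_)⟩
  rw [mul_left_comm] at hs'
  rwa [div_eq_mul_one_div]
end hol
end
end LCF

namespace LCF
noncomputable section
set_option linter.unusedSectionVars false

section approx
variable {k S : Type*} [Field k] [CommRing S] [Algebra k S] {τ : Type*} (z : τ → S)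

/-- homogeneous approximation -/
lemma hom_approx (h : ∀ s : S, ∃ c : k, s - algebraMap k S c ∈ Ideal.span (Set.range z)) (t : ℕ) :
    ∀ u ∈ (Ideal.span (Set.range z)) ^ t, ∃ G : MvPolynomial τ k, G.IsHomogeneous t ∧
      MvPolynomial.aeval z G ∈ (Ideal.span (Set.range z)) ^ t ∧
      u - MvPolynomial.aeval z G ∈ (Ideal.span (Set.range z)) ^ (t + 1) := by
  set I := Ideal.span (Set.range z) with hI
  have h1 : ∀ u ∈ I, ∃ G : MvPolynomial τ k, G.IsHomogeneous 1 ∧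
      MvPolynomial.aeval z G ∈ I ∧ u - MvPolynomial.aeval z G ∈ I ^ 2 := by
    intro u hu
    rw [hI] at hu
    induction hu using Submodule.span_induction with
    | mem x hx =>
      obtain ⟨i, rfl⟩ := hx
      refine ⟨MvPolynomial.X i, MvPolynomial.isHomogeneous_X _ _, ?_, ?_⟩
      · rw [MvPolynomial.aeval_X]; exact Ideal.subset_span ⟨i, rfl⟩
      · simp
    | zero => exact ⟨0, MvPolynomial.isHomogeneous_zero _ _ _, by simp, by simp⟩
    | add x y _ _ hx hy =>
      obtain ⟨G, g1, g2, g3⟩ := hx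
      obtain ⟨G', g1', g2', g3'⟩ := hy
      refine ⟨G + G', g1.add g1', ?_, ?_⟩
      · rw [map_add]; exact add_mem g2 g2'
      · rw [map_add, add_sub_add_comm]; exact add_mem g3 g3'
    | smul r x hx0 hx =>
      obtain ⟨G, g1, g2, g3⟩ := hx
      obtain ⟨c, hc⟩ := h r
      refine ⟨MvPolynomial.C c * G, ?_, ?_, ?_⟩
      · simpa using (MvPolynomial.isHomogeneous_C _ c).mul g1
      · rw [map_mul]; exact I.mul_mem_left _ g2
      · have e : r • x - MvPolynomial.aeval z (MvPolynomial.C c * G) =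
            r * (x - MvPolynomial.aeval z G) + (r - algebraMap k S c) * MvPolynomial.aeval z G := by
          rw [map_mul, MvPolynomial.aeval_C, smul_eq_mul]; ring
        rw [e]
        refine add_mem (Ideal.mul_mem_left _ _ g3) ?_
        rw [pow_two]
        exact Ideal.mul_mem_mul hc g2
  induction t with
  | zero =>
    intro u _
    obtain ⟨c, hc⟩ := h u
    exact ⟨MvPolynomial.C c, MvPolynomial.isHomogeneous_C _ c, by simp, by simpa using hc⟩
  | succ t ih =>
    intro u hu
    rw [pow_succ] at hu
    induction hu using Submodule.mul_induction_on' with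
    | mem_mul_mem v hv w hw =>
      obtain ⟨G, g1, g2, g3⟩ := ih v hv
      obtain ⟨G', g1', g2', g3'⟩ := h1 w hw
      refine ⟨G * G', g1.mul g1', ?_, ?_⟩
      · rw [map_mul, pow_succ]; exact Ideal.mul_mem_mul g2 g2'
      · have e : v * w - MvPolynomial.aeval z (G * G') =
            (v - MvPolynomial.aeval z G) * w + MvPolynomial.aeval z G * (w - MvPolynomial.aeval z G') := by
          rw [map_mul]; ring
        rw [e]
        refine add_mem ?_ ?_
        · rw [pow_succ]; exact Ideal.mul_mem_mul g3 hw
        · rw [show t + 1 + 1 = t + 2 from rfl, pow_add]; exact Ideal.mul_mem_mul g2 g3'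
    | add x _ y _ hx hy =>
      obtain ⟨G, g1, g2, g3⟩ := hx
      obtain ⟨G', g1', g2', g3'⟩ := hy
      refine ⟨G + G', g1.add g1', ?_, ?_⟩
      · rw [map_add]; exact add_mem g2 g2'
      · rw [map_add, add_sub_add_comm]; exact add_mem g3 g3'

lemma poly_approx (h : ∀ s : S, ∃ c : k, s - algebraMap k S c ∈ Ideal.span (Set.range z)) (t : ℕ) (u : S) :
    ∃ G : MvPolynomial τ k, u - MvPolynomial.aeval z G ∈ (Ideal.span (Set.range z)) ^ t := by
  induction t with
  | zero => exact ⟨0, by simp⟩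
  | succ t ih =>
    obtain ⟨G, hG⟩ := ih
    obtain ⟨G', -, -, h3⟩ := hom_approx z h t _ hG
    exact ⟨G + G', by rw [map_add, ← sub_sub]; exact h3⟩

/-- a continuous derivation killing coordinates is zero -/
lemma der_zero (h : ∀ s : S, ∃ c : k, s - algebraMap k S c ∈ Ideal.span (Set.range z))
    {B : Type*} [CommRing B] (m : Ideal B) (hm : ∀ b, (∀ t, b ∈ m ^ t) → b = 0) (ρ : S →+* B)
    (hρ : ∀ i, ρ (z i) ∈ m) (δ : S →+ B) (hδ : ∀ s t, δ (s * t) = ρ s * δ t + ρ t * δ s)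
    (hk : ∀ c : k, δ (algebraMap k S c) = 0) (hz : ∀ i, δ (z i) = 0) (s : S) : δ s = 0 := by
  have hI : Ideal.span (Set.range z) ≤ m.comap ρ := by
    rw [Ideal.span_le]
    rintro _ ⟨i, rfl⟩
    exact hρ i
  have hIt : ∀ t, ∀ u ∈ (Ideal.span (Set.range z)) ^ t, ρ u ∈ m ^ t := by
    intro t u hu
    have := Ideal.pow_right_mono hI t hu
    have h2 := Ideal.le_comap_pow ρ t this
    exact h2
  have h0 : ∀ G : MvPolynomial τ k, δ (MvPolynomial.aeval z G) = 0 := by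
    intro G
    induction G using MvPolynomial.induction_on with
    | C a => rw [MvPolynomial.aeval_C, hk]
    | add p q hp hq => rw [map_add, map_add, hp, hq, add_zero]
    | mul_X p i hp => rw [map_mul, MvPolynomial.aeval_X, hδ, hz, hp]; simp
  have h1 : ∀ t, ∀ u ∈ (Ideal.span (Set.range z)) ^ (t + 1), δ u ∈ m ^ t := by
    intro t
    induction t with
    | zero => intro u _; simp
    | succ t ih =>
      intro u hu
      rw [pow_succ] at hu
      induction hu using Submodule.mul_induction_on' with
      | mem_mul_mem v hv w hw =>
        rw [hδ]
        refine add_mem (Ideal.mul_mem_right _ _ (hIt _ _ hv)) ?_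
        rw [pow_succ, mul_comm (ρ w)]
        exact Ideal.mul_mem_mul (ih _ hv) (hI hw)
      | add x _ y _ hx hy => rw [map_add]; exact add_mem hx hy
  refine hm _ fun t => ?_
  obtain ⟨G, hG⟩ := poly_approx z h (t + 1) s
  have := h1 t _ hG
  rwa [map_sub, h0, sub_zero] at this

end approx

lemma ps_approx {k : Type*} [CommRing k] {σ : Type*} [Finite σ] (s : MvPowerSeries σ k) :
    s - MvPowerSeries.C (MvPowerSeries.constantCoeff s) ∈ Ideal.span (Set.range (MvPowerSeries.X (R := k) (σ := σ))) := by
  classical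
  have := Fintype.ofFinite σ
  have hch : ∀ d : σ →₀ ℕ, d ≠ 0 → ∃ i, d i ≠ 0 := by
    intro d hd
    by_contra h
    push Not at h
    exact hd (Finsupp.ext h)
  choose ch hch using hch
  let g : σ → MvPowerSeries σ k := fun i n =>
    if h : n + Finsupp.single i 1 ≠ 0 then if ch _ h = i then MvPowerSeries.coeff (n + Finsupp.single i 1) s else 0 else 0
  have e : s - MvPowerSeries.C (MvPowerSeries.constantCoeff s) = ∑ i, MvPowerSeries.X i * g i := by
    ext d
    rw [map_sum, map_sub, MvPowerSeries.coeff_C]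
    have hX : ∀ i, MvPowerSeries.coeff d (MvPowerSeries.X i * g i) =
        if h : d ≠ 0 then if ch d h = i then MvPowerSeries.coeff d s else 0 else 0 := by
      intro i
      rw [MvPowerSeries.X, MvPowerSeries.coeff_monomial_mul, one_mul]
      by_cases hd : d ≠ 0
      · rw [dif_pos hd]
        by_cases hle : Finsupp.single i 1 ≤ d
        · rw [if_pos hle]
          show g i (d - Finsupp.single i 1) = _
          have e2 : d - Finsupp.single i 1 + Finsupp.single i 1 = d := tsub_add_cancel_of_le hle
          simp only [g, e2]
          rw [dif_pos hd]
        · rw [if_neg hle, if_neg]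
          rintro rfl
          refine hle ?_
          rw [Finsupp.single_le_iff]
          exact Nat.one_le_iff_ne_zero.mpr (hch d hd)
      · rw [dif_neg hd]
        push Not at hd
        subst hd
        rw [if_neg]
        intro h
        have := h i
        simp at this
    rw [Finset.sum_congr rfl fun i _ => hX i]
    by_cases hd : d = 0
    · subst hd
      simp
    · simp [hd]
  rw [e]
  exact Ideal.sum_mem _ fun i _ => Ideal.mul_mem_right _ _ (Ideal.subset_span ⟨i, rfl⟩)

lemma ps_approx' {k : Type*} [Field k] {σ : Type*} [Finite σ] (s : MvPowerSeries σ k) :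
    ∃ c : k, s - algebraMap k (MvPowerSeries σ k) c ∈ Ideal.span (Set.range (MvPowerSeries.X (R := k) (σ := σ))) :=
  ⟨MvPowerSeries.constantCoeff s, ps_approx s⟩

lemma ps_haus {k : Type*} [CommRing k] {σ : Type*} [Finite σ] (b : MvPowerSeries σ k)
    (h : ∀ t, b ∈ (Ideal.span (Set.range (MvPowerSeries.X (R := k) (σ := σ)))) ^ t) : b = 0 := by
  refine IsHausdorff.haus (I := Ideal.span (Set.range (MvPowerSeries.X (R := k) (σ := σ)))) inferInstance b fun t => ?_
  rw [SModEq.zero, smul_eq_mul, Ideal.mul_top]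
  exact h t

/-- completeness lemma -/
lemma fin_of_mod {S R : Type*} [CommRing S] [CommRing R] (ρ : S →+* R) (m0 : Ideal S) [IsAdicComplete m0 S]
    [IsLocalRing R] [IsNoetherianRing R] (hm : ∀ s ∈ m0, ρ s ∈ IsLocalRing.maximalIdeal R) (J : Ideal R)
    {ι : Type*} [Fintype ι] (w : ι → R)
    (h : ∀ r, ∃ s : ι → S, r - ∑ b, ρ (s b) * w b ∈ J ⊔ m0.map ρ) (r : R) :
    ∃ s : ι → S, r - ∑ b, ρ (s b) * w b ∈ J := by
  classical
  letI : Algebra S R := ρ.toAlgebra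
  have hρ : ∀ s, algebraMap S R s = ρ s := fun _ => rfl
  have hpre : IsPrecomplete m0 (ι → S) := by
    constructor
    intro f hf
    have hmem : ∀ (n : ℕ) (v : ι → S), v ∈ (m0 ^ n • ⊤ : Submodule S (ι → S)) ↔ ∀ i, v i ∈ m0 ^ n := by
      intro n v
      constructor
      · intro hv i
        refine Submodule.smul_induction_on hv ?_ ?_
        · intro a ha u _
          exact Ideal.mul_mem_right _ _ ha
        · intro u u' h1 h2
          exact add_mem h1 h2
      · intro hv
        have e : v = ∑ i, v i • (Pi.single i 1 : ι → S) := by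
          ext j
          simp [Finset.sum_apply, Pi.single_apply]
        rw [e]
        exact Submodule.sum_mem _ fun i _ => Submodule.smul_mem_smul (hv i) trivial
    have hc : ∀ i, ∃ L : S, ∀ n, f n i ≡ L [SMOD (m0 ^ n • ⊤ : Submodule S S)] := by
      intro i
      refine IsPrecomplete.prec' (I := m0) (fun n => f n i) ?_
      intro a b hab
      have := hf hab
      rw [SModEq.sub_mem, hmem] at this
      rw [SModEq.sub_mem, smul_eq_mul, Ideal.mul_top]
      exact this i
    choose L hL using hc
    refine ⟨L, fun n => ?_⟩
    rw [SModEq.sub_mem, hmem]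
    intro i
    have := hL i n
    rw [SModEq.sub_mem, smul_eq_mul, Ideal.mul_top] at this
    exact this
  have key : ∀ n, ∀ x ∈ (m0 ^ n • ⊤ : Submodule S (R ⧸ J)),
      x ∈ ((IsLocalRing.maximalIdeal R) ^ n • ⊤ : Submodule R (R ⧸ J)) := by
    intro n x hx
    refine Submodule.smul_induction_on hx ?_ ?_
    · intro a ha u _
      have h1 : a • u = (ρ a) • u := by
        rw [← hρ, algebraMap_smul]
      rw [h1]
      refine Submodule.smul_mem_smul ?_ trivial
      have : m0 ≤ (IsLocalRing.maximalIdeal R).comap ρ := hm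
      exact Ideal.le_comap_pow ρ n (Ideal.pow_right_mono this n ha)
    · intro u u' h1 h2
      exact add_mem h1 h2
  have hhaus : IsHausdorff m0 (R ⧸ J) := by
    constructor
    intro x hx
    refine IsHausdorff.haus (I := IsLocalRing.maximalIdeal R) inferInstance x fun n => ?_
    have := hx n
    rw [SModEq.zero] at this ⊢
    exact key n x this
  let F : (ι → S) →ₗ[S] (R ⧸ J) := ∑ b, (LinearMap.toSpanSingleton S (R ⧸ J) (Ideal.Quotient.mk J (w b))) ∘ₗ LinearMap.proj b
  have hF : ∀ s, F s = Ideal.Quotient.mk J (∑ b, ρ (s b) * w b) := by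
    intro s
    simp only [F, LinearMap.sum_apply, map_sum, map_mul]
    refine Finset.sum_congr rfl fun b _ => ?_
    simp only [LinearMap.comp_apply, LinearMap.proj_apply, LinearMap.toSpanSingleton_apply]
    rw [Algebra.smul_def]; rfl
  have hs : Function.Surjective F := by
    refine surjective_of_mkQ_comp_surjective (I := m0) ?_
    intro y
    obtain ⟨y, rfl⟩ := Submodule.mkQ_surjective _ y
    obtain ⟨y, rfl⟩ := Ideal.Quotient.mk_surjective y
    obtain ⟨s, hs⟩ := h y
    refine ⟨s, ?_⟩
    show Submodule.mkQ _ (F s) = _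
    rw [← sub_eq_zero, ← map_sub, hF, ← map_sub, Submodule.mkQ_apply, Submodule.Quotient.mk_eq_zero]
    have hs2 := neg_mem hs
    rw [neg_sub] at hs2
    obtain ⟨j, hj, q, hq, e⟩ := Submodule.mem_sup.mp hs2
    rw [← e, map_add, Ideal.Quotient.eq_zero_iff_mem.mpr hj, zero_add]
    refine Submodule.span_induction ?_ ?_ ?_ ?_ hq
    · rintro _ ⟨a, ha, rfl⟩
      have : Ideal.Quotient.mk J (ρ a) = a • (1 : R ⧸ J) := by
        rw [Algebra.smul_def, mul_one]; rfl
      rw [this]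
      exact Submodule.smul_mem_smul ha trivial
    · simp
    · intro a b _ _ ha hb; rw [map_add]; exact add_mem ha hb
    · intro a x _ hx
      rw [smul_eq_mul, map_mul]
      refine Submodule.smul_induction_on hx ?_ ?_
      · intro c hc u _
        rw [mul_smul_comm]
        exact Submodule.smul_mem_smul hc trivial
      · intro u u' h1 h2
        rw [mul_add]; exact add_mem h1 h2
  obtain ⟨s, hs⟩ := hs (Ideal.Quotient.mk J r)
  refine ⟨s, ?_⟩
  rw [hF] at hs
  exact Ideal.Quotient.eq.mp hs.symm

end
end LCF

namespace LCF
noncomputable section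
set_option linter.unusedSectionVars false

section const
variable {k : Type*} [Field k] {e : ℕ}

lemma lex_coeff_mul {φ ψ : MvPowerSeries (Fin e) k} {p q : Fin e →₀ ℕ}
    (hp : ∀ d, toLex d < toLex p → MvPowerSeries.coeff d φ = 0)
    (hq : ∀ d, toLex d < toLex q → MvPowerSeries.coeff d ψ = 0) :
    MvPowerSeries.coeff (p + q) (φ * ψ) = MvPowerSeries.coeff p φ * MvPowerSeries.coeff q ψ := by
  rw [MvPowerSeries.coeff_mul, Finset.sum_eq_single_of_mem ⟨p, q⟩ (by simp)]
  rintro ⟨u, v⟩ h h'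
  simp only [Finset.HasAntidiagonal.mem_antidiagonal] at h
  by_cases h1 : toLex u < toLex p
  · rw [hp u h1, zero_mul]
  · by_cases h2 : toLex v < toLex q
    · rw [hq v h2, mul_zero]
    · exfalso
      push Not at h1 h2
      have hs : toLex p + toLex q = toLex u + toLex v := by
        rw [← toLex_add, ← toLex_add, h]
      have h3 : toLex p = toLex u := by
        refine le_antisymm h1 ?_
        by_contra hc
        push Not at hc
        have := add_lt_add_of_lt_of_le hc h2
        exact absurd hs this.ne
      have h4 : toLex q = toLex v := by
        rw [h3] at hs
        exact add_left_cancel hs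
      exact h' (by rw [Prod.mk.injEq]; exact ⟨(toLex.injective h3).symm, (toLex.injective h4).symm⟩)

lemma coeff_theta (i : Fin e) (a : MvPowerSeries (Fin e) k) (n : Fin e →₀ ℕ) :
    MvPowerSeries.coeff n (MvPowerSeries.X i * MvPowerSeries.pderiv k i a) = n i * MvPowerSeries.coeff n a := by
  classical
  rw [MvPowerSeries.X, MvPowerSeries.coeff_monomial_mul, one_mul]
  split_ifs with h
  · rw [MvPowerSeries.coeff_pderiv, tsub_add_cancel_of_le h]
    have : 1 ≤ n i := by simpa using h i
    simp only [Finsupp.coe_tsub, Pi.sub_apply, Finsupp.single_eq_same]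
    rw [mul_comm]
    congr 1
    have e : n i - 1 + 1 = n i := Nat.sub_add_cancel this
    exact_mod_cast congrArg (Nat.cast (R := k)) e
  · have : n i = 0 := by
      rw [Finsupp.single_le_iff] at h
      omega
    rw [this]; simp

lemma lex_lead {a : MvPowerSeries (Fin e) k} (ha : a ≠ 0) : ∃ p : Fin e →₀ ℕ, MvPowerSeries.coeff p a ≠ 0 ∧
    ∀ d, toLex d < toLex p → MvPowerSeries.coeff d a = 0 := by
  obtain ⟨p, hp⟩ := MvPowerSeries.exists_finsupp_eq_lexOrder_of_ne_zero ha
  refine ⟨p, MvPowerSeries.coeff_ne_zero_of_lexOrder hp.symm, fun d hd => ?_⟩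
  refine MvPowerSeries.coeff_eq_zero_of_lt_lexOrder ?_
  rw [hp]
  exact WithTop.coe_lt_coe.mpr hd

lemma const_lead [CharZero k] {a b : MvPowerSeries (Fin e) k}
    (h : ∀ i, b * MvPowerSeries.pderiv k i a = a * MvPowerSeries.pderiv k i b) {p q : Fin e →₀ ℕ}
    (hp : MvPowerSeries.coeff p a ≠ 0) (hp' : ∀ d, toLex d < toLex p → MvPowerSeries.coeff d a = 0)
    (hq : MvPowerSeries.coeff q b ≠ 0) (hq' : ∀ d, toLex d < toLex q → MvPowerSeries.coeff d b = 0) : p = q := by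
  ext i
  have h1 : (MvPowerSeries.X i * MvPowerSeries.pderiv k i a) * b = a * (MvPowerSeries.X i * MvPowerSeries.pderiv k i b) := by
    linear_combination MvPowerSeries.X i * h i
  have h2 := congrArg (MvPowerSeries.coeff (p + q)) h1
  rw [lex_coeff_mul (fun d hd => by rw [coeff_theta, hp' d hd, mul_zero]) hq',
    lex_coeff_mul hp' (fun d hd => by rw [coeff_theta, hq' d hd, mul_zero]), coeff_theta, coeff_theta] at h2
  have h3 : ((p i : k) - q i) * (MvPowerSeries.coeff p a * MvPowerSeries.coeff q b) = 0 := by linear_combination h2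
  rcases mul_eq_zero.mp h3 with h4 | h4
  · exact_mod_cast sub_eq_zero.mp h4
  · exact absurd h4 (mul_ne_zero hp hq)

lemma const_series [CharZero k] {a b : MvPowerSeries (Fin e) k} (hb : b ≠ 0)
    (h : ∀ i, b * MvPowerSeries.pderiv k i a = a * MvPowerSeries.pderiv k i b) :
    ∃ c : k, a = MvPowerSeries.C c * b := by
  obtain ⟨q, hq, hq'⟩ := lex_lead hb
  set c := MvPowerSeries.coeff q a / MvPowerSeries.coeff q b with hc
  refine ⟨c, ?_⟩
  by_contra hne
  have ha' : a - MvPowerSeries.C c * b ≠ 0 := sub_ne_zero.mpr hne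
  obtain ⟨p, hp, hp'⟩ := lex_lead ha'
  have hpq : p = q := by
    refine const_lead (a := a - MvPowerSeries.C c * b) (b := b) ?_ hp hp' hq hq'
    intro i
    rw [map_sub, Derivation.leibniz, MvPowerSeries.pderiv_C, smul_zero, add_zero, smul_eq_mul]
    linear_combination h i
  refine hp ?_
  rw [hpq, map_sub, MvPowerSeries.coeff_C_mul, hc]
  field_simp
  simp

instance domMv {k : Type*} [Field k] {σ : Type*} : IsDomain (MvPowerSeries σ k) := NoZeroDivisors.to_isDomain _

lemma const_frac [CharZero k] {K : Type*} [Field K] [Algebra (MvPowerSeries (Fin e) k) K]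
    [IsFractionRing (MvPowerSeries (Fin e) k) K] (κ : K) (h : ∀ i : Fin e, dK K (MvPowerSeries.pderiv k i) κ = 0) :
    ∃ a : k, κ = algebraMap (MvPowerSeries (Fin e) k) K (algebraMap k _ a) := by
  obtain ⟨a, b, hb, rfl⟩ := IsFractionRing.div_surjective (A := MvPowerSeries (Fin e) k) κ
  have hb' : b ≠ 0 := nonZeroDivisors.ne_zero hb
  have hb0 : algebraMap (MvPowerSeries (Fin e) k) K b ≠ 0 := by simpa using hb'
  set q := algebraMap (MvPowerSeries (Fin e) k) K a / algebraMap (MvPowerSeries (Fin e) k) K b with hq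
  have e1 : algebraMap _ K a = algebraMap _ K b * q := by rw [hq]; field_simp
  obtain ⟨c, hc⟩ : ∃ c : k, a = MvPowerSeries.C c * b := by
    refine const_series hb' fun i => ?_
    apply IsFractionRing.injective (MvPowerSeries (Fin e) k) K
    have h2 := congrArg (dK K (MvPowerSeries.pderiv k i)) e1
    rw [Derivation.leibniz, h, dK_alg, dK_alg, smul_zero, zero_add, smul_eq_mul] at h2
    rw [map_mul, map_mul, h2, e1]; ring
  refine ⟨c, ?_⟩
  rw [hq, hc, map_mul]
  field_simp
  rfl

end const
end
end LCF

namespace LCF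
noncomputable section
set_option linter.unusedSectionVars false

section coord
variable {k : Type*} [Field k] {σ : Type*} [Finite σ]

variable (k σ) in
/-- the ideal of the variables -/
def mI : Ideal (MvPowerSeries σ k) := Ideal.span (Set.range (MvPowerSeries.X (R := k) (σ := σ)))

lemma mem_mI (s : MvPowerSeries σ k) : s ∈ mI k σ ↔ MvPowerSeries.constantCoeff s = 0 := by
  constructor
  · intro h
    have : mI k σ ≤ RingHom.ker (MvPowerSeries.constantCoeff (σ := σ) (R := k)) := by
      rw [mI, Ideal.span_le]
      rintro _ ⟨i, rfl⟩
      simp [RingHom.mem_ker]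
    exact this h
  · intro h
    have := ps_approx s
    rwa [h, map_zero, sub_zero] at this

lemma mI_eq : mI k σ = IsLocalRing.maximalIdeal (MvPowerSeries σ k) := by
  ext s
  rw [mem_mI, IsLocalRing.mem_maximalIdeal, mem_nonunits_iff, MvPowerSeries.isUnit_iff_constantCoeff, isUnit_iff_ne_zero]
  simp

lemma sup_pow_le {R : Type*} [CommRing R] (I J : Ideal R) (n : ℕ) : (I ⊔ J) ^ n ≤ I ^ n ⊔ J := by
  induction n with
  | zero => simp
  | succ n ih =>
    rw [pow_succ, pow_succ]
    refine (Ideal.mul_mono_left ih).trans ?_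
    rw [Ideal.sup_mul, Ideal.mul_sup]
    refine sup_le (sup_le le_sup_left ?_) ?_
    · exact le_trans Ideal.mul_le_right le_sup_right
    · exact le_trans Ideal.mul_le_left le_sup_right

variable (k σ) in
/-- coordinate systems -/
structure Coord where
  y : σ → MvPowerSeries σ k
  dd : σ → Derivation k (MvPowerSeries σ k) (MvPowerSeries σ k)
  span_y : Ideal.span (Set.range y) = mI k σ
  dd_self : ∀ i, dd i (y i) = 1
  dd_ne : ∀ i j, i ≠ j → dd i (y j) = 0

namespace Coord
variable (c : Coord k σ)

lemma y_mem (i : σ) : c.y i ∈ mI k σ := by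
  rw [← c.span_y]; exact Ideal.subset_span ⟨i, rfl⟩

lemma approx (s : MvPowerSeries σ k) : ∃ a : k, s - algebraMap k (MvPowerSeries σ k) a ∈ Ideal.span (Set.range c.y) := by
  rw [c.span_y]; exact ps_approx' s

lemma ext_zero (D : Derivation k (MvPowerSeries σ k) (MvPowerSeries σ k)) (h : ∀ j, D (c.y j) = 0)
    (r : MvPowerSeries σ k) : D r = 0 := by
  refine der_zero c.y c.approx (mI k σ) ps_haus (RingHom.id _) c.y_mem (AddMonoidHomClass.toAddMonoidHom D) ?_ ?_ h r
  · intro s t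
    exact D.leibniz s t
  · intro a
    exact D.map_algebraMap a

lemma comm (i j : σ) (r : MvPowerSeries σ k) : c.dd i (c.dd j r) = c.dd j (c.dd i r) := by
  classical
  have h : ∀ i j l, c.dd i (c.dd j (c.y l)) = 0 := by
    intro i j l
    by_cases hjl : j = l
    · subst hjl; rw [c.dd_self]; simp
    · rw [c.dd_ne _ _ hjl, map_zero]
  have := c.ext_zero ⁅c.dd i, c.dd j⁆ (fun l => by
    rw [Derivation.commutator_apply, h, h, sub_zero]) r
  rw [Derivation.commutator_apply, sub_eq_zero] at this
  exact this

variable {e : ℕ} (a : Fin e → σ)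

lemma hasSubst : MvPowerSeries.HasSubst (fun i => c.y (a i)) :=
  MvPowerSeries.hasSubst_of_constantCoeff_zero fun i => (mem_mI _).mp (c.y_mem _)

/-- the parametrisation -/
def rho : MvPowerSeries (Fin e) k →ₐ[k] MvPowerSeries σ k := MvPowerSeries.substAlgHom (c.hasSubst a)

lemma rho_X (i : Fin e) : c.rho a (MvPowerSeries.X i) = c.y (a i) :=
  MvPowerSeries.substAlgHom_X _ _

lemma rho_mem (i : Fin e) : (c.rho a).toRingHom (MvPowerSeries.X i) ∈ mI k σ := by
  show c.rho a (MvPowerSeries.X i) ∈ _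
  rw [rho_X]; exact c.y_mem _

lemma rho_mI (s : MvPowerSeries (Fin e) k) (hs : s ∈ mI k (Fin e)) : c.rho a s ∈ mI k σ := by
  have : mI k (Fin e) ≤ (mI k σ).comap (c.rho a) := by
    rw [mI, Ideal.span_le]
    rintro _ ⟨i, rfl⟩
    exact c.rho_mem a i
  exact this hs

lemma rho_map : (mI k (Fin e)).map (c.rho a).toRingHom = Ideal.span (Set.range fun i => c.y (a i)) := by
  rw [mI, Ideal.map_span, ← Set.range_comp]
  congr 2
  ext1 i
  exact c.rho_X a i

lemma rho_dd (ha : Function.Injective a) (i : Fin e) (s : MvPowerSeries (Fin e) k) :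
    c.dd (a i) (c.rho a s) = c.rho a (MvPowerSeries.pderiv k i s) := by
  rw [← sub_eq_zero]
  refine der_zero (MvPowerSeries.X (R := k)) ps_approx' (mI k σ) ps_haus (c.rho a).toRingHom (c.rho_mem a)
    ((AddMonoidHomClass.toAddMonoidHom (c.dd (a i))).comp (AddMonoidHomClass.toAddMonoidHom (c.rho a)) - ((AddMonoidHomClass.toAddMonoidHom (c.rho a)).comp (AddMonoidHomClass.toAddMonoidHom (MvPowerSeries.pderiv k i)))) ?_ ?_ ?_ s
  · intro s t
    show c.dd (a i) (c.rho a (s * t)) - c.rho a (MvPowerSeries.pderiv k i (s * t)) =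
      c.rho a s * (c.dd (a i) (c.rho a t) - c.rho a (MvPowerSeries.pderiv k i t)) +
      c.rho a t * (c.dd (a i) (c.rho a s) - c.rho a (MvPowerSeries.pderiv k i s))
    rw [map_mul, Derivation.leibniz, Derivation.leibniz, map_add]
    simp only [smul_eq_mul, map_mul]
    ring
  · intro x
    show c.dd (a i) (c.rho a (algebraMap _ _ x)) - c.rho a (MvPowerSeries.pderiv k i (algebraMap _ _ x)) = 0
    rw [AlgHom.commutes, Derivation.map_algebraMap, Derivation.map_algebraMap, map_zero, sub_zero]
  · intro j
    show c.dd (a i) (c.rho a (MvPowerSeries.X j)) - c.rho a (MvPowerSeries.pderiv k i (MvPowerSeries.X j)) = 0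
    rw [rho_X]
    by_cases hij : i = j
    · subst hij; rw [c.dd_self, MvPowerSeries.pderiv_X_self, map_one, sub_self]
    · rw [c.dd_ne _ _ (fun h => hij (ha h)), MvPowerSeries.pderiv_X_of_ne (Ne.symm hij), map_zero, sub_zero]

lemma rho_dd_ne (j : σ) (hj : ∀ i, a i ≠ j) (s : MvPowerSeries (Fin e) k) :
    c.dd j (c.rho a s) = 0 := by
  refine der_zero (MvPowerSeries.X (R := k)) ps_approx' (mI k σ) ps_haus (c.rho a).toRingHom (c.rho_mem a)
    ((AddMonoidHomClass.toAddMonoidHom (c.dd j)).comp (AddMonoidHomClass.toAddMonoidHom (c.rho a))) ?_ ?_ ?_ s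
  · intro s t
    show c.dd j (c.rho a (s * t)) = c.rho a s * (c.dd j (c.rho a t)) + c.rho a t * (c.dd j (c.rho a s))
    rw [map_mul, Derivation.leibniz]
    rfl
  · intro x
    show c.dd j (c.rho a (algebraMap _ _ x)) = 0
    rw [AlgHom.commutes, Derivation.map_algebraMap]
  · intro i
    show c.dd j (c.rho a (MvPowerSeries.X i)) = 0
    rw [rho_X, c.dd_ne _ _ (hj i).symm]

lemma rho_inj [CharZero k] (ha : Function.Injective a) : Function.Injective (c.rho a) := by
  rw [injective_iff_map_eq_zero]
  intro s hs
  ext d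
  rw [map_zero]
  revert s
  induction d using WellFounded.induction (measure (fun d : Fin e →₀ ℕ => d.degree)).wf with
  | _ d ih =>
  intro s hs
  by_cases hd : d = 0
  · subst hd
    rw [MvPowerSeries.coeff_zero_eq_constantCoeff]
    have h1 := c.rho_mI a _ (ps_approx s)
    rw [map_sub, hs, zero_sub, neg_mem_iff] at h1
    have h2 : c.rho a (MvPowerSeries.C (MvPowerSeries.constantCoeff s)) = MvPowerSeries.C (MvPowerSeries.constantCoeff s) :=
      (c.rho a).commutes _
    rw [h2, mem_mI] at h1
    simpa using h1
  · obtain ⟨i, hi⟩ : ∃ i, d i ≠ 0 := by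
      by_contra h
      push Not at h
      exact hd (Finsupp.ext h)
    have hle : Finsupp.single i 1 ≤ d := by
      rw [Finsupp.single_le_iff]; omega
    have h3 := ih (d - Finsupp.single i 1) ?_ (MvPowerSeries.pderiv k i s) (by
      rw [← rho_dd c a ha, hs, map_zero])
    · rw [MvPowerSeries.coeff_pderiv, tsub_add_cancel_of_le hle] at h3
      rcases mul_eq_zero.mp h3 with h4 | h4
      · exact h4
      · exfalso
        exact Nat.cast_add_one_ne_zero _ h4
    · show (d - Finsupp.single i 1).degree < d.degree
      conv_rhs => rw [← tsub_add_cancel_of_le hle]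
      rw [map_add, Finsupp.degree_single]
      exact Nat.lt_succ_self _

variable {Φ : Type*} [Field Φ] [Algebra (Polynomial (MvPowerSeries σ k)) Φ] [IsFractionRing (Polynomial (MvPowerSeries σ k)) Φ]

/-- the finiteness hypothesis -/
lemma hfin {h : ℕ} (b : Fin h → σ) (hb : Function.Injective b)
    (hs : ∀ j, (∃ i, a i = j) ∨ ∃ l, b l = j)
    (J : Ideal (MvPowerSeries σ k)) (M : ℕ) (hM : mI k σ ^ M ≤ J ⊔ Ideal.span (Set.range fun i => c.y (a i)))
    (N : ℕ) (r : MvPowerSeries σ k) : ∃ s : (Fin h → Fin (M * N)) → MvPowerSeries (Fin e) k,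
      r - ∑ β, c.rho a (s β) * ∏ l, c.y (b l) ^ (β l : ℕ) ∈ J ^ N := by
  classical
  have := Fintype.ofFinite σ
  have hcomp : IsAdicComplete (mI k (Fin e)) (MvPowerSeries (Fin e) k) := by rw [mI]; infer_instance
  refine fin_of_mod (c.rho a).toRingHom (mI k (Fin e)) ?_ (J ^ N)
    (fun β : Fin h → Fin (M * N) => ∏ l, c.y (b l) ^ (β l : ℕ)) ?_ r
  · intro s hs
    rw [← mI_eq]; exact c.rho_mI a s hs
  rw [rho_map]
  set A := Ideal.span (Set.range fun i => c.y (a i)) with hA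
  have hMN : mI k σ ^ (M * N) ≤ J ^ N ⊔ A := by
    rw [pow_mul]
    exact (Ideal.pow_right_mono hM N).trans (sup_pow_le _ _ _)
  let Q : AddSubgroup (MvPowerSeries σ k) :=
    { carrier := {r | ∃ s : (Fin h → Fin (M * N)) → MvPowerSeries (Fin e) k,
        r - ∑ β, c.rho a (s β) * ∏ l, c.y (b l) ^ (β l : ℕ) ∈ J ^ N ⊔ A}
      zero_mem' := ⟨0, by simp⟩
      add_mem' := by
        rintro x y ⟨s, hs⟩ ⟨t, ht⟩
        refine ⟨s + t, ?_⟩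
        simp only [Pi.add_apply, map_add, add_mul, Finset.sum_add_distrib]
        rw [add_sub_add_comm]
        exact add_mem hs ht
      neg_mem' := by
        rintro x ⟨s, hs⟩
        refine ⟨-s, ?_⟩
        simp only [Pi.neg_apply, map_neg, neg_mul, Finset.sum_neg_distrib]
        rw [← neg_sub', ]
        exact neg_mem hs }
  have hQ : ∀ r ∈ J ^ N ⊔ A, r ∈ Q := fun r hr => ⟨0, by simpa using hr⟩
  suffices hall : ∀ r, r ∈ Q from hall
  intro r
  obtain ⟨G, hG⟩ := poly_approx c.y c.approx (M * N) r
  rw [c.span_y] at hG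
  rw [← sub_add_cancel r (MvPolynomial.aeval c.y G)]
  refine Q.add_mem (hQ _ (hMN hG)) ?_
  rw [MvPolynomial.aeval_def, MvPolynomial.eval₂_eq']
  refine Q.sum_mem fun d _ => ?_
  have hmon : ∀ j n, n ≤ d j → c.y j ^ n ∣ ∏ i, c.y i ^ d i := fun j n hn =>
    (pow_dvd_pow _ hn).trans (Finset.dvd_prod_of_mem _ (Finset.mem_univ j))
  by_cases h1 : ∃ i, d (a i) ≠ 0
  · obtain ⟨i, hi⟩ := h1
    refine hQ _ (Ideal.mem_sup_right (Ideal.mul_mem_left _ _ ?_))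
    have := hmon (a i) 1 (by omega)
    rw [pow_one] at this
    exact Ideal.mem_of_dvd _ this (Ideal.subset_span ⟨i, rfl⟩)
  · by_cases h2 : ∃ l, M * N ≤ d (b l)
    · obtain ⟨l, hl⟩ := h2
      refine hQ _ (hMN (Ideal.mul_mem_left _ _ ?_))
      exact Ideal.mem_of_dvd _ (hmon (b l) _ hl) (Ideal.pow_mem_pow (c.y_mem _) _)
    · push Not at h1 h2
      refine ⟨fun β => if β = fun l => ⟨d (b l), h2 l⟩ then MvPowerSeries.C (MvPolynomial.coeff d G) else 0, ?_⟩
      rw [Finset.sum_eq_single (fun l => ⟨d (b l), h2 l⟩)]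
      · simp only [if_true]
        have e1 : ∏ i, c.y i ^ d i = ∏ l, c.y (b l) ^ d (b l) := by
          refine (Finset.prod_of_injOn b hb.injOn (by simp) ?_ ?_).symm
          · intro j _ hj
            rcases hs j with ⟨i, rfl⟩ | ⟨l, rfl⟩
            · rw [h1, pow_zero]
            · exact absurd (by simp) hj
          · intro l _
            rfl
        rw [e1]
        have h2 : c.rho a (MvPowerSeries.C (MvPolynomial.coeff d G)) = algebraMap k _ (MvPolynomial.coeff d G) :=
          (c.rho a).commutes _
        rw [h2, sub_self]
        exact zero_mem _
      · intro β _ hβ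
        simp only [if_neg hβ]; simp
      · simp

variable (Φ) in
/-- one step -/
theorem step [CharZero k] (ha : Function.Injective a) {h : ℕ} (b : Fin h → σ) (hb : Function.Injective b)
    (hab : ∀ i l, a i ≠ b l) (hs : ∀ j, (∃ i, a i = j) ∨ ∃ l, b l = j) {f : MvPowerSeries σ k} (hf : f ≠ 0)
    (M : ℕ) (hM : mI k σ ^ M ≤ bA k Φ f ⊔ Ideal.span (Set.range fun i => c.y (a i))) :
    ∃ s : MvPowerSeries (Fin e) k, s ≠ 0 ∧ c.rho a s ∈ bA k Φ f := by
  have hinj : Function.Injective ((al (MvPowerSeries σ k) Φ).comp (c.rho a).toRingHom) := by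
    rw [RingHom.coe_comp]
    exact (algR_inj _ Φ).comp (c.rho_inj a ha)
  let K := FractionRing (MvPowerSeries (Fin e) k)
  let alg : Algebra K Φ := (IsFractionRing.lift hinj : K →+* Φ).toAlgebra
  have hK : ∀ s, algebraMap K Φ (algebraMap (MvPowerSeries (Fin e) k) K s) = al (MvPowerSeries σ k) Φ (c.rho a s) := by
    intro s
    exact IsFractionRing.lift_algebraMap hinj s
  have hc : CharZero (MvPowerSeries (Fin e) k) := charZero_of_injective_algebraMap (algebraMap k (MvPowerSeries (Fin e) k)).injective
  have hcK : CharZero K := charZero_of_injective_algebraMap (IsFractionRing.injective (MvPowerSeries (Fin e) k) K)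
  exact hol_step (c.rho a) hK hf (fun i => c.dd (a i)) (fun i => MvPowerSeries.pderiv k i) (fun i s => c.rho_dd a ha i s)
    (fun l => c.dd (b l)) (fun l s => c.rho_dd_ne a (b l) (fun i => hab i l) s) (fun l l' r => c.comm _ _ r)
    (fun l => c.y (b l)) (fun l => c.dd_self _) (fun l l' hl => c.dd_ne _ _ (fun h => hl (hb h))) M
    (fun N r => c.hfin a b hb hs (bA k Φ f) M hM N r) (fun κ h => const_frac κ h)

end Coord
end coord
end
end LCF

namespace LCF
noncomputable section
set_option linter.unusedSectionVars false

lemma aeval_hom {k B τ : Type*} [Field k] [CommRing B] [Algebra k B] {d : ℕ} {G : MvPolynomial τ k}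
    (hG : G.IsHomogeneous d) (μ : τ → k) (c : B) :
    MvPolynomial.aeval (fun i => algebraMap k B (μ i) * c) G = c ^ d * algebraMap k B (MvPolynomial.eval μ G) := by
  rw [MvPolynomial.aeval_def, MvPolynomial.eval₂_eq, MvPolynomial.eval_eq, map_sum, Finset.mul_sum]
  refine Finset.sum_congr rfl fun α hα => ?_
  have h1 : ∑ i ∈ α.support, α i = d := by
    have := hG (MvPolynomial.mem_support_iff.mp hα)
    rw [Finsupp.weight_apply, Finsupp.sum] at this
    simpa using this
  rw [map_mul, map_prod]
  simp only [mul_pow, Finset.prod_mul_distrib, map_pow]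
  rw [Finset.prod_pow_eq_pow_sum, h1]
  ring

lemma der_sum_apply {k B ι : Type*} [CommRing k] [CommRing B] [Algebra k B] (t : Finset ι)
    (D : ι → Derivation k B B) (x : B) : (∑ i ∈ t, D i) x = ∑ i ∈ t, D i x := by
  classical
  induction t using Finset.induction_on with
  | empty => simp
  | insert a t ha ih => rw [Finset.sum_insert ha, Finset.sum_insert ha, Derivation.add_apply, ih]

section descent
variable {k : Type*} [Field k] {σ : Type*} [Finite σ]

namespace Coord
variable (c : Coord k σ)

/-- change of coordinates -/
def shear (ℓ : σ) (ν : σ → k) (hν : ν ℓ = 0) : Coord k σ := by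
  classical
  letI := Fintype.ofFinite σ
  exact
  { y := fun j => c.y j - algebraMap k _ (ν j) * c.y ℓ
    dd := fun j => if j = ℓ then c.dd ℓ + ∑ i, ν i • c.dd i else c.dd j
    span_y := by
      rw [← c.span_y]
      have hℓ : c.y ℓ ∈ Ideal.span (Set.range fun j => c.y j - algebraMap k _ (ν j) * c.y ℓ) := by
        refine Ideal.subset_span ⟨ℓ, ?_⟩
        simp [hν]
      refine le_antisymm ?_ ?_
      · rw [Ideal.span_le]
        rintro _ ⟨j, rfl⟩
        exact sub_mem (Ideal.subset_span ⟨j, rfl⟩) (Ideal.mul_mem_left _ _ (Ideal.subset_span ⟨ℓ, rfl⟩))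
      · rw [Ideal.span_le]
        rintro _ ⟨j, rfl⟩
        have := add_mem (Ideal.subset_span ⟨j, rfl⟩ : c.y j - algebraMap k _ (ν j) * c.y ℓ ∈ Ideal.span (Set.range fun j => c.y j - algebraMap k _ (ν j) * c.y ℓ))
          (Ideal.mul_mem_left _ (algebraMap k _ (ν j)) hℓ)
        rwa [sub_add_cancel] at this
    dd_self := by
      intro j
      have hsum : ∀ l, (∑ i, ν i • c.dd i) (c.y l) = algebraMap k _ (ν l) := by
        intro l
        rw [der_sum_apply, Finset.sum_eq_single l]
        · rw [Derivation.smul_apply, c.dd_self, Algebra.algebraMap_eq_smul_one]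
        · intro i _ hi
          rw [Derivation.smul_apply, c.dd_ne _ _ hi, smul_zero]
        · simp
      by_cases hj : j = ℓ
      · subst hj
        simp only [if_true, hν, map_zero, zero_mul, sub_zero]
        rw [Derivation.add_apply, c.dd_self, hsum, hν, map_zero, add_zero]
      · simp only [if_neg hj, map_sub, Derivation.leibniz, c.dd_self, c.dd_ne _ _ hj, Derivation.map_algebraMap]
        simp
    dd_ne := by
      intro i j hij
      have hsum : ∀ l, (∑ i, ν i • c.dd i) (c.y l) = algebraMap k _ (ν l) := by
        intro l
        rw [der_sum_apply, Finset.sum_eq_single l]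
        · rw [Derivation.smul_apply, c.dd_self, Algebra.algebraMap_eq_smul_one]
        · intro i _ hi
          rw [Derivation.smul_apply, c.dd_ne _ _ hi, smul_zero]
        · simp
      by_cases hi : i = ℓ
      · subst hi
        simp only [if_true]
        rw [map_sub, Derivation.leibniz, Derivation.map_algebraMap, Derivation.add_apply, Derivation.add_apply,
          hsum, hsum, c.dd_self, c.dd_ne _ _ hij, hν]
        simp
      · simp only [if_neg hi, map_sub, Derivation.leibniz, c.dd_ne _ _ hi, c.dd_ne _ _ hij, Derivation.map_algebraMap]
        simp }

lemma shear_y (ℓ : σ) (ν : σ → k) (hν : ν ℓ = 0) (j : σ) :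
    (c.shear ℓ ν hν).y j = c.y j - algebraMap k _ (ν j) * c.y ℓ := rfl

variable {Φ : Type*} [Field Φ] [Algebra (Polynomial (MvPowerSeries σ k)) Φ] [IsFractionRing (Polynomial (MvPowerSeries σ k)) Φ]

lemma mI_exists {e : ℕ} {s : MvPowerSeries (Fin e) k} (hs : s ≠ 0) : ∃ d, s ∈ mI k (Fin e) ^ d ∧ s ∉ mI k (Fin e) ^ (d + 1) := by
  classical
  have h : ∃ t, s ∉ mI k (Fin e) ^ t := by
    by_contra h
    push Not at h
    exact hs (ps_haus s h)
  have h0 : Nat.find h ≠ 0 := by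
    intro h1
    have := Nat.find_spec h
    rw [h1] at this
    simp at this
  refine ⟨Nat.find h - 1, ?_, ?_⟩
  · have := Nat.find_min h (m := Nat.find h - 1) (by omega)
    simpa using this
  · rw [Nat.sub_add_cancel (by omega)]
    exact Nat.find_spec h

variable (Φ) in
set_option maxHeartbeats 1000000 in
theorem descent [CharZero k] {f : MvPowerSeries σ k} (hf : f ≠ 0) (e : ℕ) : ∀ (c : Coord k σ) (a : Fin e → σ) (_ : Function.Injective a)
    (h : ℕ) (b : Fin h → σ) (_ : Function.Injective b)
    (_ : ∀ i l, a i ≠ b l) (_ : ∀ j, (∃ i, a i = j) ∨ ∃ l, b l = j)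
    (M : ℕ) (_ : mI k σ ^ M ≤ bA k Φ f ⊔ Ideal.span (Set.range fun i => c.y (a i))), bA k Φ f = ⊤ := by
  classical
  induction e with
  | zero =>
    intro c a ha h b hb hab hs M hM
    obtain ⟨s, hs0, hsb⟩ := c.step a Φ ha b hb hab hs hf M hM
    have h1 := ps_approx s
    rw [show (Set.range (MvPowerSeries.X (R := k) (σ := Fin 0))) = ∅ from Set.range_eq_empty _, Ideal.span_empty, Ideal.mem_bot, sub_eq_zero] at h1
    set t := MvPowerSeries.constantCoeff s with ht
    have ht0 : t ≠ 0 := by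
      intro h2
      rw [h2, map_zero] at h1
      exact hs0 h1
    have h2 : c.rho a s = algebraMap k _ t := by
      rw [h1]; exact (c.rho a).commutes t
    rw [h2] at hsb
    exact Ideal.eq_top_of_isUnit_mem _ hsb (IsUnit.map _ (isUnit_iff_ne_zero.mpr ht0))
  | succ e ih =>
    intro c a ha h b hb hab hs M hM
    obtain ⟨s, hs0, hsb⟩ := c.step a Φ ha b hb hab hs hf M hM
    obtain ⟨d, hd, hd'⟩ := mI_exists hs0
    obtain ⟨G, g1, -, g3⟩ := hom_approx (k := k) (MvPowerSeries.X (R := k)) ps_approx' d s hd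
    have hG : G ≠ 0 := by
      rintro rfl
      rw [map_zero, sub_zero] at g3
      exact hd' g3
    have hGX : G * MvPolynomial.X (Fin.last e) ≠ 0 := mul_ne_zero hG (MvPolynomial.X_ne_zero _)
    obtain ⟨lam, hlam⟩ : ∃ lam : Fin (e + 1) → k, MvPolynomial.eval lam (G * MvPolynomial.X (Fin.last e)) ≠ 0 := by
      by_contra hc
      push Not at hc
      exact hGX (MvPolynomial.funext fun x => by rw [hc, map_zero])
    rw [map_mul, MvPolynomial.eval_X] at hlam
    have hl0 : lam (Fin.last e) ≠ 0 := right_ne_zero_of_mul hlam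
    have hlG := left_ne_zero_of_mul hlam
    set μ : Fin (e + 1) → k := fun i => lam i / lam (Fin.last e) with hμ
    have hμl : μ (Fin.last e) = 1 := div_self hl0
    have hμG : MvPolynomial.eval μ G ≠ 0 := by
      intro h0
      have h1 := aeval_hom g1 μ (lam (Fin.last e))
      rw [h0, map_zero, mul_zero] at h1
      have h2 : (fun i => algebraMap k k (μ i) * lam (Fin.last e)) = lam := by
        funext i
        rw [hμ]
        simp only [Algebra.algebraMap_self, RingHom.id_apply]
        field_simp
      rw [h2, MvPolynomial.aeval_eq_eval] at h1
      exact hlG h1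
    set ℓ := a (Fin.last e) with hℓ
    have ha' : Function.Injective (a ∘ Fin.castSucc) := ha.comp (Fin.castSucc_injective e)
    set ν : σ → k := Function.extend (a ∘ Fin.castSucc) (fun i => μ i.castSucc) 0 with hν
    have hνℓ : ν ℓ = 0 := by
      rw [hν, Function.extend_apply']
      · rfl
      · rintro ⟨i, hi⟩
        have := ha hi
        exact absurd this (Fin.castSucc_lt_last i).ne
    have hνa : ∀ i : Fin e, ν (a i.castSucc) = μ i.castSucc := fun i => ha'.extend_apply _ _ i
    set c' := c.shear ℓ ν hνℓ with hc'
    set P := Ideal.span (Set.range fun i => c'.y ((a ∘ Fin.castSucc) i)) with hP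
    have hPi : ∀ i, c.y (a i) - algebraMap k _ (μ i) * c.y ℓ ∈ P := by
      intro i
      refine Fin.lastCases ?_ (fun i => ?_) i
      · rw [hμl, map_one, one_mul, sub_self]; exact zero_mem _
      · refine Ideal.subset_span ⟨i, ?_⟩
        show c'.y (a i.castSucc) = _
        rw [hc', shear_y, hνa]
    have hya : Ideal.span (Set.range fun i => c.y (a i)) ≤ Ideal.span {c.y ℓ} ⊔ P := by
      rw [Ideal.span_le]
      rintro _ ⟨i, rfl⟩
      have := add_mem (Ideal.mem_sup_right (hPi i) : _ ∈ Ideal.span {c.y ℓ} ⊔ P)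
        (Ideal.mem_sup_left (Ideal.mul_mem_left _ (algebraMap k _ (μ i)) (Ideal.mem_span_singleton_self (c.y ℓ))))
      rwa [sub_add_cancel] at this
    have h1 : c.rho a s - MvPolynomial.aeval (fun i => c.y (a i)) G ∈ Ideal.span {c.y ℓ} ^ (d + 1) ⊔ P := by
      refine (Ideal.pow_right_mono hya (d + 1)).trans (sup_pow_le _ _ _) ?_
      rw [← rho_map, ← Ideal.map_pow]
      have h2 := Ideal.mem_map_of_mem (c.rho a).toRingHom g3
      have h3 : (c.rho a).toRingHom (s - MvPolynomial.aeval MvPowerSeries.X G) = c.rho a s - MvPolynomial.aeval (fun i => c.y (a i)) G := by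
        show c.rho a (s - MvPolynomial.aeval MvPowerSeries.X G) = _
        rw [map_sub, ← AlgHom.comp_apply, MvPolynomial.comp_aeval]
        simp only [rho_X]
      rw [h3] at h2
      exact h2
    have h2 : MvPolynomial.aeval (fun i => c.y (a i)) G - c.y ℓ ^ d * algebraMap k _ (MvPolynomial.eval μ G) ∈ P := by
      rw [← aeval_hom g1, ← Ideal.Quotient.eq, ← Ideal.Quotient.mkₐ_eq_mk k, ← AlgHom.comp_apply, ← AlgHom.comp_apply,
        MvPolynomial.comp_aeval, MvPolynomial.comp_aeval]
      congr 2
      funext i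
      exact Ideal.Quotient.eq.mpr (hPi i)
    have h3 : c.rho a s - c.y ℓ ^ d * algebraMap k _ (MvPolynomial.eval μ G) ∈ Ideal.span {c.y ℓ} ^ (d + 1) ⊔ P := by
      have := add_mem h1 (Ideal.mem_sup_right h2 : _ ∈ Ideal.span {c.y ℓ} ^ (d + 1) ⊔ P)
      rwa [sub_add_sub_cancel] at this
    obtain ⟨u, hu, p, hp, hup⟩ := Submodule.mem_sup.mp h3
    rw [Ideal.span_singleton_pow, Ideal.mem_span_singleton] at hu
    obtain ⟨r, rfl⟩ := hu
    have h4 : c.y ℓ ^ d * (algebraMap k _ (MvPolynomial.eval μ G) + c.y ℓ * r) ∈ bA k Φ f ⊔ P := by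
      have e1 : c.y ℓ ^ d * (algebraMap k _ (MvPolynomial.eval μ G) + c.y ℓ * r) = c.rho a s - p := by
        rw [pow_succ] at hup
        linear_combination hup
      rw [e1]
      exact sub_mem (Ideal.mem_sup_left hsb) (Ideal.mem_sup_right hp)
    have hun : IsUnit (algebraMap k (MvPowerSeries σ k) (MvPolynomial.eval μ G) + c.y ℓ * r) := by
      rw [MvPowerSeries.isUnit_iff_constantCoeff, map_add, map_mul, (mem_mI _).mp (c.y_mem ℓ), zero_mul, add_zero,
        isUnit_iff_ne_zero, MvPowerSeries.algebraMap_apply]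
      simpa using hμG
    have h5 : c.y ℓ ^ d ∈ bA k Φ f ⊔ P := (Ideal.mul_unit_mem_iff_mem _ hun).mp h4
    refine ih c' (a ∘ Fin.castSucc) ha' (h + 1) (Fin.cons ℓ b) ?_ ?_ ?_ (M * d) ?_
    · rw [Fin.cons_injective_iff]
      refine ⟨?_, hb⟩
      rintro ⟨l, hl⟩
      exact hab _ _ hl.symm
    · intro i l
      refine Fin.cases ?_ (fun l => ?_) l
      · rw [Fin.cons_zero]
        intro h0
        exact absurd (ha h0) (Fin.castSucc_lt_last i).ne
      · rw [Fin.cons_succ]; exact hab _ _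
    · intro j
      rcases hs j with ⟨i, rfl⟩ | ⟨l, rfl⟩
      · refine Fin.lastCases ?_ (fun i => ?_) i
        · right; exact ⟨0, by rw [Fin.cons_zero]⟩
        · left; exact ⟨i, rfl⟩
      · right; exact ⟨l.succ, by rw [Fin.cons_succ]⟩
    · have h6 : mI k σ ^ M ≤ Ideal.span {c.y ℓ} ⊔ (bA k Φ f ⊔ P) := by
        refine hM.trans (sup_le (le_sup_left.trans le_sup_right) (hya.trans ?_))
        exact sup_le le_sup_left (le_sup_right.trans le_sup_right)
      rw [pow_mul]
      refine (Ideal.pow_right_mono h6 d).trans ((sup_pow_le _ _ _).trans (sup_le ?_ le_rfl))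
      rw [Ideal.span_singleton_pow, Ideal.span_singleton_le_iff_mem]
      exact h5

end Coord

variable (k σ) in
/-- standard coordinates -/
def stdCoord : Coord k σ where
  y := MvPowerSeries.X
  dd := fun i => MvPowerSeries.pderiv k i
  span_y := rfl
  dd_self := fun i => MvPowerSeries.pderiv_X_self
  dd_ne := fun i j h => MvPowerSeries.pderiv_X_of_ne h.symm

variable {Φ : Type*} [Field Φ] [Algebra (Polynomial (MvPowerSeries σ k)) Φ] [IsFractionRing (Polynomial (MvPowerSeries σ k)) Φ]

variable (Φ) in
/-- existence of a functional equation -/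
theorem bA_top [CharZero k] {f : MvPowerSeries σ k} (hf : f ≠ 0) : (1 : MvPowerSeries σ k) ∈ bA k Φ f := by
  have := Fintype.ofFinite σ
  let eq := Fintype.equivFin σ
  have := Coord.descent Φ hf _ (stdCoord k σ) eq.symm eq.symm.injective 0 Fin.elim0 (fun i => i.elim0)
    (fun i l => l.elim0) (fun j => Or.inl ⟨eq j, by simp⟩) 1 (by
      rw [pow_one]
      refine le_trans (le_of_eq ?_) le_sup_right
      rw [← (stdCoord k σ).span_y]
      congr 1
      ext x
      constructor
      · rintro ⟨j, rfl⟩; exact ⟨eq j, by simp⟩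
      · rintro ⟨j, rfl⟩; exact ⟨_, rfl⟩)
  rw [this]; trivial

end descent
end
end LCF

namespace LCF
noncomputable section
set_option linter.unusedSectionVars false

section spec
variable {k R : Type*} [Field k] [CommRing R] [IsDomain R] [Algebra k R] {L : Type*} [CommRing L] [Algebra R L]
variable {Φ : Type*} [Field Φ] [Algebra (Polynomial R) Φ] [IsFractionRing (Polynomial R) Φ]

variable (Φ) in
/-- specialization -/
def Qsp (f : R) (a : L) (haf : algebraMap R L f * a = 1) (b : ℕ) (N : Submodule R L) : AddSubgroup Φ where
  carrier := {g | ∃ (j : ℕ) (q : Polynomial R), al _ Φ f ^ j * g = algebraMap _ Φ q ∧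
    algebraMap R L (q.eval (-(b : R))) * a ^ (j + b) ∈ N}
  zero_mem' := ⟨0, 0, by simp, by simp⟩
  neg_mem' := by
    rintro g ⟨j, q, h, h'⟩
    refine ⟨j, -q, by rw [mul_neg, h, map_neg], ?_⟩
    simpa using h'
  add_mem' := by
    rintro g g' ⟨j, q, h, h'⟩ ⟨j', q', h1, h1'⟩
    refine ⟨j + j', Polynomial.C f ^ j' * q + Polynomial.C f ^ j * q', ?_, ?_⟩
    · rw [map_add, map_mul, map_mul, ← h, ← h1, map_pow, map_pow, ← algR]
      ring
    · have e : ∀ j, algebraMap R L f ^ j * a ^ j = 1 := fun j => by rw [← mul_pow, haf, one_pow]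
      convert add_mem h' h1' using 1
      simp only [Polynomial.eval_add, Polynomial.eval_mul, Polynomial.eval_pow, Polynomial.eval_C, map_add, map_mul, map_pow]
      linear_combination (algebraMap R L (q.eval (-(b : R))) * a ^ (j + b)) * e j' +
        (algebraMap R L (q'.eval (-(b : R))) * a ^ (j' + b)) * e j

lemma ev_dco (b : ℕ) (D : Derivation k R R) (q : Polynomial R) :
    (dco (D.restrictScalars ℤ) q).eval (-(b : R)) = D (q.eval (-(b : R))) := by
  induction q using Polynomial.induction_on' with
  | add p q hp hq => rw [map_add, Polynomial.eval_add, hp, hq, Polynomial.eval_add, map_add]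
  | monomial n r =>
    rw [dco_monomial, Polynomial.eval_monomial, Polynomial.eval_monomial, Derivation.leibniz, Derivation.leibniz_pow]
    simp [mul_comm]

variable (Φ) in
lemma Yf_Qsp {f : R} (hf : f ≠ 0) (a : L) (haf : algebraMap R L f * a = 1) (b : ℕ)
    (N : Submodule R L) (hN : ∀ D : Derivation k R R, ∃ E : Derivation ℤ L L, (∀ r, E (algebraMap R L r) = algebraMap R L (D r)) ∧ ∀ v ∈ N, E v ∈ N) (hab : a ^ b ∈ N) (c : ℕ) (g : Φ) (hg : g ∈ Yf k Φ f c) :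
    g ∈ Qsp Φ f a haf b N := by
  refine Yf_le (k := k) f (fun _ => Qsp Φ f a haf b N) ?_ (fun _ => le_rfl) ?_ ?_ c g hg
  · intro p
    refine ⟨0, p, by simp, ?_⟩
    rw [← Algebra.smul_def, zero_add]
    exact N.smul_mem _ hab
  · rintro c p g ⟨j, q, h, h'⟩
    refine ⟨j, p * q, ?_, ?_⟩
    · rw [Algebra.smul_def, mul_left_comm, h, map_mul]
    · rw [Polynomial.eval_mul, map_mul, mul_assoc, ← Algebra.smul_def]
      exact N.smul_mem _ h'
  · rintro c D g ⟨j, q, h, h'⟩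
    refine ⟨j + 1, Polynomial.C f * dco (D.restrictScalars ℤ) q + (Polynomial.X - (j : Polynomial R)) * Polynomial.C (D f) * q, ?_, ?_⟩
    · have h1 := congrArg (dP Φ D) h
      rw [dP_poly, Derivation.leibniz, Derivation.leibniz_pow, dP_alg] at h1
      have hf0 : al _ Φ f ≠ 0 := by
        intro h0
        exact hf (algR_inj _ Φ (by rw [h0, map_zero]))
      simp only [smul_eq_mul, nsmul_eq_mul] at h1
      rw [nab_def, map_add, map_mul, map_mul, map_mul, ← h1, ← h, ← algR, ← algR, map_sub, map_natCast]
      change _ = _ + (sX _ Φ - _) * _ * _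
      rcases j with _ | j
      · simp only [zero_add, pow_zero, pow_one, Nat.cast_zero]; field_simp; ring
      · have : j + 1 - 1 = j := rfl
        rw [this]; field_simp; ring
    · set r := q.eval (-(b : R)) with hr
      obtain ⟨E, hE, hEN⟩ := hN D
      have da : E a = - a ^ 2 * algebraMap R L (D f) := by
        have := congrArg E haf
        rw [Derivation.leibniz, hE, Derivation.map_one_eq_zero] at this
        simp only [smul_eq_mul] at this
        linear_combination a * this - (E a) * haf
      convert hEN _ h' using 1
      rw [Derivation.leibniz, Derivation.leibniz_pow, hE, da]
      simp only [smul_eq_mul, nsmul_eq_mul]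
      simp only [Polynomial.eval_add, Polynomial.eval_mul, Polynomial.eval_C, Polynomial.eval_sub, Polynomial.eval_X,
        Polynomial.eval_natCast, ev_dco, ← hr, map_add, map_mul, map_sub, map_neg, map_natCast]
      have e : a ^ (j + 1 + b) = a * a ^ (j + b) := by ring
      rw [e]
      rcases hjb : j + b with _ | m
      · have h0 : j = 0 := by omega
        have h0' : b = 0 := by omega
        subst h0 h0'
        simp
        linear_combination (algebraMap R L (D r)) * haf
      · have : m + 1 - 1 = m := rfl
        have hh : (j : L) = m + 1 - b := by
          rw [eq_sub_iff_add_eq]; have := congrArg (Nat.cast (R := L)) hjb; push_cast at this; exact this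
        rw [this, hh]
        push_cast
        linear_combination (algebraMap R L (D r) * a ^ (m + 1)) * haf

theorem gen_step_aux [CharZero k] {f : R} (hf : f ≠ 0) (a : L) (haf : algebraMap R L f * a = 1)
    (h : (1 : R) ∈ bA k Φ f) : ∃ b0, ∀ b ≥ b0, ∀ N : Submodule R L, (∀ D : Derivation k R R, ∃ E : Derivation ℤ L L, (∀ r, E (algebraMap R L r) = algebraMap R L (D r)) ∧ ∀ v ∈ N, E v ∈ N) → a ^ b ∈ N → a ^ (b + 1) ∈ N := by
  rw [mem_bA] at h
  obtain ⟨c, p, hp, h⟩ := mem_YY.mp h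
  classical
  have hfin : {b : ℕ | p.eval (-(b : k)) = 0}.Finite := by
    refine Set.Finite.of_finite_image (f := fun b : ℕ => -(b : k)) (p.roots.toFinset.finite_toSet.subset ?_) ?_
    · rintro _ ⟨b, hb, rfl⟩
      simpa [hp] using hb
    · intro b _ b' _ h
      simpa using h
  obtain ⟨b0, hb0⟩ := hfin.bddAbove
  refine ⟨b0 + 1, fun b hb N hN hab => ?_⟩
  obtain ⟨j, q, h1, h2⟩ := Yf_Qsp Φ hf a haf b N hN hab c _ h
  have hf0 : al _ Φ f ≠ 0 := by
    intro h0
    exact hf (algR_inj _ Φ (by rw [h0, map_zero]))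
  have h3 : Polynomial.C f ^ j * p.map (algebraMap k _) = Polynomial.C f * q := by
    apply IsFractionRing.injective (Polynomial R) Φ
    rw [map_mul, map_mul, ← h1, map_pow, ← algR]
    change al _ Φ f ^ j * kp _ Φ p = _
    rw [map_one]
    field_simp
  have h4 := congrArg (Polynomial.eval (-(b : R))) h3
  have h5 : (p.map (algebraMap k R)).eval (-(b : R)) = algebraMap k _ (p.eval (-(b : k))) := by
    rw [Polynomial.eval_map, show (-(b : R)) = algebraMap k _ (-(b : k)) by simp, Polynomial.eval₂_at_apply]
  rw [Polynomial.eval_mul, Polynomial.eval_mul, Polynomial.eval_pow, Polynomial.eval_C, h5] at h4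
  have h6 := congrArg (algebraMap R L) h4
  rw [map_mul, map_mul, map_pow] at h6
  have e : ∀ j, algebraMap R L f ^ j * a ^ j = 1 := fun j => by rw [← mul_pow, haf, one_pow]
  have h7 : algebraMap R L (q.eval (-(b : R))) * a ^ (j + b) = (algebraMap k R (p.eval (-(b : k)))) • a ^ (b + 1) := by
    rw [Algebra.smul_def]
    linear_combination (- a ^ (j + b + 1)) * h6 - algebraMap R L (q.eval (-(b : R))) * a ^ (j + b) * haf
      + (algebraMap R L (algebraMap k R (p.eval (-(b : k)))) * a ^ (b + 1)) * e j
  rw [h7] at h2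
  have hne : p.eval (-(b : k)) ≠ 0 := fun h0 => by
    have := hb0 h0
    omega
  have := N.smul_mem (algebraMap k R (p.eval (-(b : k)))⁻¹) h2
  rwa [smul_smul, ← map_mul, inv_mul_cancel₀ hne, map_one, one_smul] at this

end spec

section spec2
variable {k : Type*} [Field k] {σ : Type*} [Finite σ]

lemma hd_one (i : σ) (r : MvPowerSeries σ k) : hd i 1 r = MvPowerSeries.pderiv k i r := by
  ext m
  rw [coeff_hd, MvPowerSeries.coeff_pderiv]
  simp [mul_comm]

lemma der_std [Fintype σ] (D : Derivation k (MvPowerSeries σ k) (MvPowerSeries σ k)) (r : MvPowerSeries σ k) :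
    D r = ∑ i, D (MvPowerSeries.X i) * hd i 1 r := by
  classical
  have := (stdCoord k σ).ext_zero (D - ∑ i, D (MvPowerSeries.X i) • MvPowerSeries.pderiv k i) (by
    intro j
    show (D - ∑ i, D (MvPowerSeries.X i) • MvPowerSeries.pderiv k i) (MvPowerSeries.X j) = 0
    rw [Derivation.sub_apply, der_sum_apply, Finset.sum_eq_single j, Derivation.smul_apply,
      MvPowerSeries.pderiv_X_self]
    · simp
    · intro i _ hi
      rw [Derivation.smul_apply, MvPowerSeries.pderiv_X_of_ne (Ne.symm hi), smul_zero]
    · simp) r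
  rw [Derivation.sub_apply, der_sum_apply, sub_eq_zero] at this
  rw [this]
  simp [hd_one]

variable {L : Type*} [CommRing L] [Algebra (MvPowerSeries σ k) L]

/-- first order part -/
def TayRing.d1 (TR : TayRing σ k L) (i : σ) : Derivation ℤ L L :=
  Derivation.mk' (AddMonoidHom.toIntLinearMap (TR.D i 1)) (by
    intro a b
    show TR.D i 1 (a * b) = _
    rw [TR.D_mul]
    simp [Finset.Nat.antidiagonal_succ, TR.D_zero]
    ring)

lemma TayRing.d1_apply (TR : TayRing σ k L) (i : σ) (v : L) : TR.d1 i v = TR.D i 1 v := rfl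

lemma TayRing.d1_alg (TR : TayRing σ k L) (i : σ) (r : MvPowerSeries σ k) : TR.d1 i (algebraMap _ L r) = algebraMap _ L (hd i 1 r) := by
  rw [TR.d1_apply, TR.D_alg]

/-- first order stability -/
def TayRing.S1 (TR : TayRing σ k L) (N : Submodule (MvPowerSeries σ k) L) : Prop := ∀ i, ∀ v ∈ N, TR.d1 i v ∈ N

theorem gen_step [CharZero k] (TR : TayRing σ k L) {f : MvPowerSeries σ k} (hf : f ≠ 0) (a : L) (haf : algebraMap _ L f * a = 1) :
    ∃ b0, ∀ b ≥ b0, ∀ N : Submodule (MvPowerSeries σ k) L, TR.S1 N → a ^ b ∈ N → a ^ (b + 1) ∈ N :=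
by
  have := Fintype.ofFinite σ
  obtain ⟨b0, h⟩ := gen_step_aux (L := L) (Φ := FractionRing (Polynomial (MvPowerSeries σ k))) hf a haf (bA_top _ hf)
  refine ⟨b0, fun b hb N hN => h b hb N fun D => ?_⟩
  refine ⟨∑ i, algebraMap _ L (D (MvPowerSeries.X i)) • TR.d1 i, ?_, ?_⟩
  · intro r
    rw [der_sum_apply, der_std D r, map_sum]
    refine Finset.sum_congr rfl fun i _ => ?_
    rw [Derivation.smul_apply, TR.d1_alg, map_mul, smul_eq_mul]
  · intro v hv
    rw [der_sum_apply]
    refine N.sum_mem fun i _ => ?_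
    rw [Derivation.smul_apply, smul_eq_mul, ← Algebra.smul_def]
    exact N.smul_mem _ (hN i v hv)

theorem gen_top [CharZero k] (TR : TayRing σ k L) {f : MvPowerSeries σ k} (hf : f ≠ 0) [IsLocalization.Away f L] :
    ∃ u : L, ∀ N : Submodule (MvPowerSeries σ k) L, TR.S1 N → u ∈ N → N = ⊤ := by
  obtain ⟨b0, h⟩ := gen_step TR hf (IsLocalization.Away.invSelf f) (IsLocalization.Away.mul_invSelf f)
  refine ⟨IsLocalization.Away.invSelf f ^ b0, fun N hN hu => ?_⟩
  have h1 : ∀ j, (IsLocalization.Away.invSelf f : L) ^ (b0 + j) ∈ N := by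
    intro j
    induction j with
    | zero => exact hu
    | succ j ih => exact h _ (Nat.le_add_right _ _) N hN ih
  rw [eq_top_iff]
  intro u _
  obtain ⟨j, r, hr⟩ := TayRing.exists_inv_form f u
  have e : ∀ j, algebraMap _ L f ^ j * IsLocalization.Away.invSelf f ^ j = 1 := fun j => by
    rw [← mul_pow, IsLocalization.Away.mul_invSelf, one_pow]
  have : u = (r * f ^ b0) • (IsLocalization.Away.invSelf f : L) ^ (b0 + j) := by
    rw [Algebra.smul_def, map_mul, map_pow, ← hr]
    have e1 := e j
    have e2 := e b0
    rw [pow_add]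
    linear_combination (-u) * e1 - u * algebraMap _ L f ^ j * (IsLocalization.Away.invSelf f : L) ^ j * e2
  rw [this]
  exact N.smul_mem _ (h1 j)
end spec2
end
end LCF

namespace LCF
noncomputable section
set_option linter.unusedSectionVars false

lemma exists_multi {σ M : Type*} [AddCommGroup M] (d : σ → M →+ M) (hc : ∀ i j v, d i (d j v) = d j (d i v)) (u : M) :
    ∃ w : (σ →₀ ℕ) → M, w 0 = u ∧ ∀ α i, w (α + Finsupp.single i 1) = d i (w α) := by
  let s : Set (Module.End ℤ M) := Set.range fun i => (d i).toIntLinearMap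
  have hcomm : ∀ a ∈ s, ∀ b ∈ s, a * b = b * a := by
    rintro _ ⟨i, rfl⟩ _ ⟨j, rfl⟩
    ext v
    exact hc i j v
  have hmc := Algebra.isMulCommutative_adjoin ℤ hcomm
  let inst : CommMonoid (Algebra.adjoin ℤ s) :=
    { (inferInstance : Monoid (Algebra.adjoin ℤ s)) with mul_comm := fun a b => hmc.is_comm.comm a b }
  let X : σ → Algebra.adjoin ℤ s := fun i => ⟨(d i).toIntLinearMap, Algebra.subset_adjoin ⟨i, rfl⟩⟩
  refine ⟨fun α => (α.prod fun i n => X i ^ n : Algebra.adjoin ℤ s).1 u, ?_, ?_⟩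
  · simp
  · intro α i
    have h1 : ((α + Finsupp.single i 1).prod fun i n => X i ^ n) = X i * (α.prod fun i n => X i ^ n) := by
      rw [Finsupp.prod_add_index' (h := fun i n => X i ^ n) (fun a => pow_zero _) (fun a b c => pow_add _ _ _),
        Finsupp.prod_single_index (h := fun i n => X i ^ n) (pow_zero _), pow_one, mul_comm]
    simp only [h1]
    rfl

section gr
variable {σ R : Type*} [CommRing R] (δ : σ → R →+ R)

/-- coefficientwise map -/
def mco (δ : R →+ R) : MvPolynomial σ R →+ MvPolynomial σ R :=
  AddMonoidHom.mk' (fun p => ∑ α ∈ p.support, MvPolynomial.monomial α (δ (p.coeff α))) (by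
    classical
    have h : ∀ (p : MvPolynomial σ R) β, (∑ α ∈ p.support, MvPolynomial.monomial α (δ (p.coeff α))).coeff β = δ (p.coeff β) := by
      intro p β
      rw [MvPolynomial.coeff_sum]
      simp only [MvPolynomial.coeff_monomial]
      rw [Finset.sum_ite_eq']
      split_ifs with h
      · rfl
      · rw [MvPolynomial.notMem_support_iff.mp h, map_zero]
    intro p q
    ext β
    rw [h, MvPolynomial.coeff_add, MvPolynomial.coeff_add, h, h, map_add])

lemma coeff_mco (δ : R →+ R) (p : MvPolynomial σ R) (β : σ →₀ ℕ) : (mco δ p).coeff β = δ (p.coeff β) := by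
  classical
  change (∑ α ∈ p.support, MvPolynomial.monomial α (δ (p.coeff α))).coeff β = δ (p.coeff β)
  rw [MvPolynomial.coeff_sum]
  simp only [MvPolynomial.coeff_monomial]
  rw [Finset.sum_ite_eq']
  split_ifs with h
  · rfl
  · rw [MvPolynomial.notMem_support_iff.mp h, map_zero]

lemma mco_monomial (δ : R →+ R) (α : σ →₀ ℕ) (r : R) : mco δ (MvPolynomial.monomial α r) = MvPolynomial.monomial α (δ r) := by
  classical
  ext β
  rw [coeff_mco, MvPolynomial.coeff_monomial, MvPolynomial.coeff_monomial]
  split_ifs <;> simp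

/-- operators -/
def thet (i : σ) : MvPolynomial σ R →+ MvPolynomial σ R := AddMonoidHom.mulLeft (MvPolynomial.X i) + mco (δ i)

lemma thet_apply (i : σ) (p : MvPolynomial σ R) : thet δ i p = MvPolynomial.X i * p + mco (δ i) p := rfl

/-- symbol ideal -/
def symb (N : Submodule R (MvPolynomial σ R)) (hN : ∀ i, ∀ p ∈ N, thet δ i p ∈ N) : Ideal (MvPolynomial σ R) where
  carrier := {q | ∀ d : ℕ, ∃ p ∈ N, (∀ α : σ →₀ ℕ, d < α.degree → p.coeff α = 0) ∧
    ∀ α : σ →₀ ℕ, α.degree = d → p.coeff α = q.coeff α}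
  zero_mem' := fun d => ⟨0, zero_mem _, by simp, by simp⟩
  add_mem' := by
    intro q q' h h' d
    obtain ⟨p, hp, h1, h2⟩ := h d
    obtain ⟨p', hp', h1', h2'⟩ := h' d
    refine ⟨p + p', add_mem hp hp', fun α hα => ?_, fun α hα => ?_⟩
    · rw [MvPolynomial.coeff_add, h1 α hα, h1' α hα, add_zero]
    · rw [MvPolynomial.coeff_add, h2 α hα, h2' α hα, MvPolynomial.coeff_add]
  smul_mem' := by
    classical
    intro c q
    rw [smul_eq_mul]
    induction c using MvPolynomial.induction_on generalizing q with
    | C r =>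
      intro h d
      obtain ⟨p, hp, h1, h2⟩ := h d
      refine ⟨r • p, N.smul_mem r hp, fun α hα => ?_, fun α hα => ?_⟩
      · rw [MvPolynomial.coeff_smul, h1 α hα, smul_zero]
      · rw [MvPolynomial.coeff_smul, h2 α hα, MvPolynomial.coeff_C_mul, smul_eq_mul]
    | add a b ha hb =>
      intro h d
      obtain ⟨p, hp, h1, h2⟩ := ha h d
      obtain ⟨p', hp', h1', h2'⟩ := hb h d
      refine ⟨p + p', add_mem hp hp', fun α hα => ?_, fun α hα => ?_⟩
      · rw [MvPolynomial.coeff_add, h1 α hα, h1' α hα, add_zero]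
      · rw [MvPolynomial.coeff_add, h2 α hα, h2' α hα, ← MvPolynomial.coeff_add, add_mul]
    | mul_X a i ha =>
      intro h
      rw [mul_assoc]
      refine ha ?_
      have hdeg : ∀ α : σ →₀ ℕ, i ∈ α.support → α.degree = (α - Finsupp.single i 1).degree + 1 := by
        intro α hα
        have h1 : Finsupp.single i 1 ≤ α := by
          rw [Finsupp.single_le_iff]
          have := Finsupp.mem_support_iff.mp hα
          omega
        conv_lhs => rw [← tsub_add_cancel_of_le h1]
        rw [map_add, Finsupp.degree_single]
      intro d
      rcases d with _ | d
      · refine ⟨0, zero_mem _, by simp, fun α hα => ?_⟩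
        rw [MvPolynomial.coeff_X_mul', if_neg, MvPolynomial.coeff_zero]
        intro h2
        have := hdeg α h2
        omega
      · obtain ⟨p, hp, h1, h2⟩ := h d
        refine ⟨thet δ i p, hN i p hp, fun α hα => ?_, fun α hα => ?_⟩
        · rw [thet_apply, MvPolynomial.coeff_add, coeff_mco, h1 α (by omega), map_zero, add_zero, MvPolynomial.coeff_X_mul']
          split_ifs with h3
          · exact h1 _ (by have := hdeg α h3; omega)
          · rfl
        · rw [thet_apply, MvPolynomial.coeff_add, coeff_mco, h1 α (by omega), map_zero, add_zero, MvPolynomial.coeff_X_mul', MvPolynomial.coeff_X_mul']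
          split_ifs with h3
          · exact h2 _ (by have := hdeg α h3; omega)
          · rfl

lemma symb_mono {N N' : Submodule R (MvPolynomial σ R)} (hN : ∀ i, ∀ p ∈ N, thet δ i p ∈ N) (hN' : ∀ i, ∀ p ∈ N', thet δ i p ∈ N')
    (h : N ≤ N') : symb δ N hN ≤ symb δ N' hN' := by
  intro q hq d
  obtain ⟨p, hp, h1, h2⟩ := hq d
  exact ⟨p, h hp, h1, h2⟩

lemma symb_eq {N N' : Submodule R (MvPolynomial σ R)} (hN : ∀ i, ∀ p ∈ N, thet δ i p ∈ N) (hN' : ∀ i, ∀ p ∈ N', thet δ i p ∈ N')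
    (h : N ≤ N') (he : symb δ N hN = symb δ N' hN') : N = N' := by
  refine le_antisymm h ?_
  have key : ∀ d : ℕ, ∀ p ∈ N', (∀ α : σ →₀ ℕ, d ≤ α.degree → p.coeff α = 0) → p ∈ N := by
    intro d
    induction d with
    | zero =>
      intro p _ h0
      have : p = 0 := by ext α; simpa using h0 α (Nat.zero_le _)
      rw [this]; exact zero_mem _
    | succ d ih =>
      intro p hp h0
      have hq : MvPolynomial.homogeneousComponent d p ∈ symb δ N' hN' := by
        intro d'
        by_cases hd : d' = d
        · subst hd
          refine ⟨p, hp, fun α hα => h0 α hα, fun α hα => ?_⟩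
          rw [MvPolynomial.coeff_homogeneousComponent, if_pos hα]
        · refine ⟨0, zero_mem _, by simp, fun α hα => ?_⟩
          rw [MvPolynomial.coeff_homogeneousComponent, if_neg (by omega), MvPolynomial.coeff_zero]
      rw [← he] at hq
      obtain ⟨p', hp', h1, h2⟩ := hq d
      have h3 : p - p' ∈ N := by
        refine ih _ (sub_mem hp (h hp')) fun α hα => ?_
        rw [MvPolynomial.coeff_sub]
        rcases hα.lt_or_eq with h4 | h4
        · rw [h0 α h4, h1 α h4, sub_zero]
        · rw [h2 α h4.symm, MvPolynomial.coeff_homogeneousComponent, if_pos h4.symm, sub_self]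
      simpa using add_mem h3 hp'
  intro p hp
  refine key (p.totalDegree + 1) p hp fun α hα => ?_
  by_contra hne
  have := MvPolynomial.le_totalDegree (MvPolynomial.mem_support_iff.mpr hne)
  rw [Finsupp.degree_apply] at hα
  rw [Finsupp.sum] at this
  omega

theorem acc_cyclic [Finite σ] [IsNoetherianRing R] {M : Type*} [AddCommGroup M] [Module R M] (d : σ → M →+ M)
    (hc : ∀ i j v, d i (d j v) = d j (d i v)) (hd : ∀ i (r : R) v, d i (r • v) = r • d i v + δ i r • v)
    (u : M) (hu : ∀ N : Submodule R M, (∀ i, ∀ v ∈ N, d i v ∈ N) → u ∈ N → N = ⊤) :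
    ACC {N : Submodule R M | ∀ i, ∀ v ∈ N, d i v ∈ N} := by
  classical
  obtain ⟨w, hw0, hw⟩ := exists_multi d hc u
  let F : MvPolynomial σ R →ₗ[R] M := (MvPolynomial.basisMonomials σ R).constr R w
  have hF : ∀ α r, F (MvPolynomial.monomial α r) = r • w α := by
    intro α r
    have : MvPolynomial.monomial α r = r • MvPolynomial.basisMonomials σ R α := by simp [MvPolynomial.smul_monomial]
    rw [this, map_smul, Module.Basis.constr_basis]
  have hFt : ∀ i p, F (thet δ i p) = d i (F p) := by
    intro i p
    induction p using MvPolynomial.induction_on' with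
    | monomial α r =>
      rw [thet_apply, map_add, mco_monomial, MvPolynomial.X, MvPolynomial.monomial_mul, hF, hF, hF, hd, one_mul, add_comm _ α, hw]
    | add p q hp hq => rw [map_add, map_add, hp, hq, map_add, map_add]
  have hsur : Function.Surjective F := by
    rw [← LinearMap.range_eq_top]
    refine hu _ ?_ ?_
    · rintro i _ ⟨p, rfl⟩
      exact ⟨_, hFt i p⟩
    · exact ⟨MvPolynomial.monomial 0 1, by rw [hF, one_smul, hw0]⟩
  have hst : ∀ N : Submodule R M, (∀ i, ∀ v ∈ N, d i v ∈ N) → ∀ i, ∀ p ∈ N.comap F, thet δ i p ∈ N.comap F := by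
    intro N hN i p hp
    rw [Submodule.mem_comap, hFt]
    exact hN i _ hp
  have hT : ACC (Set.univ : Set (Ideal (MvPolynomial σ R))) := by
    intro c hc _
    obtain ⟨n, hn⟩ := monotone_stabilizes_iff_noetherian.mpr (inferInstance : IsNoetherian (MvPolynomial σ R) (MvPolynomial σ R)) ⟨c, hc⟩
    exact ⟨n, fun m hm => (hn m hm).symm⟩
  refine hT.of_one (fun N => if h : ∀ i, ∀ v ∈ N, d i v ∈ N then symb δ (N.comap F) (hst N h) else ⊥) ?_ (fun _ _ => trivial) ?_
  · intro N hN N' hN' h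
    rw [Set.mem_ofPred_eq] at hN hN'
    simp only [dif_pos hN, dif_pos hN']
    exact symb_mono δ _ _ (Submodule.comap_mono h)
  · intro N hN N' hN' h he
    rw [Set.mem_ofPred_eq] at hN hN'
    simp only [dif_pos hN, dif_pos hN'] at he
    exact Submodule.comap_injective_of_surjective hsur (symb_eq δ _ _ (Submodule.comap_mono h) he)
end gr

section fin
variable {k : Type*} [Field k] {σ : Type*} [Finite σ] {L : Type*} [CommRing L] [Algebra (MvPowerSeries σ k) L]

theorem TayRing.acc_stable_char0 [CharZero k] (f : MvPowerSeries σ k) (hf : f ≠ 0)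
    [IsLocalization.Away f L] (TR : TayRing σ k L) : ACC {N | TR.Stable N} := by
  obtain ⟨u, hu⟩ := gen_top TR hf
  have hc0 : ∀ i j (r : MvPowerSeries σ k), hd i 1 (hd j 1 r) = hd j 1 (hd i 1 r) := by
    intro i j r
    ext m
    rw [coeff_hd, coeff_hd, coeff_hd, coeff_hd, add_right_comm]
    by_cases hij : i = j
    · subst hij; rfl
    · simp [Ne.symm hij, hij]; ring
  have hc : ∀ i j v, TR.d1 i (TR.d1 j v) = TR.d1 j (TR.d1 i v) := by
    intro i j v
    have h : ⁅TR.d1 i, TR.d1 j⁆ v = 0 := by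
      obtain ⟨n, r, h⟩ := TayRing.exists_inv_form f v
      have h0 : ∀ r : MvPowerSeries σ k, ⁅TR.d1 i, TR.d1 j⁆ (algebraMap _ L r) = 0 := by
        intro r
        rw [Derivation.commutator_apply, TR.d1_alg, TR.d1_alg, TR.d1_alg, TR.d1_alg, hc0, sub_self]
      have h2 := congrArg (fun v => ⁅TR.d1 i, TR.d1 j⁆ v) h
      rw [← map_pow, Derivation.leibniz, h0, h0, smul_zero, add_zero, smul_eq_mul, map_pow] at h2
      exact ((IsLocalization.Away.algebraMap_isUnit f).pow n).mul_right_eq_zero.mp h2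
    rwa [Derivation.commutator_apply, sub_eq_zero] at h
  refine ACC.mono ?_ (acc_cyclic (fun i => (hd (A := k) (σ := σ) i 1).toAddMonoidHom) (fun i => TR.D i 1) hc ?_ u ?_)
  · intro N hN i v hv
    exact hN i 1 v hv
  · intro i r v
    rw [Algebra.smul_def, Algebra.smul_def, Algebra.smul_def]
    have := (TR.d1 i).leibniz (algebraMap _ L r) v
    rw [TR.d1_alg] at this
    simp only [smul_eq_mul] at this
    rw [← TR.d1_apply, ← TR.d1_apply, this, mul_comm v]
    rfl
  · exact fun N hN => hu N hN

theorem TayRing.acc_stable_field (f : MvPowerSeries σ k) (hf : f ≠ 0)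
    [IsLocalization.Away f L] (TR : TayRing σ k L) : ACC {N | TR.Stable N} := by
  obtain ⟨p, hp⟩ := CharP.exists k
  rcases CharP.char_is_prime_or_zero k p with h | h
  · have : Fact p.Prime := ⟨h⟩
    exact TR.acc_stable_charP p f hf
  · subst h
    have := CharP.charP_to_charZero k
    exact TR.acc_stable_char0 f hf
end fin
end
end LCF

namespace LCF
noncomputable section
open MvPowerSeries
set_option linter.unusedSectionVars false

section coeffs
variable {σ A : Type*} [CommRing A]

/-- a power series with coefficients in a f.g. ideal lies in the extension -/
lemma mem_map_C {m : Ideal A} (hm : m.FG) (r : MvPowerSeries σ A) (h : ∀ e, coeff e r ∈ m) :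
    r ∈ m.map (C : A →+* MvPowerSeries σ A) := by
  obtain ⟨s, rfl⟩ := hm
  have h2 : ∀ e, ∃ c : A → A, ∑ a ∈ s, c a * a = coeff e r := by
    intro e
    obtain ⟨c, hc⟩ := Submodule.mem_span_finset.1 (h e)
    exact ⟨c, hc.2⟩
  choose c hc using h2
  have : r = ∑ a ∈ s, (show MvPowerSeries σ A from fun e => c e a) * C a := by
    ext e
    rw [map_sum, ← hc e]
    refine Finset.sum_congr rfl fun a _ => ?_
    rw [coeff_mul_C]
    rfl
  rw [this]
  exact Ideal.sum_mem _ fun a ha => Ideal.mul_mem_left _ _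
    (Ideal.mem_map_of_mem _ (Submodule.subset_span ha))

end coeffs

namespace TayRing
variable {σ A L : Type*} [CommRing A] [CommRing L] [Algebra (MvPowerSeries σ A) L]
  (TR : TayRing σ A L)

lemma D_C_smul (i : σ) (t : ℕ) (a : A) (v : L) :
    TR.D i t ((C a : MvPowerSeries σ A) • v) = (C a : MvPowerSeries σ A) • TR.D i t v := by
  rw [D_smul, Finset.sum_eq_single (0, t)]
  · rw [hd_C, if_pos rfl]
  · rintro ⟨x, y⟩ h1 h2
    have h3 : x ≠ 0 := by
      rintro rfl
      apply h2
      simpa using h1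
    rw [hd_C, if_neg h3, zero_smul]
  · intro h
    simp at h

/-- colon submodule -/
def colonC (N : Submodule (MvPowerSeries σ A) L) (a : A) : Submodule (MvPowerSeries σ A) L :=
  N.comap (LinearMap.lsmul (MvPowerSeries σ A) L (C a))

/-- multiples -/
def mulC (σ : Type*) {A : Type*} (L : Type*) [CommRing A] [CommRing L] [Algebra (MvPowerSeries σ A) L] (a : A) :
    Submodule (MvPowerSeries σ A) L :=
  LinearMap.range (LinearMap.lsmul (MvPowerSeries σ A) L (C a))

lemma mem_colonC {N : Submodule (MvPowerSeries σ A) L} {a : A} {v : L} :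
    v ∈ colonC N a ↔ (C a : MvPowerSeries σ A) • v ∈ N := Iff.rfl

lemma mem_mulC {a : A} {v : L} : v ∈ mulC σ L a ↔ ∃ w, (C a : MvPowerSeries σ A) • w = v := Iff.rfl

variable {TR} in
lemma Stable.colonC {N : Submodule (MvPowerSeries σ A) L} (h : TR.Stable N) (a : A) :
    TR.Stable (colonC N a) := by
  intro i t v hv
  rw [mem_colonC] at hv ⊢
  rw [← D_C_smul]
  exact h i t _ hv

lemma stable_mulC (a : A) : TR.Stable (mulC σ L a) := by
  rintro i t _ ⟨w, rfl⟩
  exact ⟨TR.D i t w, (TR.D_C_smul i t a w).symm⟩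

lemma smul_mem_map {m : Ideal A} {N : Submodule (MvPowerSeries σ A) L}
    (h : ∀ b ∈ m, ∀ v : L, (C b : MvPowerSeries σ A) • v ∈ N) :
    ∀ r ∈ m.map (C : A →+* MvPowerSeries σ A), ∀ v : L, r • v ∈ N := by
  intro r hr
  induction hr using Submodule.span_induction with
  | mem x hx => obtain ⟨b, hb, rfl⟩ := hx; exact h b hb
  | zero => intro v; simp
  | add x y _ _ hx hy => intro v; rw [add_smul]; exact N.add_mem (hx v) (hy v)
  | smul a x _ hx => intro v; rw [smul_eq_mul, mul_smul]; exact N.smul_mem _ (hx v)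

/-- field case over a quotient -/
lemma acc_residue [Finite σ] (f : MvPowerSeries σ A) [IsLocalization.Away f L] (m : Ideal A)
    (hfg : m.FG) {K : Type*} [Field K] (g : A →+* K) (hg : Function.Surjective g) (hgm : RingHom.ker g = m) :
    ACC {N | TR.Stable N ∧ ∀ b ∈ m, ∀ v : L, (C b : MvPowerSeries σ A) • v ∈ N} := by
  have hker : ∀ r : MvPowerSeries σ A, MvPowerSeries.map g r = 0 → r ∈ m.map (C : A →+* MvPowerSeries σ A) := by
    intro r hr
    refine mem_map_C hfg r fun e => ?_
    have := congrArg (coeff e) hr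
    rw [coeff_map, map_zero] at this
    rw [← hgm]
    exact this
  have hsur : ∀ s : MvPowerSeries σ K, ∃ r : MvPowerSeries σ A, MvPowerSeries.map g r = s := by
    intro s
    refine ⟨(show MvPowerSeries σ A from fun e => Function.surjInv hg (coeff e s)), ?_⟩
    ext e
    rw [coeff_map]
    exact Function.surjInv_eq hg _
  let z : L := IsLocalization.Away.invSelf f
  have hz : algebraMap _ L f * z = 1 := IsLocalization.Away.mul_invSelf f
  let f' := MvPowerSeries.map g f
  by_cases hf' : f' = 0
  · have h1 : ∀ N ∈ {N | TR.Stable N ∧ ∀ b ∈ m, ∀ v : L, (C b : MvPowerSeries σ A) • v ∈ N}, N = ⊤ := by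
      rintro N ⟨-, h⟩
      refine top_le_iff.1 fun v _ => ?_
      have := smul_mem_map h f (hker f hf') (z * v)
      rwa [Algebra.smul_def, ← mul_assoc, hz, one_mul] at this
    intro c _ hc
    exact ⟨0, fun n _ => by rw [h1 _ (hc n), h1 _ (hc 0)]⟩
  have : IsDomain (MvPowerSeries σ K) := NoZeroDivisors.to_isDomain _
  let L' := Localization.Away f'
  have hle : Submonoid.powers f' ≤ nonZeroDivisors (MvPowerSeries σ K) :=
    powers_le_nonZeroDivisors_of_noZeroDivisors hf'
  have hinj : Function.Injective (algebraMap (MvPowerSeries σ K) L') := IsLocalization.injective L' hle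
  let ι : L →+* L' := IsLocalization.Away.lift f (g := (algebraMap (MvPowerSeries σ K) L').comp (MvPowerSeries.map g))
    (IsLocalization.Away.algebraMap_isUnit f')
  have hι : ∀ r : MvPowerSeries σ A, ι (algebraMap _ L r) = algebraMap _ L' (MvPowerSeries.map g r) := by
    intro r
    simp only [ι, IsLocalization.Away.lift_eq]
    rfl
  have hι2 : ∀ (r : MvPowerSeries σ A) (v : L), ι (r • v) = MvPowerSeries.map g r • ι v := by
    intro r v
    rw [Algebra.smul_def, map_mul, hι, Algebra.smul_def]
  have hιk : ∀ v : L, ι v = 0 → ∀ N : Submodule (MvPowerSeries σ A) L,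
      (∀ b ∈ m, ∀ v : L, (C b : MvPowerSeries σ A) • v ∈ N) → v ∈ N := by
    intro v hv N hN
    obtain ⟨j, r, hr⟩ := exists_inv_form f v
    have h1 : ι (algebraMap _ L r) = 0 := by rw [← hr, map_mul, hv, mul_zero]
    rw [hι] at h1
    have h2 := hker r (hinj (by rw [h1, map_zero]))
    have h3 := smul_mem_map hN r h2 (z ^ j)
    rw [Algebra.smul_def, ← hr, mul_comm, ← mul_assoc, ← mul_pow, mul_comm z, hz, one_pow, one_mul] at h3
    exact h3
  let TR' : TayRing σ K L' := locTay f' L'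
  have hspan : ∀ (N : Submodule (MvPowerSeries σ A) L), ∀ w ∈ Submodule.span (MvPowerSeries σ K) (ι '' N),
      ∃ v ∈ N, ι v = w := by
    intro N w hw
    induction hw using Submodule.span_induction with
    | mem x hx => exact hx
    | zero => exact ⟨0, N.zero_mem, map_zero _⟩
    | add x y _ _ hx hy =>
      obtain ⟨v, hv, rfl⟩ := hx
      obtain ⟨w, hw, rfl⟩ := hy
      exact ⟨v + w, N.add_mem hv hw, map_add _ _ _⟩
    | smul a x _ hx =>
      obtain ⟨v, hv, rfl⟩ := hx
      obtain ⟨r, rfl⟩ := hsur a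
      exact ⟨r • v, N.smul_mem _ hv, hι2 _ _⟩
  have hacc : ACC {N | TR'.Stable N} := TR'.acc_stable_field f' hf'
  refine ACC.of_one hacc (fun N => Submodule.span (MvPowerSeries σ K) (ι '' N)) ?_ ?_ ?_
  · intro N _ N' _ h
    exact Submodule.span_mono (Set.image_mono h)
  · rintro N ⟨hN, -⟩
    apply stable_span
    rintro i t _ ⟨n, hn, rfl⟩
    rw [D_compat TR TR' g ι i t n f hι]
    exact Submodule.subset_span ⟨_, hN i t n hn, rfl⟩
  · rintro N ⟨_, hN⟩ N' _ h h'
    refine le_antisymm h fun v hv => ?_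
    have h2 : ι v ∈ Submodule.span (MvPowerSeries σ K) (ι '' N') :=
      Submodule.subset_span ⟨v, hv, rfl⟩
    have h3 : Submodule.span (MvPowerSeries σ K) (ι '' N) = Submodule.span (MvPowerSeries σ K) (ι '' N') := h'
    rw [← h3] at h2
    obtain ⟨w, hw, hwv⟩ := hspan N _ h2
    have := hιk (v - w) (by rw [map_sub, hwv, sub_self]) N hN
    have := N.add_mem this hw
    rwa [sub_add_cancel] at this

/-- main result over an Artinian quotient of the coefficients -/
theorem acc_quot [Finite σ] [IsNoetherianRing A] (f : MvPowerSeries σ A) [IsLocalization.Away f L] (p : A)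
    (hp : ∀ P : Ideal A, P.IsPrime → p ∈ P → P.IsMaximal) (b : Ideal A) (hb : p ∈ b) :
    ACC {N | TR.Stable N ∧ ∀ c ∈ b, ∀ v : L, (C c : MvPowerSeries σ A) • v ∈ N} := by
  induction b using IsNoetherian.induction with
  | hgt b ih =>
  by_cases hbP : Ideal.IsPrime b
  · have := hp b hbP hb
    let _ := Ideal.Quotient.field b
    exact TR.acc_residue f b (IsNoetherian.noetherian b) (Ideal.Quotient.mk b) Ideal.Quotient.mk_surjective
      Ideal.mk_ker
  by_cases hbt : b = ⊤
  · have h1 : ∀ N ∈ {N | TR.Stable N ∧ ∀ c ∈ b, ∀ v : L, (C c : MvPowerSeries σ A) • v ∈ N}, N = ⊤ := by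
      rintro N ⟨-, h⟩
      refine top_le_iff.1 fun v _ => ?_
      have := h 1 (by rw [hbt]; trivial) v
      rwa [map_one, one_smul] at this
    intro c _ hc
    exact ⟨0, fun n _ => by rw [h1 _ (hc n), h1 _ (hc 0)]⟩
  rw [Ideal.isPrime_iff] at hbP
  push Not at hbP
  obtain ⟨x, y, hxy, hx, hy⟩ := hbP hbt
  have hlt1 : b < b ⊔ Ideal.span {x} := by
    refine lt_of_le_of_ne le_sup_left fun h => hx ?_
    rw [h]
    exact Ideal.mem_sup_right (Ideal.mem_span_singleton_self x)
  let b2 : Ideal A := b.comap (LinearMap.lsmul A A x)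
  have hb2 : ∀ c, c ∈ b2 ↔ x * c ∈ b := fun c => Iff.rfl
  have hle2 : b ≤ b2 := fun c hc => (hb2 c).2 (Ideal.mul_mem_left b _ hc)
  have hlt2 : b < b2 := by
    refine lt_of_le_of_ne hle2 fun h => hy ?_
    rw [h]
    exact (hb2 y).2 hxy
  refine ACC.of_two (ih _ hlt1 (hlt1.le hb)) (ih _ hlt2 (hlt2.le hb)) (fun N => N ⊔ mulC σ L x)
    (fun N => colonC N x) ?_ ?_ ?_ ?_ ?_
  · intro N _ N' _ h; exact sup_le_sup_right h _
  · intro N _ N' _ h; exact Submodule.comap_mono h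
  · rintro N ⟨hN, hN'⟩
    refine ⟨hN.sup (TR.stable_mulC x), fun c hc v => ?_⟩
    obtain ⟨c1, h1, c2, h2, rfl⟩ := Submodule.mem_sup.1 hc
    obtain ⟨e, rfl⟩ := Ideal.mem_span_singleton'.1 h2
    rw [map_add, add_smul]
    refine Submodule.add_mem_sup (hN' _ h1 _) ?_
    rw [mul_comm, map_mul, mul_smul]
    exact ⟨_, rfl⟩
  · rintro N ⟨hN, hN'⟩
    refine ⟨hN.colonC x, fun c hc v => ?_⟩
    rw [mem_colonC, ← mul_smul, ← map_mul]
    exact hN' _ ((hb2 c).1 hc) v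
  · rintro N ⟨hN, -⟩ N' _ h h1 h2
    refine eq_of_inf_sup h (le_antisymm (inf_le_inf_right _ h) ?_) h1
    rintro _ ⟨hv, w, rfl⟩
    refine ⟨?_, w, rfl⟩
    have h3 : w ∈ colonC N' x := hv
    have h2' : colonC N x = colonC N' x := h2
    rw [← h2'] at h3
    exact h3

/-- the torsion part -/
theorem acc_tors [Finite σ] [IsNoetherianRing A] (f : MvPowerSeries σ A) [IsLocalization.Away f L] (p : A)
    (hp : ∀ P : Ideal A, P.IsPrime → p ∈ P → P.IsMaximal) :
    ACC {N | TR.Stable N ∧ ∀ v ∈ N, (C p : MvPowerSeries σ A) • v = 0} := by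
  have hB := TR.acc_quot f p hp (Ideal.span {p}) (Ideal.mem_span_singleton_self p)
  let E : Ideal A → Submodule (MvPowerSeries σ A) L := fun a =>
    Submodule.span _ {w | ∃ c ∈ a, ∃ v : L, w = (C c : MvPowerSeries σ A) • v}
  have hEs : ∀ a, TR.Stable (E a) := by
    intro a
    apply stable_span
    rintro i t _ ⟨c, hc, v, rfl⟩
    rw [D_C_smul]
    exact Submodule.subset_span ⟨c, hc, _, rfl⟩
  have hEr : ∀ a : Ideal A, ∀ r ∈ a.map (C : A →+* MvPowerSeries σ A), ∀ v : L, r • v ∈ E a :=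
    fun a => smul_mem_map fun b hb v => Submodule.subset_span ⟨b, hb, v, rfl⟩
  have key : ∀ a : Ideal A, (∀ c ∈ a, p * c = 0) → ACC {N | TR.Stable N ∧ N ≤ E a} := by
    intro a
    induction a, (IsNoetherian.noetherian a) using Submodule.fg_induction with
    | singleton c =>
      intro hc
      have hE : E (Ideal.span {c}) ≤ mulC σ L c := by
        refine Submodule.span_le.2 ?_
        rintro _ ⟨x, hx, v, rfl⟩
        obtain ⟨e, rfl⟩ := Ideal.mem_span_singleton'.1 hx
        rw [mul_comm, map_mul, mul_smul]
        exact ⟨_, rfl⟩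
      refine ACC.of_one hB (fun N => colonC N c) ?_ ?_ ?_
      · intro N _ N' _ h; exact Submodule.comap_mono h
      · rintro N ⟨hN, -⟩
        refine ⟨hN.colonC c, fun e he v => ?_⟩
        obtain ⟨e, rfl⟩ := Ideal.mem_span_singleton'.1 he
        have := hc c (Ideal.mem_span_singleton_self c)
        rw [mem_colonC, ← mul_smul, ← map_mul, mul_left_comm, mul_comm c, this, mul_zero, map_zero, zero_smul]
        exact N.zero_mem
      · rintro N ⟨hN, -⟩ N' ⟨_, hN'⟩ h h1
        refine le_antisymm h fun v hv => ?_
        obtain ⟨w, rfl⟩ := hE (hN' hv)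
        have h3 : w ∈ colonC N' c := hv
        have h2' : colonC N c = colonC N' c := h1
        rw [← h2'] at h3
        exact h3
    | sup a a' _ _ h1 h2 =>
      intro hc
      have hE : E (a ⊔ a') ≤ E a ⊔ E a' := by
        refine Submodule.span_le.2 ?_
        rintro _ ⟨x, hx, v, rfl⟩
        obtain ⟨y, hy, z, hz, rfl⟩ := Submodule.mem_sup.1 hx
        rw [map_add, add_smul]
        exact Submodule.add_mem_sup (Submodule.subset_span ⟨_, hy, _, rfl⟩) (Submodule.subset_span ⟨_, hz, _, rfl⟩)
      refine ACC.of_two (h1 fun c h => hc c (Ideal.mem_sup_left h)) (h2 fun c h => hc c (Ideal.mem_sup_right h))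
        (fun N => N ⊓ E a) (fun N => (N ⊔ E a) ⊓ E a') ?_ ?_ ?_ ?_ ?_
      · intro N _ N' _ h; exact inf_le_inf_right _ h
      · intro N _ N' _ h; exact inf_le_inf_right _ (sup_le_sup_right h _)
      · rintro N ⟨hN, -⟩; exact ⟨hN.inf (hEs a), inf_le_right⟩
      · rintro N ⟨hN, -⟩; exact ⟨(hN.sup (hEs a)).inf (hEs a'), inf_le_right⟩
      · rintro N ⟨hN, -⟩ N' ⟨_, hN'⟩ h h1 h2
        refine eq_of_inf_sup h h1 (le_antisymm (sup_le_sup_right h _) (sup_le ?_ le_sup_right))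
        intro v hv
        obtain ⟨x, hx, y, hy, rfl⟩ := Submodule.mem_sup.1 (hE (hN' hv))
        refine Submodule.add_mem _ (Submodule.mem_sup_right hx) ?_
        have h3 : y ∈ (N' ⊔ E a) ⊓ E a' := by
          refine ⟨?_, hy⟩
          have := Submodule.sub_mem (N' ⊔ E a) (Submodule.mem_sup_left hv) (Submodule.mem_sup_right hx)
          rwa [add_sub_cancel_left] at this
        have h2' : (N ⊔ E a) ⊓ E a' = (N' ⊔ E a) ⊓ E a' := h2
        rw [← h2'] at h3
        exact h3.1
  let a : Ideal A := LinearMap.ker (LinearMap.lsmul A A p)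
  have ha : ∀ c, c ∈ a ↔ p * c = 0 := fun c => Iff.rfl
  refine (key a fun c hc => (ha c).1 hc).mono ?_
  rintro N ⟨hN, h⟩
  refine ⟨hN, fun v hv => ?_⟩
  have hv0 := h v hv
  let z : L := IsLocalization.Away.invSelf f
  have hz : algebraMap _ L f * z = 1 := IsLocalization.Away.mul_invSelf f
  obtain ⟨j, r, hr⟩ := exists_inv_form f v
  have h1 : algebraMap (MvPowerSeries σ A) L (C p * r) = algebraMap (MvPowerSeries σ A) L 0 := by
    rw [map_mul, ← hr, mul_left_comm, ← Algebra.smul_def, hv0, mul_zero, map_zero]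
  obtain ⟨⟨_, l, rfl⟩, hl⟩ := (IsLocalization.eq_iff_exists (Submonoid.powers f) L).1 h1
  simp only [mul_zero] at hl
  have h2 : f ^ l * r ∈ a.map (C : A →+* MvPowerSeries σ A) := by
    refine mem_map_C (IsNoetherian.noetherian a) _ fun e => (ha _).2 ?_
    rw [← coeff_C_mul, mul_left_comm, hl, map_zero]
  have h3 := hEr a _ h2 (z ^ (l + j))
  rw [Algebra.smul_def, map_mul, ← hr, map_pow, ← mul_assoc, ← pow_add, mul_right_comm, ← mul_pow, hz, one_pow,
    one_mul] at h3
  exact h3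

end TayRing
end
end LCF

namespace LCF
noncomputable section
open MvPowerSeries
set_option linter.unusedSectionVars false

/-- sequences with the Taylor action -/
def TM (N : Type*) := ℕ → N

section TM
variable {S N : Type*} [CommRing S] [AddCommGroup N] [Module S N]

instance : AddCommGroup (TM N) := inferInstanceAs (AddCommGroup (ℕ → N))

lemma TM.add_apply (v w : TM N) (t : ℕ) : (v + w) t = v t + w t := rfl
lemma TM.zero_apply (t : ℕ) : (0 : TM N) t = 0 := rfl

instance : SMul (PowerSeries S) (TM N) where
  smul s v := fun t => ∑ p ∈ Finset.HasAntidiagonal.antidiagonal t, PowerSeries.coeff p.1 s • v p.2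

lemma TM.smul_apply (s : PowerSeries S) (v : TM N) (t : ℕ) :
    (s • v) t = ∑ p ∈ Finset.HasAntidiagonal.antidiagonal t, PowerSeries.coeff p.1 s • v p.2 := rfl

instance : Module (PowerSeries S) (TM N) where
  one_smul v := by
    funext t
    rw [TM.smul_apply, Finset.sum_eq_single (0, t)]
    · simp
    · rintro ⟨x, y⟩ h1 h2
      have h3 : x ≠ 0 := by
        rintro rfl
        apply h2
        simpa using h1
      rw [PowerSeries.coeff_one, if_neg h3, zero_smul]
    · intro h
      simp at h
  mul_smul a b v := by
    funext t
    simp only [TM.smul_apply, PowerSeries.coeff_mul, Finset.sum_smul, Finset.smul_sum, Finset.sum_sigma']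
    apply Finset.sum_nbij' (fun ⟨⟨_i, j⟩, ⟨k, l⟩⟩ ↦ ⟨(k, l + j), (l, j)⟩)
      (fun ⟨⟨i, _j⟩, ⟨k, l⟩⟩ ↦ ⟨(i + k, l), (i, k)⟩)
    · rintro ⟨⟨i, j⟩, ⟨k, l⟩⟩ h
      simp only [Finset.mem_sigma, Finset.HasAntidiagonal.mem_antidiagonal] at h ⊢
      lia
    · rintro ⟨⟨i, j⟩, ⟨k, l⟩⟩ h
      simp only [Finset.mem_sigma, Finset.HasAntidiagonal.mem_antidiagonal] at h ⊢
      lia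
    · rintro ⟨⟨i, j⟩, ⟨k, l⟩⟩ h
      simp only [Finset.mem_sigma, Finset.HasAntidiagonal.mem_antidiagonal] at h
      obtain ⟨h1, rfl⟩ := h
      rfl
    · rintro ⟨⟨i, j⟩, ⟨k, l⟩⟩ h
      simp only [Finset.mem_sigma, Finset.HasAntidiagonal.mem_antidiagonal] at h
      obtain ⟨h1, rfl⟩ := h
      rfl
    · rintro ⟨⟨i, j⟩, ⟨k, l⟩⟩ h
      rw [mul_smul]
  smul_zero a := by
    funext t
    simp [TM.smul_apply, TM.zero_apply]
  smul_add a v w := by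
    funext t
    simp [TM.smul_apply, TM.add_apply, Finset.sum_add_distrib]
  add_smul a b v := by
    funext t
    simp [TM.smul_apply, TM.add_apply, Finset.sum_add_distrib, add_smul]
  zero_smul v := by
    funext t
    simp [TM.smul_apply, TM.zero_apply]

end TM

/-- modules with Hasse derivative operators -/
structure DS (σ A M : Type*) [CommRing A] [AddCommGroup M] [Module (MvPowerSeries σ A) M] where
  D : σ → ℕ → M →+ M
  D_zero : ∀ i m, D i 0 m = m
  D_smul : ∀ i t (r : MvPowerSeries σ A) m, D i t (r • m) =
    ∑ x ∈ Finset.HasAntidiagonal.antidiagonal t, hd i x.1 r • D i x.2 m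

namespace DS
variable {σ A M M' : Type*} [CommRing A] [AddCommGroup M] [Module (MvPowerSeries σ A) M]
  [AddCommGroup M'] [Module (MvPowerSeries σ A) M'] (ds : DS σ A M) (ds' : DS σ A M')

/-- D-linear maps -/
def Lin (g : M →ₗ[MvPowerSeries σ A] M') : Prop := ∀ i t m, ds'.D i t (g m) = g (ds.D i t m)

/-- uniqueness -/
lemma ext_loc (f : MvPowerSeries σ A) (hinj : ∀ m : M', f • m = 0 → m = 0) (i : σ) (E E' : ℕ → M → M')
    (hE : ∀ t (r : MvPowerSeries σ A) m, E t (r • m) =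
      ∑ x ∈ Finset.HasAntidiagonal.antidiagonal t, hd i x.1 r • E x.2 m)
    (hE' : ∀ t (r : MvPowerSeries σ A) m, E' t (r • m) =
      ∑ x ∈ Finset.HasAntidiagonal.antidiagonal t, hd i x.1 r • E' x.2 m) (m : M) (j : ℕ)
    (h : ∀ t, E t (f ^ j • m) = E' t (f ^ j • m)) (t : ℕ) : E t m = E' t m := by
  have hinj' : ∀ (l : ℕ) (m : M'), f ^ l • m = 0 → m = 0 := by
    intro l
    induction l with
    | zero => intro m h; simpa using h
    | succ l ih =>
      intro m h
      rw [pow_succ, mul_smul] at h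
      exact hinj _ (ih _ h)
  induction t using Nat.strong_induction_on with
  | _ t ih =>
  have h1 := h t
  rw [hE, hE'] at h1
  have h0 : ((0, t) : ℕ × ℕ) ∈ Finset.HasAntidiagonal.antidiagonal t := by simp
  rw [← Finset.add_sum_erase _ _ h0, ← Finset.add_sum_erase _ _ h0] at h1
  have h2 : ∀ x ∈ (Finset.HasAntidiagonal.antidiagonal t).erase ((0, t) : ℕ × ℕ),
      hd i x.1 (f ^ j) • E x.2 m = hd i x.1 (f ^ j) • E' x.2 m := by
    rintro ⟨x, y⟩ hx
    rw [Finset.mem_erase, Finset.HasAntidiagonal.mem_antidiagonal] at hx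
    have : x ≠ 0 := by
      rintro rfl
      apply hx.1
      have := hx.2
      simp at this
      rw [this]
    rw [ih y (by have := hx.2; simp at this; lia)]
  rw [Finset.sum_congr rfl h2, add_left_inj, hd_zero] at h1
  have := hinj' j (E t m - E' t m) (by rw [smul_sub, sub_eq_zero]; exact h1)
  exact sub_eq_zero.1 this

section loc
variable (f : MvPowerSeries σ A)

/-- the action ring hom -/
def actHom (i : σ) : MvPowerSeries σ A →+* PowerSeries (Localization (Submonoid.powers f)) :=
  (PowerSeries.map (algebraMap (MvPowerSeries σ A) (Localization (Submonoid.powers f)))).comp (tay i)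

lemma exists_loc (i : σ) : ∃ E : ℕ → LocalizedModule (Submonoid.powers f) M →+ LocalizedModule (Submonoid.powers f) M,
    (∀ t m, E t (LocalizedModule.mkLinearMap (Submonoid.powers f) M m) =
      LocalizedModule.mkLinearMap (Submonoid.powers f) M (ds.D i t m)) ∧
    ∀ t (r : MvPowerSeries σ A) m, E t (r • m) =
      ∑ x ∈ Finset.HasAntidiagonal.antidiagonal t, hd i x.1 r • E x.2 m := by
  let N := LocalizedModule (Submonoid.powers f) M
  let _ : Module (MvPowerSeries σ A) (TM N) := Module.compHom _ (actHom f i)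
  have hact : ∀ (r : MvPowerSeries σ A) (v : TM N) t, (r • v) t =
      ∑ x ∈ Finset.HasAntidiagonal.antidiagonal t, hd i x.1 r • v x.2 := by
    intro r v t
    change (actHom f i r • v) t = _
    rw [TM.smul_apply]
    refine Finset.sum_congr rfl fun x _ => ?_
    rw [actHom, RingHom.comp_apply, PowerSeries.coeff_map, coeff_tay, algebraMap_smul]
  let g : M →ₗ[MvPowerSeries σ A] TM N :=
    { toFun := fun m t => LocalizedModule.mkLinearMap (Submonoid.powers f) M (ds.D i t m)
      map_add' := fun m m' => by
        funext t
        rw [map_add, map_add]; rfl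
      map_smul' := fun r m => by
        funext t
        rw [ds.D_smul, map_sum, RingHom.id_apply]
        refine Eq.trans ?_ (hact r (show TM N from fun t => LocalizedModule.mkLinearMap (Submonoid.powers f) M (ds.D i t m)) t).symm
        refine Finset.sum_congr rfl fun x _ => ?_
        rw [map_smul] }
  have hu : ∀ x : Submonoid.powers f, IsUnit ((algebraMap (MvPowerSeries σ A) (Module.End (MvPowerSeries σ A) (TM N))) x) := by
    intro x
    rw [Module.End.isUnit_iff]
    have h1 : IsUnit (actHom f i x) := by
      rw [PowerSeries.isUnit_iff_constantCoeff, ← PowerSeries.coeff_zero_eq_constantCoeff_apply,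
        actHom, RingHom.comp_apply, PowerSeries.coeff_map, coeff_tay, hd_zero]
      exact IsLocalization.map_units _ x
    obtain ⟨u, hu⟩ := h1
    have h2 : ∀ v : TM N, (algebraMap (MvPowerSeries σ A) (Module.End (MvPowerSeries σ A) (TM N))) x v = u • v := by
      intro v
      rw [Units.smul_def, hu]
      rfl
    constructor
    · intro v w h
      rw [h2, h2] at h
      exact smul_left_cancel u h
    · intro v
      exact ⟨u⁻¹ • v, by rw [h2, smul_inv_smul]⟩
  let T := LocalizedModule.lift (Submonoid.powers f) g hu
  refine ⟨fun t => ⟨⟨fun v => T v t, ?_⟩, ?_⟩, ?_, ?_⟩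
  · rw [map_zero]; rfl
  · intro v w
    change T (v + w) t = _
    rw [map_add]; rfl
  · intro t m
    change T (LocalizedModule.mkLinearMap (Submonoid.powers f) M m) t = _
    have := LocalizedModule.lift_comp (Submonoid.powers f) g hu
    have := LinearMap.congr_fun this m
    rw [LinearMap.comp_apply] at this
    rw [this]
    rfl
  · intro t r m
    change T (r • m) t = _
    rw [map_smul, hact]
    rfl

lemma loc_inj (m : LocalizedModule (Submonoid.powers f) M) (h : f • m = 0) : m = 0 := by
  have h1 := IsLocalizedModule.smul_injective (LocalizedModule.mkLinearMap (Submonoid.powers f) M)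
    (⟨f, Submonoid.mem_powers f⟩ : Submonoid.powers f)
  apply h1
  change f • m = f • 0
  rw [h, smul_zero]

lemma loc_surj (m : LocalizedModule (Submonoid.powers f) M) :
    ∃ (j : ℕ) (n : M), f ^ j • m = LocalizedModule.mkLinearMap (Submonoid.powers f) M n := by
  obtain ⟨⟨n, ⟨_, j, rfl⟩⟩, h⟩ := IsLocalizedModule.surj (Submonoid.powers f)
    (LocalizedModule.mkLinearMap (Submonoid.powers f) M) m
  exact ⟨j, n, h⟩

lemma loc_pow_inj (j : ℕ) {m n : LocalizedModule (Submonoid.powers f) M} (h : f ^ j • m = f ^ j • n) : m = n := by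
  induction j with
  | zero => simpa using h
  | succ l ih =>
    rw [pow_succ', mul_smul, mul_smul] at h
    exact ih (sub_eq_zero.1 (loc_inj f _ (by rw [smul_sub, h, sub_self])))

/-- localized structure -/
def loc : DS σ A (LocalizedModule (Submonoid.powers f) M) where
  D i := (ds.exists_loc f i).choose
  D_zero i m := by
    have h := (ds.exists_loc f i).choose_spec
    obtain ⟨j, n, hn⟩ := loc_surj f m
    apply loc_pow_inj f j
    have h2 := h.2 0 (f ^ j) m
    rw [Finset.Nat.antidiagonal_zero, Finset.sum_singleton, hd_zero] at h2
    rw [← h2, hn, h.1, ds.D_zero]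
  D_smul i := (ds.exists_loc f i).choose_spec.2

lemma loc_mk : ds.Lin (ds.loc f) (LocalizedModule.mkLinearMap (Submonoid.powers f) M) :=
  fun i => (ds.exists_loc f i).choose_spec.1

variable {ds ds'} in
lemma lin_of_loc {g : LocalizedModule (Submonoid.powers f) M →ₗ[MvPowerSeries σ A] M'}
    (hinj : ∀ m : M', f • m = 0 → m = 0)
    (h : ds.Lin ds' (g ∘ₗ LocalizedModule.mkLinearMap (Submonoid.powers f) M)) : (ds.loc f).Lin ds' g := by
  intro i t m
  obtain ⟨j, n, hn⟩ := loc_surj f m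
  refine ext_loc f hinj i (fun t m => ds'.D i t (g m)) (fun t m => g ((ds.loc f).D i t m)) ?_ ?_ m j ?_ t
  · intro t r m
    simp only [map_smul, ds'.D_smul]
  · intro t r m
    simp only [(ds.loc f).D_smul, map_sum, map_smul]
  · intro t
    simp only [hn]
    have := h i t n
    rw [ds.loc_mk f i t n]
    exact this

variable {ds ds'} in
lemma Lin.loc_map {g : M →ₗ[MvPowerSeries σ A] M'} (h : ds.Lin ds' g) :
    (ds.loc f).Lin (ds'.loc f) (IsLocalizedModule.map (Submonoid.powers f)
      (LocalizedModule.mkLinearMap (Submonoid.powers f) M)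
      (LocalizedModule.mkLinearMap (Submonoid.powers f) M') g) := by
  refine lin_of_loc f (loc_inj f) ?_
  rw [IsLocalizedModule.map_comp]
  intro i t m
  rw [LinearMap.comp_apply, ds'.loc_mk f, h]
  rfl

end loc

/-- product -/
def prod : DS σ A (M × M') where
  D i t := (ds.D i t).prodMap (ds'.D i t)
  D_zero i m := by
    ext <;> simp [ds.D_zero, ds'.D_zero]
  D_smul i t r m := by
    ext
    · rw [Prod.fst_sum]; simp [ds.D_smul]
    · rw [Prod.snd_sum]; simp [ds'.D_smul]

/-- zero module -/
def zero (M : Type*) [AddCommGroup M] [Module (MvPowerSeries σ A) M] [Subsingleton M] : DS σ A M where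
  D _ _ := 0
  D_zero _ _ := Subsingleton.elim _ _
  D_smul _ _ _ _ := Subsingleton.elim _ _

/-- stable submodules -/
def Stable (N : Submodule (MvPowerSeries σ A) M) : Prop := ∀ i t, ∀ v ∈ N, ds.D i t v ∈ N

/-- chain condition on torsion -/
def AT (p : A) : Prop := ACC {N | ds.Stable N ∧ ∀ v ∈ N, (C p : MvPowerSeries σ A) • v = 0}

/-- chain condition modulo `p` -/
def BQ (p : A) : Prop := ACC {N | ds.Stable N ∧ ∀ v : M, (C p : MvPowerSeries σ A) • v ∈ N}

lemma D_C_smul (i : σ) (t : ℕ) (a : A) (v : M) :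
    ds.D i t ((C a : MvPowerSeries σ A) • v) = (C a : MvPowerSeries σ A) • ds.D i t v := by
  rw [D_smul, Finset.sum_eq_single (0, t)]
  · rw [hd_C, if_pos rfl]
  · rintro ⟨x, y⟩ h1 h2
    have h3 : x ≠ 0 := by
      rintro rfl
      apply h2
      simpa using h1
    rw [hd_C, if_neg h3, zero_smul]
  · intro h
    simp at h

variable {ds ds'}

lemma Stable.comap {g : M →ₗ[MvPowerSeries σ A] M'} (h : ds.Lin ds' g) {N : Submodule (MvPowerSeries σ A) M'}
    (hN : ds'.Stable N) : ds.Stable (N.comap g) := by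
  intro i t v hv
  rw [Submodule.mem_comap] at hv ⊢
  rw [← h]
  exact hN i t _ hv

lemma Stable.map {g : M →ₗ[MvPowerSeries σ A] M'} (h : ds.Lin ds' g) {N : Submodule (MvPowerSeries σ A) M}
    (hN : ds.Stable N) : ds'.Stable (N.map g) := by
  rintro i t _ ⟨v, hv, rfl⟩
  rw [h]
  exact ⟨_, hN i t _ hv, rfl⟩

lemma Lin.comp {M'' : Type*} [AddCommGroup M''] [Module (MvPowerSeries σ A) M''] {ds'' : DS σ A M''}
    {g : M →ₗ[MvPowerSeries σ A] M'} {g' : M' →ₗ[MvPowerSeries σ A] M''} (h : ds.Lin ds' g) (h' : ds'.Lin ds'' g') :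
    ds.Lin ds'' (g' ∘ₗ g) := by
  intro i t m
  rw [LinearMap.comp_apply, h', h]
  rfl

lemma prod_lin_inl : ds.Lin (ds.prod ds') (LinearMap.inl _ M M') := by
  intro i t m
  exact Prod.ext rfl (map_zero (ds'.D i t))

lemma prod_lin_snd : (ds.prod ds').Lin ds' (LinearMap.snd _ M M') := fun _ _ _ => rfl
lemma prod_lin_fst : (ds.prod ds').Lin ds (LinearMap.fst _ M M') := fun _ _ _ => rfl

lemma prod_inj {N N' : Submodule (MvPowerSeries σ A) (M × M')} (h : N ≤ N')
    (h1 : N.comap (LinearMap.inl _ M M') = N'.comap (LinearMap.inl _ M M'))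
    (h2 : N.map (LinearMap.snd _ M M') = N'.map (LinearMap.snd _ M M')) : N = N' := by
  refine le_antisymm h ?_
  rintro ⟨v, w⟩ hv
  have h3 : w ∈ N'.map (LinearMap.snd _ M M') := ⟨_, hv, rfl⟩
  rw [← h2] at h3
  obtain ⟨⟨v', w'⟩, hv', h4⟩ := h3
  obtain rfl : w' = w := h4
  have h5 : v - v' ∈ N'.comap (LinearMap.inl _ M M') := by
    have := N'.sub_mem hv (h hv')
    simpa using this
  rw [← h1] at h5
  have := N.add_mem h5 hv'
  simpa using this

lemma AT.prod {p : A} (h : ds.AT p) (h' : ds'.AT p) : (ds.prod ds').AT p := by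
  refine ACC.of_two h h' (fun N => N.comap (LinearMap.inl _ M M')) (fun N => N.map (LinearMap.snd _ M M')) ?_ ?_ ?_ ?_ ?_
  · intro N _ N' _ h; exact Submodule.comap_mono h
  · intro N _ N' _ h; exact Submodule.map_mono h
  · rintro N ⟨hN, h⟩
    exact ⟨hN.comap prod_lin_inl, fun v hv => congrArg Prod.fst (h _ hv)⟩
  · rintro N ⟨hN, h⟩
    refine ⟨hN.map prod_lin_snd, ?_⟩
    rintro _ ⟨v, hv, rfl⟩
    exact congrArg Prod.snd (h _ hv)
  · intro N _ N' _ h h1 h2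
    exact prod_inj h h1 h2

lemma BQ.prod {p : A} (h : ds.BQ p) (h' : ds'.BQ p) : (ds.prod ds').BQ p := by
  refine ACC.of_two h h' (fun N => N.comap (LinearMap.inl _ M M')) (fun N => N.map (LinearMap.snd _ M M')) ?_ ?_ ?_ ?_ ?_
  · intro N _ N' _ h; exact Submodule.comap_mono h
  · intro N _ N' _ h; exact Submodule.map_mono h
  · rintro N ⟨hN, h⟩
    refine ⟨hN.comap prod_lin_inl, fun v => ?_⟩
    have := h (v, 0)
    rw [Prod.smul_mk, smul_zero] at this
    exact this
  · rintro N ⟨hN, h⟩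
    exact ⟨hN.map prod_lin_snd, fun v => ⟨_, h (0, v), rfl⟩⟩
  · intro N _ N' _ h h1 h2
    exact prod_inj h h1 h2

lemma AT_of_subsingleton [Subsingleton M] (p : A) : ds.AT p :=
  fun _ _ _ => ⟨0, fun _ _ => Subsingleton.elim _ _⟩

lemma BQ_of_subsingleton [Subsingleton M] (p : A) : ds.BQ p :=
  fun _ _ _ => ⟨0, fun _ _ => Subsingleton.elim _ _⟩

lemma AT.of_inj {p : A} (h : ds'.AT p) (g : M →ₗ[MvPowerSeries σ A] M') (hg : ds.Lin ds' g)
    (hinj : Function.Injective g) : ds.AT p := by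
  refine ACC.of_one h (fun N => N.map g) ?_ ?_ ?_
  · intro N _ N' _ h; exact Submodule.map_mono h
  · rintro N ⟨hN, h⟩
    refine ⟨hN.map hg, ?_⟩
    rintro _ ⟨v, hv, rfl⟩
    rw [← map_smul, h _ hv, map_zero]
  · intro N _ N' _ h h'
    exact Submodule.map_injective_of_injective hinj h'

lemma BQ.of_inj {p : A} (h : ds'.BQ p) (g : M →ₗ[MvPowerSeries σ A] M') (hg : ds.Lin ds' g)
    (hinj : Function.Bijective g) : ds.BQ p := by
  refine ACC.of_one h (fun N => N.map g) ?_ ?_ ?_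
  · intro N _ N' _ h; exact Submodule.map_mono h
  · rintro N ⟨hN, h⟩
    refine ⟨hN.map hg, fun v => ?_⟩
    obtain ⟨w, rfl⟩ := hinj.2 v
    exact ⟨_, h w, map_smul _ _ _⟩
  · intro N _ N' _ h h'
    exact Submodule.map_injective_of_injective hinj.1 h'

/-- D-structure from a ring -/
def ofTay {L : Type*} [CommRing L] [Algebra (MvPowerSeries σ A) L] (TR : TayRing σ A L) : DS σ A L where
  D := TR.D
  D_zero := TR.D_zero
  D_smul := TR.D_smul

/-- modules isomorphic to a localization of the ring -/
def Good (ds : DS σ A M) : Prop := ∃ (g : MvPowerSeries σ A)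
  (e : M →ₗ[MvPowerSeries σ A] Localization.Away g), Function.Bijective e ∧
    ds.Lin (ofTay (locTay g (Localization.Away g))) e

lemma Good.AT [Finite σ] [IsNoetherianRing A] (h : ds.Good) (p : A)
    (hp : ∀ P : Ideal A, P.IsPrime → p ∈ P → P.IsMaximal) : ds.AT p := by
  obtain ⟨g, e, he, hl⟩ := h
  exact AT.of_inj (ds' := ofTay (locTay g (Localization.Away g))) ((locTay g (Localization.Away g)).acc_tors g p hp) e hl he.1

lemma Good.BQ [Finite σ] [IsNoetherianRing A] (h : ds.Good) (p : A)
    (hp : ∀ P : Ideal A, P.IsPrime → p ∈ P → P.IsMaximal) : ds.BQ p := by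
  obtain ⟨g, e, he, hl⟩ := h
  refine BQ.of_inj (ds' := ofTay (locTay g (Localization.Away g))) (((locTay g (Localization.Away g)).acc_quot g p hp _ (Ideal.mem_span_singleton_self p)).mono ?_) e hl he
  rintro N ⟨hN, h⟩
  refine ⟨hN, fun c hc v => ?_⟩
  obtain ⟨e, rfl⟩ := Ideal.mem_span_singleton'.1 hc
  rw [map_mul, mul_smul]
  exact N.smul_mem _ (h v)

/-- the ring itself -/
def base (σ A : Type*) [CommRing A] : DS σ A (MvPowerSeries σ A) where
  D i t := (hd i t).toAddMonoidHom
  D_zero i m := hd_zero i m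
  D_smul i t r m := hd_mul i t r m

lemma good_base (σ A : Type*) [CommRing A] : (base σ A).Good := by
  refine ⟨1, Algebra.linearMap _ _, ?_, ?_⟩
  · exact (IsLocalization.atUnits (MvPowerSeries σ A) (Submonoid.powers (1 : MvPowerSeries σ A))
      (S := Localization.Away (1 : MvPowerSeries σ A)) (by
        rintro _ ⟨n, rfl⟩
        simp)).bijective
  · intro i t m
    exact TayRing.D_alg _ i t m

lemma Good.loc (h : ds.Good) (f : MvPowerSeries σ A) : (ds.loc f).Good := by
  obtain ⟨g, e, he, hl⟩ := h
  let R := MvPowerSeries σ A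
  let L := Localization.Away g
  let L' := Localization.Away (g * f)
  have hu : IsUnit (algebraMap R L' (g * f)) := IsLocalization.Away.algebraMap_isUnit (g * f)
  rw [map_mul] at hu
  have hug : IsUnit (algebraMap R L' g) := isUnit_of_mul_isUnit_left hu
  have huf : IsUnit (algebraMap R L' f) := isUnit_of_mul_isUnit_right hu
  let ψ : L →+* L' := IsLocalization.Away.lift g (g := algebraMap R L') hug
  have hψ : ∀ r : R, ψ (algebraMap R L r) = algebraMap R L' r := fun r => IsLocalization.Away.lift_eq g hug r
  let ψl : L →ₗ[R] L' :=
    { toFun := ψ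
      map_add' := map_add ψ
      map_smul' := fun r v => by rw [Algebra.smul_def, map_mul, hψ, RingHom.id_apply, Algebra.smul_def] }
  have hlinψ : (ofTay (locTay g L)).Lin (ofTay (locTay (g * f) L')) ψl := by
    intro i t m
    refine TayRing.D_compat (locTay g L) (locTay (g * f) L') (RingHom.id A) ψ i t m g ?_
    intro r
    rw [hψ]
    congr 1
  have hunit : ∀ x : Submonoid.powers f, IsUnit ((algebraMap R (Module.End R L')) x) := by
    rintro ⟨_, j, rfl⟩
    have h1 : IsUnit (algebraMap R L' (f ^ j)) := by rw [map_pow]; exact huf.pow j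
    have h2 := h1.map (algebraMap L' (Module.End L' L'))
    rw [Module.End.isUnit_iff] at h2 ⊢
    have h3 : ∀ v : L', (algebraMap R (Module.End R L')) (f ^ j) v = (algebraMap L' (Module.End L' L')) (algebraMap R L' (f ^ j)) v := by
      intro v
      rw [Module.algebraMap_end_apply, Module.algebraMap_end_apply, Algebra.smul_def, smul_eq_mul]
    exact ⟨fun v w h => h2.1 (by rw [← h3, ← h3]; exact h), fun v => by
      obtain ⟨w, hw⟩ := h2.2 v
      exact ⟨w, by rw [← hw]; exact h3 w⟩⟩
  let E : LocalizedModule (Submonoid.powers f) M →ₗ[R] L' :=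
    LocalizedModule.lift (Submonoid.powers f) (ψl ∘ₗ e) hunit
  have hE : E ∘ₗ LocalizedModule.mkLinearMap (Submonoid.powers f) M = ψl ∘ₗ e := LocalizedModule.lift_comp _ _ _
  have hE' : ∀ m, E (LocalizedModule.mkLinearMap (Submonoid.powers f) M m) = ψ (e m) := LinearMap.congr_fun hE
  have hfinj : ∀ (j : ℕ) (v w : L'), f ^ j • v = f ^ j • w → v = w := by
    intro j v w h
    rw [Algebra.smul_def, Algebra.smul_def, map_pow] at h
    exact (huf.pow j).mul_left_cancel h
  have hz : algebraMap R L g * IsLocalization.Away.invSelf g = 1 := IsLocalization.Away.mul_invSelf g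
  refine ⟨g * f, E, ⟨?_, ?_⟩, ?_⟩
  · rw [injective_iff_map_eq_zero]
    intro x hx
    obtain ⟨j, n, hn⟩ := loc_surj f x
    have h1 : ψ (e n) = 0 := by rw [← hE', ← hn, map_smul, hx, smul_zero]
    obtain ⟨k, r, hr⟩ := TayRing.exists_inv_form g (e n)
    have h2 : algebraMap R L' r = algebraMap R L' 0 := by
      rw [← hψ, ← hr, map_mul, h1, mul_zero, map_zero]
    obtain ⟨⟨_, l, rfl⟩, hl⟩ := (IsLocalization.eq_iff_exists (Submonoid.powers (g * f)) L').1 h2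
    simp only [mul_zero] at hl
    have h3 : f ^ l • n = 0 := by
      apply he.1
      rw [map_smul, map_zero]
      have h4 : algebraMap R L g ^ (l + k) * (algebraMap R L f ^ l * e n) = 0 := by
        rw [mul_pow] at hl
        have := congrArg (algebraMap R L) hl
        rw [map_mul, map_mul, map_pow, map_pow, map_zero, ← hr] at this
        rw [← this]
        ring
      have h5 := congrArg (IsLocalization.Away.invSelf (S := L) g ^ (l + k) * ·) h4
      simp only [mul_zero] at h5
      rw [← mul_assoc, ← mul_pow, mul_comm _ (algebraMap R L g), hz, one_pow, one_mul] at h5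
      rw [Algebra.smul_def, map_pow]
      exact h5
    apply loc_pow_inj f (l + j)
    rw [pow_add, mul_smul, hn, ← map_smul, h3, map_zero, smul_zero]
  · intro y
    obtain ⟨j, r, hr⟩ := TayRing.exists_inv_form (g * f) y
    obtain ⟨m, hm⟩ := he.2 (algebraMap R L r * IsLocalization.Away.invSelf (S := L) g ^ j)
    have hbij := (Module.End.isUnit_iff _).1 (IsLocalizedModule.map_units
      (LocalizedModule.mkLinearMap (Submonoid.powers f) M) (⟨f ^ j, j, rfl⟩ : Submonoid.powers f))
    obtain ⟨x, hx⟩ := hbij.2 (LocalizedModule.mkLinearMap (Submonoid.powers f) M m)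
    have hx' : f ^ j • x = LocalizedModule.mkLinearMap (Submonoid.powers f) M m := hx
    refine ⟨x, hfinj j _ _ ?_⟩
    rw [← map_smul, hx', hE', hm]
    apply (hug.pow j).mul_left_cancel
    rw [Algebra.smul_def, ← mul_assoc, map_pow (algebraMap R L'), ← mul_pow, ← map_mul, hr, ← hψ g, ← map_pow, ← map_mul,
      mul_left_comm, ← mul_pow, hz, one_pow, mul_one, hψ]
  · refine lin_of_loc f ?_ ?_
    · intro v hv
      apply hfinj 1
      rw [pow_one, hv, smul_zero]
    · rw [hE]
      exact hl.comp hlinψ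

end DS
end
end LCF

namespace LCF
noncomputable section
open MvPowerSeries
set_option linter.unusedSectionVars false

/-- Hasse derivatives of powers of ideals -/
lemma hd_pow_mem {σ A : Type*} [CommRing A] (i : σ) (J : Ideal (MvPowerSeries σ A)) (n : ℕ) :
    ∀ (a : ℕ), ∀ r ∈ J ^ (n + a), hd i a r ∈ J ^ n := by
  have key : ∀ (m a n : ℕ), m = n + a → ∀ r ∈ J ^ m, hd i a r ∈ J ^ n := by
    intro m
    induction m with
    | zero =>
      intro a n h r hr
      obtain ⟨rfl, rfl⟩ : n = 0 ∧ a = 0 := by lia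
      simp
    | succ m ih =>
      intro a n h r hr
      rw [pow_succ] at hr
      induction hr using Submodule.mul_induction_on' with
      | add x _ y _ hx hy => rw [map_add]; exact Ideal.add_mem _ hx hy
      | mem_mul_mem x hx y hy =>
        rw [hd_mul]
        refine Ideal.sum_mem _ ?_
        rintro ⟨b, c⟩ hbc
        rw [Finset.HasAntidiagonal.mem_antidiagonal] at hbc
        simp only at hbc ⊢
        rcases Nat.eq_zero_or_pos c with rfl | hc
        · rw [hd_zero]
          rcases Nat.eq_zero_or_pos n with rfl | hn
          · simp
          · obtain ⟨n, rfl⟩ : ∃ n', n = n' + 1 := ⟨n - 1, by lia⟩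
            rw [pow_succ]
            exact Ideal.mul_mem_mul (ih b n (by lia) x hx) hy
        · refine Ideal.mul_mem_right _ _ (Ideal.pow_le_pow_right (m := n) (n := m - b) (by lia) ?_)
          exact ih b (m - b) (by lia) x hx
  intro a r hr
  exact key _ a n rfl r hr

namespace DS
variable {σ A M : Type*} [CommRing A] [AddCommGroup M] [Module (MvPowerSeries σ A) M] (ds : DS σ A M)

/-- torsion in a subquotient -/
def gam (B Z : Submodule (MvPowerSeries σ A) M) (p : A) (J : Ideal (MvPowerSeries σ A)) :
    Submodule (MvPowerSeries σ A) M where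
  carrier := {z | z ∈ Z ∧ (C p : MvPowerSeries σ A) • z ∈ B ∧ ∃ k, ∀ r ∈ J ^ k, r • z ∈ B}
  zero_mem' := ⟨Z.zero_mem, by simp, 0, fun r _ => by simp⟩
  add_mem' := by
    rintro a b ⟨ha, ha', k, hk⟩ ⟨hb, hb', l, hl⟩
    refine ⟨Z.add_mem ha hb, by rw [smul_add]; exact B.add_mem ha' hb', max k l, fun r hr => ?_⟩
    rw [smul_add]
    exact B.add_mem (hk r (Ideal.pow_le_pow_right (le_max_left _ _) hr)) (hl r (Ideal.pow_le_pow_right (le_max_right _ _) hr))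
  smul_mem' := by
    rintro c a ⟨ha, ha', k, hk⟩
    exact ⟨Z.smul_mem _ ha, by rw [smul_comm]; exact B.smul_mem _ ha', k, fun r hr => by
      rw [smul_comm]; exact B.smul_mem _ (hk r hr)⟩

variable {ds} in
lemma Stable.gam {B Z : Submodule (MvPowerSeries σ A) M} (hB : ds.Stable B) (hZ : ds.Stable Z) (p : A)
    (J : Ideal (MvPowerSeries σ A)) : ds.Stable (gam B Z p J) := by
  rintro i t z ⟨h1, h2, k, hk⟩
  refine ⟨hZ i t z h1, by rw [← D_C_smul]; exact hB i t _ h2, k + t, ?_⟩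
  induction t using Nat.strong_induction_on with
  | _ t ih =>
  intro r hr
  have h3 := hB i t (r • z) (hk r (Ideal.pow_le_pow_right (Nat.le_add_right _ _) hr))
  rw [ds.D_smul] at h3
  have h0 : ((0, t) : ℕ × ℕ) ∈ Finset.HasAntidiagonal.antidiagonal t := by simp
  rw [← Finset.add_sum_erase _ _ h0, hd_zero] at h3
  refine (Submodule.add_mem_iff_left _ (Submodule.sum_mem _ ?_)).1 h3
  rintro ⟨x, y⟩ hx
  rw [Finset.mem_erase, Finset.HasAntidiagonal.mem_antidiagonal] at hx
  obtain ⟨hx1, hx2⟩ := hx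
  simp only at hx2 ⊢
  have : x ≠ 0 := by
    rintro rfl
    apply hx1
    simp at hx2
    rw [hx2]
  refine ih y (by lia) _ (hd_pow_mem i J (k + y) x r ?_)
  rwa [add_assoc, add_comm y, hx2]

/-- finiteness of associated primes from the chain condition -/
theorem fin_of_acc [IsNoetherianRing (MvPowerSeries σ A)] (B Z : Submodule (MvPowerSeries σ A) M)
    (hB : ds.Stable B) (hZ : ds.Stable Z) (p : A)
    (hBZ : B ≤ Z)
    (hacc : ACC {N | ds.Stable N ∧ B ≤ N ∧ ∀ v ∈ N, v ∈ Z ∧ (C p : MvPowerSeries σ A) • v ∈ B}) :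
    {P : Ideal (MvPowerSeries σ A) | P.IsPrime ∧ C p ∈ P ∧ ∃ z ∈ Z, ∀ r, r ∈ P ↔ r • z ∈ B}.Finite := by
  classical
  set S := {P : Ideal (MvPowerSeries σ A) | P.IsPrime ∧ C p ∈ P ∧ ∃ z ∈ Z, ∀ r, r ∈ P ↔ r • z ∈ B} with hS
  by_contra hinf
  have hmax : ∀ F : Finset (Ideal (MvPowerSeries σ A)), ∃ P, P ∈ S ∧ P ∉ F ∧ ∀ Q ∈ S, Q ∉ F → P ≤ Q → P = Q := by
    intro F
    obtain ⟨P, hP, hPm⟩ := set_has_maximal_iff_noetherian.2 (inferInstance : IsNoetherianRing (MvPowerSeries σ A))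
      (S \ F) (Set.Infinite.sdiff hinf F.finite_toSet).nonempty
    refine ⟨P, hP.1, hP.2, fun Q hQ hQF hPQ => ?_⟩
    by_contra hne
    exact hPm Q ⟨hQ, hQF⟩ (lt_of_le_of_ne hPQ hne)
  choose nx hn1 hn2 hn3 using hmax
  obtain ⟨F, hF0, hF⟩ : ∃ F : ℕ → Finset (Ideal (MvPowerSeries σ A)), F 0 = ∅ ∧
      ∀ n, F (n + 1) = insert (nx (F n)) (F n) :=
    ⟨fun n => Nat.rec ∅ (fun _ G => insert (nx G) G) n, rfl, fun n => rfl⟩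
  have hFm : Monotone F := monotone_nat_of_le_succ fun n => by rw [hF]; exact Finset.subset_insert _ _
  have hmem : ∀ n, ∀ Q ∈ F n, ∃ j, j < n ∧ Q = nx (F j) := by
    intro n
    induction n with
    | zero => intro Q hQ; rw [hF0] at hQ; exact absurd hQ (Finset.notMem_empty _)
    | succ n ih =>
      intro Q hQ
      rw [hF, Finset.mem_insert] at hQ
      rcases hQ with rfl | hQ
      · exact ⟨n, by lia, rfl⟩
      · obtain ⟨j, hj, h⟩ := ih Q hQ
        exact ⟨j, by lia, h⟩
  obtain ⟨J, hJd⟩ : ∃ J : ℕ → Ideal (MvPowerSeries σ A), ∀ n, J n = ∏ Q ∈ F n, Q := ⟨_, fun _ => rfl⟩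
  have hJ : ∀ n, J (n + 1) = nx (F n) * J n := by
    intro n
    rw [hJd, hJd, hF, Finset.prod_insert (hn2 _)]
  obtain ⟨n, hn⟩ := hacc (fun n => gam B Z p (J n)) (monotone_nat_of_le_succ fun n => by
      rintro z ⟨h1, h2, k, hk⟩
      refine ⟨h1, h2, k, fun r hr => hk r (Ideal.pow_right_mono ?_ k hr)⟩
      rw [hJ]
      exact le_trans Ideal.mul_le_inf inf_le_right) (fun n => by
      refine ⟨hB.gam hZ p (J n), fun v hv => ⟨hBZ hv, B.smul_mem _ hv, 0, fun r _ => B.smul_mem _ hv⟩, ?_⟩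
      rintro v ⟨h1, h2, -⟩
      exact ⟨h1, h2⟩)
  obtain ⟨hP, hp, z, hz, hzP⟩ := hn1 (F n)
  have h1 : z ∈ gam B Z p (J (n + 1)) := by
    refine ⟨hz, (hzP _).1 hp, 1, fun r hr => (hzP r).1 ?_⟩
    rw [pow_one, hJ] at hr
    exact (le_trans Ideal.mul_le_inf inf_le_left) hr
  have h2 : gam B Z p (J (n + 1)) = gam B Z p (J n) := hn (n + 1) (by lia)
  rw [h2] at h1
  obtain ⟨-, -, k, hk⟩ := h1
  have h3 : J n ^ k ≤ nx (F n) := fun r hr => (hzP r).2 (hk r hr)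
  have h4 : J n ≤ nx (F n) := Ideal.IsPrime.le_of_pow_le h3
  rw [hJd] at h4
  obtain ⟨Q, hQ, hQle⟩ := (Ideal.IsPrime.prod_le hP).1 h4
  obtain ⟨j, hj, rfl⟩ := hmem n Q hQ
  have h5 := hn3 (F j) (nx (F n)) (hn1 _) (fun h => hn2 (F n) (hFm hj.le h)) hQle
  rw [h5] at hQ
  exact hn2 _ hQ

/-- the main finiteness result for the cohomology of a complex -/
theorem fin_complex [IsNoetherianRing (MvPowerSeries σ A)] {X₁ X₂ X₃ : Type*} [AddCommGroup X₁] [AddCommGroup X₂]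
    [AddCommGroup X₃] [Module (MvPowerSeries σ A) X₁] [Module (MvPowerSeries σ A) X₂] [Module (MvPowerSeries σ A) X₃]
    {d₁ : DS σ A X₁} {d₂ : DS σ A X₂} {d₃ : DS σ A X₃} (f : X₁ →ₗ[MvPowerSeries σ A] X₂)
    (g : X₂ →ₗ[MvPowerSeries σ A] X₃) (hf : d₁.Lin d₂ f) (hg : d₂.Lin d₃ g) (hgf : ∀ x, g (f x) = 0) (p : A)
    (h1 : d₁.BQ p) (h2 : d₂.AT p) :
    {P : Ideal (MvPowerSeries σ A) | P.IsPrime ∧ C p ∈ P ∧ ∃ z, g z = 0 ∧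
      ∀ r, r ∈ P ↔ r • z ∈ LinearMap.range f}.Finite := by
  have hB : d₂.Stable (LinearMap.range f) := by
    rintro i t _ ⟨v, rfl⟩
    exact ⟨d₁.D i t v, (hf i t v).symm⟩
  have hZ : d₂.Stable (LinearMap.ker g) := by
    intro i t v hv
    rw [LinearMap.mem_ker] at hv ⊢
    rw [← hg, hv, map_zero]
  refine d₂.fin_of_acc (LinearMap.range f) (LinearMap.ker g) hB hZ p ?_ ?_
  · rintro _ ⟨x, rfl⟩; exact hgf x
  let T : Submodule (MvPowerSeries σ A) X₂ := LinearMap.ker (LinearMap.lsmul _ X₂ (C p : MvPowerSeries σ A))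
  have hT : ∀ v, v ∈ T ↔ (C p : MvPowerSeries σ A) • v = 0 := fun v => Iff.rfl
  let Y : Submodule (MvPowerSeries σ A) X₂ → Submodule (MvPowerSeries σ A) X₁ := fun N =>
    (N.map (LinearMap.lsmul _ X₂ (C p : MvPowerSeries σ A))).comap f
  have hY : ∀ N y, y ∈ Y N ↔ ∃ z ∈ N, (C p : MvPowerSeries σ A) • z = f y := fun N y => Iff.rfl
  refine ACC.of_two h1 h2 Y (fun N => N ⊓ T) ?_ ?_ ?_ ?_ ?_
  · intro N _ N' _ h; exact Submodule.comap_mono (Submodule.map_mono h)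
  · intro N _ N' _ h; exact inf_le_inf_right _ h
  · rintro N ⟨hN, hBN, -⟩
    constructor
    · intro i t y hy
      obtain ⟨z, hz, h⟩ := (hY _ _).1 hy
      refine (hY _ _).2 ⟨d₂.D i t z, hN i t z hz, ?_⟩
      rw [← D_C_smul, h, hf]
    · intro v
      exact (hY _ _).2 ⟨f v, hBN ⟨v, rfl⟩, (map_smul _ _ _).symm⟩
  · rintro N ⟨hN, -⟩
    refine ⟨?_, fun v hv => (hT v).1 hv.2⟩
    intro i t v hv
    refine ⟨hN i t v hv.1, (hT _).2 ?_⟩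
    rw [← D_C_smul, (hT _).1 hv.2, map_zero]
  · rintro N _ N' ⟨-, -, hN'⟩ h hYe hTe
    refine le_antisymm h fun v hv => ?_
    obtain ⟨y, hy⟩ := (hN' v hv).2
    have h3 : y ∈ Y N' := (hY _ _).2 ⟨v, hv, hy.symm⟩
    rw [← hYe] at h3
    obtain ⟨z, hz, hzy⟩ := (hY _ _).1 h3
    have h4 : v - z ∈ N' ⊓ T := ⟨N'.sub_mem hv (h hz), (hT _).2 (by rw [smul_sub, hzy, hy, sub_self])⟩
    have hTe' : N ⊓ T = N' ⊓ T := hTe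
    rw [← hTe'] at h4
    have := N.add_mem h4.1 hz
    rwa [sub_add_cancel] at this

end DS
end
end LCF

namespace LCF
noncomputable section
open CategoryTheory
universe u
set_option linter.unusedSectionVars false

variable {R : Type u} [CommRing R]

/-- localization functor -/
def LocF (f : R) : ModuleCat.{u} R ⥤ ModuleCat.{u} R where
  obj M := ModuleCat.of R (LocalizedModule (Submonoid.powers f) M)
  map {M N} φ := ModuleCat.ofHom (IsLocalizedModule.map (Submonoid.powers f)
    (LocalizedModule.mkLinearMap (Submonoid.powers f) M)
    (LocalizedModule.mkLinearMap (Submonoid.powers f) N) φ.hom)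
  map_id M := by
    ext1
    exact IsLocalizedModule.map_id _ _
  map_comp {M N P} φ ψ := by
    ext1
    exact IsLocalizedModule.map_comp' _ _ _ _ _ _

/-- the localization map -/
def locMk (f : R) : 𝟭 (ModuleCat.{u} R) ⟶ LocF f where
  app M := ModuleCat.ofHom (LocalizedModule.mkLinearMap (Submonoid.powers f) M)
  naturality {M N} φ := by
    ext1
    exact (IsLocalizedModule.map_comp (Submonoid.powers f) (LocalizedModule.mkLinearMap (Submonoid.powers f) M)
      (LocalizedModule.mkLinearMap (Submonoid.powers f) N) φ.hom).symm

/-- product functor -/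
def prodF (F G : ModuleCat.{u} R ⥤ ModuleCat.{u} R) : ModuleCat.{u} R ⥤ ModuleCat.{u} R where
  obj M := ModuleCat.of R (F.obj M × G.obj M)
  map {M N} φ := ModuleCat.ofHom (LinearMap.prodMap (F.map φ).hom (G.map φ).hom)

/-- complexes of functors -/
structure CF (R : Type u) [CommRing R] where
  X : ℕ → ModuleCat.{u} R ⥤ ModuleCat.{u} R
  d : ∀ j, X j ⟶ X (j + 1)
  dd : ∀ j M x, ((d (j + 1)).app M).hom (((d j).app M).hom x) = 0

namespace CF

lemma nat_apply {F G : ModuleCat.{u} R ⥤ ModuleCat.{u} R} (α : F ⟶ G) {M N : ModuleCat.{u} R} (φ : M ⟶ N) (x : F.obj M) :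
    (α.app N).hom ((F.map φ).hom x) = (G.map φ).hom ((α.app M).hom x) :=
  LinearMap.congr_fun (congrArg ModuleCat.Hom.hom (α.naturality φ)) x

/-- objects of the cone -/
def coneX (f : R) (F : CF R) : ℕ → ModuleCat.{u} R ⥤ ModuleCat.{u} R
  | 0 => F.X 0
  | j + 1 => prodF (F.X (j + 1)) (LocF f ⋙ F.X j)

/-- the comparison map -/
def phi (f : R) (F : CF R) (j : ℕ) : F.X j ⟶ LocF f ⋙ F.X j where
  app M := (F.X j).map ((locMk f).app M)
  naturality {M N} φ := by
    rw [Functor.comp_map, ← Functor.map_comp, ← Functor.map_comp]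
    congr 1
    exact (locMk f).naturality φ

/-- differentials of the cone -/
def coneD (f : R) (F : CF R) : ∀ j, coneX f F j ⟶ coneX f F (j + 1)
  | 0 =>
    { app := fun M => ModuleCat.ofHom (LinearMap.prod ((F.d 0).app M).hom ((phi f F 0).app M).hom)
      naturality := fun M N φ => by
        ext x
        exact Prod.ext (nat_apply (F.d 0) φ x) (nat_apply (phi f F 0) φ x) }
  | j + 1 =>
    { app := fun M => ModuleCat.ofHom (LinearMap.prod (((F.d (j + 1)).app M).hom ∘ₗ LinearMap.fst R _ _)
        (((phi f F (j + 1)).app M).hom ∘ₗ LinearMap.fst R _ _ - ((F.d j).app ((LocF f).obj M)).hom ∘ₗ LinearMap.snd R _ _))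
      naturality := fun M N φ => by
        ext x
        refine Prod.ext (nat_apply (F.d (j + 1)) φ x.1) ?_
        have h1 : ((F.X (j + 1)).map ((locMk f).app N)).hom (((F.X (j + 1)).map φ).hom x.1) =
            ((F.X (j + 1)).map ((LocF f).map φ)).hom (((F.X (j + 1)).map ((locMk f).app M)).hom x.1) :=
          nat_apply (phi f F (j + 1)) φ x.1
        have h2 := nat_apply (F.d j) ((LocF f).map φ) x.2
        refine Eq.trans (congrArg₂ (· - ·) h1 h2) ?_
        exact (map_sub ((F.X (j + 1)).map ((LocF f).map φ)).hom _ _).symm }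

/-- cone -/
def cone (f : R) (F : CF R) : CF R where
  X := coneX f F
  d := coneD f F
  dd j M x := by
    rcases j with _ | j
    · refine Prod.ext (F.dd 0 M x) ?_
      exact sub_eq_zero.2 (nat_apply (F.d 0) ((locMk f).app M) x).symm
    · refine Prod.ext (F.dd (j + 1) M x.1) ?_
      have h1 := nat_apply (F.d (j + 1)) ((locMk f).app M) x.1
      have h2 := F.dd j ((LocF f).obj M) x.2
      refine Eq.trans (congrArg₂ (· - ·) h1.symm (map_sub ((F.d (j + 1)).app ((LocF f).obj M)).hom _ _)) ?_
      refine Eq.trans (sub_sub_cancel _ _) h2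

/-- trivial complex -/
def triv (R : Type u) [CommRing R] : CF R where
  X j := match j with
    | 0 => 𝟭 _
    | _ + 1 => (Functor.const _).obj (ModuleCat.of R PUnit)
  d _ := { app := fun _ => 0, naturality := fun _ _ _ => by simp }
  dd _ _ _ := rfl

/-- Cech complex -/
def cech : List R → CF R
  | [] => triv R
  | f :: fs => cone f (cech fs)

end CF
end
end LCF

namespace LCF
noncomputable section
open CategoryTheory MvPowerSeries
universe u
set_option linter.unusedSectionVars false

namespace CF
variable {σ : Type} {A : Type u} [CommRing A]

/-- the differential structure on the Cech complex -/
def dsC : (fs : List (MvPowerSeries σ A)) → (j : ℕ) → (M : ModuleCat.{u} (MvPowerSeries σ A)) → DS σ A M →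
    DS σ A (((cech fs).X j).obj M)
  | [], 0, _, ds => ds
  | [], _ + 1, _, _ => DS.zero PUnit
  | _ :: fs, 0, M, ds => dsC fs 0 M ds
  | f :: fs, j + 1, M, ds => (dsC fs (j + 1) M ds).prod (dsC fs j ((LocF f).obj M) (ds.loc f))

lemma dsC_map : ∀ (fs : List (MvPowerSeries σ A)) (j : ℕ) {M N : ModuleCat.{u} (MvPowerSeries σ A)} (ds : DS σ A M)
    (ds' : DS σ A N) (φ : M ⟶ N) (_ : ds.Lin ds' φ.hom), (dsC fs j M ds).Lin (dsC fs j N ds') (((cech fs).X j).map φ).hom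
  | [], 0, _, _, _, _, _, h => h
  | [], _ + 1, _, _, _, _, _, _ => fun _ _ _ => rfl
  | _ :: fs, 0, _, _, ds, ds', φ, h => dsC_map fs 0 ds ds' φ h
  | f :: fs, j + 1, _, _, ds, ds', φ, h => fun i t m => by
      have h2 := dsC_map fs j (ds.loc f) (ds'.loc f) ((LocF f).map φ) (DS.Lin.loc_map f h) i t m.2
      exact Prod.ext (dsC_map fs (j + 1) ds ds' φ h i t m.1) h2

lemma dsC_d : ∀ (fs : List (MvPowerSeries σ A)) (j : ℕ) (M : ModuleCat.{u} (MvPowerSeries σ A)) (ds : DS σ A M),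
    (dsC fs j M ds).Lin (dsC fs (j + 1) M ds) (((cech fs).d j).app M).hom
  | [], _, _, _ => fun _ _ _ => rfl
  | f :: fs, 0, M, ds => fun i t m => by
      have h2 := dsC_map fs 0 ds (ds.loc f) ((locMk f).app M) (ds.loc_mk f) i t m
      exact Prod.ext (dsC_d fs 0 M ds i t m) h2
  | f :: fs, j + 1, M, ds => fun i t m => Prod.ext (dsC_d fs (j + 1) M ds i t m.1) (by
      have h1 := dsC_map fs (j + 1) ds (ds.loc f) ((locMk f).app M) (ds.loc_mk f) i t m.1
      have h2 := dsC_d fs j ((LocF f).obj M) (ds.loc f) i t m.2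
      refine Eq.trans (map_sub ((dsC fs (j + 1) ((LocF f).obj M) (ds.loc f)).D i t) _ _) ?_
      exact congrArg₂ (· - ·) h1 h2)

lemma dsC_AT [Finite σ] [IsNoetherianRing A] (p : A) (hp : ∀ P : Ideal A, P.IsPrime → p ∈ P → P.IsMaximal) :
    ∀ (fs : List (MvPowerSeries σ A)) (j : ℕ) (M : ModuleCat.{u} (MvPowerSeries σ A)) (ds : DS σ A M) (_ : ds.Good),
    (dsC fs j M ds).AT p ∧ (dsC fs j M ds).BQ p
  | [], 0, _, _, h => ⟨h.AT p hp, h.BQ p hp⟩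
  | [], _ + 1, _, _, _ => ⟨DS.AT_of_subsingleton (M := PUnit) p, DS.BQ_of_subsingleton (M := PUnit) p⟩
  | _ :: fs, 0, M, ds, h => dsC_AT p hp fs 0 M ds h
  | f :: fs, j + 1, M, ds, h =>
    ⟨(dsC_AT p hp fs (j + 1) M ds h).1.prod (dsC_AT p hp fs j ((LocF f).obj M) (ds.loc f) (h.loc f)).1,
      (dsC_AT p hp fs (j + 1) M ds h).2.prod (dsC_AT p hp fs j ((LocF f).obj M) (ds.loc f) (h.loc f)).2⟩

end CF
end
end LCF

namespace LCF
noncomputable section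
open CategoryTheory
universe u
set_option linter.unusedSectionVars false

variable {R : Type u} [CommRing R]

/-- quotients related by a linear relation are isomorphic -/
lemma rel_equiv {Z Z' : Type*} [AddCommGroup Z] [Module R Z] [AddCommGroup Z'] [Module R Z'] (W : Submodule R (Z × Z'))
    (B : Submodule R Z) (B' : Submodule R Z') (h1 : ∀ z, ∃ z', (z, z') ∈ W) (h2 : ∀ z', ∃ z, (z, z') ∈ W)
    (h3 : ∀ z z', (z, z') ∈ W → (z ∈ B ↔ z' ∈ B')) : Nonempty ((Z ⧸ B) ≃ₗ[R] (Z' ⧸ B')) := by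
  let p : W →ₗ[R] Z ⧸ B := B.mkQ ∘ₗ LinearMap.fst R Z Z' ∘ₗ W.subtype
  let q : W →ₗ[R] Z' ⧸ B' := B'.mkQ ∘ₗ LinearMap.snd R Z Z' ∘ₗ W.subtype
  have hp : Function.Surjective p := by
    intro y
    obtain ⟨z, rfl⟩ := B.mkQ_surjective y
    obtain ⟨z', h⟩ := h1 z
    exact ⟨⟨_, h⟩, rfl⟩
  have hq : Function.Surjective q := by
    intro y
    obtain ⟨z, rfl⟩ := B'.mkQ_surjective y
    obtain ⟨z', h⟩ := h2 z
    exact ⟨⟨_, h⟩, rfl⟩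
  have hk : LinearMap.ker p = LinearMap.ker q := by
    ext ⟨⟨z, z'⟩, h⟩
    have e1 : p ⟨(z, z'), h⟩ = B.mkQ z := rfl
    have e2 : q ⟨(z, z'), h⟩ = B'.mkQ z' := rfl
    rw [LinearMap.mem_ker, LinearMap.mem_ker, e1, e2, Submodule.mkQ_apply, Submodule.mkQ_apply,
      Submodule.Quotient.mk_eq_zero, Submodule.Quotient.mk_eq_zero]
    exact h3 z z' h
  exact ⟨(p.quotKerEquivOfSurjective hp).symm ≪≫ₗ Submodule.quotEquivOfEq _ _ hk ≪≫ₗ q.quotKerEquivOfSurjective hq⟩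

/-- short exact sequences -/
def SE {Y E Q : ModuleCat.{u} R} (a : Y ⟶ E) (b : E ⟶ Q) : Prop :=
  Function.Injective a.hom ∧ Function.Exact a.hom b.hom ∧ Function.Surjective b.hom

lemma SE.loc (f : R) {Y E Q : ModuleCat.{u} R} {a : Y ⟶ E} {b : E ⟶ Q} (h : SE a b) :
    SE ((LocF f).map a) ((LocF f).map b) := by
  let l (M : ModuleCat.{u} R) := LocalizedModule.mkLinearMap (Submonoid.powers f) M
  exact ⟨IsLocalizedModule.map_injective (Submonoid.powers f) (l Y) (l E) a.hom h.1,
    IsLocalizedModule.map_exact (Submonoid.powers f) (l Y) (l E) (l Q) a.hom b.hom h.2.1,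
    IsLocalizedModule.map_surjective (Submonoid.powers f) (l E) (l Q) b.hom h.2.2⟩

lemma SE.prod (F G : ModuleCat.{u} R ⥤ ModuleCat.{u} R) {Y E Q : ModuleCat.{u} R} {a : Y ⟶ E} {b : E ⟶ Q}
    (h : SE (F.map a) (F.map b)) (h' : SE (G.map a) (G.map b)) : SE ((prodF F G).map a) ((prodF F G).map b) := by
  refine ⟨fun x y e => Prod.ext (h.1 (congrArg Prod.fst e)) (h'.1 (congrArg Prod.snd e)), fun x => ⟨fun e => ?_, ?_⟩, fun x => ?_⟩
  · obtain ⟨u, hu⟩ := (h.2.1 x.1).1 (congrArg Prod.fst e)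
    obtain ⟨v, hv⟩ := (h'.2.1 x.2).1 (congrArg Prod.snd e)
    exact ⟨(u, v), Prod.ext hu hv⟩
  · rintro ⟨u, rfl⟩
    exact Prod.ext ((h.2.1 _).2 ⟨u.1, rfl⟩) ((h'.2.1 _).2 ⟨u.2, rfl⟩)
  · obtain ⟨u, hu⟩ := h.2.2 x.1
    obtain ⟨v, hv⟩ := h'.2.2 x.2
    exact ⟨(u, v), Prod.ext hu hv⟩

namespace CF

lemma SE_X : ∀ (fs : List R) (j : ℕ) {Y E Q : ModuleCat.{u} R} {a : Y ⟶ E} {b : E ⟶ Q} (_ : SE a b),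
    SE (((cech fs).X j).map a) (((cech fs).X j).map b)
  | [], 0, _, _, _, _, _, h => h
  | [], _ + 1, _, _, _, _, _, _ => ⟨fun _ _ _ => rfl, fun _ => ⟨fun _ => ⟨PUnit.unit, rfl⟩, fun _ => rfl⟩,
      fun _ => ⟨PUnit.unit, rfl⟩⟩
  | _ :: fs, 0, _, _, _, _, _, h => SE_X fs 0 h
  | f :: fs, j + 1, _, _, _, _, _, h => SE.prod ((cech fs).X (j + 1)) (LocF f ⋙ (cech fs).X j) (SE_X fs (j + 1) h)
      (SE_X fs j (h.loc f))

variable (F : CF R)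

/-- boundaries -/
def Bd (M : ModuleCat.{u} R) : ∀ j, Submodule R ((F.X j).obj M)
  | 0 => ⊥
  | j + 1 => LinearMap.range ((F.d j).app M).hom

/-- cocycles -/
abbrev Zc (M : ModuleCat.{u} R) (j : ℕ) : Submodule R ((F.X j).obj M) := LinearMap.ker ((F.d j).app M).hom

/-- cohomology -/
abbrev Hc (M : ModuleCat.{u} R) (j : ℕ) : Type u := Zc F M j ⧸ (Bd F M j).comap (Zc F M j).subtype

variable {F} {Y E Q : ModuleCat.{u} R} {a : Y ⟶ E} {b : E ⟶ Q}

/-- the connecting relation -/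
def conn (F : CF R) (a : Y ⟶ E) (b : E ⟶ Q) (j : ℕ) : Submodule R (Zc F Q j × Zc F Y (j + 1)) where
  carrier := {z | ∃ x, ((F.X j).map b).hom x = z.1.1 ∧ ((F.d j).app E).hom x = ((F.X (j + 1)).map a).hom z.2.1}
  add_mem' := by
    rintro ⟨⟨z1, _⟩, ⟨z2, _⟩⟩ ⟨⟨y1, _⟩, ⟨y2, _⟩⟩ ⟨x, h1, h2⟩ ⟨x', h1', h2'⟩
    refine ⟨x + x', ?_, ?_⟩
    · rw [map_add, h1, h1']; rfl
    · rw [map_add, h2, h2', ← map_add]; rfl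
  zero_mem' := ⟨0, by rw [map_zero]; rfl, by rw [map_zero, ← map_zero ((F.X (j + 1)).map a).hom]; rfl⟩
  smul_mem' := by
    rintro c ⟨⟨z1, _⟩, ⟨z2, _⟩⟩ ⟨x, h1, h2⟩
    refine ⟨c • x, ?_, ?_⟩
    · rw [map_smul, h1]; rfl
    · rw [map_smul, h2, ← map_smul]; rfl

lemma conn_fst (j : ℕ) (h : SE ((F.X j).map a) ((F.X j).map b)) (h' : SE ((F.X (j + 1)).map a) ((F.X (j + 1)).map b))
    (h'' : SE ((F.X (j + 2)).map a) ((F.X (j + 2)).map b)) (z : Zc F Q j) : ∃ z', (z, z') ∈ conn F a b j := by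
  obtain ⟨x, hx⟩ := h.2.2 z.1
  obtain ⟨y, hy⟩ := (h'.2.1 (((F.d j).app E).hom x)).1 (by
    rw [← nat_apply, hx]
    exact z.2)
  refine ⟨⟨y, ?_⟩, x, hx, hy.symm⟩
  apply h''.1
  rw [← nat_apply, hy, F.dd, map_zero]

lemma conn_snd (j : ℕ) (hE : ∀ c, ((F.d (j + 1)).app E).hom c = 0 → ∃ x, ((F.d j).app E).hom x = c)
    (h' : SE ((F.X (j + 1)).map a) ((F.X (j + 1)).map b))
    (z : Zc F Y (j + 1)) : ∃ z', (z', z) ∈ conn F a b j := by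
  obtain ⟨x, hx⟩ := hE (((F.X (j + 1)).map a).hom z.1) (by
    rw [nat_apply]
    refine Eq.trans (congrArg _ z.2) (map_zero _))
  refine ⟨⟨((F.X j).map b).hom x, ?_⟩, x, rfl, hx⟩
  refine Eq.trans (nat_apply (F.d j) b x) ?_
  rw [hx]
  exact (h'.2.1 _).2 ⟨_, rfl⟩

/-- dimension shifting -/
lemma shift (h : ∀ j, SE ((F.X j).map a) ((F.X j).map b))
    (hE : ∀ j c, ((F.d (j + 1)).app E).hom c = 0 → ∃ x, ((F.d j).app E).hom x = c) (j : ℕ) :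
    Nonempty (Hc F Q (j + 1) ≃ₗ[R] Hc F Y (j + 2)) := by
  refine rel_equiv (conn F a b (j + 1)) _ _ (conn_fst _ (h _) (h _) (h _)) (conn_snd _ (hE _) (h _)) ?_
  rintro ⟨z, hz⟩ ⟨z', hz'⟩ ⟨x, h1, h2⟩
  change _ = z at h1
  change _ = ((F.X (j + 1 + 1)).map a).hom z' at h2
  change (z ∈ LinearMap.range ((F.d j).app Q).hom) ↔ z' ∈ LinearMap.range ((F.d (j + 1)).app Y).hom
  constructor
  · rintro ⟨w, hw⟩
    obtain ⟨v, rfl⟩ := (h j).2.2 w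
    rw [nat_apply] at hw
    obtain ⟨y, hy⟩ := ((h (j + 1)).2.1 (x - ((F.d j).app E).hom v)).1 (by rw [map_sub, h1, hw, sub_self])
    refine ⟨y, (h (j + 2)).1 ?_⟩
    rw [← nat_apply, hy, map_sub, F.dd, sub_zero, h2]
  · rintro ⟨w, rfl⟩
    rw [← nat_apply] at h2
    obtain ⟨v, hv⟩ := hE j (x - ((F.X (j + 1)).map a).hom w) (by rw [map_sub, h2, sub_self])
    refine ⟨((F.X j).map b).hom v, ?_⟩
    rw [nat_apply, hv, map_sub, h1, (((h (j + 1)).2.1 _).2 ⟨_, rfl⟩), sub_zero]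

/-- dimension shifting in degree zero -/
lemma shift_zero (h : ∀ j, SE ((F.X j).map a) ((F.X j).map b))
    (hE : ∀ j c, ((F.d (j + 1)).app E).hom c = 0 → ∃ x, ((F.d j).app E).hom x = c) :
    Nonempty ((Zc F Q 0 ⧸ ((Zc F E 0).map ((F.X 0).map b).hom).comap (Zc F Q 0).subtype) ≃ₗ[R] Hc F Y 1) := by
  refine rel_equiv (conn F a b 0) _ _ (conn_fst _ (h _) (h _) (h _)) (conn_snd _ (hE _) (h _)) ?_
  rintro ⟨z, hz⟩ ⟨z', hz'⟩ ⟨x, h1, h2⟩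
  change _ = z at h1
  change _ = ((F.X (0 + 1)).map a).hom z' at h2
  change (z ∈ (Zc F E 0).map ((F.X 0).map b).hom) ↔ z' ∈ LinearMap.range ((F.d 0).app Y).hom
  constructor
  · rintro ⟨w, hw, hw2⟩
    obtain ⟨y, hy⟩ := ((h 0).2.1 (x - w)).1 (by rw [map_sub, h1, hw2, sub_self])
    refine ⟨y, (h 1).1 ?_⟩
    rw [← nat_apply, hy, map_sub]
    have hw' : ((F.d 0).app E).hom w = 0 := hw
    rw [hw', sub_zero, h2]
  · rintro ⟨w, rfl⟩
    rw [← nat_apply] at h2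
    refine ⟨x - ((F.X 0).map a).hom w, ?_, ?_⟩
    · change ((F.d 0).app E).hom _ = 0
      rw [map_sub, h2, sub_self]
    · rw [map_sub, h1, (((h 0).2.1 _).2 ⟨_, rfl⟩), sub_zero]

end CF
end
end LCF

namespace LCF
noncomputable section
open CategoryTheory
universe u
set_option linter.unusedSectionVars false

variable {R : Type u} [CommRing R]

section Inj
variable {M : Type u} [AddCommGroup M] [Module R M]

lemma ext_ker (hM : Module.Baer R M) {X Y : Type u} [AddCommGroup X] [Module R X] [AddCommGroup Y] [Module R Y]
    (v : X →ₗ[R] Y) (g : X →ₗ[R] M) (h : LinearMap.ker v ≤ LinearMap.ker g) : ∃ H : Y →ₗ[R] M, ∀ x, H (v x) = g x := by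
  obtain ⟨H, hH⟩ := hM.injective.out ((LinearMap.ker v).liftQ v le_rfl)
    (LinearMap.ker_eq_bot.1 (Submodule.ker_liftQ_eq_bot' _ v rfl)) ((LinearMap.ker v).liftQ g h)
  exact ⟨H, fun x => hH (Submodule.Quotient.mk x)⟩

variable (M) in
/-- torsion for powers of an element -/
def gf (f : R) : Submodule R M := LinearMap.ker (LocalizedModule.mkLinearMap (Submonoid.powers f) M)

lemma mem_gf {f : R} {m : M} : m ∈ gf M f ↔ ∃ N : ℕ, f ^ N • m = 0 := by
  rw [gf, LinearMap.mem_ker, IsLocalizedModule.eq_zero_iff (Submonoid.powers f)]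
  constructor
  · rintro ⟨⟨_, N, rfl⟩, h⟩
    exact ⟨N, h⟩
  · rintro ⟨N, h⟩
    exact ⟨⟨_, N, rfl⟩, h⟩

lemma baer_gf [IsNoetherianRing R] (hM : Module.Baer R M) (f : R) : Module.Baer R (gf M f) := by
  intro J h
  obtain ⟨N, hN⟩ : ∃ N : ℕ, ∀ x, f ^ N • (h x : M) = 0 := by
    obtain ⟨S, hS⟩ := Module.Finite.fg_top (R := R) (M := J)
    choose n hn using fun x => mem_gf.1 (h x).2
    refine ⟨S.sup n, fun x => ?_⟩
    have hx : x ∈ Submodule.span R (S : Set J) := hS ▸ Submodule.mem_top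
    induction hx using Submodule.span_induction with
    | mem x hx =>
      obtain ⟨c, hc⟩ := Nat.exists_eq_add_of_le (Finset.le_sup (f := n) hx)
      rw [hc, add_comm, pow_add, mul_smul, hn, smul_zero]
    | zero => simp
    | add x y _ _ hx hy => rw [map_add, Submodule.coe_add, smul_add, hx, hy, add_zero]
    | smul c x _ hx => rw [map_smul, Submodule.coe_smul, smul_comm, hx, smul_zero]
  obtain ⟨k, hk⟩ := Ideal.exists_pow_inf_eq_pow_smul (Ideal.span {f}) (M := R) J
  have h0 : ∀ x : J, (x : R) ∈ Ideal.span {f ^ (N + k)} → (h x : M) = 0 := by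
    intro x hx
    have h1 : (x : R) ∈ Ideal.span {f} ^ N • (Ideal.span {f} ^ k • ⊤ ⊓ J : Submodule R R) := by
      have := hk (N + k) (by lia)
      rw [Nat.add_sub_cancel] at this
      rw [← this]
      refine ⟨?_, x.2⟩
      rw [Ideal.span_singleton_pow, smul_eq_mul, Ideal.mul_top]
      exact hx
    rw [Ideal.span_singleton_pow] at h1
    rw [Submodule.ideal_span_singleton_smul] at h1
    obtain ⟨y, hy, h2⟩ := h1
    have h3 : x = f ^ N • (⟨y, hy.2⟩ : J) := Subtype.ext h2.symm
    rw [h3, map_smul]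
    exact hN _
  obtain ⟨H, hH⟩ := ext_ker hM ((Ideal.span {f ^ (N + k)}).mkQ ∘ₗ Submodule.subtype J) ((gf M f).subtype ∘ₗ h) (by
    intro x hx
    have : (Ideal.span {f ^ (N + k)}).mkQ (x : R) = 0 := hx
    rw [Submodule.mkQ_apply, Submodule.Quotient.mk_eq_zero] at this
    exact h0 x this)
  refine ⟨LinearMap.codRestrict (gf M f) (H ∘ₗ (Ideal.span {f ^ (N + k)}).mkQ) ?_, ?_⟩
  · intro c
    refine mem_gf.2 ⟨N + k, ?_⟩
    rw [← map_smul, LinearMap.comp_apply, Submodule.mkQ_apply, (Submodule.Quotient.mk_eq_zero (Ideal.span {f ^ (N + k)})).2, map_zero]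
    exact Ideal.mem_span_singleton.2 ⟨c, rfl⟩
  · intro x hx
    exact Subtype.ext (hH ⟨x, hx⟩)

lemma loc_surj_inj [IsNoetherianRing R] (hM : Module.Baer R M) (f : R) :
    Function.Surjective (LocalizedModule.mkLinearMap (Submonoid.powers f) M) := by
  intro y
  obtain ⟨⟨m, ⟨_, n, rfl⟩⟩, rfl⟩ := IsLocalizedModule.mk'_surjective (Submonoid.powers f)
    (LocalizedModule.mkLinearMap (Submonoid.powers f) M) y
  obtain ⟨t, ht⟩ := monotone_stabilizes_iff_noetherian (R := R) (M := R) |>.2 inferInstance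
    ⟨fun t => LinearMap.ker (LinearMap.lsmul R R (f ^ t)), fun a b hab x hx => by
      obtain ⟨c, rfl⟩ := Nat.exists_eq_add_of_le hab
      have : f ^ a * x = 0 := hx
      change f ^ (a + c) * x = 0
      rw [add_comm, pow_add, mul_assoc, this, mul_zero]⟩
  obtain ⟨H, hH⟩ := ext_ker hM (LinearMap.lsmul R R (f ^ (t + n))) (LinearMap.toSpanSingleton R M (f ^ t • m)) (by
    have := ht (t + n) (by lia)
    intro x hx
    have h1 : x ∈ LinearMap.ker (LinearMap.lsmul R R (f ^ t)) := by
      rw [show LinearMap.ker (LinearMap.lsmul R R (f ^ t)) = LinearMap.ker (LinearMap.lsmul R R (f ^ (t + n))) from this]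
      exact hx
    have h2 : f ^ t * x = 0 := h1
    rw [LinearMap.mem_ker, LinearMap.toSpanSingleton_apply, smul_smul, mul_comm, h2, zero_smul])
  refine ⟨H 1, ?_⟩
  have h1 := hH 1
  rw [LinearMap.toSpanSingleton_apply, one_smul, LinearMap.lsmul_apply, map_smul] at h1
  symm
  rw [Function.uncurry_apply_pair, IsLocalizedModule.mk'_eq_iff]
  refine Eq.trans ?_ (map_smul (LocalizedModule.mkLinearMap (Submonoid.powers f) M) (f ^ n) (H 1))
  rw [IsLocalizedModule.eq_iff_exists (Submonoid.powers f)]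
  refine ⟨⟨_, t, rfl⟩, ?_⟩
  change f ^ t • m = f ^ t • f ^ n • H 1
  rw [smul_smul, ← pow_add, h1]

lemma exists_section [IsNoetherianRing R] (hM : Module.Baer R M) (f : R) :
    ∃ s : LocalizedModule (Submonoid.powers f) M →ₗ[R] M,
      ∀ y, LocalizedModule.mkLinearMap (Submonoid.powers f) M (s y) = y := by
  obtain ⟨r, hr⟩ := ext_ker (baer_gf hM f) (gf M f).subtype LinearMap.id (by simp)
  have hs := loc_surj_inj hM f
  have hk : LinearMap.ker (LocalizedModule.mkLinearMap (Submonoid.powers f) M) ≤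
      LinearMap.ker (LinearMap.id - (gf M f).subtype ∘ₗ r) := by
    intro m hm
    have := hr ⟨m, hm⟩
    rw [LinearMap.mem_ker, LinearMap.sub_apply, LinearMap.comp_apply, LinearMap.id_apply, sub_eq_zero]
    exact (congrArg Subtype.val this).symm
  refine ⟨(LinearMap.ker _).liftQ _ hk ∘ₗ ((LocalizedModule.mkLinearMap (Submonoid.powers f) M).quotKerEquivOfSurjective hs).symm, ?_⟩
  intro y
  obtain ⟨m, rfl⟩ := hs y
  have e : ((LocalizedModule.mkLinearMap (Submonoid.powers f) M).quotKerEquivOfSurjective hs).symm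
      (LocalizedModule.mkLinearMap (Submonoid.powers f) M m) = Submodule.Quotient.mk m := by
    rw [LinearEquiv.symm_apply_eq]; rfl
  rw [LinearMap.comp_apply, LinearEquiv.coe_coe, e, Submodule.liftQ_apply, LinearMap.sub_apply, map_sub]
  have h2 : LocalizedModule.mkLinearMap (Submonoid.powers f) M (((gf M f).subtype ∘ₗ r) m) = 0 := (r m).2
  rw [h2, sub_zero, LinearMap.id_apply]

lemma baer_loc [IsNoetherianRing R] (hM : Module.Baer R M) (f : R) :
    Module.Baer R (LocalizedModule (Submonoid.powers f) M) := by
  obtain ⟨s, hs⟩ := exists_section hM f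
  intro J g
  obtain ⟨H, hH⟩ := hM J (s ∘ₗ g)
  refine ⟨LocalizedModule.mkLinearMap (Submonoid.powers f) M ∘ₗ H, fun x hx => ?_⟩
  rw [LinearMap.comp_apply, hH x hx, LinearMap.comp_apply, hs]

end Inj

namespace CF

lemma inj_exact [IsNoetherianRing R] : ∀ (fs : List R) (j : ℕ) (E : ModuleCat.{u} R) (_ : Module.Baer R E)
    (c : ((cech fs).X (j + 1)).obj E), (((cech fs).d (j + 1)).app E).hom c = 0 → ∃ x, (((cech fs).d j).app E).hom x = c
  | [], _, _, _, _, _ => ⟨0, rfl⟩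
  | f :: fs, 0, E, hE, c, hc => by
    obtain ⟨c2, hcc⟩ : ∃ c2 : ((cech fs).X 0).obj ((LocF f).obj E), c2 = c.2 := ⟨c.2, rfl⟩
    have hc1 : (((cech fs).d 1).app E).hom c.1 = 0 := congrArg Prod.fst hc
    have hc2 : (((cech fs).X 1).map ((locMk f).app E)).hom c.1 - (((cech fs).d 0).app ((LocF f).obj E)).hom c2 = 0 :=
      hcc ▸ congrArg Prod.snd hc
    obtain ⟨b, hb⟩ := inj_exact fs 0 E hE c.1 hc1
    obtain ⟨s, hs⟩ := exists_section hE f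
    let s' : (LocF f).obj E ⟶ E := ModuleCat.ofHom s
    have e : s' ≫ (locMk f).app E = 𝟙 _ := by
      ext y
      exact hs y
    have hs' : ∀ y, (((cech fs).X 0).map ((locMk f).app E)).hom ((((cech fs).X 0).map s').hom y) = y := by
      intro y
      have h1 := congrArg ((cech fs).X 0).map e
      rw [CategoryTheory.Functor.map_comp, CategoryTheory.Functor.map_id] at h1
      exact LinearMap.congr_fun (congrArg ModuleCat.Hom.hom h1) y
    let y : ((cech fs).X 0).obj ((LocF f).obj E) := (((cech fs).X 0).map ((locMk f).app E)).hom b - c2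
    have hy : (((cech fs).d 0).app ((LocF f).obj E)).hom y = 0 := by
      rw [← hb] at hc2
      rw [map_sub, nat_apply]
      exact hc2
    refine ⟨b - (((cech fs).X 0).map s').hom y, Prod.ext ?_ ?_⟩
    · change (((cech fs).d 0).app E).hom _ = c.1
      rw [map_sub, nat_apply, hy, map_zero, sub_zero, hb]
    · change (((cech fs).X 0).map ((locMk f).app E)).hom _ = c.2
      rw [map_sub, hs', sub_sub_cancel, hcc]
  | f :: fs, j + 1, E, hE, c, hc => by
    obtain ⟨c2, hcc⟩ : ∃ c2 : ((cech fs).X (j + 1)).obj ((LocF f).obj E), c2 = c.2 := ⟨c.2, rfl⟩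
    have hc1 : (((cech fs).d (j + 2)).app E).hom c.1 = 0 := congrArg Prod.fst hc
    have hc2 : (((cech fs).X (j + 2)).map ((locMk f).app E)).hom c.1 -
      (((cech fs).d (j + 1)).app ((LocF f).obj E)).hom c2 = 0 := hcc ▸ congrArg Prod.snd hc
    obtain ⟨b, hb⟩ := inj_exact fs (j + 1) E hE c.1 hc1
    obtain ⟨b2, hb2⟩ := inj_exact fs j ((LocF f).obj E) (baer_loc hE f)
      ((((cech fs).X (j + 1)).map ((locMk f).app E)).hom b - c2) (by
      rw [← hb] at hc2
      rw [map_sub, nat_apply]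
      exact hc2)
    refine ⟨(b, b2), Prod.ext hb ?_⟩
    change (((cech fs).X (j + 1)).map ((locMk f).app E)).hom b - (((cech fs).d j).app ((LocF f).obj E)).hom b2 = c.2
    rw [hb2, sub_sub_cancel, hcc]

end CF
end
end LCF

namespace LCF
noncomputable section
open CategoryTheory
universe u
set_option linter.unusedSectionVars false

variable {R : Type u} [CommRing R]

/-- sections with support in an ideal -/
def gamI (I : Ideal R) (M : Type u) [AddCommGroup M] [Module R M] : Submodule R M := ⨅ f ∈ I, gf M f

section
variable {M : Type u} [AddCommGroup M] [Module R M]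

lemma mem_gamI {I : Ideal R} {m : M} : m ∈ gamI I M ↔ ∀ f ∈ I, ∃ N : ℕ, f ^ N • m = 0 := by
  simp only [gamI, Submodule.mem_iInf, mem_gf]

lemma mem_gamI_iff_rad {I : Ideal R} {m : M} : m ∈ gamI I M ↔
    I ≤ Ideal.radical (LinearMap.ker (LinearMap.toSpanSingleton R M m)) := by
  rw [mem_gamI]
  rfl

lemma mem_gamI_span {S : Set R} {m : M} : m ∈ gamI (Ideal.span S) M ↔ ∀ f ∈ S, m ∈ gf M f := by
  rw [mem_gamI_iff_rad, Ideal.span_le]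
  simp only [mem_gf]
  rfl

lemma mem_gamI_pow [IsNoetherianRing R] {I : Ideal R} {m : M} : m ∈ gamI I M ↔ ∃ N : ℕ, ∀ r ∈ I ^ N, r • m = 0 := by
  rw [mem_gamI_iff_rad]
  constructor
  · intro h
    obtain ⟨N, hN⟩ := Ideal.exists_pow_le_of_le_radical_of_fg h (IsNoetherian.noetherian I)
    exact ⟨N, fun r hr => hN hr⟩
  · rintro ⟨N, hN⟩ f hf
    exact ⟨N, hN _ (Ideal.pow_mem_pow hf N)⟩

end

namespace CF

/-- the degree zero term -/
def ez : ∀ (fs : List R) (M : ModuleCat.{u} R), M ≃ₗ[R] ((cech fs).X 0).obj M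
  | [], M => LinearEquiv.refl R M
  | _ :: fs, M => ez fs M

lemma ez_nat : ∀ (fs : List R) {M N : ModuleCat.{u} R} (φ : M ⟶ N) (m : M),
    (((cech fs).X 0).map φ).hom (ez fs M m) = ez fs N (φ.hom m)
  | [], _, _, _, _ => rfl
  | _ :: fs, _, _, φ, m => ez_nat fs φ m

lemma ez_mem : ∀ (fs : List R) (M : ModuleCat.{u} R) (m : M),
    (((cech fs).d 0).app M).hom (ez fs M m) = 0 ↔ ∀ f ∈ fs, m ∈ gf M f
  | [], _, _ => ⟨fun _ _ h => absurd h List.not_mem_nil, fun _ => rfl⟩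
  | f :: fs, M, m => by
    have h1 : (((cech (f :: fs)).d 0).app M).hom (ez (f :: fs) M m) = 0 ↔
        (((cech fs).d 0).app M).hom (ez fs M m) = 0 ∧ (((cech fs).X 0).map ((locMk f).app M)).hom (ez fs M m) = 0 :=
      ⟨fun h => ⟨congrArg Prod.fst h, congrArg Prod.snd h⟩, fun h => Prod.ext h.1 h.2⟩
    have h2 := ez_nat fs ((locMk f).app M) m
    have h3 : (((cech fs).X 0).map ((locMk f).app M)).hom (ez fs M m) = 0 ↔ m ∈ gf M f := by
      rw [show (((cech fs).X 0).map ((locMk f).app M)).hom (ez fs M m) = _ from h2, LinearEquiv.map_eq_zero_iff]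
      rfl
    rw [h1, ez_mem fs M m, h3]
    simp [and_comm]

lemma ez_Zc (I : Ideal R) (fs : List R) (hI : Ideal.span {f | f ∈ fs} = I) (M : ModuleCat.{u} R) :
    (gamI I M).map (ez fs M : M →ₗ[R] ((cech fs).X 0).obj M) = Zc (cech fs) M 0 := by
  subst hI
  ext x
  obtain ⟨m, rfl⟩ := (ez fs M).surjective x
  rw [LinearMap.mem_ker, ez_mem, ← LinearEquiv.coe_coe, Submodule.mem_map]
  constructor
  · rintro ⟨y, hy, e⟩
    obtain rfl := (ez fs M).injective e
    exact mem_gamI_span.1 hy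
  · intro h
    exact ⟨m, mem_gamI_span.2 h, rfl⟩

/-- degree zero -/
lemma Hc_zero (I : Ideal R) (fs : List R) (hI : Ideal.span {f | f ∈ fs} = I) (M : ModuleCat.{u} R) :
    Nonempty (gamI I M ≃ₗ[R] Hc (cech fs) M 0) := by
  have e1 := (ez fs M).submoduleMap (gamI I M) ≪≫ₗ LinearEquiv.ofEq _ _ (ez_Zc I fs hI M)
  refine ⟨e1 ≪≫ₗ (Submodule.quotEquivOfEqBot _ ?_).symm⟩
  rw [eq_bot_iff]
  rintro ⟨x, hx⟩ h
  exact Subtype.ext h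

/-- degree one -/
lemma Hc_one [IsNoetherianRing R] (I : Ideal R) (fs : List R) (hI : Ideal.span {f | f ∈ fs} = I) {Y E Q : ModuleCat.{u} R}
    {a : Y ⟶ E} {b : E ⟶ Q} (h : SE a b) (hE : Module.Baer R E) :
    Nonempty ((gamI I Q ⧸ ((gamI I E).map b.hom).comap (gamI I Q).subtype) ≃ₗ[R] Hc (cech fs) Y 1) := by
  obtain ⟨e⟩ := shift_zero (F := cech fs) (fun j => SE_X fs j h) (fun j => inj_exact fs j E hE)
  have e1 := (ez fs Q).submoduleMap (gamI I Q) ≪≫ₗ LinearEquiv.ofEq _ _ (ez_Zc I fs hI Q)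
  refine ⟨Submodule.Quotient.equiv _ _ ((ez fs Q).submoduleMap (gamI I Q) ≪≫ₗ LinearEquiv.ofEq _ _ (ez_Zc I fs hI Q)) ?_ ≪≫ₗ e⟩
  ext ⟨x, hx⟩
  rw [Submodule.mem_comap, Submodule.subtype_apply, ← ez_Zc I fs hI E]
  constructor
  · rintro ⟨⟨q, hq⟩, ⟨m, hm, hmq⟩, e2⟩
    change b.hom m = q at hmq
    have e3 : ez fs Q q = x := congrArg Subtype.val e2
    refine ⟨ez fs E m, ⟨m, hm, rfl⟩, ?_⟩
    rw [ez_nat, hmq, e3]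
  · rintro ⟨_, ⟨m, hm, rfl⟩, hx2⟩
    have h5 : ez fs Q (b.hom m) = x := by
      rw [← ez_nat]; exact hx2
    have h6 : b.hom m ∈ gamI I Q := by
      rw [← ez_Zc I fs hI Q] at hx
      obtain ⟨q, hq, hq2⟩ := hx
      have := (ez fs Q).injective (h5.trans hq2.symm)
      rw [this]; exact hq
    exact ⟨⟨b.hom m, h6⟩, ⟨m, hm, rfl⟩, Subtype.ext h5⟩

end CF
end
end LCF

namespace LCF
noncomputable section
open CategoryTheory CategoryTheory.Limits
set_option linter.unusedSectionVars false

namespace LD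
universe v v' w w'
variable {C : Type w} [Category.{v} C] [Abelian C] [HasProjectiveResolutions C] {D : Type w'} [Category.{v'} D] [Abelian D]
  {F G H : C ⥤ D} [F.Additive] [G.Additive] [H.Additive] (α : F ⟶ G) (β : G ⟶ H) (hz : α ≫ β = 0)

/-- complex level sequence -/
def scK : ChainComplex C ℕ ⥤ ShortComplex (ChainComplex D ℕ) where
  obj K := ShortComplex.mk ((NatTrans.mapHomologicalComplex α (ComplexShape.down ℕ)).app K)
    ((NatTrans.mapHomologicalComplex β (ComplexShape.down ℕ)).app K) (by
      ext n
      exact congrArg (fun t => t.app (K.X n)) hz)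
  map φ := ShortComplex.homMk ((F.mapHomologicalComplex _).map φ) ((G.mapHomologicalComplex _).map φ)
    ((H.mapHomologicalComplex _).map φ) (by simp) (by simp)

variable (hS : ∀ X : C, Projective X → (ShortComplex.mk (α.app X) (β.app X) (congrArg (fun t => t.app X) hz)).ShortExact)

lemma scK_se (hS : ∀ X : C, Projective X → (ShortComplex.mk (α.app X) (β.app X) (congrArg (fun t => t.app X) hz)).ShortExact)
    {X : C} (P : ProjectiveResolution X) : ((scK α β hz).obj P.complex).ShortExact :=
  HomologicalComplex.shortExact_of_degreewise_shortExact _ (fun n => hS (P.complex.X n) inferInstance)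

lemma rel (n : ℕ) : (ComplexShape.down ℕ).Rel (n + 1) n := rfl

/-- homology of the image of a resolution -/
abbrev hm (F : C ⥤ D) [F.Additive] (K : ChainComplex C ℕ) (n : ℕ) : D :=
  (HomologicalComplex.homologyFunctor D (ComplexShape.down ℕ) n).obj ((F.mapHomologicalComplex _).obj K)

/-- functoriality -/
abbrev hmMap (F : C ⥤ D) [F.Additive] {K L : ChainComplex C ℕ} (φ : K ⟶ L) (n : ℕ) : hm F K n ⟶ hm F L n :=
  (F.mapHomologicalComplex _ ⋙ HomologicalComplex.homologyFunctor _ _ n).map φ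

/-- the connecting map of a resolution -/
def dl {X : C} (P : ProjectiveResolution X) (n : ℕ) : hm H P.complex (n + 1) ⟶ hm F P.complex n :=
  (scK_se α β hz hS P).δ (n + 1) n (rel n)

lemma dl_nat {X Y : C} (P : ProjectiveResolution X) (Q : ProjectiveResolution Y) (φ : P.complex ⟶ Q.complex) (n : ℕ) :
    dl α β hz hS P n ≫ hmMap F φ n = hmMap H φ (n + 1) ≫ dl α β hz hS Q n :=
  HomologicalComplex.HomologySequence.δ_naturality ((scK α β hz).map φ)
      (scK_se α β hz hS P) (scK_se α β hz hS Q) (n + 1) n (rel n)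

lemma dl_comp {X : C} (P : ProjectiveResolution X) (n : ℕ) : dl α β hz hS P n ≫
    (HomologicalComplex.homologyFunctor D (ComplexShape.down ℕ) n).map
        ((NatTrans.mapHomologicalComplex α _).app P.complex) = 0 :=
  (scK_se α β hz hS P).δ_comp (n + 1) n (rel _)

lemma dl_exact {X : C} (P : ProjectiveResolution X) (n : ℕ) : (ShortComplex.mk _ _ (dl_comp α β hz hS P n)).Exact :=
  (scK_se α β hz hS P).homology_exact₁ (n + 1) n (rel _)

lemma dl_mono {X : C} (P : ProjectiveResolution X) (n : ℕ) (h : IsZero (hm G P.complex (n + 1))) : Mono (dl α β hz hS P n) :=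
  (scK_se α β hz hS P).mono_δ (n + 1) n (rel _) h

lemma dl_isIso {X : C} (P : ProjectiveResolution X) (n : ℕ) (h : IsZero (hm G P.complex (n + 1)))
    (h' : IsZero (hm G P.complex n)) : IsIso (dl α β hz hS P n) :=
  (scK_se α β hz hS P).isIso_δ (n + 1) n (rel _) h h'

/-- the connecting map -/
def del (n : ℕ) : H.leftDerived (n + 1) ⟶ F.leftDerived n where
  app X := ((projectiveResolution X).isoLeftDerivedObj H (n + 1)).hom ≫ dl α β hz hS (projectiveResolution X) n ≫
    ((projectiveResolution X).isoLeftDerivedObj F n).inv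
  naturality X Y f := by
    have comm : (ProjectiveResolution.lift f (projectiveResolution X) (projectiveResolution Y)).f 0 ≫ (projectiveResolution Y).π.f 0 =
      (projectiveResolution X).π.f 0 ≫ f := ProjectiveResolution.lift_commutes_zero f _ _
    have h1 := ProjectiveResolution.isoLeftDerivedObj_hom_naturality f (projectiveResolution X) (projectiveResolution Y) _ comm H (n + 1)
    have h2 := ProjectiveResolution.isoLeftDerivedObj_inv_naturality f (projectiveResolution X) (projectiveResolution Y) _ comm F n
    have h3 := dl_nat α β hz hS _ _ (ProjectiveResolution.lift f (projectiveResolution X) (projectiveResolution Y)) n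
    calc _ = ((H.leftDerived (n + 1)).map f ≫ ((projectiveResolution Y).isoLeftDerivedObj H (n + 1)).hom) ≫
          dl α β hz hS (projectiveResolution Y) n ≫ ((projectiveResolution Y).isoLeftDerivedObj F n).inv := by
            rw [Category.assoc]
      _ = ((projectiveResolution X).isoLeftDerivedObj H (n + 1)).hom ≫ (hmMap H _ (n + 1) ≫
          dl α β hz hS (projectiveResolution Y) n) ≫ ((projectiveResolution Y).isoLeftDerivedObj F n).inv := by
            rw [h1, Category.assoc, Category.assoc]
      _ = ((projectiveResolution X).isoLeftDerivedObj H (n + 1)).hom ≫ dl α β hz hS (projectiveResolution X) n ≫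
          ((projectiveResolution X).isoLeftDerivedObj F n).inv ≫ (F.leftDerived n).map f := by
            rw [← h3, h2, Category.assoc]
      _ = _ := by rw [Category.assoc, Category.assoc]

lemma hm_zero (hG : ∀ n X, IsZero ((G.leftDerived (n + 1)).obj X)) (n : ℕ) (X : C) :
    IsZero (hm G (projectiveResolution X).complex (n + 1)) :=
  IsZero.of_iso (hG n X) ((projectiveResolution X).isoLeftDerivedObj G (n + 1)).symm

lemma del_iso (hG : ∀ n X, IsZero ((G.leftDerived (n + 1)).obj X)) (n : ℕ) : IsIso (del α β hz hS (n + 1)) := by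
  have : ∀ X, IsIso ((del α β hz hS (n + 1)).app X) := by
    intro X
    have := dl_isIso α β hz hS (projectiveResolution X) (n + 1) (hm_zero hG _ _) (hm_zero hG _ _)
    dsimp only [del]
    infer_instance
  exact NatIso.isIso_of_isIso_app _

lemma from_nat (X : C) : (NatTrans.leftDerived α 0).app X ≫ G.fromLeftDerivedZero.app X = F.fromLeftDerivedZero.app X ≫ α.app X := by
  rw [(projectiveResolution X).fromLeftDerivedZero_eq, (projectiveResolution X).fromLeftDerivedZero_eq,
    (projectiveResolution X).leftDerived_app_eq α 0]
  simp only [Category.assoc, Iso.inv_hom_id_assoc]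
  congr 1
  have h1 : (HomologicalComplex.homologyFunctor D (ComplexShape.down ℕ) 0).map
        ((NatTrans.mapHomologicalComplex α _).app (projectiveResolution X).complex) ≫ (ChainComplex.isoHomologyι₀ _).hom =
      (ChainComplex.isoHomologyι₀ _).hom ≫ HomologicalComplex.opcyclesMap
        ((NatTrans.mapHomologicalComplex α _).app (projectiveResolution X).complex) 0 :=
    HomologicalComplex.homologyι_naturality _ _
  have h2 : HomologicalComplex.opcyclesMap
        ((NatTrans.mapHomologicalComplex α _).app (projectiveResolution X).complex) 0 ≫
        (projectiveResolution X).fromLeftDerivedZero' G = (projectiveResolution X).fromLeftDerivedZero' F ≫ α.app X := by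
    rw [← cancel_epi (HomologicalComplex.pOpcycles _ _), HomologicalComplex.p_opcyclesMap_assoc,
      ProjectiveResolution.pOpcycles_comp_fromLeftDerivedZero'_assoc,
      ProjectiveResolution.pOpcycles_comp_fromLeftDerivedZero']
    exact (α.naturality _).symm
  refine Eq.trans (Category.assoc _ _ _).symm (Eq.trans (congrArg (· ≫ _) h1) ?_)
  refine Eq.trans (Category.assoc _ _ _) ?_
  rw [h2]
  exact (Category.assoc _ _ _).symm

/-- connecting map in the lowest degree -/
def delz : H.leftDerived 1 ⟶ F := del α β hz hS 0 ≫ F.fromLeftDerivedZero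

lemma delz_mono [PreservesFiniteColimits F] (hG : ∀ n X, IsZero ((G.leftDerived (n + 1)).obj X)) (X : C) : Mono ((delz α β hz hS).app X) := by
  have := dl_mono α β hz hS (projectiveResolution X) 0 (hm_zero hG _ _)
  dsimp only [delz, del, NatTrans.comp_app]
  infer_instance

lemma delz_comp (X : C) : (delz α β hz hS).app X ≫ α.app X = 0 := by
  have h1 := dl_comp α β hz hS (projectiveResolution X) 0
  dsimp only [delz, NatTrans.comp_app, del]
  rw [Category.assoc, ← from_nat, (projectiveResolution X).leftDerived_app_eq α 0]
  simp only [Category.assoc, Iso.inv_hom_id_assoc]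
  rw [reassoc_of% h1]
  simp

lemma delz_exact [PreservesFiniteColimits F] [PreservesFiniteColimits G] (X : C) :
    (ShortComplex.mk _ _ (delz_comp α β hz hS X)).Exact := by
  have h1 := dl_exact α β hz hS (projectiveResolution X) 0
  refine ShortComplex.exact_of_iso (ShortComplex.isoMk ((projectiveResolution X).isoLeftDerivedObj H 1).symm
    (((projectiveResolution X).isoLeftDerivedObj F 0).symm ≪≫ asIso (F.fromLeftDerivedZero.app X))
    (((projectiveResolution X).isoLeftDerivedObj G 0).symm ≪≫ asIso (G.fromLeftDerivedZero.app X)) ?_ ?_) h1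
  · simp only [delz, del, NatTrans.comp_app, Iso.symm_hom, Iso.trans_hom, asIso_hom, Category.assoc, Iso.inv_hom_id_assoc]
  · have h2 := from_nat α X
    rw [(projectiveResolution X).leftDerived_app_eq α 0] at h2
    simp only [Iso.symm_hom, Iso.trans_hom, asIso_hom, Category.assoc]
    rw [← h2]
    simp only [Category.assoc, Iso.inv_hom_id_assoc]

end LD
end
end LCF

namespace LCF
noncomputable section
open CategoryTheory CategoryTheory.Limits
set_option linter.unusedSectionVars false

namespace LD
universe u
variable {R : Type u} [CommRing R]

/-- contravariant Hom into the opposite category -/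
abbrev FY (Y : ModuleCat.{u} R) : ModuleCat.{u} R ⥤ (ModuleCat.{u} R)ᵒᵖ :=
  ((linearYoneda R (ModuleCat.{u} R)).obj Y).rightOp

/-- transformation of Hom functors (reversed) -/
abbrev FYm {Y Z : ModuleCat.{u} R} (a : Y ⟶ Z) : FY Z ⟶ FY Y :=
  NatTrans.rightOp ((linearYoneda R (ModuleCat.{u} R)).map a)

instance (Y : ModuleCat.{u} R) : PreservesLimitsOfSize.{0,0} ((linearYoneda R (ModuleCat.{u} R)).obj Y) := by
  have : PreservesLimitsOfSize.{0,0} ((linearYoneda R (ModuleCat.{u} R)).obj Y ⋙ forget (ModuleCat.{u} R)) := by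
    change PreservesLimitsOfSize.{0,0} (yoneda.obj Y)
    infer_instance
  exact preservesLimits_of_reflects_of_preserves _ (forget (ModuleCat.{u} R))

instance (Y : ModuleCat.{u} R) : PreservesFiniteColimits (FY Y) := by
  have : PreservesFiniteLimits ((linearYoneda R (ModuleCat.{u} R)).obj Y) := PreservesLimitsOfSize.preservesFiniteLimits _
  exact preservesFiniteColimits_rightOp _

variable {Y E Q : ModuleCat.{u} R} {a : Y ⟶ E} {b : E ⟶ Q}

lemma FY_zero (h : SE a b) : FYm b ≫ FYm a = 0 := by
  have hab : a ≫ b = 0 := by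
    ext x
    exact h.2.1.apply_apply_eq_zero x
  ext X
  apply Quiver.Hom.unop_inj
  ext (x : X ⟶ Y)
  change (x ≫ a) ≫ b = 0
  rw [Category.assoc, hab, comp_zero]

lemma FY_se (h : SE a b) (X : ModuleCat.{u} R) (hX : Projective X) :
    (ShortComplex.mk ((FYm b).app X) ((FYm a).app X) (congrArg (fun t => t.app X) (FY_zero h))).ShortExact := by
  have hab : a ≫ b = 0 := by
    ext x
    exact h.2.1.apply_apply_eq_zero x
  let T : ShortComplex (ModuleCat.{u} R) := ShortComplex.mk (((linearYoneda R (ModuleCat.{u} R)).map a).app (.op X))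
    (((linearYoneda R (ModuleCat.{u} R)).map b).app (.op X)) (by
      ext (x : X ⟶ Y)
      change (x ≫ a) ≫ b = 0
      rw [Category.assoc, hab, comp_zero])
  have ma : Mono a := (ModuleCat.mono_iff_injective a).2 h.1
  have eb : Epi b := (ModuleCat.epi_iff_surjective b).2 h.2.2
  have S0 : (ShortComplex.mk a b hab).Exact := by
    rw [ShortComplex.moduleCat_exact_iff]
    intro x hx
    exact (h.2.1 x).1 hx
  have hT : T.ShortExact := by
    refine { exact := ?_, mono_f := ?_, epi_g := ?_ }
    · rw [ShortComplex.moduleCat_exact_iff]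
      intro x hx
      have hx' : (show X ⟶ E from x) ≫ b = 0 := hx
      exact ⟨S0.lift _ hx', S0.lift_f _ hx'⟩
    · rw [ModuleCat.mono_iff_injective]
      intro x y hxy
      have : (show X ⟶ Y from x) ≫ a = (show X ⟶ Y from y) ≫ a := hxy
      exact (cancel_mono a).1 this
    · rw [ModuleCat.epi_iff_surjective]
      intro x
      exact ⟨Projective.factorThru (show X ⟶ Q from x) b, Projective.factorThru_comp (show X ⟶ Q from x) b⟩
  exact hT.op

lemma FY_inj (E : ModuleCat.{u} R) [Injective E] (n : ℕ) (X : ModuleCat.{u} R) :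
    IsZero (((FY E).leftDerived (n + 1)).obj X) := by
  let P := ProjectiveResolution.of X
  have h1 : IsZero (((Ext R (ModuleCat.{u} R) (n+1)).obj (Opposite.op X)).obj E) := by
    refine IsZero.of_iso ?_ (P.isoExt (n + 1) E)
    rw [← HomologicalComplex.exactAt_iff_isZero_homology,
      HomologicalComplex.exactAt_iff' _ n (n+1) (n+2) (by simp) (by simp), ShortComplex.moduleCat_exact_iff]
    intro x hx
    have hx' : P.complex.d (n+2) (n+1) ≫ (show P.complex.X (n+1) ⟶ E from x) = 0 := hx
    exact ⟨(P.exact_succ n).descToInjective (show P.complex.X (n+1) ⟶ E from x) hx',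
      (P.exact_succ n).comp_descToInjective _ hx'⟩
  exact h1.op.of_iso (Iso.refl _)

end LD
end
end LCF

namespace LCF
noncomputable section
open CategoryTheory CategoryTheory.Limits Opposite
set_option linter.unusedSectionVars false

namespace LD
universe u
variable {R : Type u} [CommRing R] (I : Ideal R)

instance fgt_pres : PreservesColimitsOfShape ℕᵒᵖᵒᵖ (forget (ModuleCat.{u} R)) := by
  have : PreservesFilteredColimitsOfSize.{0,0} (forget (ModuleCat.{u} R)) :=
    preservesFilteredColimitsOfSize_shrink.{0, u, 0, u} _
  infer_instance

/-- the system of the quotients by powers -/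
abbrev XI : ℕᵒᵖ ⥤ ModuleCat.{u} R := localCohomology.ringModIdeals (localCohomology.idealPowersDiagram I)

/-- colimit along the powers -/
abbrev TD (G : ModuleCat.{u} R ⥤ (ModuleCat.{u} R)ᵒᵖ) : ℕᵒᵖᵒᵖ ⥤ ModuleCat.{u} R := (XI I).op ⋙ G.leftOp

variable {I} {Q : ModuleCat.{u} R}

/-- evaluation at one -/
def ev {j : ℕᵒᵖ} (h : (XI I).obj j ⟶ Q) : Q := h.hom (Submodule.Quotient.mk (1 : R) : R ⧸ (I ^ unop j))

lemma ev_add {j : ℕᵒᵖ} (h h' : (XI I).obj j ⟶ Q) : ev (h + h') = ev h + ev h' := rfl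
lemma ev_smul {j : ℕᵒᵖ} (r : R) (h : (XI I).obj j ⟶ Q) : ev (r • h) = r • ev h := rfl
lemma ev_map {j k : ℕᵒᵖ} (f : k ⟶ j) (h : (XI I).obj j ⟶ Q) : ev ((XI I).map f ≫ h) = ev h := rfl
lemma ev_comp {j : ℕᵒᵖ} {E : ModuleCat.{u} R} (h : (XI I).obj j ⟶ E) (b : E ⟶ Q) : ev (h ≫ b) = b.hom (ev h) := rfl

lemma ev_kill {j : ℕᵒᵖ} (h : (XI I).obj j ⟶ Q) (r : R) (hr : r ∈ I ^ unop j) : r • ev h = 0 := by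
  have : r • (Submodule.Quotient.mk (1 : R) : R ⧸ (I ^ unop j)) = 0 := by
    rw [← Submodule.Quotient.mk_smul, Submodule.Quotient.mk_eq_zero]
    simpa using hr
  exact (map_smul h.hom r _).symm.trans ((congrArg h.hom this).trans (map_zero h.hom))

lemma ev_inj {j : ℕᵒᵖ} (h h' : (XI I).obj j ⟶ Q) (hh : ev h = ev h') : h = h' := by
  ext x
  obtain ⟨r, rfl⟩ := Submodule.Quotient.mk_surjective (I ^ unop j) x
  have e : (Submodule.Quotient.mk r : R ⧸ (I ^ unop j)) = r • (Submodule.Quotient.mk (1 : R) : R ⧸ (I ^ unop j)) := by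
    rw [← Submodule.Quotient.mk_smul]; simp
  have e1 (g : (XI I).obj j ⟶ Q) : g.hom (Submodule.Quotient.mk r : R ⧸ (I ^ unop j)) = r • ev g :=
    (congrArg g.hom e).trans (map_smul g.hom r _)
  exact (e1 h).trans ((congrArg (r • ·) hh).trans (e1 h').symm)

lemma ev_lift (j : ℕᵒᵖ) (q : Q) (hq : ∀ r ∈ I ^ unop j, r • q = 0) : ∃ h : (XI I).obj j ⟶ Q, ev h = q :=
  ⟨ModuleCat.ofHom (Submodule.liftQ (I ^ unop j) (LinearMap.toSpanSingleton R Q q) (fun r hr => hq r hr)), by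
    change (1 : R) • q = q
    simp⟩

variable [IsNoetherianRing R]

lemma ev_mem {j : ℕᵒᵖ} (h : (XI I).obj j ⟶ Q) : ev h ∈ gamI I Q :=
  mem_gamI_pow.2 ⟨_, ev_kill h⟩

/-- stage maps -/
def st {G : ModuleCat.{u} R ⥤ (ModuleCat.{u} R)ᵒᵖ} (δ : G ⟶ FY Q) {j : ℕᵒᵖ} (h : (XI I).obj j ⟶ Q) : (TD I G).obj (op j) :=
  (δ.app ((XI I).obj j)).unop.hom h

lemma st_add {G : ModuleCat.{u} R ⥤ (ModuleCat.{u} R)ᵒᵖ} (δ : G ⟶ FY Q) {j : ℕᵒᵖ} (h h' : (XI I).obj j ⟶ Q) :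
    st δ (h + h') = st δ h + st δ h' := map_add (δ.app ((XI I).obj j)).unop.hom h h'

lemma st_smul {G : ModuleCat.{u} R ⥤ (ModuleCat.{u} R)ᵒᵖ} (δ : G ⟶ FY Q) {j : ℕᵒᵖ} (r : R) (h : (XI I).obj j ⟶ Q) :
    st δ (r • h) = r • st δ h := map_smul (δ.app ((XI I).obj j)).unop.hom r h

lemma st_map {G : ModuleCat.{u} R ⥤ (ModuleCat.{u} R)ᵒᵖ} (δ : G ⟶ FY Q) {j k : ℕᵒᵖ} (f : k ⟶ j) (h : (XI I).obj j ⟶ Q) :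
    ((TD I G).map f.op).hom (st δ h) = st δ ((XI I).map f ≫ h) := by
  have := congrArg (fun t => t.unop.hom h) (δ.naturality ((XI I).map f))
  exact this

/-- image in the colimit -/
def sti {G : ModuleCat.{u} R ⥤ (ModuleCat.{u} R)ᵒᵖ} (δ : G ⟶ FY Q) {j : ℕᵒᵖ} (h : (XI I).obj j ⟶ Q) : (colimit (TD I G) : ModuleCat.{u} R) :=
  (colimit.ι (TD I G) (op j)).hom (st δ h)

lemma sti_map {G : ModuleCat.{u} R ⥤ (ModuleCat.{u} R)ᵒᵖ} (δ : G ⟶ FY Q) {j k : ℕᵒᵖ} (f : k ⟶ j) (h : (XI I).obj j ⟶ Q) :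
    sti δ ((XI I).map f ≫ h) = sti δ h := by
  unfold sti
  rw [← st_map, ← colimit.w (TD I G) f.op]
  rfl

lemma sti_ev {G : ModuleCat.{u} R ⥤ (ModuleCat.{u} R)ᵒᵖ} (δ : G ⟶ FY Q) {j k : ℕᵒᵖ} (h : (XI I).obj j ⟶ Q) (h' : (XI I).obj k ⟶ Q)
    (e : ev h = ev h') : sti δ h = sti δ h' := by
  let f : op (max j.unop k.unop) ⟶ j := (homOfLE (le_max_left _ _)).op
  let g : op (max j.unop k.unop) ⟶ k := (homOfLE (le_max_right _ _)).op
  rw [← sti_map δ f, ← sti_map δ g, ev_inj ((XI I).map f ≫ h) ((XI I).map g ≫ h') e]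

lemma sti_zero {G : ModuleCat.{u} R ⥤ (ModuleCat.{u} R)ᵒᵖ} (δ : G ⟶ FY Q) {j : ℕᵒᵖ} (h : (XI I).obj j ⟶ Q) (hz : sti δ h = 0) :
    ∃ k : ℕᵒᵖ, ∃ f : k ⟶ j, st δ ((XI I).map f ≫ h) = 0 := by
  obtain ⟨k, f, g, e⟩ := Concrete.colimit_exists_of_rep_eq (TD I G) (i := op j) (j := op j) (st δ h) 0
    (hz.trans (map_zero (colimit.ι (TD I G) (op j)).hom).symm)
  refine ⟨k.unop, f.unop, ?_⟩
  rw [← st_map]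
  exact e.trans (map_zero ((TD I G).map g).hom)

/-- recognition of the colimit -/
lemma colim_equiv {G : ModuleCat.{u} R ⥤ (ModuleCat.{u} R)ᵒᵖ} (δ : G ⟶ FY Q) (hs : ∀ X, Function.Surjective (δ.app X).unop.hom)
    (B : Submodule R (gamI I Q))
    (h1 : ∀ q ∈ B, ∃ (j : ℕᵒᵖ) (h : (XI I).obj j ⟶ Q), ev h = q ∧ st δ h = 0)
    (h2 : ∀ (j : ℕᵒᵖ) (h : (XI I).obj j ⟶ Q), st δ h = 0 → (⟨ev h, ev_mem h⟩ : gamI I Q) ∈ B) :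
    Nonempty ((gamI I Q ⧸ B) ≃ₗ[R] (colimit (TD I G) : ModuleCat.{u} R)) := by
  let W : Submodule R (gamI I Q × (colimit (TD I G) : ModuleCat.{u} R)) :=
    { carrier := {x | ∃ (j : ℕᵒᵖ) (h : (XI I).obj j ⟶ Q), ev h = x.1 ∧ sti δ h = x.2}
      zero_mem' := ⟨op 0, 0, rfl, (congrArg _ (map_zero (δ.app ((XI I).obj (op 0))).unop.hom)).trans (map_zero _)⟩
      add_mem' := by
        rintro x y ⟨j, h, e1, e2⟩ ⟨k, h', e3, e4⟩
        let f : op (max j.unop k.unop) ⟶ j := (homOfLE (le_max_left _ _)).op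
        let g : op (max j.unop k.unop) ⟶ k := (homOfLE (le_max_right _ _)).op
        refine ⟨_, (XI I).map f ≫ h + (XI I).map g ≫ h', ?_, ?_⟩
        · rw [ev_add, ev_map, ev_map, e1, e3]; rfl
        · rw [Prod.snd_add, ← e2, ← e4, ← sti_map δ f h, ← sti_map δ g h']
          exact (congrArg _ (st_add δ _ _)).trans (map_add _ _ _)
      smul_mem' := by
        rintro r x ⟨j, h, e1, e2⟩
        refine ⟨j, r • h, ?_, ?_⟩
        · rw [ev_smul, e1]; rfl
        · rw [Prod.smul_snd, ← e2]
          exact (congrArg _ (st_smul δ _ _)).trans (map_smul _ _ _) }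
  refine (rel_equiv W B ⊥ ?_ ?_ ?_).map (fun e => e ≪≫ₗ Submodule.quotEquivOfEqBot _ rfl)
  · intro z
    obtain ⟨N, hN⟩ := mem_gamI_pow.1 z.2
    obtain ⟨h, hh⟩ := ev_lift (op N) z.1 hN
    exact ⟨_, _, h, hh, rfl⟩
  · intro z'
    obtain ⟨j, y, hy⟩ := Concrete.colimit_exists_rep (TD I G) z'
    obtain ⟨h, hh⟩ := hs ((XI I).obj j.unop) y
    refine ⟨⟨ev (j := j.unop) h, ev_mem (j := j.unop) h⟩, j.unop, h, rfl, ?_⟩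
    rw [← hy, ← hh]
    rfl
  · rintro z z' ⟨j, h, e1, e2⟩
    dsimp only at e1 e2
    rw [Submodule.mem_bot, ← e2]
    constructor
    · intro hz
      obtain ⟨k, h', e3, e4⟩ := h1 _ hz
      rw [sti_ev δ h h' (e1.trans e3.symm)]
      exact (congrArg _ e4).trans (map_zero _)
    · intro hz
      obtain ⟨k, f, e⟩ := sti_zero δ h hz
      have := h2 _ _ e
      convert this
      exact e1.symm

end LD
end
end LCF

namespace LCF
noncomputable section
open CategoryTheory CategoryTheory.Limits Opposite
set_option linter.unusedSectionVars false

namespace LD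
universe u
variable {R : Type u} [CommRing R] (I : Ideal R)

/-- local cohomology as a colimit -/
def lcIso (i : ℕ) (M : ModuleCat.{u} R) : (localCohomology I i).obj M ≅ colimit (TD I ((FY M).leftDerived i)) :=
  colimitObjIsoColimitCompEvaluation (localCohomology.diagram (localCohomology.idealPowersDiagram I) i) M

variable {I} {Y E Q : ModuleCat.{u} R} {a : Y ⟶ E} {b : E ⟶ Q}

lemma lc_shift (h : SE a b) (hE : Injective E) (n : ℕ) :
    Nonempty ((localCohomology I (n + 2)).obj Y ≅ (localCohomology I (n + 1)).obj Q) := by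
  have := del_iso (FYm b) (FYm a) (FY_zero h) (FY_se h) (FY_inj E) n
  let d := del (FYm b) (FYm a) (FY_zero h) (FY_se h) (n + 1)
  let e : ((FY Q).leftDerived (n + 1)).leftOp ≅ ((FY Y).leftDerived (n + 2)).leftOp :=
    { hom := NatTrans.leftOp d
      inv := NatTrans.leftOp (inv d)
      hom_inv_id := by
        have : inv d ≫ d = 𝟙 _ := IsIso.inv_hom_id d
        ext1
        ext1 X
        exact congrArg (fun t => (t.app X.unop).unop) this
      inv_hom_id := by
        have : d ≫ inv d = 𝟙 _ := IsIso.hom_inv_id d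
        ext1
        ext1 X
        exact congrArg (fun t => (t.app X.unop).unop) this }
  exact ⟨lcIso I (n + 2) Y ≪≫ (HasColimit.isoOfNatIso (Functor.isoWhiskerLeft (XI I).op e)).symm ≪≫ (lcIso I (n + 1) Q).symm⟩

variable [IsNoetherianRing R]

lemma lc_zero (M : ModuleCat.{u} R) : Nonempty ((localCohomology I 0).obj M ≃ₗ[R] gamI I M) := by
  let δ : (FY M).leftDerived 0 ⟶ FY M := ((FY M).leftDerivedZeroIsoSelf).hom
  have hb (X) : Function.Bijective (δ.app X).unop.hom := by
    have : IsIso (δ.app X).unop := inferInstance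
    exact (ConcreteCategory.isIso_iff_bijective (δ.app X).unop).1 this
  have hst {j : ℕᵒᵖ} (h : (XI I).obj j ⟶ M) (hz : st δ h = 0) : h = 0 :=
    (hb _).1 (hz.trans (map_zero (δ.app ((XI I).obj j)).unop.hom).symm)
  obtain ⟨e⟩ := colim_equiv δ (fun X => (hb X).2) (⊥ : Submodule R (gamI I M)) (by
    intro q hq
    refine ⟨op 0, 0, ?_, map_zero (δ.app ((XI I).obj (op 0))).unop.hom⟩
    rw [(Submodule.mem_bot R).1 hq]; rfl) (by
    intro j h hz
    rw [Submodule.mem_bot]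
    apply Subtype.ext
    change ev h = 0
    rw [hst h hz]
    rfl)
  exact ⟨(lcIso I 0 M).toLinearEquiv ≪≫ₗ e.symm ≪≫ₗ Submodule.quotEquivOfEqBot _ rfl⟩

lemma lc_one (h : SE a b) (hE : Injective E) :
    Nonempty ((localCohomology I 1).obj Y ≃ₗ[R] (gamI I Q ⧸ ((gamI I E).map b.hom).comap (gamI I Q).subtype)) := by
  let δ : (FY Y).leftDerived 1 ⟶ FY Q := delz (FYm b) (FYm a) (FY_zero h) (FY_se h)
  have hs (X) : Function.Surjective (δ.app X).unop.hom := by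
    have : Mono (δ.app X) := delz_mono (FYm b) (FYm a) (FY_zero h) (FY_se h) (FY_inj E) X
    exact (ModuleCat.epi_iff_surjective (δ.app X).unop).1 inferInstance
  have hx (X) := (delz_exact (FYm b) (FYm a) (FY_zero h) (FY_se h) X).unop
  have hx1 (X : ModuleCat.{u} R) (t : X ⟶ Q) (ht : (δ.app X).unop.hom t = 0) : ∃ s : X ⟶ E, s ≫ b = t :=
    ((ShortComplex.moduleCat_exact_iff _).1 (hx X)) t ht
  have hx2 (X : ModuleCat.{u} R) (s : X ⟶ E) : (δ.app X).unop.hom (s ≫ b) = 0 := by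
    have := delz_comp (FYm b) (FYm a) (FY_zero h) (FY_se h) X
    exact congrArg (fun t => t.unop.hom s) this
  obtain ⟨e⟩ := colim_equiv (I := I) δ hs (((gamI I E).map b.hom).comap (gamI I Q).subtype) (by
    rintro q ⟨e, he, hq⟩
    obtain ⟨N, hN⟩ := mem_gamI_pow.1 he
    obtain ⟨s, hs⟩ := ev_lift (op N) e hN
    refine ⟨op N, s ≫ b, ?_, hx2 _ s⟩
    rw [ev_comp, hs]
    exact hq) (by
    intro j t ht
    obtain ⟨s, hs⟩ := hx1 _ t ht
    refine ⟨ev s, ev_mem s, ?_⟩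
    rw [← ev_comp, hs]
    rfl)
  exact ⟨(lcIso I 1 Y).toLinearEquiv ≪≫ₗ e.symm⟩

lemma exists_SE (M : ModuleCat.{u} R) : ∃ (E Q : ModuleCat.{u} R) (a : M ⟶ E) (b : E ⟶ Q), SE a b ∧ Injective E := by
  let E : ModuleCat.{u} R := Injective.under M
  let a : M ⟶ E := Injective.ι M
  let b := ModuleCat.ofHom (LinearMap.range a.hom).mkQ
  refine ⟨E, ModuleCat.of R ((E : Type u) ⧸ (LinearMap.range a.hom)), a, b,
    ⟨(ModuleCat.mono_iff_injective a).1 inferInstance, ?_, Submodule.mkQ_surjective _⟩,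
    inferInstanceAs (Injective (Injective.under M))⟩
  exact LinearMap.exact_map_mkQ_range a.hom

theorem lc_cech (fs : List R) (hI : Ideal.span {f | f ∈ fs} = I) (i : ℕ) :
    ∀ M : ModuleCat.{u} R, Nonempty ((localCohomology I i).obj M ≃ₗ[R] CF.Hc (CF.cech fs) M i) := by
  match i with
  | 0 =>
    intro M
    obtain ⟨e⟩ := lc_zero (I := I) M
    obtain ⟨e'⟩ := CF.Hc_zero I fs hI M
    exact ⟨e ≪≫ₗ e'⟩
  | 1 =>
    intro M
    obtain ⟨E, Q, a, b, h, hE⟩ := exists_SE M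
    obtain ⟨e⟩ := lc_one (I := I) h hE
    have hB : Module.Baer R E := Module.Baer.iff_injective.2 ((Module.injective_iff_injective_object R E).2 hE)
    obtain ⟨e'⟩ := CF.Hc_one I fs hI h hB
    exact ⟨e ≪≫ₗ e'⟩
  | n + 2 =>
    intro M
    obtain ⟨E, Q, a, b, h, hE⟩ := exists_SE M
    obtain ⟨e⟩ := lc_shift (I := I) h hE n
    have hB : Module.Baer R E := Module.Baer.iff_injective.2 ((Module.injective_iff_injective_object R E).2 hE)
    obtain ⟨e'⟩ := CF.shift (fun j => CF.SE_X fs j h) (fun j => CF.inj_exact fs j E hB) n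
    obtain ⟨e''⟩ := lc_cech fs hI (n + 1) Q
    exact ⟨e.toLinearEquiv ≪≫ₗ e'' ≪≫ₗ e'⟩

end LD
end
end LCF

namespace LCF
noncomputable section
open CategoryTheory MvPowerSeries
universe u
set_option linter.unusedSectionVars false

lemma max_of_dim {A : Type u} [CommRing A] (p : A) (hp : ringKrullDim (A ⧸ Ideal.span {p}) = 0) (P : Ideal A) (hP : P.IsPrime)
    (h : p ∈ P) : P.IsMaximal := by
  have h0 : Ring.KrullDimLE 0 (A ⧸ Ideal.span {p}) := Ring.krullDimLE_iff.2 (by simp [hp])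
  have hle : RingHom.ker (Ideal.Quotient.mk (Ideal.span {p})) ≤ P := by
    rw [Ideal.mk_ker, Ideal.span_le]
    simpa using h
  have h1 : (P.map (Ideal.Quotient.mk (Ideal.span {p}))).IsPrime := Ideal.map_isPrime_of_surjective Ideal.Quotient.mk_surjective hle
  have h2 := Ring.krullDimLE_zero_iff.1 h0 _ h1
  have h3 := Ideal.comap_isMaximal_of_surjective (Ideal.Quotient.mk (Ideal.span {p})) Ideal.Quotient.mk_surjective
    (K := P.map (Ideal.Quotient.mk (Ideal.span {p})))
  rwa [Ideal.comap_map_of_surjective' _ Ideal.Quotient.mk_surjective, sup_eq_left.2 hle] at h3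

lemma ass_Hc {R : Type u} [CommRing R] [IsNoetherianRing R] (F : CF R) (M : ModuleCat.{u} R) (i : ℕ) (P : Ideal R)
    (h : P ∈ associatedPrimes R (CF.Hc F M i)) :
    P.IsPrime ∧ ∃ z, ((F.d i).app M).hom z = 0 ∧ ∀ r, r ∈ P ↔ r • z ∈ CF.Bd F M i := by
  obtain ⟨h1, x, hx⟩ := isAssociatedPrime_iff.1 h
  refine ⟨h1, ?_⟩
  obtain ⟨z, rfl⟩ := Submodule.mkQ_surjective _ x
  refine ⟨z.1, z.2, fun r => ?_⟩
  rw [hx, Submodule.mem_colon_singleton, Submodule.mem_bot, ← map_smul, Submodule.mkQ_apply, Submodule.Quotient.mk_eq_zero]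
  rfl

theorem main {A : Type u} [CommRing A] [IsNoetherianRing A] (p : A) (hp : ringKrullDim (A ⧸ Ideal.span {p}) = 0)
    (σ : Type) [Finite σ] [IsNoetherianRing (MvPowerSeries σ A)] (I : Ideal (MvPowerSeries σ A)) (i : ℕ) :
    {P ∈ associatedPrimes (MvPowerSeries σ A)
        ((localCohomology I i).obj (ModuleCat.of _ (MvPowerSeries σ A))) | MvPowerSeries.C p ∈ P}.Finite := by
  have hp' := max_of_dim p hp
  obtain ⟨s, hs⟩ := (isNoetherianRing_iff_ideal_fg _).1 inferInstance I
  let fs := s.toList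
  have hI : Ideal.span {f | f ∈ fs} = I := by
    rw [← hs]
    congr 1
    ext x
    simp [fs]
  let M : ModuleCat.{u} (MvPowerSeries σ A) := ModuleCat.of _ (MvPowerSeries σ A)
  let ds : DS σ A M := DS.base σ A
  have hg : ds.Good := DS.good_base σ A
  obtain ⟨e⟩ := LD.lc_cech fs hI i M
  cases i with
  | zero =>
    have key := DS.fin_complex (d₁ := CF.dsC fs 0 M ds) (d₂ := CF.dsC fs 0 M ds) 0 (((CF.cech fs).d 0).app M).hom
      (fun i t _ => map_zero ((CF.dsC fs 0 M ds).D i t)) (CF.dsC_d fs 0 M ds) (fun _ => map_zero _) p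
      (CF.dsC_AT p hp' fs 0 M ds hg).2 (CF.dsC_AT p hp' fs 0 M ds hg).1
    refine key.subset ?_
    rintro P ⟨h1, h2⟩
    obtain ⟨h3, z, hz, h4⟩ := ass_Hc _ _ _ P ((LinearEquiv.AssociatedPrimes.eq e) ▸ h1)
    refine ⟨h3, h2, z, hz, fun r => ?_⟩
    rw [LinearMap.range_zero]
    exact h4 r
  | succ i =>
    have key := DS.fin_complex (((CF.cech fs).d i).app M).hom (((CF.cech fs).d (i + 1)).app M).hom
      (CF.dsC_d fs i M ds) (CF.dsC_d fs (i + 1) M ds) ((CF.cech fs).dd i M) p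
      (CF.dsC_AT p hp' fs i M ds hg).2 (CF.dsC_AT p hp' fs (i + 1) M ds hg).1
    refine key.subset ?_
    rintro P ⟨h1, h2⟩
    obtain ⟨h3, z, hz, h4⟩ := ass_Hc _ _ _ P ((LinearEquiv.AssociatedPrimes.eq e) ▸ h1)
    exact ⟨h3, h2, z, hz, h4⟩

end
end LCF

/-!
STATEMENT 5: Let `A` be a commutative Noetherian ring of Krull dimension one, let
`π ∈ A` be such that `dim (A/πA) = 0`, and let `R` be a powerSeries ring in `n`
variables over `A`.  Then for every ideal `I` of `R` and every `i ≥ 0`, the set of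
associated primes of `H^i_I(R)` that contain `π` is finite.
-/

universe u

open CategoryTheory

theorem associatedPrimes_containing_pi_localCohomology_finite_of_dim_one_powerSeries
    (A : Type u) [CommRing A] [IsNoetherianRing A] (hA : ringKrullDim A = 1)
    (π : A) (hπ : ringKrullDim (A ⧸ Ideal.span {π}) = 0)
    (n : ℕ) (I : Ideal (MvPowerSeries (Fin n) A)) (i : ℕ) :
    {P ∈ associatedPrimes (MvPowerSeries (Fin n) A)
        ((localCohomology I i).obj (ModuleCat.of _ (MvPowerSeries (Fin n) A))) |
      algebraMap A (MvPowerSeries (Fin n) A) π ∈ P}.Finite := by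
  exact LCF.main π hπ (Fin n) I i
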